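/- Global existence and decay for Model I. Let P^{αβ} (α,β ∈ {0,1,2}) be arbitrary real constants and let N ≥ 10 be an integer. There exists ε₀ > 0 such that for every 0 < ε < ε₀ and all smooth initial data (w₀, w₁, v₀, v₁) on the slice {t = 2}, supported in the unit ball {|x| ≤ 1} of ℝ² and satisfying ‖w₀‖_{H^{N+1}(ℝ²)} + ‖w₁‖_{H^{N}(ℝ²)} + ‖v₀‖_{H^{N+1}(ℝ²)} + ‖v₁‖_{H^{N}(ℝ²)} ≤ ε, the Cauchy problem −□w = v², −□v + v = P^{αβ} ∂_α w ∂_β w, with (w, ∂_t w, v, ∂_t v)(2,·) = (w₀, w₁, v₀, v₁), admits a smooth solution (w, v) defined for all t ≥ 2, supported for each t in {|x| ≤ t − 1}; moreover there exists C > 0 such that for all t ≥ 2 and |x| ≤ t − 1: |w(t,x)| ≤ Cε t^{−1/2}(t − |x|)^{1/2}, Σ_α |∂_α w(t,x)| ≤ Cε t^{−1/2}(t − |x|)^{−1/2}, |v(t,x)| ≤ Cε t^{−1}, and Σ_α |∂_α v(t,x)| ≤ Cε t^{−1}. -/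

import Mathlib

noncomputable section

open MeasureTheory

/-- A point of `ℝ^{1+2}`; coordinate `0` is the time `t`, coordinates `1, 2` are spatial. -/
abbrev Pt : Type := Fin 3 → ℝ

/-- The spatial radius `r = |x| = √((x¹)² + (x²)²)`. -/
def rad (p : Pt) : ℝ := Real.sqrt ((p 1)^2 + (p 2)^2)

/-- The coordinate partial derivative `∂_i` (with `∂_0 = ∂_t`). -/
def pd (i : Fin 3) (φ : Pt → ℝ) (p : Pt) : ℝ := fderiv ℝ φ p (Pi.single i 1)

/-- `−□φ = ∂_t²φ − ∂_1²φ − ∂_2²φ`. -/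
def negBox (φ : Pt → ℝ) (p : Pt) : ℝ :=
  pd 0 (pd 0 φ) p - pd 1 (pd 1 φ) p - pd 2 (pd 2 φ) p

/-- The Lorentz boost `L_a = x^a ∂_t + t ∂_a`, for `a ∈ {1,2}` (indexed by `Fin 2`,
with `a : Fin 2` corresponding to the spatial coordinate `a.succ`). -/
def boost (a : Fin 2) (φ : Pt → ℝ) (p : Pt) : ℝ :=
  p a.succ * pd 0 φ p + p 0 * pd a.succ φ p

/-- The semi-hyperboloidal derivative `∂̲_a = (x^a/t) ∂_t + ∂_a`, `a ∈ {1,2}` (indexed by `Fin 2`). -/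
def ubd (a : Fin 2) (φ : Pt → ℝ) (p : Pt) : ℝ :=
  (p a.succ / p 0) * pd 0 φ p + pd a.succ φ p

/-- `∂̲_β` for `β ∈ {0,1,2}`, with `∂̲_0 = ∂_t`. -/
def ubar (β : Fin 3) (φ : Pt → ℝ) (p : Pt) : ℝ :=
  if β = 0 then pd 0 φ p else (p β / p 0) * pd 0 φ p + pd β φ p

/-- Iterated coordinate derivatives `∂^I`. -/
def pdSeq : List (Fin 3) → (Pt → ℝ) → Pt → ℝ
  | [], φ => φ
  | i :: I, φ => pd i (pdSeq I φ)

/-- Iterated boosts `L^J`. -/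
def boostSeq : List (Fin 2) → (Pt → ℝ) → Pt → ℝ
  | [], φ => φ
  | a :: J, φ => boost a (boostSeq J φ)

/-- The interior of the light cone, `K = {(t,x) : r < t − 1}`. -/
def coneK : Set Pt := {p | rad p < p 0 - 1}

/-- The slab `K_{[s0,s1]} = {(t,x) ∈ K : s0² ≤ t² − r² ≤ s1²}`. -/
def slab (s0 s1 : ℝ) : Set Pt :=
  {p | rad p < p 0 - 1 ∧ s0^2 ≤ (p 0)^2 - (rad p)^2 ∧ (p 0)^2 - (rad p)^2 ≤ s1^2}

/-- The parametrization `x ↦ (√(s² + |x|²), x)` of the hyperboloid `H_s`. -/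
def hyp (s : ℝ) (x : Fin 2 → ℝ) : Pt :=
  ![Real.sqrt (s^2 + (x 0)^2 + (x 1)^2), x 0, x 1]

/-- The flat `L²` norm on the hyperboloid `H_s`. -/
def L2f (s : ℝ) (g : Pt → ℝ) : ℝ :=
  Real.sqrt (∫ x : Fin 2 → ℝ, (g (hyp s x))^2)

/-- `φ` vanishes near the conical boundary `∂K_{[s0,s1]}` (i.e. on a neighbourhood of
`r = t − 1` within the slab, in particular outside the cone on the slab). -/
def VanishNearBdry (s0 s1 : ℝ) (φ : Pt → ℝ) : Prop :=
  ∃ ε > (0:ℝ), ∀ p : Pt, 0 < p 0 → s0^2 ≤ (p 0)^2 - (rad p)^2 →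
    (p 0)^2 - (rad p)^2 ≤ s1^2 → p 0 - 1 - ε < rad p → φ p = 0

/-- The hyperboloidal energy functional `E_m(s, φ)`. -/
def energyE (m s : ℝ) (φ : Pt → ℝ) : ℝ :=
  ∫ x : Fin 2 → ℝ,
    ((pd 0 φ (hyp s x))^2 + (pd 1 φ (hyp s x))^2 + (pd 2 φ (hyp s x))^2
      + 2 * (hyp s x 1 / hyp s x 0) * pd 0 φ (hyp s x) * pd 1 φ (hyp s x)
      + 2 * (hyp s x 2 / hyp s x 0) * pd 0 φ (hyp s x) * pd 2 φ (hyp s x)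
      + m^2 * (φ (hyp s x))^2)

/-- The weighted inverted time translation `Kφ = (t + r²/t) ∂_t φ + 2 x^a ∂_a φ`. -/
def Kvf (φ : Pt → ℝ) (p : Pt) : ℝ :=
  (p 0 + (rad p)^2 / p 0) * pd 0 φ p + 2 * (p 1 * pd 1 φ p + p 2 * pd 2 φ p)

/-- The conformal energy `E_con(s, φ)`. -/
def Econ (s : ℝ) (φ : Pt → ℝ) : ℝ :=
  ∫ x : Fin 2 → ℝ,
    ((s * ubd 0 φ (hyp s x))^2 + (s * ubd 1 φ (hyp s x))^2
      + (Kvf φ (hyp s x) + φ (hyp s x))^2)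

/-- The `H^k(ℝ²)` Sobolev norm: `‖f‖_{H^k}² = Σ_{j ≤ k} ‖D^j f‖_{L²}²`,
with `D^j` the `j`-th iterated total derivative. -/
def sobolevNorm (k : ℕ) (f : (Fin 2 → ℝ) → ℝ) : ℝ :=
  Real.sqrt (∑ j ∈ Finset.range (k + 1), ∫ x : Fin 2 → ℝ, ‖iteratedFDeriv ℝ j f x‖^2)

/-- Inclusion of the initial slice `{t = 2}`. -/
def sl (x : Fin 2 → ℝ) : Pt := ![2, x 0, x 1]

/-- Spatial radius `|x|` on `ℝ²`. -/
def rad2 (x : Fin 2 → ℝ) : ℝ := Real.sqrt ((x 0)^2 + (x 1)^2)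

notation "Sm" => ContDiff ℝ (WithTop.some (⊤ : ℕ∞))

theorem ContDiff.da {u : Pt → ℝ} (h : Sm u) (p : Pt) : DifferentiableAt ℝ u p :=
  (h.differentiable (by simp)) p

@[fun_prop]
theorem smPd {u : Pt → ℝ} (h : ContDiff ℝ (⊤ : ℕ∞) u) (i : Fin 3) : ContDiff ℝ (⊤ : ℕ∞) (pd i u) := by
  unfold _root_.pd
  have : ContDiff ℝ (⊤ : ℕ∞) (fderiv ℝ u) := h.fderiv_right (by simp)
  exact this.clm_apply contDiff_const

theorem pd_add {u v : Pt → ℝ} (hu : Sm u) (hv : Sm v) (i : Fin 3) :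
    pd i (fun p => u p + v p) = fun p => pd i u p + pd i v p := by
  funext p
  simp only [pd]
  rw [fderiv_fun_add (hu.da p) (hv.da p)]; rfl

theorem pd_sub {u v : Pt → ℝ} (hu : Sm u) (hv : Sm v) (i : Fin 3) :
    pd i (fun p => u p - v p) = fun p => pd i u p - pd i v p := by
  funext p
  simp only [pd]
  rw [fderiv_fun_sub (hu.da p) (hv.da p)]; rfl

theorem pd_neg (u : Pt → ℝ) (i : Fin 3) :
    pd i (fun p => - u p) = fun p => - pd i u p := by
  funext p
  simp only [pd]
  rw [fderiv_fun_neg]; rfl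

theorem pd_mul {u v : Pt → ℝ} (hu : Sm u) (hv : Sm v) (i : Fin 3) :
    pd i (fun p => u p * v p) = fun p => pd i u p * v p + u p * pd i v p := by
  funext p
  simp only [pd]
  rw [fderiv_fun_mul (hu.da p) (hv.da p)]
  simp; ring

theorem pd_const (c : ℝ) (i : Fin 3) : pd i (fun _ => c) = fun _ => 0 := by
  funext p; simp [pd]

theorem pd_cmul {u : Pt → ℝ} (hu : Sm u) (c : ℝ) (i : Fin 3) :
    pd i (fun p => c * u p) = fun p => c * pd i u p := by
  rw [pd_mul contDiff_const hu, pd_const]; simp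

theorem pd_pow {u : Pt → ℝ} (hu : Sm u) (n : ℕ) (i : Fin 3) :
    pd i (fun p => u p ^ n) = fun p => n * u p ^ (n-1) * pd i u p := by
  funext p
  simp only [pd]
  rw [fderiv_fun_pow n (hu.da p)]
  simp

theorem pd_coord (j i : Fin 3) : pd i (fun p => p j) = fun _ => if i = j then 1 else 0 := by
  funext p
  have : fderiv ℝ (fun p : Pt => p j) p = ContinuousLinearMap.proj j :=
    (ContinuousLinearMap.proj (R := ℝ) (φ := fun _ : Fin 3 => ℝ) j).fderiv
  simp only [pd]
  rw [this]
  simp [Pi.single_apply, eq_comm]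

theorem pd_comm {u : Pt → ℝ} (hu : Sm u) (i j : Fin 3) : pd i (pd j u) = pd j (pd i u) := by
  funext p
  have h1 : Differentiable ℝ (fderiv ℝ u) := (hu.fderiv_right (m := 1) (by norm_cast)).differentiable (by simp)
  have key : ∀ a b : Fin 3, pd a (pd b u) p = fderiv ℝ (fderiv ℝ u) p (Pi.single a 1) (Pi.single b 1) := by
    intro a b
    unfold pd
    rw [fderiv_clm_apply (h1 p) (by fun_prop)]
    simp
  rw [key, key]
  have := second_derivative_symmetric (f := u) (f' := fderiv ℝ u) (f'' := fderiv ℝ (fderiv ℝ u) p) (x := p)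
    (fun y => (hu.da y).hasFDerivAt) (h1 p).hasFDerivAt
  exact this _ _


theorem smBoost {u : Pt → ℝ} (h : ContDiff ℝ (⊤ : ℕ∞) u) (a : Fin 2) :
    ContDiff ℝ (⊤ : ℕ∞) (boost a u) := by
  unfold boost; fun_prop

/-- the letters -/
def dd (i : Fin 5) : (Pt → ℝ) → Pt → ℝ := ![pd 0, pd 1, pd 2, boost 0, boost 1] i

theorem dd0 : dd 0 = pd 0 := rfl
theorem dd1 : dd 1 = pd 1 := rfl
theorem dd2 : dd 2 = pd 2 := rfl
theorem dd3 : dd 3 = boost 0 := rfl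
theorem dd4 : dd 4 = boost 1 := rfl
/-- embed coordinate letters -/
def emb (α : Fin 3) : Fin 5 := ⟨α.1, by omega⟩
theorem dd_emb (α : Fin 3) : dd (emb α) = pd α := by fin_cases α <;> rfl

theorem boost0 (u : Pt → ℝ) : boost 0 u = fun p => p 1 * pd 0 u p + p 0 * pd 1 u p := rfl
theorem boost1 (u : Pt → ℝ) : boost 1 u = fun p => p 2 * pd 0 u p + p 0 * pd 2 u p := rfl

@[fun_prop]
theorem smDd {u : Pt → ℝ} (h : ContDiff ℝ (⊤ : ℕ∞) u) (i : Fin 5) : ContDiff ℝ (⊤ : ℕ∞) (dd i u) := by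
  fin_cases i
  · exact smPd h 0
  · exact smPd h 1
  · exact smPd h 2
  · exact smBoost h 0
  · exact smBoost h 1

theorem dd_add {u v : Pt → ℝ} (hu : Sm u) (hv : Sm v) (i : Fin 5) :
    dd i (fun p => u p + v p) = fun p => dd i u p + dd i v p := by
  fin_cases i <;> simp (disch := fun_prop) only [Fin.zero_eta, Fin.mk_one, Fin.reduceFinMk, dd0, dd1, dd2, dd3, dd4, boost0, boost1, pd_add] <;>
    funext p <;> ring

theorem dd_cmul {u : Pt → ℝ} (hu : Sm u) (c : ℝ) (i : Fin 5) :
    dd i (fun p => c * u p) = fun p => c * dd i u p := by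
  fin_cases i <;> simp (disch := fun_prop) only [Fin.zero_eta, Fin.mk_one, Fin.reduceFinMk, dd0, dd1, dd2, dd3, dd4, boost0, boost1, pd_cmul] <;>
    funext p <;> ring

theorem dd_mul {u v : Pt → ℝ} (hu : Sm u) (hv : Sm v) (i : Fin 5) :
    dd i (fun p => u p * v p) = fun p => dd i u p * v p + u p * dd i v p := by
  fin_cases i <;> simp (disch := fun_prop) only [Fin.zero_eta, Fin.mk_one, Fin.reduceFinMk, dd0, dd1, dd2, dd3, dd4, boost0, boost1, pd_mul] <;>
    funext p <;> ring

/-- commutator coefficients -/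
def cc (i : Fin 5) (α β : Fin 3) : ℝ :=
  if i = 3 then (if (α = 0 ∧ β = 1) ∨ (α = 1 ∧ β = 0) then -1 else 0)
  else if i = 4 then (if (α = 0 ∧ β = 2) ∨ (α = 2 ∧ β = 0) then -1 else 0) else 0

theorem cc_abs (i α β) : |cc i α β| ≤ 1 := by
  unfold cc; split_ifs <;> simp

theorem dd_pd {u : Pt → ℝ} (hu : Sm u) (i : Fin 5) (α : Fin 3) :
    dd i (pd α u) = fun p => pd α (dd i u) p + (cc i α 0 * pd 0 u p + cc i α 1 * pd 1 u p + cc i α 2 * pd 2 u p) := by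
  funext p
  fin_cases i
  · simp [cc, dd0, pd_comm hu α 0]
  · simp [cc, dd1, pd_comm hu α 1]
  · simp [cc, dd2, pd_comm hu α 2]
  · fin_cases α <;> simp (disch := fun_prop) [cc, dd3, boost0, pd_add, pd_mul, pd_coord, pd_comm hu 1 0, pd_comm hu 2 0, pd_comm hu 2 1] <;> ring
  · fin_cases α <;> simp (disch := fun_prop) [cc, dd4, boost1, pd_add, pd_mul, pd_coord, pd_comm hu 1 0, pd_comm hu 2 0, pd_comm hu 2 1] <;> ring

theorem negBox_eq (u : Pt → ℝ) : negBox u = fun p => pd 0 (pd 0 u) p - pd 1 (pd 1 u) p - pd 2 (pd 2 u) p := rfl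

@[fun_prop]
theorem smNegBox {u : Pt → ℝ} (h : ContDiff ℝ (⊤ : ℕ∞) u) : ContDiff ℝ (⊤ : ℕ∞) (negBox u) := by
  rw [negBox_eq]; fun_prop

theorem dd_negBox {u : Pt → ℝ} (hu : Sm u) (i : Fin 5) : negBox (dd i u) = dd i (negBox u) := by
  have h10 := pd_comm hu 1 0
  have h20 := pd_comm hu 2 0
  have h21 := pd_comm hu 2 1
  have k10 := fun α => pd_comm (smPd hu α) 1 0
  have k20 := fun α => pd_comm (smPd hu α) 2 0
  have k21 := fun α => pd_comm (smPd hu α) 2 1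
  funext p
  fin_cases i <;> simp (disch := fun_prop) [dd0, dd1, dd2, dd3, dd4, boost0, boost1, negBox_eq, pd_add, pd_sub, pd_mul, pd_coord, h10, h20, h21, k10, k20, k21, pd_const] <;> ring

/-- support in the double cone -/
def Sup (u : Pt → ℝ) : Prop := ∀ p, |p 0 - 2| + 1 < rad p → u p = 0

theorem rad_cont : Continuous rad := by unfold rad; fun_prop

theorem Sup.pd {u : Pt → ℝ} (h : Sup u) (i : Fin 3) : Sup (pd i u) := by
  intro p hp
  have : u =ᶠ[nhds p] fun _ => 0 := by
    have ho : IsOpen {p : Pt | |p 0 - 2| + 1 < rad p} :=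
      isOpen_lt (by fun_prop) rad_cont
    filter_upwards [ho.mem_nhds hp] with q hq using h q hq
  simp [_root_.pd, this.fderiv_eq]

theorem Sup.dd {u : Pt → ℝ} (h : Sup u) (i : Fin 5) : Sup (dd i u) := by
  fin_cases i
  · exact h.pd 0
  · exact h.pd 1
  · exact h.pd 2
  · intro p hp; change boost 0 u p = 0; simp [boost0, h.pd 0 p hp, h.pd 1 p hp]
  · intro p hp; change boost 1 u p = 0; simp [boost1, h.pd 0 p hp, h.pd 2 p hp]

theorem Sup.add {u v : Pt → ℝ} (h : Sup u) (h' : Sup v) : Sup (fun p => u p + v p) := by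
  intro p hp; simp [h p hp, h' p hp]
theorem Sup.sub {u v : Pt → ℝ} (h : Sup u) (h' : Sup v) : Sup (fun p => u p - v p) := by
  intro p hp; simp [h p hp, h' p hp]
theorem Sup.mul_left {u : Pt → ℝ} (h : Sup u) (v : Pt → ℝ) : Sup (fun p => v p * u p) := by
  intro p hp; simp [h p hp]
theorem Sup.mul_right {u : Pt → ℝ} (h : Sup u) (v : Pt → ℝ) : Sup (fun p => u p * v p) := by
  intro p hp; simp [h p hp]
theorem Sup.pow {u : Pt → ℝ} (h : Sup u) (n : ℕ) : Sup (fun p => u p ^ (n+1)) := by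
  intro p hp; simp [h p hp]
theorem Sup.negBox {u : Pt → ℝ} (h : Sup u) : Sup (negBox u) := by
  intro p hp; simp [_root_.negBox, (h.pd _).pd _ p hp]

/-- words, innermost letter first -/
def Dw : List (Fin 5) → (Pt → ℝ) → Pt → ℝ
  | [], u => u
  | i :: l, u => Dw l (dd i u)

theorem smDw {u : Pt → ℝ} (h : Sm u) (l : List (Fin 5)) : Sm (Dw l u) := by
  induction l generalizing u with
  | nil => exact h
  | cons i l ih => exact ih (smDd h i)

theorem Sup.Dw {u : Pt → ℝ} (h : Sup u) (l : List (Fin 5)) : Sup (Dw l u) := by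
  induction l generalizing u with
  | nil => exact h
  | cons i l ih => exact ih (h.dd i)

theorem Dw_append (l m : List (Fin 5)) (u : Pt → ℝ) : Dw (l ++ m) u = Dw m (Dw l u) := by
  induction l generalizing u with
  | nil => rfl
  | cons i l ih => exact ih _

theorem Dw_add {u v : Pt → ℝ} (hu : Sm u) (hv : Sm v) (l : List (Fin 5)) :
    Dw l (fun p => u p + v p) = fun p => Dw l u p + Dw l v p := by
  induction l generalizing u v with
  | nil => rfl
  | cons i l ih => simp only [Dw, dd_add hu hv]; exact ih (smDd hu i) (smDd hv i)

theorem Dw_cmul {u : Pt → ℝ} (hu : Sm u) (c : ℝ) (l : List (Fin 5)) :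
    Dw l (fun p => c * u p) = fun p => c * Dw l u p := by
  induction l generalizing u with
  | nil => rfl
  | cons i l ih => simp only [Dw, dd_cmul hu]; exact ih (smDd hu i)

theorem Dw_sub {u v : Pt → ℝ} (hu : Sm u) (hv : Sm v) (l : List (Fin 5)) :
    Dw l (fun p => u p - v p) = fun p => Dw l u p - Dw l v p := by
  have h := Dw_add hu (show Sm (fun p => (-1) * v p) by fun_prop) l
  rw [Dw_cmul hv] at h
  simpa [sub_eq_add_neg] using h

theorem Dw_negBox {u : Pt → ℝ} (hu : Sm u) (l : List (Fin 5)) : negBox (Dw l u) = Dw l (negBox u) := by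
  induction l generalizing u with
  | nil => rfl
  | cons i l ih => simp only [Dw]; rw [ih (smDd hu i), dd_negBox hu]

/-- words of letters in `A` of length at most `k` -/
def Wd (A : Finset (Fin 5)) (k : ℕ) : Set (List (Fin 5)) := {l | l.length ≤ k ∧ ∀ i ∈ l, i ∈ A}

theorem Wd_nil (A k) : [] ∈ Wd A k := by simp [Wd]
theorem Wd_cons {A k i l} (hi : i ∈ A) (h : l ∈ Wd A k) : i :: l ∈ Wd A (k+1) := by
  simp only [Wd, Set.mem_ofPred_eq, List.length_cons, List.mem_cons] at h ⊢
  exact ⟨by omega, by rintro j (rfl | hj); exacts [hi, h.2 j hj]⟩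
theorem Wd_mono {A j k l} (h : j ≤ k) (hl : l ∈ Wd A j) : l ∈ Wd A k := ⟨hl.1.trans h, hl.2⟩
theorem Wd_append {A j k l m} (hl : l ∈ Wd A j) (hm : m ∈ Wd A k) : l ++ m ∈ Wd A (j+k) := by
  refine ⟨by simp; have := hl.1; have := hm.1; omega, fun i hi => ?_⟩
  rcases List.mem_append.1 hi with h | h
  exacts [hl.2 i h, hm.2 i h]

/-- seminorm-type densities -/
structure Sn (N : (Pt → ℝ) → Pt → ℝ) : Prop where
  nn : ∀ u p, 0 ≤ N u p
  add : ∀ u v p, Sm u → Sm v → N (fun q => u q + v q) p ≤ N u p + N v p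
  smul : ∀ u p (c : ℝ), Sm u → N (fun q => c * u q) p = |c| * N u p

/-- sum of the density over words -/
def nmF (A : Finset (Fin 5)) (N : (Pt → ℝ) → Pt → ℝ) : ℕ → (Pt → ℝ) → Pt → ℝ
  | 0, u, p => N u p
  | k+1, u, p => nmF A N k u p + ∑ i ∈ A, nmF A N k (dd i u) p

def aN (u : Pt → ℝ) (p : Pt) : ℝ := |u p|
def dA (u : Pt → ℝ) (p : Pt) : ℝ := |pd 0 u p| + |pd 1 u p| + |pd 2 u p|

theorem Sn_aN : Sn aN where
  nn u p := abs_nonneg _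
  add u v p _ _ := abs_add_le _ _
  smul u p c _ := abs_mul _ _

theorem Sn_dA : Sn dA where
  nn u p := by unfold dA; positivity
  add u v p hu hv := by
    simp only [dA, pd_add hu hv]
    linarith [abs_add_le (pd 0 u p) (pd 0 v p), abs_add_le (pd 1 u p) (pd 1 v p), abs_add_le (pd 2 u p) (pd 2 v p)]
  smul u p c hu := by simp only [dA, pd_cmul hu, abs_mul]; ring

section nm
variable {A : Finset (Fin 5)} {N : (Pt → ℝ) → Pt → ℝ}

theorem nmF_nn (hN : Sn N) (k u p) : 0 ≤ nmF A N k u p := by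
  induction k generalizing u with
  | zero => exact hN.nn u p
  | succ k ih => exact add_nonneg (ih u) (Finset.sum_nonneg fun i _ => ih _)

theorem nmF_le_succ (hN : Sn N) (k u p) : nmF A N k u p ≤ nmF A N (k+1) u p :=
  le_add_of_nonneg_right (Finset.sum_nonneg fun i _ => nmF_nn hN k _ p)

theorem nmF_mono (hN : Sn N) {j k} (h : j ≤ k) (u p) : nmF A N j u p ≤ nmF A N k u p := by
  induction h with
  | refl => exact le_rfl
  | step _ ih => exact ih.trans (nmF_le_succ hN _ _ _)

theorem nmF_dd (hN : Sn N) (k u p) {i} (hi : i ∈ A) : nmF A N k (dd i u) p ≤ nmF A N (k+1) u p :=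
  (Finset.single_le_sum (f := fun i => nmF A N k (dd i u) p) (fun i _ => nmF_nn hN k _ p) hi).trans
    (le_add_of_nonneg_left (nmF_nn hN k u p))

theorem nmF_Dw' (hN : Sn N) {k j u p} {l : List (Fin 5)} (hl : l ∈ Wd A j) :
    nmF A N k (Dw l u) p ≤ nmF A N (k+j) u p := by
  induction l generalizing j u with
  | nil => exact nmF_mono hN (by omega) u p
  | cons i l ih =>
    obtain ⟨h1, h2⟩ := hl
    simp only [List.length_cons] at h1
    obtain ⟨j, rfl⟩ : ∃ m, j = m+1 := ⟨j-1, by omega⟩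
    have := ih (j := j) (u := dd i u) ⟨by omega, fun a ha => h2 a (by simp [ha])⟩
    exact this.trans (nmF_dd hN (k+j) u p (h2 i (by simp)))

theorem nmF_Dw (hN : Sn N) {k u p} {l : List (Fin 5)} (hl : l ∈ Wd A k) :
    N (Dw l u) p ≤ nmF A N k u p := by
  have := nmF_Dw' hN (k := 0) (u := u) (p := p) hl
  simpa [nmF] using this

theorem nmF_le {k u p K} (hK : 0 ≤ K) (h : ∀ l ∈ Wd A k, N (Dw l u) p ≤ K) : nmF A N k u p ≤ 6^k * K := by
  induction k generalizing u with
  | zero => simpa [nmF, Dw] using h [] (Wd_nil A 0)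
  | succ k ih =>
    have h1 := ih (u := u) (fun l hl => h l (Wd_mono (by omega) hl))
    have h2 : ∑ i ∈ A, nmF A N k (dd i u) p ≤ ∑ i ∈ A, 6^k * K :=
      Finset.sum_le_sum fun i hi => ih (u := dd i u) fun l hl => h (i :: l) (Wd_cons hi hl)
    have h3 : ∑ i ∈ A, (6:ℝ)^k * K ≤ 5 * (6^k * K) := by
      rw [Finset.sum_const, nsmul_eq_mul]
      have : A.card ≤ 5 := by simpa using Finset.card_le_univ A
      gcongr; exact_mod_cast this
    simp only [nmF]; rw [pow_succ]; linarith

theorem nmF_add (hN : Sn N) {u v} (hu : Sm u) (hv : Sm v) (k p) :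
    nmF A N k (fun q => u q + v q) p ≤ nmF A N k u p + nmF A N k v p := by
  induction k generalizing u v with
  | zero => exact hN.add u v p hu hv
  | succ k ih =>
    simp only [nmF, dd_add hu hv]
    have := ih hu hv
    have h2 : ∑ i ∈ A, nmF A N k (fun p => dd i u p + dd i v p) p ≤ ∑ i ∈ A, (nmF A N k (dd i u) p + nmF A N k (dd i v) p) :=
      Finset.sum_le_sum fun i _ => ih (smDd hu i) (smDd hv i)
    rw [Finset.sum_add_distrib] at h2
    linarith

theorem nmF_cmul (hN : Sn N) {u} (hu : Sm u) (c : ℝ) (k p) :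
    nmF A N k (fun q => c * u q) p = |c| * nmF A N k u p := by
  induction k generalizing u with
  | zero => exact hN.smul u p c hu
  | succ k ih =>
    simp only [nmF, dd_cmul hu, ih hu, mul_add, Finset.mul_sum]
    congr 1
    exact Finset.sum_congr rfl fun i _ => ih (smDd hu i)

theorem nmF_sub (hN : Sn N) {u v} (hu : Sm u) (hv : Sm v) (k p) :
    nmF A N k (fun q => u q - v q) p ≤ nmF A N k u p + nmF A N k v p := by
  have h := nmF_add (A := A) hN hu (show Sm (fun p => (-1) * v p) by fun_prop) k p
  rw [nmF_cmul hN hv] at h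
  simpa [sub_eq_add_neg] using h

theorem nmF_congr_le {N' : (Pt → ℝ) → Pt → ℝ} {u p} (c : ℝ)
    (h : ∀ l, N (Dw l u) p ≤ c * N' (Dw l u) p) (k) : nmF A N k u p ≤ c * nmF A N' k u p := by
  induction k generalizing u with
  | zero => exact h []
  | succ k ih =>
    simp only [nmF, mul_add, Finset.mul_sum]
    exact add_le_add (ih h) (Finset.sum_le_sum fun i _ => ih fun l => h (i :: l))


theorem nm_dd_pd (hN : Sn N) {u} (hu : Sm u) (i : Fin 5) (α : Fin 3) (k p) :
    nmF A N k (dd i (pd α u)) p ≤ nmF A N k (pd α (dd i u)) p +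
      (nmF A N k (pd 0 u) p + nmF A N k (pd 1 u) p + nmF A N k (pd 2 u) p) := by
  rw [dd_pd hu]
  have h1 : ∀ β, Sm (fun p => cc i α β * pd β u p) := fun β => by fun_prop
  have h2 : ∀ β, nmF A N k (fun p => cc i α β * pd β u p) p ≤ nmF A N k (pd β u) p := fun β => by
    rw [nmF_cmul hN (smPd hu β)]
    exact mul_le_of_le_one_left (nmF_nn hN _ _ _) (cc_abs _ _ _)
  have a1 := nmF_add (A := A) hN (smPd (smDd hu i) α) (((h1 0).add (h1 1)).add (h1 2)) k p
  have a2 := nmF_add (A := A) hN ((h1 0).add (h1 1)) (h1 2) k p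
  have a3 := nmF_add (A := A) hN (h1 0) (h1 1) k p
  linarith [h2 0, h2 1, h2 2]

theorem nm_pd_dd (hN : Sn N) {u} (hu : Sm u) (i : Fin 5) (α : Fin 3) (k p) :
    nmF A N k (pd α (dd i u)) p ≤ nmF A N k (dd i (pd α u)) p +
      (nmF A N k (pd 0 u) p + nmF A N k (pd 1 u) p + nmF A N k (pd 2 u) p) := by
  have e : pd α (dd i u) = fun p => dd i (pd α u) p - (cc i α 0 * pd 0 u p + cc i α 1 * pd 1 u p + cc i α 2 * pd 2 u p) := by
    rw [dd_pd hu]; funext p; ring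
  rw [e]
  have h1 : ∀ β, Sm (fun p => cc i α β * pd β u p) := fun β => by fun_prop
  have h2 : ∀ β, nmF A N k (fun p => cc i α β * pd β u p) p ≤ nmF A N k (pd β u) p := fun β => by
    rw [nmF_cmul hN (smPd hu β)]
    exact mul_le_of_le_one_left (nmF_nn hN _ _ _) (cc_abs _ _ _)
  have a1 := nmF_sub (A := A) hN (smDd (smPd hu α) i) (((h1 0).add (h1 1)).add (h1 2)) k p
  have a2 := nmF_add (A := A) hN ((h1 0).add (h1 1)) (h1 2) k p
  have a3 := nmF_add (A := A) hN (h1 0) (h1 1) k p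
  linarith [h2 0, h2 1, h2 2]

theorem sum_le_five {f : Fin 5 → ℝ} {K : ℝ} (hK : 0 ≤ K) (h : ∀ i ∈ A, f i ≤ K) : ∑ i ∈ A, f i ≤ 5 * K := by
  refine (Finset.sum_le_sum h).trans ?_
  rw [Finset.sum_const, nsmul_eq_mul]
  have : A.card ≤ 5 := by simpa using Finset.card_le_univ A
  gcongr; exact_mod_cast this

/-- ∂ passes through words, I -/
theorem nm_pd_le {u} (hu : Sm u) (α : Fin 3) (k p) :
    nmF A aN k (pd α u) p ≤ 16^k * nmF A dA k u p := by
  induction k generalizing u α with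
  | zero =>
    simp only [nmF, aN, dA, pow_zero, one_mul]
    fin_cases α <;> simp <;> linarith [abs_nonneg (pd 0 u p), abs_nonneg (pd 1 u p), abs_nonneg (pd 2 u p)]
  | succ k ih =>
    have hn := nmF_nn (A := A) Sn_dA k u p
    have h2 : ∑ i ∈ A, nmF A aN k (dd i (pd α u)) p ≤ ∑ i ∈ A, (16^k * nmF A dA k (dd i u) p + 3 * (16^k * nmF A dA k u p)) := by
      refine Finset.sum_le_sum fun i _ => ?_
      linarith [nm_dd_pd (A := A) Sn_aN hu i α k p, ih (smDd hu i) α, ih hu 0, ih hu 1, ih hu 2]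
    have h3 : ∑ i ∈ A, 3 * (16^k * nmF A dA k u p) ≤ 5 * (3 * (16^k * nmF A dA k u p)) :=
      sum_le_five (by positivity) fun i _ => le_rfl
    rw [Finset.sum_add_distrib, ← Finset.mul_sum] at h2
    have h4 : 0 ≤ (16:ℝ)^k * ∑ i ∈ A, nmF A dA k (dd i u) p :=
      mul_nonneg (by positivity) (Finset.sum_nonneg fun i _ => nmF_nn Sn_dA _ _ _)
    simp only [nmF]
    rw [pow_succ]
    linarith [ih hu α]

/-- ∂ passes through words, II -/
theorem nm_dA_le {u} (hu : Sm u) (k p) :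
    nmF A dA k u p ≤ 19^k * (nmF A aN k (pd 0 u) p + nmF A aN k (pd 1 u) p + nmF A aN k (pd 2 u) p) := by
  induction k generalizing u with
  | zero => simp [nmF, aN, dA]
  | succ k ih =>
    have hn := fun α => nmF_nn (A := A) Sn_aN k (pd α u) p
    have h2 : ∑ i ∈ A, nmF A dA k (dd i u) p ≤ ∑ i ∈ A, 19^k * ((nmF A aN k (dd i (pd 0 u)) p + nmF A aN k (dd i (pd 1 u)) p + nmF A aN k (dd i (pd 2 u)) p) + 3 * (nmF A aN k (pd 0 u) p + nmF A aN k (pd 1 u) p + nmF A aN k (pd 2 u) p)) := by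
      refine Finset.sum_le_sum fun i _ => (ih (smDd hu i)).trans (mul_le_mul_of_nonneg_left ?_ (by positivity))
      linarith [nm_pd_dd (A := A) Sn_aN hu i 0 k p, nm_pd_dd (A := A) Sn_aN hu i 1 k p, nm_pd_dd (A := A) Sn_aN hu i 2 k p]
    have h3 : ∑ i ∈ A, 3 * (nmF A aN k (pd 0 u) p + nmF A aN k (pd 1 u) p + nmF A aN k (pd 2 u) p) ≤ 5 * (3 * (nmF A aN k (pd 0 u) p + nmF A aN k (pd 1 u) p + nmF A aN k (pd 2 u) p)) :=
      sum_le_five (by linarith [hn 0, hn 1, hn 2]) fun i _ => le_rfl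
    rw [← Finset.mul_sum, Finset.sum_add_distrib, Finset.sum_add_distrib, Finset.sum_add_distrib] at h2
    have h4 := fun α => Finset.sum_nonneg (s := A) fun i _ => nmF_nn (A := A) Sn_aN k (dd i (pd α u)) p
    simp only [nmF]
    have h5 := ih hu
    have h6 := (add_le_add h5 h2).trans_eq (by ring : _ = (19:ℝ)^k * ((nmF A aN k (pd 0 u) p + nmF A aN k (pd 1 u) p + nmF A aN k (pd 2 u) p) + (∑ i ∈ A, nmF A aN k (dd i (pd 0 u)) p + ∑ i ∈ A, nmF A aN k (dd i (pd 1 u)) p + ∑ i ∈ A, nmF A aN k (dd i (pd 2 u)) p + ∑ i ∈ A, 3 * (nmF A aN k (pd 0 u) p + nmF A aN k (pd 1 u) p + nmF A aN k (pd 2 u) p))))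
    refine h6.trans ?_
    rw [pow_succ, mul_assoc]
    refine mul_le_mul_of_nonneg_left ?_ (by positivity)
    linarith [hn 0, hn 1, hn 2, h4 0, h4 1, h4 2]

/-- Leibniz bound for bilinear derivation-type operations -/
theorem leib {B : (Pt → ℝ) → (Pt → ℝ) → Pt → ℝ}
    (hS : ∀ f g, Sm f → Sm g → Sm (B f g))
    (hB : ∀ f g i, Sm f → Sm g → dd i (B f g) = fun p => B (dd i f) g p + B f (dd i g) p)
    {f g} (hf : Sm f) (hg : Sm g) {p K} {l : List (Fin 5)}
    (h : ∀ l1 l2, l1.length + l2.length = l.length → (∀ i ∈ l1, i ∈ l) → (∀ i ∈ l2, i ∈ l) →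
      |B (Dw l1 f) (Dw l2 g) p| ≤ K) : |Dw l (B f g) p| ≤ 2^l.length * K := by
  induction l generalizing f g with
  | nil => simpa [Dw] using h [] [] rfl (by simp) (by simp)
  | cons i l ih =>
    simp only [Dw, hB f g i hf hg]
    rw [Dw_add (hS _ _ (smDd hf i) hg) (hS _ _ hf (smDd hg i))]
    have h1 := ih (f := dd i f) (g := g) (smDd hf i) hg (fun l1 l2 e a b => h (i :: l1) l2 (by simp; omega)
      (by intro j hj; rcases List.mem_cons.1 hj with rfl | hj; exacts [by simp, by simp [a j hj]]) (fun j hj => by simp [b j hj]))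
    have h2 := ih (f := f) (g := dd i g) hf (smDd hg i) (fun l1 l2 e a b => h l1 (i :: l2) (by simp; omega)
      (fun j hj => by simp [a j hj]) (by intro j hj; rcases List.mem_cons.1 hj with rfl | hj; exacts [by simp, by simp [b j hj]]))
    refine (abs_add_le _ _).trans ?_
    rw [List.length_cons, pow_succ]; linarith

theorem leibW {B : (Pt → ℝ) → (Pt → ℝ) → Pt → ℝ}
    (hS : ∀ f g, Sm f → Sm g → Sm (B f g))
    (hB : ∀ f g i, Sm f → Sm g → dd i (B f g) = fun p => B (dd i f) g p + B f (dd i g) p)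
    {f g} (hf : Sm f) (hg : Sm g) {p K k} {l : List (Fin 5)} (hl : l ∈ Wd A k)
    (h : ∀ i j l1 l2, i + j = k → l1 ∈ Wd A i → l2 ∈ Wd A j → |B (Dw l1 f) (Dw l2 g) p| ≤ K) :
    |Dw l (B f g) p| ≤ 2^k * K := by
  have hK : 0 ≤ K := (abs_nonneg _).trans (h k 0 [] [] rfl (Wd_nil _ _) (Wd_nil _ _))
  have := leib hS hB hf hg (p := p) (K := K) (l := l) fun l1 l2 e a b =>
    h l1.length (k - l1.length) l1 l2 (by have := hl.1; omega) ⟨le_rfl, fun j hj => hl.2 j (a j hj)⟩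
      ⟨by have := hl.1; omega, fun j hj => hl.2 j (b j hj)⟩
  refine this.trans ?_
  gcongr
  · norm_num
  · exact hl.1

theorem leib_mul {f g} (hf : Sm f) (hg : Sm g) {p K k} {l : List (Fin 5)} (hl : l ∈ Wd A k)
    (h : ∀ i j, i + j = k → nmF A aN i f p * nmF A aN j g p ≤ K) :
    |Dw l (fun q => f q * g q) p| ≤ 2^k * K := by
  refine leibW (B := fun f g q => f q * g q) (fun f g hf hg => hf.mul hg) (fun f g i hf hg => dd_mul hf hg i)
    hf hg hl fun i j l1 l2 e h1 h2 => ?_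
  rw [abs_mul]
  exact (mul_le_mul (nmF_Dw Sn_aN h1) (nmF_Dw Sn_aN h2) (abs_nonneg _) (nmF_nn Sn_aN _ _ _)).trans (h i j e)

theorem nm_mul {f g} (hf : Sm f) (hg : Sm g) {p K k}
    (h : ∀ i j, i + j = k → nmF A aN i f p * nmF A aN j g p ≤ K) :
    nmF A aN k (fun q => f q * g q) p ≤ 12^k * K := by
  have hK : 0 ≤ K := (mul_nonneg (nmF_nn Sn_aN _ _ _) (nmF_nn Sn_aN _ _ _)).trans (h k 0 rfl)
  have := nmF_le (A := A) (N := aN) (k := k) (u := fun q => f q * g q) (p := p) (K := 2^k * K) (by positivity)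
    fun l hl => leib_mul hf hg hl h
  refine this.trans_eq ?_
  rw [← mul_assoc, ← mul_pow]; norm_num

end nm

@[fun_prop]
theorem smDw' {u : Pt → ℝ} (h : ContDiff ℝ (⊤ : ℕ∞) u) (l : List (Fin 5)) : ContDiff ℝ (⊤ : ℕ∞) (Dw l u) := smDw h l

theorem fderiv_sum3 (u : Pt → ℝ) (p v : Pt) :
    fderiv ℝ u p v = v 0 * pd 0 u p + v 1 * pd 1 u p + v 2 * pd 2 u p := by
  have : v = v 0 • (Pi.single 0 1 : Pt) + v 1 • (Pi.single 1 1 : Pt) + v 2 • (Pi.single 2 1 : Pt) := by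
    funext i; fin_cases i <;> simp [Pi.single_apply]
  conv_lhs => rw [this]
  simp [pd]

/-- chain rule along a curve -/
theorem chain {u : Pt → ℝ} (hu : Sm u) {c : ℝ → Pt} {y : ℝ} {a0 a1 a2 : ℝ}
    (h0 : HasDerivAt (fun y => c y 0) a0 y) (h1 : HasDerivAt (fun y => c y 1) a1 y)
    (h2 : HasDerivAt (fun y => c y 2) a2 y) :
    HasDerivAt (fun y => u (c y)) (a0 * pd 0 u (c y) + a1 * pd 1 u (c y) + a2 * pd 2 u (c y)) y := by
  have hc : HasDerivAt c ![a0, a1, a2] y := by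
    rw [hasDerivAt_pi]; intro i; fin_cases i
    exacts [h0, h1, h2]
  have := (hu.da (c y)).hasFDerivAt.comp_hasDerivAt y hc
  rw [fderiv_sum3] at this
  exact this

abbrev X2 : Type := Fin 2 → ℝ

theorem rad2_cont : Continuous rad2 := by unfold rad2; fun_prop

theorem rad2_le_iff {x : X2} {R : ℝ} (hR : 0 ≤ R) : rad2 x ≤ R ↔ x 0 ^ 2 + x 1 ^ 2 ≤ R^2 := by
  unfold rad2; rw [Real.sqrt_le_left hR]

theorem norm_le_rad2 (x : X2) : ‖x‖ ≤ rad2 x := by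
  refine (pi_norm_le_iff_of_nonneg (Real.sqrt_nonneg _)).2 fun i => ?_
  rw [Real.norm_eq_abs]
  apply Real.abs_le_sqrt
  fin_cases i <;> simp <;> positivity

theorem compact_rad2 (R : ℝ) : IsCompact {x : X2 | rad2 x ≤ R} := by
  apply Metric.isCompact_of_isClosed_isBounded (isClosed_le rad2_cont continuous_const)
  refine (Metric.isBounded_closedBall (x := (0:X2)) (r := R)).subset ?_
  intro x hx
  simpa using (norm_le_rad2 x).trans hx

/-- continuous and compactly supported -/
def CC (R : ℝ) (f : X2 → ℝ) : Prop := Continuous f ∧ ∀ x, R < rad2 x → f x = 0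

theorem CC.hcs {R f} (h : CC R f) : HasCompactSupport f :=
  HasCompactSupport.intro (compact_rad2 R) fun x hx => h.2 x (not_le.1 hx)

theorem CC.int {R f} (h : CC R f) : Integrable f := h.1.integrable_of_hasCompactSupport h.hcs

theorem CC.add {R f g} (h : CC R f) (h' : CC R g) : CC R (fun x => f x + g x) :=
  ⟨h.1.add h'.1, fun x hx => by simp [h.2 x hx, h'.2 x hx]⟩
theorem CC.sub {R f g} (h : CC R f) (h' : CC R g) : CC R (fun x => f x - g x) :=
  ⟨h.1.sub h'.1, fun x hx => by simp [h.2 x hx, h'.2 x hx]⟩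
theorem CC.mul {R f g} (h : CC R f) (h' : Continuous g) : CC R (fun x => g x * f x) :=
  ⟨h'.mul h.1, fun x hx => by simp [h.2 x hx]⟩
theorem CC.pow {R f} (h : CC R f) (n : ℕ) : CC R (fun x => f x ^ (n+1)) :=
  ⟨h.1.pow _, fun x hx => by simp [h.2 x hx]⟩
theorem CC.sq {R f} (h : CC R f) : CC R (fun x => f x ^ 2) := h.pow 1
theorem CC.abs {R f} (h : CC R f) : CC R (fun x => |f x|) :=
  ⟨h.1.abs, fun x hx => by simp [h.2 x hx]⟩

/-- monotonicity of integrals with integrability of the majorant only -/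
theorem int_mono {f g : X2 → ℝ} (h0 : ∀ x, 0 ≤ f x) (hg : Integrable g) (h : ∀ x, f x ≤ g x) :
    ∫ x, f x ≤ ∫ x, g x :=
  integral_mono_of_nonneg (Filter.Eventually.of_forall h0) hg (Filter.Eventually.of_forall h)

theorem fub {f : X2 → ℝ} (h : Integrable f) : ∫ x, f x = ∫ a : ℝ, ∫ b : ℝ, f ![a, b] := by
  have mp := (volume_preserving_finTwoArrow ℝ).symm
  have e := mp.integral_comp (MeasurableEquiv.measurableEmbedding _) f
  rw [← e, Measure.volume_eq_prod, integral_prod]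
  · rfl
  · have := (mp.integrable_comp_emb (MeasurableEquiv.measurableEmbedding _) (g := f)).2 h
    rw [Measure.volume_eq_prod] at this
    exact this

theorem fub' {f : X2 → ℝ} (h : Integrable f) : ∫ x, f x = ∫ b : ℝ, ∫ a : ℝ, f ![a, b] := by
  have mp := (volume_preserving_finTwoArrow ℝ).symm
  have e := mp.integral_comp (MeasurableEquiv.measurableEmbedding _) f
  rw [← e, Measure.volume_eq_prod, integral_prod_symm]
  · rfl
  · have := (mp.integrable_comp_emb (MeasurableEquiv.measurableEmbedding _) (g := f)).2 h
    rw [Measure.volume_eq_prod] at this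
    exact this

theorem fub_int {f : X2 → ℝ} (h : Integrable f) : Integrable (fun a : ℝ => ∫ b : ℝ, f ![a, b]) := by
  have mp := (volume_preserving_finTwoArrow ℝ).symm
  have := (mp.integrable_comp_emb (MeasurableEquiv.measurableEmbedding _) (g := f)).2 h
  rw [Measure.volume_eq_prod] at this
  exact this.integral_prod_left

theorem rad2_pair1 (a b : ℝ) : |a| ≤ rad2 ![a, b] := by
  unfold rad2; apply Real.abs_le_sqrt; simp; positivity
theorem rad2_pair2 (a b : ℝ) : |b| ≤ rad2 ![a, b] := by
  unfold rad2; apply Real.abs_le_sqrt; simp; positivity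

theorem cpair2 (a : ℝ) : Continuous fun b : ℝ => (![a, b] : X2) := by
  refine continuous_pi fun i => ?_
  fin_cases i <;> simp <;> fun_prop
theorem cpair1 (b : ℝ) : Continuous fun a : ℝ => (![a, b] : X2) := by
  refine continuous_pi fun i => ?_
  fin_cases i <;> simp <;> fun_prop

theorem hcs1 {g : ℝ → ℝ} {R : ℝ} (h : ∀ a, R < |a| → g a = 0) : HasCompactSupport g := by
  refine HasCompactSupport.intro (isCompact_Icc (a := -R) (b := R)) fun a ha => h a ?_
  by_contra hc
  exact ha (abs_le.1 (not_lt.1 hc))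

theorem int1_zero {g g' : ℝ → ℝ} {R : ℝ} (h : ∀ a, HasDerivAt g (g' a) a) (hc : Continuous g')
    (h0 : ∀ a, R < |a| → g a = 0) (h0' : ∀ a, R < |a| → g' a = 0) : ∫ a, g' a = 0 := by
  have hi : Integrable g' := hc.integrable_of_hasCompactSupport (hcs1 h0')
  have t1 : Filter.Tendsto g Filter.atBot (nhds 0) := by
    refine tendsto_const_nhds.congr' ?_
    filter_upwards [Filter.eventually_lt_atBot (-R), Filter.eventually_lt_atBot 0] with a ha h2
    exact (h0 a (by rw [abs_of_neg h2]; linarith)).symm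
  have t2 : Filter.Tendsto g Filter.atTop (nhds 0) := by
    refine tendsto_const_nhds.congr' ?_
    filter_upwards [Filter.eventually_gt_atTop R, Filter.eventually_gt_atTop 0] with a ha h2
    exact (h0 a (by rw [abs_of_pos h2]; linarith)).symm
  have := integral_of_hasDerivAt_of_tendsto h hi t1 t2
  simpa using this

theorem int1_bd {g g' : ℝ → ℝ} {R : ℝ} (h : ∀ a, HasDerivAt g (g' a) a) (hc : Continuous g')
    (h0 : ∀ a, R < |a| → g a = 0) (h0' : ∀ a, R < |a| → g' a = 0) (a : ℝ) : |g a| ≤ ∫ y, |g' y| := by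
  have hi : Integrable g' := hc.integrable_of_hasCompactSupport (hcs1 h0')
  have t1 : Filter.Tendsto g Filter.atBot (nhds 0) := by
    refine tendsto_const_nhds.congr' ?_
    filter_upwards [Filter.eventually_lt_atBot (-R), Filter.eventually_lt_atBot 0] with a ha h2
    exact (h0 a (by rw [abs_of_neg h2]; linarith)).symm
  have := integral_Iic_of_hasDerivAt_of_tendsto' (a := a) (fun x _ => h x) hi.integrableOn t1
  rw [sub_zero] at this
  rw [← this]
  calc |∫ x in Set.Iic a, g' x| ≤ ∫ x in Set.Iic a, |g' x| := abs_integral_le_integral_abs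
    _ ≤ ∫ y, |g' y| := setIntegral_le_integral hi.abs (Filter.Eventually.of_forall fun _ => abs_nonneg _)

theorem int_d0 {R} {h h1 : X2 → ℝ} (d : ∀ a b, HasDerivAt (fun y => h ![y, b]) (h1 ![a, b]) a)
    (c : CC R h) (c1 : CC R h1) : ∫ x, h1 x = 0 := by
  rw [fub' c1.int]
  have : ∀ b, ∫ a : ℝ, h1 ![a, b] = 0 := fun b =>
    int1_zero (R := R) (fun a => d a b) (c1.1.comp (cpair1 b)) (fun a ha => c.2 _ (ha.trans_le (rad2_pair1 a b)))
      (fun a ha => c1.2 _ (ha.trans_le (rad2_pair1 a b)))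
  simp [this]

theorem int_d1 {R} {h h1 : X2 → ℝ} (d : ∀ a b, HasDerivAt (fun y => h ![a, y]) (h1 ![a, b]) b)
    (c : CC R h) (c1 : CC R h1) : ∫ x, h1 x = 0 := by
  rw [fub c1.int]
  have : ∀ a, ∫ b : ℝ, h1 ![a, b] = 0 := fun a =>
    int1_zero (R := R) (fun b => d a b) (c1.1.comp (cpair2 a)) (fun b ha => c.2 _ (ha.trans_le (rad2_pair2 a b)))
      (fun b ha => c1.2 _ (ha.trans_le (rad2_pair2 a b)))
  simp [this]

theorem x2_eta (x : X2) : ![x 0, x 1] = x := by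
  funext i; fin_cases i <;> rfl

/-- basic Sobolev bound -/
theorem sob2 {R} {h h1 h12 : X2 → ℝ} (d : ∀ a b, HasDerivAt (fun y => h ![y, b]) (h1 ![a, b]) a)
    (d' : ∀ a b, HasDerivAt (fun y => h1 ![a, y]) (h12 ![a, b]) b)
    (c : CC R h) (c1 : CC R h1) (c2 : CC R h12) (x : X2) : |h x| ≤ ∫ y, |h12 y| := by
  rw [fub c2.abs.int]
  have e1 : |h x| ≤ ∫ a, |h1 ![a, x 1]| := by
    have := int1_bd (R := R) (fun a => d a (x 1)) (c1.1.comp (cpair1 (x 1))) (fun a ha => c.2 _ (ha.trans_le (rad2_pair1 a _)))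
      (fun a ha => c1.2 _ (ha.trans_le (rad2_pair1 a _))) (x 0)
    rwa [x2_eta] at this
  refine e1.trans (integral_mono_of_nonneg (Filter.Eventually.of_forall fun _ => abs_nonneg _) (fub_int c2.abs.int) (Filter.Eventually.of_forall fun a => ?_))
  exact int1_bd (R := R) (fun b => d' a b) (c2.1.comp (cpair2 a)) (fun b ha => c1.2 _ (ha.trans_le (rad2_pair2 a b)))
      (fun b ha => c2.2 _ (ha.trans_le (rad2_pair2 a b))) (x 1)

/-- differentiation of a parametric integral with compact support -/
theorem dint {O : Set ℝ} (hO : IsOpen O) {s0 : ℝ} (h0 : s0 ∈ O) {F F' : ℝ → X2 → ℝ} {R : ℝ → ℝ}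
    (hR : ContinuousOn R O)
    (hd : ∀ s ∈ O, ∀ x, HasDerivAt (fun s => F s x) (F' s x) s)
    (hc : ContinuousOn (fun q : ℝ × X2 => F' q.1 q.2) (O ×ˢ Set.univ))
    (hF : ∀ s ∈ O, CC (R s) (F s)) (hF' : ∀ s ∈ O, ∀ x, R s < rad2 x → F' s x = 0) :
    HasDerivAt (fun s => ∫ x, F s x) (∫ x, F' s0 x) s0 := by
  obtain ⟨r, hr, hrO⟩ := Metric.isOpen_iff.1 hO s0 h0
  have hsub : Metric.closedBall s0 (r/2) ⊆ O := (Metric.closedBall_subset_ball (by linarith)).trans hrO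
  have hK : IsCompact (Metric.closedBall s0 (r/2)) := isCompact_closedBall _ _
  obtain ⟨M, hM⟩ := hK.bddAbove_image (hR.mono hsub)
  have hM' : ∀ s ∈ Metric.closedBall s0 (r/2), R s ≤ M := fun s hs => hM ⟨s, hs, rfl⟩
  obtain ⟨B, hB⟩ := (hK.prod (compact_rad2 M)).exists_bound_of_continuousOn (hc.mono (Set.prod_mono hsub (Set.subset_univ _)))
  have hsl : ∀ s ∈ O, Continuous (F' s) := fun s hs => by
    have : ContinuousOn (fun x : X2 => ((s, x) : ℝ × X2)) Set.univ := by fun_prop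
    have := hc.comp this (fun x _ => ⟨hs, Set.mem_univ _⟩)
    exact continuousOn_univ.1 this
  refine (hasDerivAt_integral_of_dominated_loc_of_deriv_le (μ := volume) (F := F) (F' := F')
    (bound := Set.indicator {x : X2 | rad2 x ≤ M} fun _ => B)
    (Metric.ball_mem_nhds s0 (show 0 < r/2 by linarith)) ?_ (hF s0 h0).int ?_ ?_ ?_ ?_).2
  · filter_upwards [hO.mem_nhds h0] with s hs using (hF s hs).1.aestronglyMeasurable
  · exact (hsl s0 h0).aestronglyMeasurable
  · refine Filter.Eventually.of_forall fun x s hs => ?_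
    have hs' := Metric.ball_subset_closedBall hs
    by_cases hx : rad2 x ≤ M
    · rw [Set.indicator_of_mem (by exact hx)]
      exact hB (s, x) ⟨hs', hx⟩
    · rw [Set.indicator_of_notMem (by exact hx), hF' s (hsub hs') x ((hM' s hs').trans_lt (not_le.1 hx))]
      simp
  · rw [integrable_indicator_iff (compact_rad2 M).isClosed.measurableSet]
    exact integrableOn_const (compact_rad2 M).measure_lt_top.ne
  · exact Filter.Eventually.of_forall fun x s hs => hd s (hsub (Metric.ball_subset_closedBall hs)) x

section hyper

theorem hyp0 (s : ℝ) (x : X2) : hyp s x 0 = Real.sqrt (s^2 + (x 0)^2 + (x 1)^2) := rfl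
theorem hyp1 (s : ℝ) (x : X2) : hyp s x 1 = x 0 := rfl
theorem hyp2 (s : ℝ) (x : X2) : hyp s x 2 = x 1 := rfl
theorem hyp_sq (s : ℝ) (x : X2) : hyp s x 0 ^ 2 = s^2 + (x 0)^2 + (x 1)^2 := by
  rw [hyp0, Real.sq_sqrt (by positivity)]
theorem hyp_ge {s : ℝ} (x : X2) : s ≤ hyp s x 0 := by
  rw [hyp0]; apply Real.le_sqrt_of_sq_le; nlinarith [sq_nonneg (x 0), sq_nonneg (x 1)]
theorem hyp_pos {s : ℝ} (hs : 0 < s) (x : X2) : 0 < hyp s x 0 := hs.trans_le (hyp_ge x)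
theorem hyp_rad (s : ℝ) (x : X2) : rad (hyp s x) = rad2 x := rfl

theorem hyp_sup {u : Pt → ℝ} (hu : Sup u) {s : ℝ} {x : X2} (hx : s^2+3 < rad2 x) : u (hyp s x) = 0 := by
  apply hu
  rw [hyp_rad]
  have h1 : rad2 x ^ 2 = x 0 ^2 + x 1 ^2 := Real.sq_sqrt (by positivity)
  have h2 := hyp_sq s x
  have h3 : 0 ≤ hyp s x 0 := Real.sqrt_nonneg _
  have h4 : 0 ≤ s^2 := sq_nonneg s
  have : hyp s x 0 < rad2 x + 1 := by
    refine lt_of_pow_lt_pow_left₀ 2 (by linarith) ?_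
    nlinarith
  rw [← lt_sub_iff_add_lt, abs_lt]; constructor <;> linarith

theorem hyp_cont2 : Continuous fun q : ℝ × X2 => hyp q.1 q.2 := by
  refine continuous_pi fun i => ?_
  fin_cases i <;> simp [hyp] <;> fun_prop

@[fun_prop]
theorem hyp_cont (s : ℝ) : Continuous fun x => hyp s x := by
  refine continuous_pi fun i => ?_
  fin_cases i <;> simp [hyp] <;> fun_prop

theorem hd_t {s : ℝ} (hs : 0 < s) (x : X2) : HasDerivAt (fun s => hyp s x 0) (s / hyp s x 0) s := by
  have h : HasDerivAt (fun s : ℝ => s^2 + (x 0)^2 + (x 1)^2) (2*s) s := by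
    simpa using (((hasDerivAt_id s).pow 2).add_const ((x 0)^2)).add_const ((x 1)^2)
  have h2 := h.sqrt (by positivity)
  simp only [hyp0]
  convert h2 using 1
  field_simp

theorem hd_t0 {s : ℝ} (hs : 0 < s) (a b : ℝ) : HasDerivAt (fun y => hyp s ![y, b] 0) (a / hyp s ![a, b] 0) a := by
  have h : HasDerivAt (fun y : ℝ => s^2 + y^2 + b^2) (2*a) a := by
    simpa using (((hasDerivAt_id a).pow 2).const_add (s^2)).add_const (b^2)
  have h2 := h.sqrt (by positivity)
  simp only [hyp0, Matrix.cons_val_zero, Matrix.cons_val_one]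
  convert h2 using 1
  field_simp

theorem hd_t1 {s : ℝ} (hs : 0 < s) (a b : ℝ) : HasDerivAt (fun y => hyp s ![a, y] 0) (b / hyp s ![a, b] 0) b := by
  have h : HasDerivAt (fun y : ℝ => s^2 + a^2 + y^2) (2*b) b := by
    simpa using (((hasDerivAt_id b).pow 2).const_add (s^2 + a^2))
  have h2 := h.sqrt (by positivity)
  simp only [hyp0, Matrix.cons_val_zero, Matrix.cons_val_one]
  convert h2 using 1
  field_simp

theorem hd_s {u : Pt → ℝ} (hu : Sm u) {s : ℝ} (hs : 0 < s) (x : X2) :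
    HasDerivAt (fun s => u (hyp s x)) (s / hyp s x 0 * pd 0 u (hyp s x)) s := by
  have := chain hu (c := fun s => hyp s x) (hd_t hs x) (hasDerivAt_const s (x 0)) (hasDerivAt_const s (x 1))
  simpa using this

theorem hd_0 {u : Pt → ℝ} (hu : Sm u) {s : ℝ} (hs : 0 < s) (a b : ℝ) :
    HasDerivAt (fun y => u (hyp s ![y, b])) (ubd 0 u (hyp s ![a, b])) a := by
  have := chain hu (c := fun y => hyp s ![y, b]) (hd_t0 hs a b) (hasDerivAt_id a) (hasDerivAt_const a b)
  simpa [ubd, hyp1] using this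

theorem hd_1 {u : Pt → ℝ} (hu : Sm u) {s : ℝ} (hs : 0 < s) (a b : ℝ) :
    HasDerivAt (fun y => u (hyp s ![a, y])) (ubd 1 u (hyp s ![a, b])) b := by
  have := chain hu (c := fun y => hyp s ![a, y]) (hd_t1 hs a b) (hasDerivAt_const b a) (hasDerivAt_id b)
  simpa [ubd, hyp2] using this

theorem CCh {u : Pt → ℝ} (hu : Sm u) (hs : Sup u) (s : ℝ) : CC (s^2+3) (fun x => u (hyp s x)) :=
  ⟨hu.continuous.comp (hyp_cont s), fun _ hx => hyp_sup hs hx⟩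

theorem inv_t_cont {s : ℝ} (hs : 0 < s) : Continuous fun x => (hyp s x 0)⁻¹ :=
  Continuous.inv₀ (by fun_prop) fun x => (hyp_pos hs x).ne'

@[fun_prop]
theorem ContDiff.contPt {u : Pt → ℝ} (hu : ContDiff ℝ (⊤ : ℕ∞) u) : Continuous u := hu.continuous

/-- the divergence identity on hyperboloids -/
theorem divid {J0 J1 J2 : Pt → ℝ} (s0 : Sm J0) (s1 : Sm J1) (s2 : Sm J2) (p0 : Sup J0) (p1 : Sup J1) (p2 : Sup J2)
    {s : ℝ} (hs : 0 < s) :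
    HasDerivAt (fun s => ∫ x, (J0 (hyp s x) - x 0 / hyp s x 0 * J1 (hyp s x) - x 1 / hyp s x 0 * J2 (hyp s x)))
      (∫ x, s / hyp s x 0 * (pd 0 J0 (hyp s x) + pd 1 J1 (hyp s x) + pd 2 J2 (hyp s x))) s := by
  have hx0 : Continuous fun x : X2 => x 0 := by fun_prop
  have hx1 : Continuous fun x : X2 => x 1 := by fun_prop
  -- the s-derivative
  have D := dint (O := Set.Ioi 0) isOpen_Ioi hs (R := fun s => s^2+3) (by fun_prop)
    (F := fun s x => J0 (hyp s x) - x 0 / hyp s x 0 * J1 (hyp s x) - x 1 / hyp s x 0 * J2 (hyp s x))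
    (F' := fun s x => s / hyp s x 0 * pd 0 J0 (hyp s x)
      - ((0 * hyp s x 0 - x 0 * (s / hyp s x 0)) / hyp s x 0 ^ 2 * J1 (hyp s x) + x 0 / hyp s x 0 * (s / hyp s x 0 * pd 0 J1 (hyp s x)))
      - ((0 * hyp s x 0 - x 1 * (s / hyp s x 0)) / hyp s x 0 ^ 2 * J2 (hyp s x) + x 1 / hyp s x 0 * (s / hyp s x 0 * pd 0 J2 (hyp s x))))
    (by
      intro s hs x
      refine ((hd_s s0 hs x).sub ?_).sub ?_
      · exact ((hasDerivAt_const s (x 0)).div (hd_t hs x) (hyp_pos hs x).ne').mul (hd_s s1 hs x)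
      · exact ((hasDerivAt_const s (x 1)).div (hd_t hs x) (hyp_pos hs x).ne').mul (hd_s s2 hs x))
    (by
      have hc : ∀ {u : Pt → ℝ}, Continuous u → ContinuousOn (fun q : ℝ × X2 => u (hyp q.1 q.2)) (Set.Ioi 0 ×ˢ Set.univ) :=
        fun hu => (hu.comp hyp_cont2).continuousOn
      have ht := hc (u := fun p => p 0) (by fun_prop)
      have hn : ∀ q ∈ (Set.Ioi (0:ℝ)) ×ˢ (Set.univ : Set X2), hyp q.1 q.2 0 ≠ 0 := fun q hq => (hyp_pos hq.1 q.2).ne'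
      have a0 := hc (smPd s0 0).continuous
      have a1 := hc (smPd s1 0).continuous
      have a2 := hc (smPd s2 0).continuous
      have b1 := hc s1.continuous
      have b2 := hc s2.continuous
      have hi : ContinuousOn (fun q : ℝ × X2 => (hyp q.1 q.2 0)⁻¹) (Set.Ioi 0 ×ˢ Set.univ) := ht.inv₀ hn
      have q1 : ContinuousOn (fun q : ℝ × X2 => q.1) (Set.Ioi 0 ×ˢ Set.univ) := by fun_prop
      have q2 : ContinuousOn (fun q : ℝ × X2 => q.2 0) (Set.Ioi 0 ×ˢ Set.univ) := by fun_prop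
      have q3 : ContinuousOn (fun q : ℝ × X2 => q.2 1) (Set.Ioi 0 ×ˢ Set.univ) := by fun_prop
      have key : ∀ (S : Set (ℝ × X2)) (f1 f2 f3 i t a0 a1 a2 b1 b2 : ℝ × X2 → ℝ), ContinuousOn f1 S → ContinuousOn f2 S →
        ContinuousOn f3 S → ContinuousOn i S → ContinuousOn t S → ContinuousOn a0 S → ContinuousOn a1 S → ContinuousOn a2 S →
        ContinuousOn b1 S → ContinuousOn b2 S → ContinuousOn (fun q => f1 q * i q * a0 q -
          ((0 * t q - f2 q * (f1 q * i q)) * i q ^ 2 * b1 q + f2 q * i q * (f1 q * i q * a1 q)) -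
          ((0 * t q - f3 q * (f1 q * i q)) * i q ^ 2 * b2 q + f3 q * i q * (f1 q * i q * a2 q))) S := by
        intros; fun_prop
      simp only [div_eq_mul_inv, ← inv_pow]
      exact key _ _ _ _ _ _ _ _ _ _ _ q1 q2 q3 hi ht a0 a1 a2 b1 b2)
    (by
      intro s hs
      have i := inv_t_cont (s := s) hs
      simp only [div_eq_mul_inv]
      exact ((CCh s0 p0 s).sub ((CCh s1 p1 s).mul (hx0.mul i))).sub ((CCh s2 p2 s).mul (hx1.mul i)))
    (by
      intro s _ x hx
      simp [hyp_sup p1 hx, hyp_sup p2 hx, hyp_sup (p0.pd 0) hx, hyp_sup (p1.pd 0) hx, hyp_sup (p2.pd 0) hx])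
  refine D.congr_deriv ?_
  have i := inv_t_cont (s := s) hs
  have t : Continuous fun x : X2 => hyp s x 0 := by fun_prop
  -- the x-derivatives
  let g1 : X2 → ℝ := fun x => (0 * hyp s x 0 - s * (x 0 / hyp s x 0)) / hyp s x 0 ^ 2 * J1 (hyp s x) + s / hyp s x 0 * ubd 0 J1 (hyp s x)
  let g2 : X2 → ℝ := fun x => (0 * hyp s x 0 - s * (x 1 / hyp s x 0)) / hyp s x 0 ^ 2 * J2 (hyp s x) + s / hyp s x 0 * ubd 1 J2 (hyp s x)
  have cg1 : CC (s^2+3) g1 := by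
    simp only [g1, ubd, div_eq_mul_inv, ← inv_pow]
    refine ⟨?_, fun x hx => ?_⟩
    · have := (smPd s1 0).continuous; have := (smPd s1 1).continuous; have := s1.continuous
      fun_prop
    · simp [hyp_sup p1 hx, hyp_sup (p1.pd _) hx]
  have cg2 : CC (s^2+3) g2 := by
    simp only [g2, ubd, div_eq_mul_inv, ← inv_pow]
    refine ⟨?_, fun x hx => ?_⟩
    · have := (smPd s2 0).continuous; have := (smPd s2 2).continuous; have := s2.continuous
      fun_prop
    · simp [hyp_sup p2 hx, hyp_sup (p2.pd _) hx]
  have z1 : ∫ x, g1 x = 0 := by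
    refine int_d0 (h := fun x => s / hyp s x 0 * J1 (hyp s x)) (fun a b => ?_) ?_ cg1
    · exact ((hasDerivAt_const a s).div (hd_t0 hs a b) (hyp_pos hs _).ne').mul (hd_0 s1 hs a b)
    · simp only [div_eq_mul_inv]; exact (CCh s1 p1 s).mul (continuous_const.mul i)
  have z2 : ∫ x, g2 x = 0 := by
    refine int_d1 (h := fun x => s / hyp s x 0 * J2 (hyp s x)) (fun a b => ?_) ?_ cg2
    · exact ((hasDerivAt_const b s).div (hd_t1 hs a b) (hyp_pos hs _).ne').mul (hd_1 s2 hs a b)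
    · simp only [div_eq_mul_inv]; exact (CCh s2 p2 s).mul (continuous_const.mul i)
  have cd : CC (s^2+3) (fun x => s / hyp s x 0 * (pd 0 J0 (hyp s x) + pd 1 J1 (hyp s x) + pd 2 J2 (hyp s x))) := by
    simp only [div_eq_mul_inv]
    exact (((CCh (smPd s0 0) (p0.pd 0) s).add (CCh (smPd s1 1) (p1.pd 1) s)).add (CCh (smPd s2 2) (p2.pd 2) s)).mul (continuous_const.mul i)
  have e : ∫ x, s / hyp s x 0 * (pd 0 J0 (hyp s x) + pd 1 J1 (hyp s x) + pd 2 J2 (hyp s x)) =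
    ∫ x, (s / hyp s x 0 * (pd 0 J0 (hyp s x) + pd 1 J1 (hyp s x) + pd 2 J2 (hyp s x)) - g1 x - g2 x) := by
    rw [integral_sub (cd.sub cg1).int cg2.int, integral_sub cd.int cg1.int, z1, z2]; ring
  rw [e]
  congr 1
  funext x
  have := (hyp_pos hs x).ne'
  simp only [g1, g2, ubd, hyp1, hyp2, Fin.succ_zero_eq_one, Fin.succ_one_eq_two]
  field_simp
  ring
end hyper

theorem cauchy_sq {f g : X2 → ℝ} (hf : Integrable fun x => f x ^ 2) (hg : Integrable fun x => g x ^ 2)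
    (hfg : Integrable fun x => f x * g x) : (∫ x, f x * g x)^2 ≤ (∫ x, f x ^ 2) * ∫ x, g x ^ 2 := by
  have h : ∀ c : ℝ, 0 ≤ (∫ x, g x ^ 2) * (c * c) + (2 * ∫ x, f x * g x) * c + ∫ x, f x ^ 2 := by
    intro c
    have e : ∫ x, (f x + c * g x)^2 = (∫ x, g x ^ 2) * (c * c) + (2 * ∫ x, f x * g x) * c + ∫ x, f x ^ 2 := by
      have : ∀ x, (f x + c * g x)^2 = (c*c) * g x ^ 2 + (2*c) * (f x * g x) + f x ^ 2 := fun x => by ring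
      simp only [this]
      have i1 : Integrable (fun x => (c*c) * g x ^ 2 + (2*c) * (f x * g x)) := (hg.const_mul _).add (hfg.const_mul _)
      rw [integral_add i1 hf, integral_add (hg.const_mul _) (hfg.const_mul _),
        integral_const_mul, integral_const_mul]; ring
    rw [← e]; exact integral_nonneg fun x => sq_nonneg _
  have := discrim_le_zero h
  unfold discrim at this
  nlinarith

/-- Gronwall-type lemma for square roots of energies -/
theorem ode_sqrt {E E' g G : ℝ → ℝ} {a b : ℝ} (hab : a ≤ b)
    (hE : ∀ s ∈ Set.Icc a b, HasDerivAt E (E' s) s) (hG : ∀ s ∈ Set.Icc a b, HasDerivAt G (g s) s)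
    (h0 : ∀ s ∈ Set.Icc a b, 0 ≤ E s) (hg : ∀ s ∈ Set.Icc a b, 0 ≤ g s)
    (h : ∀ s ∈ Set.Icc a b, E' s ≤ 2 * Real.sqrt (E s) * g s) :
    Real.sqrt (E b) ≤ Real.sqrt (E a) + (G b - G a) := by
  have key : ∀ k : ℝ, 0 < k → Real.sqrt (E b) ≤ Real.sqrt (E a) + (G b - G a) + k := by
    intro k hk
    have hk2 : 0 < k^2 := by positivity
    have hd : ∀ s ∈ Set.Icc a b, HasDerivAt (fun s => Real.sqrt (E s + k^2) - G s) (E' s / (2 * Real.sqrt (E s + k^2)) - g s) s := by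
      intro s hs
      have := h0 s hs
      exact (((hE s hs).add_const (k^2)).sqrt (by positivity)).sub (hG s hs)
    have anti : AntitoneOn (fun s => Real.sqrt (E s + k^2) - G s) (Set.Icc a b) := by
      refine antitoneOn_of_deriv_nonpos (convex_Icc a b) (fun s hs => (hd s hs).continuousAt.continuousWithinAt)
        (fun s hs => (hd s (interior_subset hs)).differentiableAt.differentiableWithinAt) fun s hs => ?_
      have hs := interior_subset hs
      rw [(hd s hs).deriv]
      have hp : 0 < Real.sqrt (E s + k^2) := Real.sqrt_pos.2 (by have := h0 s hs; positivity)
      have : E' s / (2 * Real.sqrt (E s + k^2)) ≤ g s := by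
        rw [div_le_iff₀ (by positivity)]
        have h1 : Real.sqrt (E s) ≤ Real.sqrt (E s + k^2) := Real.sqrt_le_sqrt (by linarith)
        have := mul_le_mul_of_nonneg_left h1 (hg s hs)
        linarith [h s hs]
      linarith
    have := anti (Set.left_mem_Icc.2 hab) (Set.right_mem_Icc.2 hab) hab
    have h1 : Real.sqrt (E b) ≤ Real.sqrt (E b + k^2) := Real.sqrt_le_sqrt (by linarith)
    have h2 : Real.sqrt (E a + k^2) ≤ Real.sqrt (E a) + k := by
      have := Real.sqrt_le_sqrt (show E a + k^2 ≤ (Real.sqrt (E a) + k)^2 by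
        have h3 := Real.sq_sqrt (h0 a (Set.left_mem_Icc.2 hab))
        nlinarith [Real.sqrt_nonneg (E a), mul_nonneg (Real.sqrt_nonneg (E a)) hk.le])
      rwa [Real.sqrt_sq (by positivity)] at this
    simp only at this
    linarith
  exact le_of_forall_pos_le_add fun k hk => key k hk

/-- hyperboloidal energy density -/
def eD (m s : ℝ) (u : Pt → ℝ) (p : Pt) : ℝ :=
  (s / p 0 * pd 0 u p)^2 + (ubd 0 u p)^2 + (ubd 1 u p)^2 + m * (u p)^2

def Em (m s : ℝ) (u : Pt → ℝ) : ℝ := ∫ x, eD m s u (hyp s x)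

theorem eD_nn {m : ℝ} (hm : 0 ≤ m) (s u p) : 0 ≤ eD m s u p := by unfold eD; positivity
theorem Em_nn {m : ℝ} (hm : 0 ≤ m) (s u) : 0 ≤ Em m s u := integral_nonneg fun _ => eD_nn hm _ _ _

theorem eD_cc (m : ℝ) {s : ℝ} (hs : 0 < s) {u : Pt → ℝ} (hu : Sm u) (su : Sup u) :
    CC (s^2+3) fun x => eD m s u (hyp s x) := by
  have i := inv_t_cont (s := s) hs
  simp only [eD, ubd, div_eq_mul_inv]
  refine ⟨?_, fun x hx => ?_⟩
  · have := (smPd hu 0).continuous; have := (smPd hu 1).continuous; have := (smPd hu 2).continuous; have := hu.continuous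
    simp only [Fin.succ_zero_eq_one, Fin.succ_one_eq_two]
    fun_prop
  · simp [hyp_sup su hx, hyp_sup (su.pd _) hx]

theorem Em_deriv (m : ℝ) {s : ℝ} (hs : 0 < s) {u : Pt → ℝ} (hu : Sm u) (su : Sup u) :
    HasDerivAt (fun s => Em m s u) (∫ x, (s / hyp s x 0 * pd 0 u (hyp s x)) * (2 * (negBox u (hyp s x) + m * u (hyp s x)))) s := by
  have d := divid (J0 := fun p => pd 0 u p ^ 2 + pd 1 u p ^ 2 + pd 2 u p ^ 2 + m * u p ^ 2)
    (J1 := fun p => (-2) * (pd 0 u p * pd 1 u p)) (J2 := fun p => (-2) * (pd 0 u p * pd 2 u p))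
    (by fun_prop) (by fun_prop) (by fun_prop)
    ((((su.pd 0).pow 1).add ((su.pd 1).pow 1)).add ((su.pd 2).pow 1) |>.add ((su.pow 1).mul_left _))
    (((su.pd 0).mul_right _).mul_left _) (((su.pd 0).mul_right _).mul_left _) hs
  have e : (fun s => Em m s u) =ᶠ[nhds s] (fun s => ∫ x : X2, ((pd 0 u (hyp s x) ^ 2 + pd 1 u (hyp s x) ^ 2 + pd 2 u (hyp s x) ^ 2 + m * u (hyp s x) ^ 2) -
      x 0 / hyp s x 0 * ((-2) * (pd 0 u (hyp s x) * pd 1 u (hyp s x))) - x 1 / hyp s x 0 * ((-2) * (pd 0 u (hyp s x) * pd 2 u (hyp s x))))) := by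
    filter_upwards [isOpen_Ioi.mem_nhds hs] with r hr
    unfold Em
    congr 1; funext x
    have h1 := (hyp_pos hr x).ne'
    have h2 : r^2 = hyp r x 0 ^ 2 - (x 0)^2 - (x 1)^2 := by rw [hyp_sq]; ring
    simp only [eD, ubd, hyp1, hyp2, Fin.succ_zero_eq_one, Fin.succ_one_eq_two, div_mul_eq_mul_div, div_pow, mul_pow, h2]
    field_simp
    ring
  refine (d.congr_of_eventuallyEq e).congr_deriv ?_
  congr 1; funext x
  simp (disch := fun_prop) only [pd_add, pd_mul, pd_pow, pd_const, negBox, pd_comm hu 0 1, pd_comm hu 0 2]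
  push_cast
  ring

theorem pd_sq_le_eD {m : ℝ} (hm : 0 ≤ m) (s u p) : (s / p 0 * pd 0 u p)^2 ≤ eD m s u p := by
  unfold eD; nlinarith [sq_nonneg (ubd 0 u p), sq_nonneg (ubd 1 u p), mul_nonneg hm (sq_nonneg (u p))]

/-- the energy inequality -/
theorem energy_ineq {m : ℝ} (hm : 0 ≤ m) {u : Pt → ℝ} (hu : Sm u) (su : Sup u) {g G : ℝ → ℝ}
    (hg : ∀ s, 2 ≤ s → 0 ≤ g s) (hG : ∀ s, 2 ≤ s → HasDerivAt G (g s) s)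
    (h : ∀ s, 2 ≤ s → ∫ x, (negBox u (hyp s x) + m * u (hyp s x))^2 ≤ g s ^ 2) {b : ℝ} (hb : 2 ≤ b) :
    Real.sqrt (Em m b u) ≤ Real.sqrt (Em m 2 u) + (G b - G 2) := by
  refine ode_sqrt (E := fun s => Em m s u) hb (fun s hs => Em_deriv m (by linarith [hs.1]) hu su) (fun s hs => hG s hs.1)
    (fun s _ => Em_nn hm s u) (fun s hs => hg s hs.1) fun s hs => ?_
  have hs0 : 0 < s := by linarith [hs.1]
  have i := inv_t_cont (s := s) hs0
  have c1 : CC (s^2+3) (fun x => s / hyp s x 0 * pd 0 u (hyp s x)) := by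
    simp only [div_eq_mul_inv]
    exact (CCh (smPd hu 0) (su.pd 0) s).mul (continuous_const.mul i)
  have c2 : CC (s^2+3) (fun x => negBox u (hyp s x) + m * u (hyp s x)) :=
    (CCh (smNegBox hu) su.negBox s).add ((CCh hu su s).mul continuous_const)
  have e : ∫ x, (s / hyp s x 0 * pd 0 u (hyp s x)) * (2 * (negBox u (hyp s x) + m * u (hyp s x))) =
      2 * ∫ x, (s / hyp s x 0 * pd 0 u (hyp s x)) * (negBox u (hyp s x) + m * u (hyp s x)) := by
    rw [← integral_const_mul]; congr 1; funext x; ring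
  rw [e]
  have cs := cauchy_sq c1.sq.int c2.sq.int ((c2.mul c1.1).int)
  have h1 : ∫ x, (s / hyp s x 0 * pd 0 u (hyp s x))^2 ≤ Em m s u :=
    int_mono (fun _ => sq_nonneg _) (eD_cc m hs0 hu su).int fun x => pd_sq_le_eD hm _ _ _
  have h2 : (∫ x, (s / hyp s x 0 * pd 0 u (hyp s x)) * (negBox u (hyp s x) + m * u (hyp s x)))^2 ≤ (Real.sqrt (Em m s u) * g s)^2 := by
    rw [mul_pow, Real.sq_sqrt (Em_nn hm s u)]
    exact cs.trans (mul_le_mul h1 (h s hs.1) (integral_nonneg fun _ => sq_nonneg _) (Em_nn hm s u))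
  have h3 := abs_le_of_sq_le_sq h2 (mul_nonneg (Real.sqrt_nonneg _) (hg s hs.1))
  linarith [(abs_le.1 h3).2]

/-- Sobolev on hyperboloids -/
theorem ubd_boost {p : Pt} (hp : p 0 ≠ 0) (a : Fin 2) (u : Pt → ℝ) : ubd a u p = boost a u p / p 0 := by
  unfold ubd boost; field_simp

theorem nmF_ccont {A N k} {u : Pt → ℝ} {s : ℝ} (hN : ∀ v, Sm v → Sup v → CC (s^2+3) (fun x => N v (hyp s x))) (hu : Sm u) (su : Sup u) :
    CC (s^2+3) (fun x => nmF A N k u (hyp s x)) := by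
  induction k generalizing u with
  | zero => exact hN u hu su
  | succ k ih =>
    refine (ih hu su).add ⟨?_, fun x hx => ?_⟩
    · exact continuous_finsetSum _ fun i _ => (ih (smDd hu i) (su.dd i)).1
    · exact Finset.sum_eq_zero fun i _ => (ih (smDd hu i) (su.dd i)).2 x hx

theorem aN_cc {v : Pt → ℝ} (s : ℝ) (hv : Sm v) (sv : Sup v) : CC (s^2+3) (fun x => aN v (hyp s x)) := (CCh hv sv s).abs

abbrev Z5 : Finset (Fin 5) := Finset.univ

theorem sob_h {u : Pt → ℝ} (hu : Sm u) (su : Sup u) {s : ℝ} (hs : 0 < s) (x : X2) :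
    u (hyp s x) ^ 2 ≤ 6 * ∫ y, ((hyp s y 0)⁻¹ * nmF Z5 aN 2 u (hyp s y))^2 := by
  have i := inv_t_cont (s := s) hs
  have sb0 := smBoost hu 0
  have pb0 : Sup (boost 0 u) := su.dd 3
  have hn : ∀ y, hyp s y 0 ≠ 0 := fun y => (hyp_pos hs y).ne'
  let h12 : X2 → ℝ := fun y => 2 * (boost 1 u (hyp s y) * boost 0 u (hyp s y) * ((hyp s y 0)⁻¹)^2
    + u (hyp s y) * boost 1 (boost 0 u) (hyp s y) * ((hyp s y 0)⁻¹)^2 - u (hyp s y) * boost 0 u (hyp s y) * (y 1 * ((hyp s y 0)⁻¹)^3))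
  have S := sob2 (R := s^2+3) (h := fun y => u (hyp s y) ^ 2) (h1 := fun y => 2 * (u (hyp s y) * boost 0 u (hyp s y) * (hyp s y 0)⁻¹))
    (h12 := h12) (fun a b => by
      refine ((hd_0 hu hs a b).pow 2).congr_deriv ?_
      rw [ubd_boost (hn _)]; push_cast; field_simp)
    (fun a b => by
      have d1 := ((hd_1 hu hs a b).fun_mul (hd_1 sb0 hs a b)).fun_mul ((hd_t1 hs a b).fun_inv (hn _))
      refine (d1.const_mul 2).congr_deriv ?_
      have := hn ![a, b]
      simp only [h12, ubd_boost (hn _), Matrix.cons_val_one]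
      field_simp
      simp only [Matrix.cons_val_fin_one]
      ring)
    (CCh hu su s).sq
    ⟨by have := hu.continuous; have := sb0.continuous; fun_prop, fun y hy => by simp [hyp_sup su hy]⟩
    ⟨by
      have := hu.continuous; have := sb0.continuous; have := (smBoost hu 1).continuous; have := (smBoost sb0 1).continuous
      simp only [h12]; fun_prop,
     fun y hy => by
      have e1 : boost 1 u (hyp s y) = 0 := hyp_sup (su.dd 4) hy
      simp [h12, hyp_sup su hy, hyp_sup pb0 hy, e1]⟩ x
  rw [abs_of_nonneg (sq_nonneg _)] at S
  refine S.trans ?_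
  rw [← integral_const_mul]
  refine int_mono (fun _ => abs_nonneg _) ((((nmF_ccont (fun v hv sv => aN_cc s hv sv) hu su).mul i).sq.int).const_mul _) fun y => ?_
  have nn := nmF_nn (A := Z5) Sn_aN 2 u (hyp s y)
  have w0 : |u (hyp s y)| ≤ nmF Z5 aN 2 u (hyp s y) := nmF_Dw Sn_aN (l := []) (Wd_nil _ _)
  have w1 : |boost 0 u (hyp s y)| ≤ nmF Z5 aN 2 u (hyp s y) := nmF_Dw Sn_aN (l := [3]) (by simp [Wd])
  have w2 : |boost 1 u (hyp s y)| ≤ nmF Z5 aN 2 u (hyp s y) := nmF_Dw Sn_aN (l := [4]) (by simp [Wd])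
  have w3 : |boost 1 (boost 0 u) (hyp s y)| ≤ nmF Z5 aN 2 u (hyp s y) := nmF_Dw Sn_aN (l := [3, 4]) (by simp [Wd])
  set n := nmF Z5 aN 2 u (hyp s y)
  have ip : 0 < (hyp s y 0)⁻¹ := inv_pos.2 (hyp_pos hs y)
  have hy : |y 1 * (hyp s y 0)⁻¹| ≤ 1 := by
    rw [← div_eq_mul_inv, abs_div, abs_of_pos (hyp_pos hs y), div_le_one (hyp_pos hs y)]
    apply Real.abs_le_sqrt; nlinarith [sq_nonneg s, sq_nonneg (y 0)]
  have e : h12 y = 2 * ((boost 1 u (hyp s y) * boost 0 u (hyp s y)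
    + u (hyp s y) * boost 1 (boost 0 u) (hyp s y) - u (hyp s y) * boost 0 u (hyp s y) * (y 1 * (hyp s y 0)⁻¹)) * ((hyp s y 0)⁻¹)^2) := by
    simp only [h12]; ring
  rw [e, abs_mul, abs_mul, abs_of_pos (pow_pos ip 2), mul_pow]
  have a1 : |boost 1 u (hyp s y) * boost 0 u (hyp s y)| ≤ n * n := by rw [abs_mul]; exact mul_le_mul w2 w1 (abs_nonneg _) nn
  have a2 : |u (hyp s y) * boost 1 (boost 0 u) (hyp s y)| ≤ n * n := by rw [abs_mul]; exact mul_le_mul w0 w3 (abs_nonneg _) nn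
  have a3 : |u (hyp s y) * boost 0 u (hyp s y) * (y 1 * (hyp s y 0)⁻¹)| ≤ n * n * 1 := by
    rw [abs_mul, abs_mul]; exact mul_le_mul (mul_le_mul w0 w1 (abs_nonneg _) nn) hy (abs_nonneg _) (by positivity)
  have a4 : |boost 1 u (hyp s y) * boost 0 u (hyp s y)
    + u (hyp s y) * boost 1 (boost 0 u) (hyp s y) - u (hyp s y) * boost 0 u (hyp s y) * (y 1 * (hyp s y 0)⁻¹)| ≤ 3 * n^2 := by
    refine (abs_sub _ _).trans ?_
    linarith [abs_add_le (boost 1 u (hyp s y) * boost 0 u (hyp s y)) (u (hyp s y) * boost 1 (boost 0 u) (hyp s y))]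
  rw [abs_of_pos (by norm_num : (0:ℝ) < 2)]
  nlinarith [mul_le_mul_of_nonneg_right a4 (pow_pos ip 2).le]

/-- scaling field -/
def Sf (u : Pt → ℝ) (p : Pt) : ℝ := p 0 * pd 0 u p + p 1 * pd 1 u p + p 2 * pd 2 u p

theorem Sf_eq (u : Pt → ℝ) : Sf u = fun p => p 0 * pd 0 u p + p 1 * pd 1 u p + p 2 * pd 2 u p := rfl

@[fun_prop]
theorem smSf {u : Pt → ℝ} (h : ContDiff ℝ (⊤ : ℕ∞) u) : ContDiff ℝ (⊤ : ℕ∞) (Sf u) := by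
  rw [Sf_eq]; fun_prop

theorem Sup.Sf {u : Pt → ℝ} (h : Sup u) : Sup (Sf u) := by
  intro p hp; simp [_root_.Sf, h.pd _ p hp]

def zf (u : Pt → ℝ) (p : Pt) : ℝ := Sf u p + 1/2 * u p

/-- the density of the S-energy -/
def qd (u : Pt → ℝ) (p : Pt) : ℝ :=
  (zf u p ^ 2 + boost 0 u p ^ 2 + boost 1 u p ^ 2 - (p 1 * pd 2 u p - p 2 * pd 1 u p)^2 - 1/4 * u p ^ 2) * (p 0)⁻¹

theorem zf_cc {s : ℝ} {u : Pt → ℝ} (hu : Sm u) (su : Sup u) : CC (s^2+3) fun x => zf u (hyp s x) :=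
  (CCh (smSf hu) su.Sf s).add ((CCh hu su s).mul continuous_const)

theorem qd_cc {s : ℝ} (hs : 0 < s) {u : Pt → ℝ} (hu : Sm u) (su : Sup u) : CC (s^2+3) fun x => qd u (hyp s x) := by
  have i := inv_t_cont (s := s) hs
  unfold qd zf boost Sf
  refine ⟨?_, fun x hx => ?_⟩
  · have := (smPd hu 0).continuous; have := (smPd hu 1).continuous; have := (smPd hu 2).continuous; have := hu.continuous
    simp only [Fin.succ_zero_eq_one, Fin.succ_one_eq_two]
    fun_prop
  · simp [hyp_sup su hx, hyp_sup (su.pd _) hx]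

theorem Y_deriv {s : ℝ} (hs : 0 < s) {u : Pt → ℝ} (hu : Sm u) (su : Sup u) :
    HasDerivAt (fun s => ∫ x, qd u (hyp s x)) (∫ x, s / hyp s x 0 * (2 * (zf u (hyp s x) * negBox u (hyp s x)))) s := by
  have d := divid (J0 := fun p => p 0 * (pd 0 u p ^ 2 + pd 1 u p ^ 2 + pd 2 u p ^ 2) + 2 * (pd 0 u p * (p 1 * pd 1 u p + p 2 * pd 2 u p)) + u p * pd 0 u p)
    (J1 := fun p => p 1 * (pd 1 u p ^ 2 + pd 2 u p ^ 2 - pd 0 u p ^ 2) - 2 * (pd 1 u p * (p 0 * pd 0 u p + p 1 * pd 1 u p + p 2 * pd 2 u p)) - u p * pd 1 u p)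
    (J2 := fun p => p 2 * (pd 1 u p ^ 2 + pd 2 u p ^ 2 - pd 0 u p ^ 2) - 2 * (pd 2 u p * (p 0 * pd 0 u p + p 1 * pd 1 u p + p 2 * pd 2 u p)) - u p * pd 2 u p)
    (by fun_prop) (by fun_prop) (by fun_prop)
    (by intro p hp; simp [su.pd _ p hp]) (by intro p hp; simp [su.pd _ p hp]) (by intro p hp; simp [su.pd _ p hp]) hs
  refine (d.congr_of_eventuallyEq ?_).congr_deriv ?_
  · filter_upwards [isOpen_Ioi.mem_nhds hs] with r hr
    congr 1; funext x
    have h1 := (hyp_pos hr x).ne'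
    simp only [qd, zf, Sf, boost, hyp1, hyp2, Fin.succ_zero_eq_one, Fin.succ_one_eq_two]
    field_simp
    ring
  · congr 1; funext x
    simp (disch := fun_prop) only [pd_add, pd_sub, pd_mul, pd_pow, pd_const, pd_coord, negBox, zf, Sf, pd_comm hu 1 0, pd_comm hu 2 0, pd_comm hu 2 1]
    simp
    left
    ring

/-- gap -/
theorem Y_gap {s : ℝ} (hs : 0 < s) {u : Pt → ℝ} (hu : Sm u) (su : Sup u) :
    ∫ x, zf u (hyp s x) ^ 2 * (hyp s x 0)⁻¹ ≤ ∫ x, qd u (hyp s x) := by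
  have i := inv_t_cont (s := s) hs
  have c0 := (smPd hu 0).continuous
  have c1 := (smPd hu 1).continuous
  have c2 := (smPd hu 2).continuous
  have c := hu.continuous
  let g1 : X2 → ℝ := fun x => (1 * u (hyp s x) ^ 2 + x 0 * (2 * u (hyp s x) * ubd 0 u (hyp s x))) * (hyp s x 0)⁻¹
      + x 0 * u (hyp s x) ^ 2 * (- (x 0 / hyp s x 0) / hyp s x 0 ^ 2)
  let g2 : X2 → ℝ := fun x => (1 * u (hyp s x) ^ 2 + x 1 * (2 * u (hyp s x) * ubd 1 u (hyp s x))) * (hyp s x 0)⁻¹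
      + x 1 * u (hyp s x) ^ 2 * (- (x 1 / hyp s x 0) / hyp s x 0 ^ 2)
  have cg1 : CC (s^2+3) g1 := by
    simp only [g1, ubd, div_eq_mul_inv, ← inv_pow, Fin.succ_zero_eq_one]
    exact ⟨by fun_prop, fun x hx => by simp [hyp_sup su hx]⟩
  have cg2 : CC (s^2+3) g2 := by
    simp only [g2, ubd, div_eq_mul_inv, ← inv_pow, Fin.succ_one_eq_two]
    exact ⟨by fun_prop, fun x hx => by simp [hyp_sup su hx]⟩
  have z1 : ∫ x, g1 x = 0 := by
    refine int_d0 (h := fun x => x 0 * u (hyp s x) ^ 2 * (hyp s x 0)⁻¹) (fun a b => ?_) ?_ cg1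
    · have := ((hasDerivAt_id a).fun_mul ((hd_0 hu hs a b).fun_pow 2)).fun_mul ((hd_t0 hs a b).fun_inv (hyp_pos hs _).ne')
      simpa [g1] using this
    · exact ⟨by fun_prop, fun x hx => by simp [hyp_sup su hx]⟩
  have z2 : ∫ x, g2 x = 0 := by
    refine int_d1 (h := fun x => x 1 * u (hyp s x) ^ 2 * (hyp s x 0)⁻¹) (fun a b => ?_) ?_ cg2
    · have := ((hasDerivAt_id b).fun_mul ((hd_1 hu hs a b).fun_pow 2)).fun_mul ((hd_t1 hs a b).fun_inv (hyp_pos hs _).ne')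
      simpa [g2] using this
    · exact ⟨by fun_prop, fun x hx => by simp [hyp_sup su hx]⟩
  have cq := qd_cc hs hu su
  have e : ∫ x, qd u (hyp s x) = ∫ x, (qd u (hyp s x) + 1/2 * g1 x + 1/2 * g2 x) := by
    rw [integral_add (cq.add (cg1.mul continuous_const)).int (cg2.mul continuous_const).int, integral_add cq.int (cg1.mul continuous_const).int,
      integral_const_mul, integral_const_mul, z1, z2]; ring
  rw [e]
  refine int_mono (fun x => mul_nonneg (sq_nonneg _) (inv_pos.2 (hyp_pos hs x)).le) (((cq.add (cg1.mul continuous_const)).add (cg2.mul continuous_const)).int) fun x => ?_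
  have tp := hyp_pos hs x
  have e2 : qd u (hyp s x) + 1/2 * g1 x + 1/2 * g2 x - zf u (hyp s x) ^ 2 * (hyp s x 0)⁻¹
     = ((1/2 * u (hyp s x) + x 0 * ubd 0 u (hyp s x) + x 1 * ubd 1 u (hyp s x))^2 + 1/2 * u (hyp s x)^2 * (1 - (x 0 ^2 + x 1^2) / hyp s x 0 ^2)
       + (hyp s x 0 ^ 2 - x 0 ^ 2 - x 1 ^ 2) * (ubd 0 u (hyp s x) ^ 2 + ubd 1 u (hyp s x) ^2)) * (hyp s x 0)⁻¹ := by
    have := tp.ne'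
    simp only [qd, g1, g2, ubd, boost, hyp1, hyp2, Fin.succ_zero_eq_one, Fin.succ_one_eq_two]
    field_simp
    ring
  have h3 : (x 0 ^2 + x 1^2) / hyp s x 0 ^2 ≤ 1 := by
    rw [div_le_one (by positivity), hyp_sq]; nlinarith [sq_nonneg s]
  have h4 : 0 ≤ hyp s x 0 ^ 2 - x 0 ^ 2 - x 1 ^ 2 := by rw [hyp_sq]; nlinarith [sq_nonneg s]
  have h5 : 0 ≤ 1 - (x 0 ^2 + x 1^2) / hyp s x 0 ^2 := by linarith
  have : 0 ≤ qd u (hyp s x) + 1/2 * g1 x + 1/2 * g2 x - zf u (hyp s x) ^ 2 * (hyp s x 0)⁻¹ := by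
    rw [e2]; positivity
  linarith

theorem G_deriv {s : ℝ} (hs : 0 < s) {u : Pt → ℝ} (hu : Sm u) (su : Sup u) :
    HasDerivAt (fun s => ∫ x, u (hyp s x) ^ 2 * (hyp s x 0)⁻¹) (2 / s * ∫ x, u (hyp s x) * zf u (hyp s x) * (hyp s x 0)⁻¹) s := by
  have i := inv_t_cont (s := s) hs
  have d := divid (J0 := fun p => p 0 * u p ^ 2) (J1 := fun p => p 1 * u p ^ 2) (J2 := fun p => p 2 * u p ^ 2)
    (by fun_prop) (by fun_prop) (by fun_prop)
    (by intro p hp; simp [su p hp]) (by intro p hp; simp [su p hp]) (by intro p hp; simp [su p hp]) hs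
  have d2 := d.fun_mul ((hasDerivAt_pow 2 s).fun_inv (pow_ne_zero 2 hs.ne'))
  have h0 : ∀ r : ℝ, 0 < r → (∫ x : X2, (hyp r x 0 * u (hyp r x) ^ 2 - x 0 / hyp r x 0 * (hyp r x 1 * u (hyp r x) ^ 2) - x 1 / hyp r x 0 * (hyp r x 2 * u (hyp r x) ^ 2)))
      = r^2 * ∫ x, u (hyp r x) ^ 2 * (hyp r x 0)⁻¹ := by
    intro r hr
    rw [← integral_const_mul]; congr 1; funext x
    have h1 := (hyp_pos hr x).ne'
    have h2 : r^2 = hyp r x 0 ^ 2 - (x 0)^2 - (x 1)^2 := by rw [hyp_sq]; ring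
    rw [h2, hyp1, hyp2]; field_simp
  refine (d2.congr_of_eventuallyEq ?_).congr_deriv ?_
  · filter_upwards [isOpen_Ioi.mem_nhds hs] with r hr
    rw [h0 r hr]; have : r ≠ 0 := (Set.mem_Ioi.1 hr).ne'
    field_simp
  · rw [h0 s hs]
    have c1 : CC (s^2+3) (fun x => u (hyp s x)^2 * (hyp s x 0)⁻¹) :=
      ⟨by have := hu.continuous; fun_prop, fun x hx => by simp [hyp_sup su hx]⟩
    have c2 : CC (s^2+3) (fun x => u (hyp s x) * zf u (hyp s x) * (hyp s x 0)⁻¹) :=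
      ⟨by have := hu.continuous; have := (zf_cc (s := s) hu su).1; fun_prop, fun x hx => by simp [hyp_sup su hx]⟩
    have e : ∫ x : X2, s / hyp s x 0 * (pd 0 (fun p => p 0 * u p ^ 2) (hyp s x) + pd 1 (fun p => p 1 * u p ^ 2) (hyp s x) + pd 2 (fun p => p 2 * u p ^ 2) (hyp s x))
       = 2 * s * (∫ x, u (hyp s x) ^ 2 * (hyp s x 0)⁻¹) + 2 * s * ∫ x, u (hyp s x) * zf u (hyp s x) * (hyp s x 0)⁻¹ := by
      rw [← integral_const_mul, ← integral_const_mul, ← integral_add (c1.mul continuous_const).int (c2.mul continuous_const).int]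
      congr 1; funext x
      simp (disch := fun_prop) only [pd_mul, pd_pow, pd_coord, zf, Sf]
      simp
      field_simp
      ring
    rw [e]
    push_cast
    field_simp
    ring

theorem S_energy {u : Pt → ℝ} (hu : Sm u) (su : Sup u) {K D : ℝ} (hK : 0 ≤ K) (hD : 0 ≤ D)
    (hF : ∀ s, 2 ≤ s → ∫ x, negBox u (hyp s x) ^ 2 ≤ (K / s)^2)
    (hi : ∫ x, (zf u (hyp 2 x) ^ 2 + boost 0 u (hyp 2 x) ^ 2 + boost 1 u (hyp 2 x) ^ 2 + u (hyp 2 x)^2) * (hyp 2 x 0)⁻¹ ≤ D^2)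
    {b : ℝ} (hb : 2 ≤ b) :
    ∫ x, (|Sf u (hyp b x)| + |u (hyp b x)|)^2 * (hyp b x 0)⁻¹ ≤ 104 * (D + K)^2 * b := by
  have C1 : ∀ s : ℝ, 0 < s → CC (s^2+3) (fun x => u (hyp s x)^2 * (hyp s x 0)⁻¹) := fun s hs =>
    ⟨by have i := inv_t_cont hs; have := hu.continuous; fun_prop, fun x hx => by simp [hyp_sup su hx]⟩
  have C2 : ∀ s : ℝ, 0 < s → CC (s^2+3) (fun x => zf u (hyp s x)^2 * (hyp s x 0)⁻¹) := fun s hs =>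
    ⟨by have i := inv_t_cont hs; have := (zf_cc (s := s) hu su).1; fun_prop, fun x hx => by simp [(zf_cc (s := s) hu su).2 x hx]⟩
  have CI : CC (2^2+3) (fun x => (zf u (hyp 2 x) ^ 2 + boost 0 u (hyp 2 x) ^ 2 + boost 1 u (hyp 2 x) ^ 2 + u (hyp 2 x)^2) * (hyp 2 x 0)⁻¹) :=
    ⟨by have i := inv_t_cont (s := 2) (by norm_num); have := (zf_cc (s := 2) hu su).1
        have := (smBoost hu 0).continuous; have := (smBoost hu 1).continuous; have := hu.continuous; fun_prop,
     fun x hx => by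
      have e1 : boost 1 u (hyp 2 x) = 0 := hyp_sup (su.dd 4) hx
      have e2 : boost 0 u (hyp 2 x) = 0 := hyp_sup (su.dd 3) hx
      simp [(zf_cc (s := 2) hu su).2 x hx, e1, e2, hyp_sup su hx]⟩
  have i2 : (0:ℝ) < 2 := by norm_num
  have ip : ∀ s : ℝ, 0 < s → ∀ x, 0 < (hyp s x 0)⁻¹ := fun s hs x => inv_pos.2 (hyp_pos hs x)
  -- initial values
  have hY2 : ∫ x, qd u (hyp 2 x) ≤ D^2 := by
    refine (integral_mono (qd_cc i2 hu su).int CI.int fun x => ?_).trans hi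
    refine mul_le_mul_of_nonneg_right ?_ (ip 2 i2 x).le
    nlinarith [sq_nonneg (u (hyp 2 x)), sq_nonneg (hyp 2 x 1 * pd 2 u (hyp 2 x) - hyp 2 x 2 * pd 1 u (hyp 2 x))]
  have hG2 : ∫ x, u (hyp 2 x) ^ 2 * (hyp 2 x 0)⁻¹ ≤ D^2 := by
    refine (integral_mono (C1 2 i2).int CI.int fun x => ?_).trans hi
    refine mul_le_mul_of_nonneg_right ?_ (ip 2 i2 x).le
    nlinarith [sq_nonneg (zf u (hyp 2 x)), sq_nonneg (boost 0 u (hyp 2 x)), sq_nonneg (boost 1 u (hyp 2 x))]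
  have hsq : ∀ s : ℝ, 2 ≤ s → HasDerivAt (fun s => Real.sqrt s) (1 / (2 * Real.sqrt s)) s := fun s hs =>
    Real.hasDerivAt_sqrt (by linarith)
  have znn : ∀ s : ℝ, 0 < s → 0 ≤ ∫ x, zf u (hyp s x)^2 * (hyp s x 0)⁻¹ := fun s hs => integral_nonneg fun x => by
    have := ip s hs x; simp only [Pi.zero_apply]; positivity
  have gnn : ∀ s : ℝ, 0 < s → 0 ≤ ∫ x, u (hyp s x)^2 * (hyp s x 0)⁻¹ := fun s hs => integral_nonneg fun x => by
    have := ip s hs x; simp only [Pi.zero_apply]; positivity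
  have Ynn : ∀ s : ℝ, 0 < s → 0 ≤ ∫ x, qd u (hyp s x) := fun s hs => (znn s hs).trans (Y_gap hs hu su)
  -- step 1
  have hz : ∀ s, 2 ≤ s → Real.sqrt (∫ x, zf u (hyp s x)^2 * (hyp s x 0)⁻¹) ≤ (D + 2*K) * Real.sqrt s := by
    intro b hb
    have st := ode_sqrt (E := fun s => ∫ x, qd u (hyp s x)) (G := fun s => 2 * K * Real.sqrt s) (g := fun s => 2 * K * (1 / (2 * Real.sqrt s))) hb
      (fun s hs => Y_deriv (by linarith [hs.1]) hu su) (fun s hs => (hsq s hs.1).const_mul _)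
      (fun s hs => Ynn s (by linarith [hs.1])) (fun s hs => by positivity) (fun s hs => by
        have hs0 : 0 < s := by linarith [hs.1]
        have i := inv_t_cont hs0
        have cz := zf_cc (s := s) hu su
        have cn := CCh (smNegBox hu) su.negBox s
        let w : X2 → ℝ := fun x => Real.sqrt ((hyp s x 0)⁻¹)
        have cw : Continuous w := by fun_prop
        have w2 : ∀ x, w x ^2 = (hyp s x 0)⁻¹ := fun x => Real.sq_sqrt (ip s hs0 x).le
        have e : ∫ x, s / hyp s x 0 * (2 * (zf u (hyp s x) * negBox u (hyp s x))) = 2 * ∫ x, (w x * zf u (hyp s x)) * (s * (w x * negBox u (hyp s x))) := by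
          rw [← integral_const_mul]; congr 1; funext x
          rw [div_eq_mul_inv, ← w2]; ring
        rw [e]
        have f1 := cz.mul cw
        have f2 := (cn.mul cw).mul (continuous_const (y := s))
        have cs := cauchy_sq f1.sq.int f2.sq.int (f2.mul f1.1).int
        have h1 : ∫ x, (w x * zf u (hyp s x))^2 ≤ ∫ x, qd u (hyp s x) := by
          refine le_trans (le_of_eq ?_) (Y_gap hs0 hu su)
          congr 1; funext x; rw [mul_pow, w2]; ring
        have h2 : ∫ x, (s * (w x * negBox u (hyp s x)))^2 ≤ (K / Real.sqrt s)^2 := by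
          calc ∫ x, (s * (w x * negBox u (hyp s x)))^2 ≤ ∫ x, s * negBox u (hyp s x)^2 := by
                refine int_mono (fun _ => sq_nonneg _) (cn.sq.int.const_mul s) fun x => ?_
                rw [mul_pow, mul_pow, w2]
                have : s * (hyp s x 0)⁻¹ ≤ 1 := by
                  rw [← div_eq_mul_inv, div_le_one (hyp_pos hs0 x)]; exact hyp_ge x
                have := mul_le_mul_of_nonneg_right this (mul_nonneg hs0.le (sq_nonneg (negBox u (hyp s x))))
                nlinarith
            _ ≤ s * (K/s)^2 := by rw [integral_const_mul]; exact mul_le_mul_of_nonneg_left (hF s hs.1) hs0.le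
            _ = (K / Real.sqrt s)^2 := by rw [div_pow, div_pow, Real.sq_sqrt hs0.le]; field_simp
        have h3 := cs.trans (mul_le_mul h1 h2 (integral_nonneg fun _ => sq_nonneg _) (Ynn s hs0))
        rw [← Real.sq_sqrt (Ynn s hs0), ← mul_pow] at h3
        have h4 := (abs_le.1 (abs_le_of_sq_le_sq h3 (by positivity))).2
        calc _ ≤ 2 * (Real.sqrt (∫ x, qd u (hyp s x)) * (K / Real.sqrt s)) := by linarith
          _ = _ := by field_simp)
    have a1 : Real.sqrt (∫ x, qd u (hyp 2 x)) ≤ D := by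
      rw [← Real.sqrt_sq hD]; exact Real.sqrt_le_sqrt hY2
    have a2 := Real.sqrt_le_sqrt (Y_gap (s := b) (by linarith) hu su)
    have a3 : 1 ≤ Real.sqrt b := by rw [Real.one_le_sqrt]; linarith
    have a4 : 0 ≤ 2 * K * Real.sqrt 2 := by positivity
    nlinarith
  have hg : Real.sqrt (∫ x, u (hyp b x)^2 * (hyp b x 0)⁻¹) ≤ (3 * D + 4*K) * Real.sqrt b := by
    have st := ode_sqrt (E := fun s => ∫ x, u (hyp s x)^2 * (hyp s x 0)⁻¹) (G := fun s => 2 * (D + 2 * K) * Real.sqrt s) (g := fun s => 2 * (D + 2 * K) * (1 / (2 * Real.sqrt s))) hb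
      (fun s hs => G_deriv (by linarith [hs.1]) hu su) (fun s hs => (hsq s hs.1).const_mul _)
      (fun s hs => gnn s (by linarith [hs.1])) (fun s hs => by positivity) (fun s hs => by
        have hs0 : 0 < s := by linarith [hs.1]
        have i := inv_t_cont hs0
        have cz := zf_cc (s := s) hu su
        have cn := CCh hu su s
        let w : X2 → ℝ := fun x => Real.sqrt ((hyp s x 0)⁻¹)
        have cw : Continuous w := by fun_prop
        have w2 : ∀ x, w x ^2 = (hyp s x 0)⁻¹ := fun x => Real.sq_sqrt (ip s hs0 x).le
        have e : ∫ x, u (hyp s x) * zf u (hyp s x) * (hyp s x 0)⁻¹ = ∫ x, (w x * u (hyp s x)) * (w x * zf u (hyp s x)) := by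
          congr 1; funext x
          rw [← w2]; ring
        rw [e]
        have f1 := cn.mul cw
        have f2 := cz.mul cw
        have cs := cauchy_sq f1.sq.int f2.sq.int (f2.mul f1.1).int
        have h1 : ∫ x, (w x * u (hyp s x))^2 = ∫ x, u (hyp s x)^2 * (hyp s x 0)⁻¹ := by
          congr 1; funext x; rw [mul_pow, w2]; ring
        have h2 : ∫ x, (w x * zf u (hyp s x))^2 = ∫ x, zf u (hyp s x)^2 * (hyp s x 0)⁻¹ := by
          congr 1; funext x; rw [mul_pow, w2]; ring
        rw [h1, h2, ← Real.sq_sqrt (gnn s hs0), ← Real.sq_sqrt (znn s hs0), ← mul_pow] at cs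
        have h4 := (abs_le.1 (abs_le_of_sq_le_sq cs (by positivity))).2
        have h5 := mul_le_mul_of_nonneg_left (hz s hs.1) (Real.sqrt_nonneg (∫ x, u (hyp s x)^2 * (hyp s x 0)⁻¹))
        have h6 : Real.sqrt s * Real.sqrt s = s := Real.mul_self_sqrt hs0.le
        have h7 : 0 < Real.sqrt s := Real.sqrt_pos.2 hs0
        calc _ ≤ 2 / s * (Real.sqrt (∫ x, u (hyp s x)^2 * (hyp s x 0)⁻¹) * ((D + 2*K) * Real.sqrt s)) :=
              mul_le_mul_of_nonneg_left (h4.trans h5) (by positivity)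
          _ = _ := by
            nth_rewrite 1 [← h6]
            field_simp)
    have a1 : Real.sqrt (∫ x, u (hyp 2 x)^2 * (hyp 2 x 0)⁻¹) ≤ D := by
      rw [← Real.sqrt_sq hD]; exact Real.sqrt_le_sqrt hG2
    have a3 : 1 ≤ Real.sqrt b := by rw [Real.one_le_sqrt]; linarith
    have a4 : 0 ≤ 2 * (D + 2 * K) * Real.sqrt 2 := by positivity
    nlinarith
  have b0 : 0 < b := by linarith
  have rb : Real.sqrt b ^ 2 = b := Real.sq_sqrt b0.le
  have hz2 : ∫ x, zf u (hyp b x)^2 * (hyp b x 0)⁻¹ ≤ (D+2*K)^2 * b := by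
    have := (Real.sqrt_le_iff.1 (hz b hb)).2
    rwa [mul_pow, rb] at this
  have hg2 : ∫ x, u (hyp b x)^2 * (hyp b x 0)⁻¹ ≤ (3*D+4*K)^2 * b := by
    have := (Real.sqrt_le_iff.1 hg).2
    rwa [mul_pow, rb] at this
  have fin : ∫ x, (|Sf u (hyp b x)| + |u (hyp b x)|)^2 * (hyp b x 0)⁻¹ ≤
      ∫ x, (2 * (zf u (hyp b x)^2 * (hyp b x 0)⁻¹) + 9/2 * (u (hyp b x)^2 * (hyp b x 0)⁻¹)) := by
    refine int_mono (fun x => mul_nonneg (sq_nonneg _) (ip b b0 x).le) (((C2 b b0).int.const_mul 2).add ((C1 b b0).int.const_mul (9/2))) fun x => ?_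
    have : (|Sf u (hyp b x)| + |u (hyp b x)|)^2 ≤ 2 * zf u (hyp b x)^2 + 9/2 * u (hyp b x)^2 := by
      have h1 : |Sf u (hyp b x)| ≤ |zf u (hyp b x)| + 1/2 * |u (hyp b x)| := by
        have : Sf u (hyp b x) = zf u (hyp b x) - 1/2 * u (hyp b x) := by unfold zf; ring
        rw [this]; refine (abs_sub _ _).trans (le_of_eq ?_); rw [abs_mul, abs_of_pos (by norm_num : (0:ℝ) < 1/2)]
      rw [← sq_abs (zf u (hyp b x)), ← sq_abs (u (hyp b x))]
      nlinarith [abs_nonneg (Sf u (hyp b x)), abs_nonneg (u (hyp b x)), abs_nonneg (zf u (hyp b x)), sq_nonneg (|zf u (hyp b x)| - 3/2 * |u (hyp b x)|)]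
    calc _ ≤ (2 * zf u (hyp b x)^2 + 9/2 * u (hyp b x)^2) * (hyp b x 0)⁻¹ := mul_le_mul_of_nonneg_right this (ip b b0 x).le
      _ = _ := by ring
  rw [integral_add ((C2 b b0).int.const_mul 2) ((C1 b b0).int.const_mul (9/2)), integral_const_mul, integral_const_mul] at fin
  have m1 : 2 * (D+2*K)^2 + 9/2 * (3*D+4*K)^2 ≤ 104 * (D+K)^2 := by nlinarith [mul_nonneg hD hK, sq_nonneg D, sq_nonneg K]
  nlinarith [mul_le_mul_of_nonneg_right m1 b0.le]

theorem abs_le_of_deriv {f f' G G' : ℝ → ℝ} {a b : ℝ} (hab : a ≤ b)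
    (hf : ∀ s ∈ Set.Icc a b, HasDerivAt f (f' s) s) (hG : ∀ s ∈ Set.Icc a b, HasDerivAt G (G' s) s)
    (h : ∀ s ∈ Set.Icc a b, |f' s| ≤ G' s) : |f b - f a| ≤ G b - G a := by
  have m : ∀ {h h' : ℝ → ℝ}, (∀ s ∈ Set.Icc a b, HasDerivAt h (h' s) s) → (∀ s ∈ Set.Icc a b, 0 ≤ h' s) → h a ≤ h b := by
    intro h h' hd hn
    refine monotoneOn_of_deriv_nonneg (convex_Icc a b) (fun s hs => (hd s hs).continuousAt.continuousWithinAt) ?_ ?_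
      (Set.left_mem_Icc.2 hab) (Set.right_mem_Icc.2 hab) hab
    · intro s hs; exact (hd s (interior_subset hs)).differentiableAt.differentiableWithinAt
    · intro s hs; rw [(hd s (interior_subset hs)).deriv]; exact hn s (interior_subset hs)
  have m1 := m (fun s hs => (hG s hs).fun_sub (hf s hs)) fun s hs => by linarith [le_abs_self (f' s), h s hs]
  have m2 := m (fun s hs => (hG s hs).fun_add (hf s hs)) fun s hs => by linarith [neg_abs_le (f' s), h s hs]
  rw [abs_le]; constructor <;> linarith

theorem rad_sq (p : Pt) : rad p ^ 2 = p 1 ^ 2 + p 2 ^ 2 := Real.sq_sqrt (by positivity)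
theorem rad_nn (p : Pt) : 0 ≤ rad p := Real.sqrt_nonneg _
theorem abs1_le_rad (p : Pt) : |p 1| ≤ rad p := by
  apply abs_le_of_sq_le_sq _ (rad_nn p); nlinarith [rad_sq p, sq_nonneg (p 2)]
theorem abs2_le_rad (p : Pt) : |p 2| ≤ rad p := by
  apply abs_le_of_sq_le_sq _ (rad_nn p); nlinarith [rad_sq p, sq_nonneg (p 1)]

theorem abs_mul_le {a b A B : ℝ} (ha : |a| ≤ A) (hb : |b| ≤ B) : |a * b| ≤ A * B := by
  rw [abs_mul]; exact mul_le_mul ha hb (abs_nonneg _) ((abs_nonneg _).trans ha)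

theorem inter_bd {u : Pt → ℝ} {p : Pt} {K : ℝ} (hp : 0 < p 0) (hr : rad p ≤ p 0 / 2) (hS : |Sf u p| ≤ K)
    (h0 : |boost 0 u p| ≤ K) (h1 : |boost 1 u p| ≤ K) (α : Fin 3) : |pd α u p| ≤ 3 * K / p 0 := by
  have hK : 0 ≤ K := (abs_nonneg _).trans hS
  have x1 := (abs1_le_rad p).trans hr
  have x2 := (abs2_le_rad p).trans hr
  have rs := rad_sq p
  have hs : 3/4 * p 0 ^ 2 ≤ p 0 ^ 2 - p 1 ^ 2 - p 2 ^ 2 := by nlinarith [rad_nn p]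
  have key : (p 0 ^ 2 - p 1 ^ 2 - p 2 ^ 2) * pd 0 u p = p 0 * Sf u p - p 1 * boost 0 u p - p 2 * boost 1 u p := by
    rw [Sf_eq, boost0, boost1]; ring
  have k2 : |(p 0 ^ 2 - p 1 ^ 2 - p 2 ^ 2) * pd 0 u p| ≤ 2 * p 0 * K := by
    rw [key]
    have a1 := abs_mul_le (abs_of_pos hp).le hS
    have a2 := abs_mul_le x1 h0
    have a3 := abs_mul_le x2 h1
    rw [abs_le] at *; constructor <;> linarith
  have k3 : |pd 0 u p| ≤ 8/3 * K / p 0 := by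
    rw [le_div_iff₀ hp]
    rw [abs_mul, abs_of_nonneg (by nlinarith)] at k2
    have := (mul_le_mul_of_nonneg_right hs (abs_nonneg (pd 0 u p))).trans k2
    have : p 0 * (3/4 * (p 0 * |pd 0 u p|)) ≤ p 0 * (2 * K) := by nlinarith
    have := le_of_mul_le_mul_left this hp
    linarith
  have k4 : ∀ x d L : ℝ, |x| ≤ p 0 / 2 → |L| ≤ K → L = x * pd 0 u p + p 0 * d → |d| ≤ 3 * K / p 0 := by
    intro x d L hx hL e
    rw [le_div_iff₀ hp]
    have a := abs_mul_le hx k3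
    have e2 : p 0 / 2 * (8/3 * K / p 0) = 4/3 * K := by field_simp; ring
    rw [e2] at a
    have : |d * p 0| ≤ 3 * K := by
      rw [show d * p 0 = L - x * pd 0 u p by rw [e]; ring]
      rw [abs_le] at *; constructor <;> linarith
    rwa [abs_mul, abs_of_pos hp] at this
  fin_cases α
  · exact k3.trans (by gcongr; norm_num)
  · exact k4 _ _ _ x1 h0 rfl
  · exact k4 _ _ _ x2 h1 rfl

/-- `t²Ω²u` in terms of boosts -/
theorem omega_sq {u : Pt → ℝ} (hu : Sm u) (p : Pt) :
    p 0 ^ 2 * (p 1 ^ 2 * pd 2 (pd 2 u) p - 2 * p 1 * p 2 * pd 1 (pd 2 u) p + p 2 ^ 2 * pd 1 (pd 1 u) p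
      - p 1 * pd 1 u p - p 2 * pd 2 u p) =
    - p 0 * (p 1 * boost 0 u p + p 2 * boost 1 u p) + p 1 ^ 2 * boost 1 (boost 1 u) p
      - p 1 * p 2 * (boost 0 (boost 1 u) p + boost 1 (boost 0 u) p) + p 2 ^ 2 * boost 0 (boost 0 u) p := by
  simp only [boost0, boost1]
  simp (disch := fun_prop) only [pd_add, pd_mul, pd_coord]
  rw [pd_comm hu 2 0, pd_comm hu 1 0, pd_comm hu 2 1]
  simp
  ring

set_option maxHeartbeats 2000000 in
theorem null_bd {u : Pt → ℝ} (hu : Sm u) {K : ℝ} (H : ∀ p : Pt, 2 ≤ p 0 → rad p ≤ p 0 - 1 →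
    |u p| ≤ K ∧ |Sf u p| ≤ K ∧ (∀ a, |boost a u p| ≤ K) ∧ (∀ a b, |boost a (boost b u) p| ≤ K) ∧ |negBox u p| ≤ K / p 0 ^ 2)
    {p : Pt} (hp : 2 ≤ p 0) (hr : rad p ≤ p 0 - 1) (α : Fin 3) :
    p 0 * (p 0 - rad p) * pd α u p ^ 2 ≤ (40 * K)^2 := by
  have hK : 0 ≤ K := (abs_nonneg _).trans (H p hp hr).1
  have hp0 : 0 < p 0 := by linarith
  by_cases hc : rad p ≤ p 0 / 2
  · obtain ⟨_, b, c, -⟩ := H p hp hr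
    have := inter_bd hp0 hc b (c 0) (c 1) α
    rw [le_div_iff₀ hp0] at this
    have h2 : (|pd α u p| * p 0)^2 ≤ (3*K)^2 := by gcongr
    rw [mul_pow, sq_abs] at h2
    have : p 0 * (p 0 - rad p) * pd α u p ^ 2 ≤ p 0 * p 0 * pd α u p ^ 2 := by
      gcongr; linarith [rad_nn p]
    nlinarith
  push Not at hc
  obtain ⟨r, er⟩ : ∃ r, r = rad p := ⟨_, rfl⟩
  rw [← er] at hr hc ⊢
  obtain ⟨q, eq⟩ : ∃ q, q = p 0 - r := ⟨_, rfl⟩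
  have hr0 : 0 < r := by linarith
  have hq : 1 ≤ q := by linarith
  have hq0 : 0 < q := by linarith
  have hqr : q ≤ r := by linarith
  obtain ⟨e1, he1⟩ : ∃ e, e = p 1 / r := ⟨_, rfl⟩
  obtain ⟨e2, he2⟩ : ∃ e, e = p 2 / r := ⟨_, rfl⟩
  have p1 : p 1 = r * e1 := by rw [he1]; field_simp
  have p2 : p 2 = r * e2 := by rw [he2]; field_simp
  have he : e1 ^ 2 + e2 ^ 2 = 1 := by
    have := rad_sq p; rw [← er, p1, p2] at this
    have : r^2 * (e1^2+e2^2) = r^2 * 1 := by linarith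
    exact mul_left_cancel₀ (by positivity) this
  have ae1 : |e1| ≤ 1 := by apply abs_le_of_sq_le_sq <;> nlinarith [sq_nonneg e2]
  have ae2 : |e2| ≤ 1 := by apply abs_le_of_sq_le_sq <;> nlinarith [sq_nonneg e1]
  let c : ℝ → Pt := fun τ => ![τ + q, τ * e1, τ * e2]
  have c0 : ∀ τ, c τ 0 = τ + q := fun τ => rfl
  have c1 : ∀ τ, c τ 1 = τ * e1 := fun τ => rfl
  have c2 : ∀ τ, c τ 2 = τ * e2 := fun τ => rfl
  have crad : ∀ τ, 0 ≤ τ → rad (c τ) = τ := by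
    intro τ hτ
    rw [← Real.sqrt_sq (rad_nn (c τ)), rad_sq, c1, c2, ← Real.sqrt_sq hτ]; congr 1
    rw [Real.sqrt_sq hτ]; linear_combination τ^2 * he
  have cp : c r = p := by
    ext i; fin_cases i
    · show r + q = p 0; linarith
    · show r * e1 = p 1; linarith
    · show r * e2 = p 2; linarith
  have dc : ∀ {v : Pt → ℝ}, Sm v → ∀ τ, HasDerivAt (fun τ => v (c τ)) (1 * pd 0 v (c τ) + e1 * pd 1 v (c τ) + e2 * pd 2 v (c τ)) τ := by
    intro v hv τ
    refine chain hv ((hasDerivAt_id τ).add_const q) ?_ ?_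
    · exact ((hasDerivAt_id τ).mul_const e1).congr_deriv (one_mul _)
    · exact ((hasDerivAt_id τ).mul_const e2).congr_deriv (one_mul _)
  let m : Pt → ℝ := fun x => pd 0 u x - e1 * pd 1 u x - e2 * pd 2 u x
  have hm : Sm m := by fun_prop
  let Φ : ℝ → ℝ := fun τ => Real.sqrt τ * m (c τ) - u (c τ) * (2 * Real.sqrt τ)⁻¹
  let X : ℝ → ℝ := fun τ => τ^2 * (e1 ^ 2 * pd 2 (pd 2 u) (c τ) - 2 * e1 * e2 * pd 1 (pd 2 u) (c τ) + e2 ^ 2 * pd 1 (pd 1 u) (c τ))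
      - τ * (e1 * pd 1 u (c τ) + e2 * pd 2 u (c τ))
  have dΦ : ∀ τ ∈ Set.Icc q r, HasDerivAt Φ (Real.sqrt τ * (negBox u (c τ) + X τ / τ^2) + u (c τ) / (4 * (Real.sqrt τ)^3)) τ := by
    intro τ hτ
    have ht : 0 < τ := hq0.trans_le hτ.1
    have hs : 0 < Real.sqrt τ := Real.sqrt_pos.2 ht
    have ds := Real.hasDerivAt_sqrt ht.ne'
    have d1 := (ds.fun_mul (dc hm τ)).fun_sub ((dc hu τ).fun_mul ((ds.const_mul 2).fun_inv (by positivity)))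
    refine d1.congr_deriv ?_
    have ss : τ = Real.sqrt τ ^ 2 := (Real.sq_sqrt ht.le).symm
    show _ = _
    simp only [m, X, negBox_eq]
    simp (disch := fun_prop) only [pd_sub, pd_cmul]
    rw [pd_comm hu 2 0, pd_comm hu 1 0, pd_comm hu 2 1]
    generalize Real.sqrt τ = σ at *
    subst ss
    have he' : e2 ^ 2 = 1 - e1 ^ 2 := by linarith
    field_simp
    ring_nf
    simp only [he']
    ring
  have tr : ∀ τ ∈ Set.Icc q r, |X τ| ≤ 6 * K := by
    intro τ hτ
    have ht : 0 < τ := hq0.trans_le hτ.1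
    have t0 : 0 < τ + q := by linarith
    obtain ⟨-, -, g1, g2, -⟩ := H (c τ) (by rw [c0]; linarith [hτ.1]) (by rw [c0, crad τ ht.le]; linarith)
    have o := omega_sq hu (c τ)
    rw [c0, c1, c2] at o
    have o2 : (τ+q)^2 * X τ = - (τ+q) * τ * (e1 * boost 0 u (c τ) + e2 * boost 1 u (c τ)) + τ^2 * (e1 * e1 * boost 1 (boost 1 u) (c τ))
      - τ^2 * (e1 * e2 * boost 0 (boost 1 u) (c τ)) - τ^2 * (e1 * e2 * boost 1 (boost 0 u) (c τ)) + τ^2 * (e2 * e2 * boost 0 (boost 0 u) (c τ)) := by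
      simp only [X]; linear_combination o
    have f1 : ∀ {a L : ℝ}, |a| ≤ 1 → |L| ≤ K → |a * L| ≤ K := fun ha hL => by simpa using abs_mul_le ha hL
    have f2 : ∀ {a b : ℝ}, |a| ≤ 1 → |b| ≤ 1 → |a * b| ≤ 1 := fun ha hL => by simpa using abs_mul_le ha hL
    have f3 : ∀ {L : ℝ}, |L| ≤ K → |τ^2 * L| ≤ (τ+q)^2 * K := fun hL => by
      apply abs_mul_le _ hL; rw [abs_of_nonneg (by positivity)]; gcongr; linarith
    have h1 := f3 (f1 (f2 ae1 ae1) (g2 1 1))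
    have h2 := f3 (f1 (f2 ae1 ae2) (g2 0 1))
    have h3 := f3 (f1 (f2 ae1 ae2) (g2 1 0))
    have h4 := f3 (f1 (f2 ae2 ae2) (g2 0 0))
    have h5 : |(τ+q) * τ * (e1 * boost 0 u (c τ) + e2 * boost 1 u (c τ))| ≤ (τ+q)^2 * (2 * K) := by
      apply abs_mul_le
      · rw [abs_of_nonneg (by positivity), sq]; gcongr; linarith
      · have a := f1 ae1 (g1 0); have b := f1 ae2 (g1 1)
        rw [abs_le] at *; constructor <;> linarith
    have : |(τ+q)^2 * X τ| ≤ (τ+q)^2 * (6 * K) := by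
      rw [o2]; clear o2 o
      rw [abs_le] at h1 h2 h3 h4 h5 ⊢; constructor <;> linarith
    rw [abs_mul, abs_of_pos (by positivity)] at this
    exact le_of_mul_le_mul_left this (by positivity)
  have main : |Φ r - Φ q| ≤ (-16 * K * (Real.sqrt r)⁻¹) - (-16 * K * (Real.sqrt q)⁻¹) := by
    refine abs_le_of_deriv (G := fun τ => -16 * K * (Real.sqrt τ)⁻¹) (G' := fun τ => 8 * K / Real.sqrt τ ^ 3) hqr dΦ ?_ ?_
    · intro τ hτ
      have ht : 0 < τ := hq0.trans_le hτ.1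
      have hs : 0 < Real.sqrt τ := Real.sqrt_pos.2 ht
      refine (((Real.hasDerivAt_sqrt ht.ne').fun_inv hs.ne').const_mul _).congr_deriv ?_
      field_simp; ring
    · intro τ hτ
      have ht : 0 < τ := hq0.trans_le hτ.1
      have hs : 0 < Real.sqrt τ := Real.sqrt_pos.2 ht
      obtain ⟨a1, -, -, -, a2⟩ := H (c τ) (by rw [c0]; linarith [hτ.1]) (by rw [c0, crad τ ht.le]; linarith)
      have a3 := tr τ hτ
      have ss : τ = Real.sqrt τ ^ 2 := (Real.sq_sqrt ht.le).symm
      have a4 : |negBox u (c τ)| ≤ K / τ^2 := a2.trans (by rw [c0]; gcongr; linarith)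
      have a5 : |X τ / τ^2| ≤ 6 * K / τ^2 := by rw [abs_div, abs_of_pos (a := τ^2) (by positivity)]; gcongr
      have b1 : |Real.sqrt τ * (negBox u (c τ) + X τ / τ^2)| ≤ Real.sqrt τ * (K/τ^2 + 6 * K / τ^2) :=
        abs_mul_le (abs_of_pos hs).le ((abs_add_le _ _).trans (add_le_add a4 a5))
      have b2 : |u (c τ) / (4 * (Real.sqrt τ)^3)| ≤ K / (4 * (Real.sqrt τ)^3) := by
        rw [abs_div, abs_of_pos (a := 4 * (Real.sqrt τ)^3) (by positivity)]; gcongr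
      refine (abs_add_le _ _).trans ((add_le_add b1 b2).trans ?_)
      generalize Real.sqrt τ = σ at *
      subst ss
      have : σ * (K / (σ^2)^2 + 6 * K / (σ^2)^2) + K / (4 * σ^3) = (29/4 * K) / σ^3 := by field_simp; norm_num
      rw [this]; gcongr; norm_num
  have sq0 : 0 < Real.sqrt q := Real.sqrt_pos.2 hq0
  have sr0 : 0 < Real.sqrt r := Real.sqrt_pos.2 hr0
  have start : |Φ q| ≤ 5 * K * (Real.sqrt q)⁻¹ := by
    obtain ⟨a1, b, g, -⟩ := H (c q) (by rw [c0]; linarith) (by rw [c0, crad q hq0.le]; linarith)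
    have ib := inter_bd (p := c q) (by rw [c0]; linarith) (by rw [c0, crad q hq0.le]; linarith) b (g 0) (g 1)
    rw [c0] at ib
    have i1 := abs_mul_le ae1 (ib 1)
    have i2 := abs_mul_le ae2 (ib 2)
    have i0 := ib 0
    have mb : |m (c q)| ≤ 9 / 2 * K / q := by
      have : 9/2 * K / q = 3 * (3 * K / (q+q)) := by field_simp; ring
      rw [this]; simp only [m]
      rw [abs_le] at *; constructor <;> linarith
    have b1 : |Real.sqrt q * m (c q)| ≤ Real.sqrt q * (9/2 * K / q) := abs_mul_le (abs_of_pos sq0).le mb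
    have b2 : |u (c q) * (2 * Real.sqrt q)⁻¹| ≤ K * (2 * Real.sqrt q)⁻¹ := abs_mul_le a1 (abs_of_pos (by positivity)).le
    have e : Real.sqrt q * (9/2 * K / q) + K * (2 * Real.sqrt q)⁻¹ = 5 * K * (Real.sqrt q)⁻¹ := by
      have ss : q = Real.sqrt q ^ 2 := (Real.sq_sqrt hq0.le).symm
      generalize Real.sqrt q = σ at *
      rw [ss]; field_simp; ring
    rw [← e]; exact (abs_sub _ _).trans (add_le_add b1 b2)
  have qr : (Real.sqrt r)⁻¹ ≤ (Real.sqrt q)⁻¹ := inv_anti₀ sq0 (Real.sqrt_le_sqrt hqr)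
  obtain ⟨a1, b, g, -⟩ := H p hp (by rw [← er]; linarith)
  have um : |Real.sqrt r * m p| ≤ 22 * K * (Real.sqrt q)⁻¹ := by
    have b2 : |u p * (2 * Real.sqrt r)⁻¹| ≤ K * (2 * Real.sqrt q)⁻¹ :=
      abs_mul_le a1 (by rw [abs_of_pos (by positivity), mul_inv, mul_inv]; gcongr)
    have e : Real.sqrt r * m p = Φ r + u p * (2 * Real.sqrt r)⁻¹ := by simp only [Φ, cp]; ring
    have : K * (2 * Real.sqrt q)⁻¹ = 1/2 * (K * (Real.sqrt q)⁻¹) := by rw [mul_inv]; ring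
    rw [e]
    have : 0 ≤ K * (Real.sqrt r)⁻¹ := by positivity
    rw [abs_le] at *; constructor <;> linarith
  -- square-root bookkeeping
  have um2 : |m p| ≤ 22 * K / (Real.sqrt q * Real.sqrt r) := by
    rw [abs_mul, abs_of_pos sr0] at um
    rw [le_div_iff₀ (by positivity)]
    have := mul_le_mul_of_nonneg_left um sq0.le
    rw [show Real.sqrt q * (22 * K * (Real.sqrt q)⁻¹) = 22 * K by field_simp] at this
    linarith
  obtain ⟨k, hk⟩ : ∃ k, k = K / (Real.sqrt q * Real.sqrt r) := ⟨_, rfl⟩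
  have hk0 : 0 ≤ k := by rw [hk]; positivity
  have um3 : |m p| ≤ 22 * k := by rw [hk, ← mul_div_assoc]; exact um2
  have kK : q * k ≤ K := by
    rw [hk, ← mul_div_assoc, div_le_iff₀ (by positivity), mul_comm]
    gcongr
    calc q = Real.sqrt q * Real.sqrt q := (Real.mul_self_sqrt hq0.le).symm
      _ ≤ _ := by gcongr
  have Kk : K ≤ r * k := by
    rw [hk, ← mul_div_assoc, le_div_iff₀ (by positivity), mul_comm]
    gcongr
    calc _ ≤ Real.sqrt r * Real.sqrt r := by gcongr
      _ = r := Real.mul_self_sqrt hr0.le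
  have ksq : q * r * k^2 = K^2 := by
    rw [hk, div_pow, mul_pow, Real.sq_sqrt hq0.le, Real.sq_sqrt hr0.le]; field_simp
  have pt : p 0 = r + q := by linarith
  let mp := pd 0 u p + e1 * pd 1 u p + e2 * pd 2 u p
  have Le : (p 0 - q/2) * mp = e1 * boost 0 u p + e2 * boost 1 u p + q/2 * m p := by
    simp only [mp, m, boost0, boost1, p1, p2, pt]
    linear_combination (-r * pd 0 u p) * he
  have g0 := abs_mul_le ae1 (g 0)
  have g1 := abs_mul_le ae2 (g 1)
  have up : |mp| ≤ 13 * k := by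
    have a : |q / 2 * m p| ≤ q/2 * (22 * k) := abs_mul_le (abs_of_pos (by positivity)).le um3
    have : |(p 0 - q/2) * mp| ≤ 13 * K := by
      rw [Le]; rw [abs_le] at *; constructor <;> linarith
    rw [abs_mul, abs_of_pos (by linarith)] at this
    have h2 : r * |mp| ≤ r * (13 * k) := by
      have : r * |mp| ≤ (p 0 - q/2) * |mp| := by gcongr; linarith
      linarith
    exact le_of_mul_le_mul_left h2 hr0
  have uo : |e1 * pd 2 u p - e2 * pd 1 u p| ≤ 2 * k := by
    have e : p 0 * (e1 * pd 2 u p - e2 * pd 1 u p) = e1 * boost 1 u p - e2 * boost 0 u p := by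
      simp only [boost0, boost1, p1, p2]; ring
    have i1 := abs_mul_le ae1 (g 1)
    have i2 := abs_mul_le ae2 (g 0)
    have : |p 0 * (e1 * pd 2 u p - e2 * pd 1 u p)| ≤ 2 * K := by
      rw [e]; rw [abs_le] at *; constructor <;> linarith
    rw [abs_mul, abs_of_pos hp0] at this
    have h2 : r * |e1 * pd 2 u p - e2 * pd 1 u p| ≤ r * (2 * k) := by
      have : r * |e1 * pd 2 u p - e2 * pd 1 u p| ≤ p 0 * |e1 * pd 2 u p - e2 * pd 1 u p| := by gcongr; linarith
      linarith
    exact le_of_mul_le_mul_left h2 hr0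
  have ut : |pd 0 u p| ≤ 18 * k := by
    have : pd 0 u p = (m p + mp) / 2 := by simp only [m, mp]; ring
    rw [this]; rw [abs_le] at *; constructor <;> linarith
  have ur : |e1 * pd 1 u p + e2 * pd 2 u p| ≤ 18 * k := by
    have : e1 * pd 1 u p + e2 * pd 2 u p = (mp - m p) / 2 := by simp only [m, mp]; ring
    rw [this]; rw [abs_le] at *; constructor <;> linarith
  have fin : |pd α u p| ≤ 20 * k := by
    have i1 := abs_mul_le ae1 ur
    have i2 := abs_mul_le ae2 ur
    have i3 := abs_mul_le ae1 uo
    have i4 := abs_mul_le ae2 uo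
    fin_cases α
    · exact ut.trans (by linarith)
    · have : pd 1 u p = e1 * (e1 * pd 1 u p + e2 * pd 2 u p) - e2 * (e1 * pd 2 u p - e2 * pd 1 u p) := by
        linear_combination (-pd 1 u p) * he
      show |pd 1 u p| ≤ _
      rw [this]; rw [abs_le] at *; constructor <;> linarith
    · have : pd 2 u p = e2 * (e1 * pd 1 u p + e2 * pd 2 u p) + e1 * (e1 * pd 2 u p - e2 * pd 1 u p) := by
        linear_combination (-pd 2 u p) * he
      show |pd 2 u p| ≤ _
      rw [this]; rw [abs_le] at *; constructor <;> linarith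
  have f2 : pd α u p ^ 2 ≤ (20 * k)^2 := by rw [← sq_abs]; gcongr
  calc p 0 * (p 0 - r) * pd α u p ^ 2 = (r + q) * q * pd α u p ^ 2 := by rw [← eq, pt]
    _ ≤ (r + r) * q * (20 * k)^2 := by gcongr
    _ = 800 * (q * r * k^2) := by ring
    _ = 800 * K^2 := by rw [ksq]
    _ ≤ _ := by nlinarith

/-- `y = s^{1/10}` -/
def yy (s : ℝ) : ℝ := s ^ ((1:ℝ)/10)

theorem yy_pow {s : ℝ} (hs : 0 ≤ s) : yy s ^ 10 = s := by
  unfold yy; rw [← Real.rpow_natCast, ← Real.rpow_mul hs]; norm_num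
theorem yy_one {s : ℝ} (hs : 1 ≤ s) : 1 ≤ yy s := Real.one_le_rpow hs (by norm_num)
theorem yy_deriv {s : ℝ} (hs : 0 < s) : HasDerivAt yy (yy s / (10 * s)) s := by
  have := Real.hasDerivAt_rpow_const (x := s) (p := (1:ℝ)/10) (Or.inl hs.ne')
  refine this.congr_deriv ?_
  rw [Real.rpow_sub hs, Real.rpow_one]; unfold yy; field_simp
theorem yy_le {s : ℝ} (hs : 1 ≤ s) (k : ℕ) (hk : k ≤ 10) : yy s ^ k ≤ s := by
  calc yy s ^ k ≤ yy s ^ 10 := pow_le_pow_right₀ (yy_one hs) hk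
    _ = s := yy_pow (by linarith)

/-- `L²` bounds for compactly supported continuous functions -/
def Lb (R K : ℝ) (f : X2 → ℝ) : Prop := CC R f ∧ 0 ≤ K ∧ ∫ x, f x ^ 2 ≤ K ^ 2

theorem CC.mulc {R f} (h : CC R f) (c : ℝ) : CC R (fun x => c * f x) :=
  ⟨h.1.const_mul c, fun x hx => by simp [h.2 x hx]⟩

theorem Lb.add {R K K' f g} (h : Lb R K f) (h' : Lb R K' g) : Lb R (K + K') (fun x => f x + g x) := by
  refine ⟨h.1.add h'.1, add_nonneg h.2.1 h'.2.1, ?_⟩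
  have if2 := h.1.sq.int
  have ig2 := h'.1.sq.int
  have ifg := (h.1.mul h'.1.1).int
  have ifg' : Integrable fun x => f x * g x := ifg.congr (Filter.Eventually.of_forall fun x => by ring)
  have e : ∫ x, (f x + g x)^2 = (∫ x, f x ^ 2) + (∫ x, g x ^ 2) + 2 * ∫ x, f x * g x := by
    rw [← integral_const_mul, ← integral_add if2 ig2, ← integral_add (if2.fun_add ig2) (ifg'.const_mul 2)]
    congr 1; ext x; ring
  have c := cauchy_sq if2 ig2 ifg'
  have c2 : (∫ x, f x * g x) ≤ K * K' := by
    apply le_of_sq_le_sq _ (mul_nonneg h.2.1 h'.2.1) |> fun h => h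
    rw [mul_pow]
    exact c.trans (mul_le_mul h.2.2 h'.2.2 (integral_nonneg fun _ => sq_nonneg _) (sq_nonneg _))
  rw [e]; nlinarith [h.2.2, h'.2.2]

theorem Lb.mono {R K f g} (h : Lb R K f) (hg : CC R g) (hl : ∀ x, |g x| ≤ |f x|) : Lb R K g :=
  ⟨hg, h.2.1, (integral_mono hg.sq.int h.1.sq.int fun x => sq_le_sq.2 (hl x)).trans h.2.2⟩

theorem Lb.le {R K K' f} (h : Lb R K f) (hK : K ≤ K') : Lb R K' f :=
  ⟨h.1, h.2.1.trans hK, h.2.2.trans (by gcongr; exact h.2.1)⟩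

theorem Lb.cmul {R K f} (h : Lb R K f) {c : ℝ} (hc : 0 ≤ c) : Lb R (c * K) (fun x => c * f x) := by
  refine ⟨h.1.mulc c, mul_nonneg hc h.2.1, ?_⟩
  simp only [mul_pow]
  rw [integral_const_mul]
  exact mul_le_mul_of_nonneg_left h.2.2 (sq_nonneg c)

theorem Lb.zero {R : ℝ} : Lb R 0 (fun _ => 0) := ⟨⟨continuous_const, fun _ _ => rfl⟩, le_rfl, by simp⟩

theorem Lb.sum {ι : Type*} (A : Finset ι) {R : ℝ} {K : ℝ} {f : ι → X2 → ℝ} (h : ∀ i ∈ A, Lb R K (f i)) :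
    Lb R (A.card * K) (fun x => ∑ i ∈ A, f i x) := by
  classical
  induction A using Finset.induction_on with
  | empty => simpa using Lb.zero
  | insert a A ha ih =>
    have := (h a (Finset.mem_insert_self _ _)).add (ih fun i hi => h i (Finset.mem_insert_of_mem hi))
    simp only [Finset.sum_insert ha, Finset.card_insert_of_notMem ha]
    exact this.le (by push_cast; linarith)

/-- area of the disk of radius `R` -/
def area (R : ℝ) : ℝ := volume.real {x : X2 | rad2 x ≤ R}

theorem area_nn (R) : 0 ≤ area R := measureReal_nonneg

theorem int_bd {R M : ℝ} {f : X2 → ℝ} (h : CC R f) (hM : ∀ x, f x ≤ M) : ∫ x, f x ≤ M * area R := by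
  have hm : MeasurableSet {x : X2 | rad2 x ≤ R} := (isClosed_le rad2_cont continuous_const).measurableSet
  have e : ∫ x, f x = ∫ x in {x : X2 | rad2 x ≤ R}, f x := by
    rw [setIntegral_eq_integral_of_forall_compl_eq_zero]
    intro x hx; exact h.2 x (not_le.1 hx)
  rw [e]
  calc _ ≤ ∫ x in {x : X2 | rad2 x ≤ R}, M :=
        setIntegral_mono_on h.int.integrableOn (integrableOn_const (compact_rad2 R).measure_lt_top.ne) hm fun x _ => hM x
    _ = _ := by rw [setIntegral_const, smul_eq_mul, mul_comm]; rfl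

theorem Lb.of_bd {R M : ℝ} {f : X2 → ℝ} (h : CC R f) (hM0 : 0 ≤ M) (hM : ∀ x, |f x| ≤ M) : Lb R (M * (area R + 1)) f := by
  refine ⟨h, mul_nonneg hM0 (by linarith [area_nn R]), (int_bd h.sq (M := M^2) fun x => ?_).trans ?_⟩
  · rw [← sq_abs]; gcongr; exact hM x
  · rw [mul_pow]; gcongr; nlinarith [area_nn R]

/-- L² bound on the hyperboloid -/
def LH (s K : ℝ) (f : Pt → ℝ) : Prop := Lb (s^2+3) K (fun x => f (hyp s x))

theorem nmF_LH {A : Finset (Fin 5)} {N : (Pt → ℝ) → Pt → ℝ} {s K : ℝ} {k : ℕ} {u : Pt → ℝ}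
    (h : ∀ l ∈ Wd A k, LH s K (N (Dw l u))) : LH s (6^k * K) (nmF A N k u) := by
  induction k generalizing u with
  | zero => simpa [nmF, Dw] using h [] (Wd_nil _ _)
  | succ k ih =>
    have h1 := ih (u := u) fun l hl => h l (Wd_mono (Nat.le_succ k) hl)
    have h2 : ∀ i ∈ A, LH s (6^k * K) (nmF A N k (dd i u)) := fun i hi => ih fun l hl => h (i :: l) (Wd_cons hi hl)
    have h3 := Lb.add h1 (Lb.sum A h2)
    refine h3.le ?_
    have : (A.card : ℝ) ≤ 5 := by exact_mod_cast A.card_le_univ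
    have := mul_le_mul_of_nonneg_right this (h1.2.1)
    rw [pow_succ]; linarith

/-- energy densities -/
def dn (s : ℝ) (u : Pt → ℝ) (p : Pt) : ℝ := |s * (p 0)⁻¹| * dA u p + |ubd 0 u p| + |ubd 1 u p|
def dm (s : ℝ) (u : Pt → ℝ) (p : Pt) : ℝ := dn s u p + |u p|

theorem ubd_eq (a : Fin 2) (u : Pt → ℝ) (p : Pt) : ubd a u p = (p a.succ / p 0) * pd 0 u p + pd a.succ u p := rfl

theorem Sn_ubd (a : Fin 2) : Sn (fun u p => |ubd a u p|) where
  nn u p := abs_nonneg _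
  add u v p hu hv := by
    simp only [ubd_eq, pd_add hu hv]
    refine le_trans (le_of_eq ?_) (abs_add_le _ _); congr 1; ring
  smul u p c hu := by simp only [ubd_eq, pd_cmul hu]; rw [← abs_mul]; congr 1; ring

theorem Sn_dn (s) : Sn (dn s) where
  nn u p := by unfold dn; have := Sn_dA.nn u p; positivity
  add u v p hu hv := by
    have h1 := mul_le_mul_of_nonneg_left (Sn_dA.add u v p hu hv) (abs_nonneg (s * (p 0)⁻¹))
    have h2 := (Sn_ubd 0).add u v p hu hv
    have h3 := (Sn_ubd 1).add u v p hu hv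
    unfold dn; linarith
  smul u p c hu := by
    have h1 := Sn_dA.smul u p c hu
    have h2 := (Sn_ubd 0).smul u p c hu
    have h3 := (Sn_ubd 1).smul u p c hu
    unfold dn; rw [h1, h2, h3]; ring

theorem Sn_dm (s) : Sn (dm s) where
  nn u p := add_nonneg ((Sn_dn s).nn u p) (abs_nonneg _)
  add u v p hu hv := by
    have h1 := (Sn_dn s).add u v p hu hv
    have h2 := Sn_aN.add u v p hu hv
    unfold dm; unfold aN at h2; linarith
  smul u p c hu := by
    have h1 := (Sn_dn s).smul u p c hu
    have h2 := Sn_aN.smul u p c hu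
    unfold dm; unfold aN at h2; rw [h1, h2]; ring

theorem hyp_ne {s : ℝ} (hs : 0 < s) (x) : hyp s x 0 ≠ 0 := (hyp_pos hs x).ne'

theorem CC.mul' {R f g} (h : CC R f) (hg : Continuous g) : CC R (fun x => f x * g x) :=
  ⟨h.1.mul hg, fun x hx => by simp [h.2 x hx]⟩

theorem ubd_cc {s : ℝ} (hs : 0 < s) (a : Fin 2) {u : Pt → ℝ} (hu : Sm u) (su : Sup u) : CC (s^2+3) fun x => ubd a u (hyp s x) := by
  have := (CCh (smBoost hu a) (by
    have : Sup (dd (if a = 0 then 3 else 4) u) := su.dd _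
    fin_cases a <;> exact this : Sup (boost a u)) s).mul' (inv_t_cont hs)
  simpa only [ubd_boost (hyp_ne hs _), div_eq_mul_inv] using this

theorem dA_cc {s : ℝ} {u : Pt → ℝ} (hu : Sm u) (su : Sup u) : CC (s^2+3) fun x => dA u (hyp s x) :=
  (((CCh (smPd hu 0) (su.pd 0) s).abs).add ((CCh (smPd hu 1) (su.pd 1) s).abs)).add ((CCh (smPd hu 2) (su.pd 2) s).abs)

theorem dn_cc {s : ℝ} (hs : 0 < s) {u : Pt → ℝ} (hu : Sm u) (su : Sup u) : CC (s^2+3) fun x => dn s u (hyp s x) := by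
  have h := (((dA_cc (s := s) hu su).mul' ((inv_t_cont hs).const_mul s).abs).add (ubd_cc hs 0 hu su).abs).add (ubd_cc hs 1 hu su).abs
  unfold dn; simpa only [mul_comm] using h

theorem dm_cc {s : ℝ} (hs : 0 < s) {u : Pt → ℝ} (hu : Sm u) (su : Sup u) : CC (s^2+3) fun x => dm s u (hyp s x) :=
  (dn_cc hs hu su).add (aN_cc s hu su)

theorem hyp_le {s : ℝ} (hs : 0 < s) (x) : s ≤ hyp s x 0 := by
  have := hyp_sq s x; have := hyp_pos hs x
  by_contra h; push Not at h; nlinarith [sq_nonneg (x 0), sq_nonneg (x 1)]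

theorem x_le_t {s : ℝ} (hs : 0 < s) (x) : |hyp s x 1| ≤ hyp s x 0 ∧ |hyp s x 2| ≤ hyp s x 0 := by
  have := hyp_sq s x; have h := hyp_pos hs x
  rw [hyp1, hyp2]
  constructor <;> apply abs_le_of_sq_le_sq _ h.le <;> nlinarith [sq_nonneg (x 0), sq_nonneg (x 1)]

theorem dn_sq_le {s : ℝ} (hs : 0 < s) (u : Pt → ℝ) (x) : dn s u (hyp s x) ^ 2 ≤ 100 * eD 0 s u (hyp s x) := by
  unfold dn eD dA
  have ht := hyp_pos hs x
  have hst := hyp_le hs x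
  obtain ⟨x1, x2⟩ := x_le_t hs x
  have c1 : 0 < s * (hyp s x 0)⁻¹ := by positivity
  have c2 : s * (hyp s x 0)⁻¹ ≤ 1 := by rw [← div_eq_mul_inv, div_le_one ht]; exact hst
  rw [abs_of_pos c1]
  have k : ∀ a : Fin 2, |hyp s x a.succ| ≤ hyp s x 0 → s * (hyp s x 0)⁻¹ * |pd a.succ u (hyp s x)| ≤ |ubd a u (hyp s x)| + s * (hyp s x 0)⁻¹ * |pd 0 u (hyp s x)| := by
    intro a ha
    have e : pd a.succ u (hyp s x) = ubd a u (hyp s x) - hyp s x a.succ / hyp s x 0 * pd 0 u (hyp s x) := by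
      rw [ubd_eq]; ring
    have h1 : |hyp s x a.succ / hyp s x 0 * pd 0 u (hyp s x)| ≤ 1 * |pd 0 u (hyp s x)| := by
      refine abs_mul_le ?_ le_rfl
      rw [abs_div, abs_of_pos ht, div_le_one ht]; exact ha
    have h2 : |pd a.succ u (hyp s x)| ≤ |ubd a u (hyp s x)| + |pd 0 u (hyp s x)| := by
      rw [e]; exact (abs_sub _ _).trans (by linarith)
    have := mul_le_mul_of_nonneg_left h2 c1.le
    have : s * (hyp s x 0)⁻¹ * |ubd a u (hyp s x)| ≤ |ubd a u (hyp s x)| := mul_le_of_le_one_left (abs_nonneg _) c2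
    nlinarith
  have k0 := k 0 x1
  have k1 := k 1 x2
  have e0 : (s / hyp s x 0 * pd 0 u (hyp s x))^2 = (s * (hyp s x 0)⁻¹ * |pd 0 u (hyp s x)|)^2 := by
    rw [mul_pow _ (|_|), sq_abs, ← mul_pow, div_eq_mul_inv]
  rw [e0, ← sq_abs (ubd 0 u _), ← sq_abs (ubd 1 u _)]
  have hA : 0 ≤ s * (hyp s x 0)⁻¹ * |pd 0 u (hyp s x)| := by positivity
  have hB := abs_nonneg (ubd 0 u (hyp s x))
  have hC := abs_nonneg (ubd 1 u (hyp s x))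
  have hD : 0 ≤ s * (hyp s x 0)⁻¹ * |pd 1 u (hyp s x)| := by positivity
  have hE : 0 ≤ s * (hyp s x 0)⁻¹ * |pd 2 u (hyp s x)| := by positivity
  rw [mul_add, mul_add]
  change s * (hyp s x 0)⁻¹ * |pd 1 u (hyp s x)| ≤ _ at k0
  change s * (hyp s x 0)⁻¹ * |pd 2 u (hyp s x)| ≤ _ at k1
  generalize s * (hyp s x 0)⁻¹ * |pd 0 u (hyp s x)| = a at *
  generalize |ubd 0 u (hyp s x)| = b at *
  generalize |ubd 1 u (hyp s x)| = c at *
  generalize s * (hyp s x 0)⁻¹ * |pd 1 u (hyp s x)| = d at *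
  generalize s * (hyp s x 0)⁻¹ * |pd 2 u (hyp s x)| = e at *
  calc (a + d + e + b + c)^2 ≤ (3 * a + 2 * b + 2 * c)^2 := pow_le_pow_left₀ (by positivity) (by linarith) 2
    _ ≤ _ := by nlinarith [sq_nonneg (a-b), sq_nonneg (a-c), sq_nonneg (b-c), sq_nonneg a, sq_nonneg b, sq_nonneg c]

theorem LH_dn {s : ℝ} (hs : 0 < s) {u : Pt → ℝ} (hu : Sm u) (su : Sup u) {K : ℝ} (h : Real.sqrt (Em 0 s u) ≤ K) : LH s (10 * K) (dn s u) := by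
  have hK : 0 ≤ K := (Real.sqrt_nonneg _).trans h
  refine ⟨dn_cc hs hu su, by linarith, ?_⟩
  refine (integral_mono (dn_cc hs hu su).sq.int ((eD_cc 0 hs hu su).int.const_mul 100) fun x => dn_sq_le hs u x).trans ?_
  rw [integral_const_mul]
  have := (Real.sqrt_le_left hK).1 h
  have e : ∫ x, eD 0 s u (hyp s x) = Em 0 s u := rfl
  rw [e]; linarith

theorem LH_dm {s : ℝ} (hs : 0 < s) {u : Pt → ℝ} (hu : Sm u) (su : Sup u) {K : ℝ} (h : Real.sqrt (Em 1 s u) ≤ K) : LH s (11 * K) (dm s u) := by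
  have hK : 0 ≤ K := (Real.sqrt_nonneg _).trans h
  have h2 := (Real.sqrt_le_left hK).1 h
  have i0 := (eD_cc 0 hs hu su).int
  have iu := (CCh hu su s).sq.int
  have e : Em 1 s u = Em 0 s u + ∫ x, u (hyp s x) ^ 2 := by
    unfold Em; rw [← integral_add i0 iu]; congr 1; ext x; unfold eD; ring
  have n0 := Em_nn le_rfl s u (m := 0)
  have n1 : 0 ≤ ∫ x, u (hyp s x) ^ 2 := integral_nonneg fun _ => sq_nonneg _
  have a := LH_dn hs hu su (K := K) ((Real.sqrt_le_left hK).2 (by linarith))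
  have b : LH s K (aN u) := ⟨aN_cc s hu su, hK, by simp only [aN, sq_abs]; linarith⟩
  exact (Lb.add a b).le (by linarith)

/-- on the support, `t ≤ s²` -/
theorem supp_t {s : ℝ} (hs : 0 < s) {x : X2} (hx : rad (hyp s x) ≤ hyp s x 0 - 1) : hyp s x 0 ≤ s^2 ∧ 2 * hyp s x 0 - 1 ≤ s^2 := by
  have h1 := hyp_sq s x
  have h2 := rad_sq (hyp s x)
  rw [hyp1, hyp2] at h2
  have := rad_nn (hyp s x)
  have : 1 ≤ hyp s x 0 := by linarith
  have : rad (hyp s x)^2 ≤ (hyp s x 0 - 1)^2 := by gcongr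
  constructor <;> nlinarith

theorem Sup.hyp0 {u : Pt → ℝ} (su : Sup u) {s : ℝ} (hs : 2 ≤ s) {x : X2} (hx : ¬ rad (hyp s x) ≤ hyp s x 0 - 1) : u (hyp s x) = 0 := by
  have h := hyp_le (by linarith) x (s := s)
  apply su; rw [abs_of_nonneg (by linarith)]; linarith

theorem sob_Lb {u : Pt → ℝ} (hu : Sm u) (su : Sup u) {s : ℝ} (hs : 0 < s) {K : ℝ} {f : Pt → ℝ} (h : LH s K f)
    (hf : ∀ y, (hyp s y 0)⁻¹ * nmF Z5 aN 2 u (hyp s y) ≤ |f (hyp s y)|) (x : X2) : |u (hyp s x)| ≤ 3 * K := by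
  have c : CC (s^2+3) fun y => (hyp s y 0)⁻¹ * nmF Z5 aN 2 u (hyp s y) :=
    (nmF_ccont (fun v hv sv => aN_cc s hv sv) hu su).mul (inv_t_cont hs)
  have g := (Lb.mono h c fun y => by
    rw [abs_of_nonneg (mul_nonneg (inv_nonneg.2 (hyp_pos hs y).le) (nmF_nn Sn_aN _ _ _))]; exact hf y).2.2
  have := sob_h hu su hs x
  apply abs_le_of_sq_le_sq _ (by linarith [h.2.1])
  rw [mul_pow]; nlinarith

/-- generic closed class of coordinate functions -/
def Gd (f : Pt → ℝ) : Prop := f = (fun _ => 0) ∨ f = (fun _ => 1) ∨ ∃ i : Fin 3, f = fun p => p i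

theorem Gd.dd {f : Pt → ℝ} (h : Gd f) (i : Fin 5) : Gd (dd i f) := by
  rcases h with rfl | rfl | ⟨j, rfl⟩
  · left; fin_cases i <;> ext p <;> simp [_root_.dd, boost, pd_const]
  · left; fin_cases i <;> ext p <;> simp [_root_.dd, boost, pd_const]
  · fin_cases j <;> fin_cases i
    · right; left; ext p; simp [_root_.dd, pd_coord]
    · left; ext p; simp [_root_.dd, pd_coord]
    · left; ext p; simp [_root_.dd, pd_coord]
    · right; right; refine ⟨1, ?_⟩; ext p; simp [_root_.dd, pd_coord, boost]
    · right; right; refine ⟨2, ?_⟩; ext p; simp [_root_.dd, pd_coord, boost]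
    · left; ext p; simp [_root_.dd, pd_coord]
    · right; left; ext p; simp [_root_.dd, pd_coord]
    · left; ext p; simp [_root_.dd, pd_coord]
    · right; right; refine ⟨0, ?_⟩; ext p; simp [_root_.dd, pd_coord, boost]
    · left; ext p; simp [_root_.dd, pd_coord, boost]
    · left; ext p; simp [_root_.dd, pd_coord]
    · left; ext p; simp [_root_.dd, pd_coord]
    · right; left; ext p; simp [_root_.dd, pd_coord]
    · left; ext p; simp [_root_.dd, pd_coord, boost]
    · right; right; refine ⟨0, ?_⟩; ext p; simp [_root_.dd, pd_coord, boost]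

theorem Gd.Dw {f : Pt → ℝ} (h : Gd f) (l : List (Fin 5)) : Gd (Dw l f) := by
  induction l generalizing f with
  | nil => exact h
  | cons i l ih => exact ih (h.dd i)

theorem Gd.le {f : Pt → ℝ} (h : Gd f) {p : Pt} (h0 : 1 ≤ p 0) (h1 : |p 1| ≤ p 0) (h2 : |p 2| ≤ p 0) : |f p| ≤ p 0 := by
  rcases h with rfl | rfl | ⟨j, rfl⟩
  · simp; linarith
  · simpa using h0
  · fin_cases j
    · simp [abs_of_nonneg (by linarith : 0 ≤ p 0)]
    · exact h1
    · exact h2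

theorem nm_t {A k} {p : Pt} (h0 : 1 ≤ p 0) (h1 : |p 1| ≤ p 0) (h2 : |p 2| ≤ p 0) (j : Fin 3) :
    nmF A aN k (fun p => p j) p ≤ 6^k * p 0 :=
  nmF_le (by linarith) fun l _ => (Gd.Dw (Or.inr (Or.inr ⟨j, rfl⟩)) l).le h0 h1 h2

theorem nm_t_mul {A k} {u : Pt → ℝ} (hu : Sm u) {p : Pt} (h0 : 1 ≤ p 0) (h1 : |p 1| ≤ p 0) (h2 : |p 2| ≤ p 0) (j : Fin 3) :
    nmF A aN k (fun p => p j * u p) p ≤ 12^k * (6^k * p 0 * nmF A aN k u p) := by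
  refine nm_mul (by fun_prop) hu fun i i' hi => ?_
  have := nmF_nn (A := A) Sn_aN i (fun p => p j) p
  refine mul_le_mul ((nmF_mono Sn_aN (by omega) _ _).trans (nm_t h0 h1 h2 j)) (nmF_mono Sn_aN (by omega) _ _) (nmF_nn Sn_aN _ _ _) (by positivity)

theorem hyp_tx {s : ℝ} (hs : 2 ≤ s) (x) : 1 ≤ hyp s x 0 ∧ |hyp s x 1| ≤ hyp s x 0 ∧ |hyp s x 2| ≤ hyp s x 0 :=
  ⟨by linarith [hyp_le (by linarith : 0 < s) x], x_le_t (by linarith) x⟩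

theorem dA_le_dn {s : ℝ} (hs : 0 < s) (u : Pt → ℝ) (x) : dA u (hyp s x) ≤ (hyp s x 0 / s) * dn s u (hyp s x) := by
  have ht := hyp_pos hs x
  unfold dn
  rw [abs_of_pos (by positivity)]
  have e : hyp s x 0 / s * (s * (hyp s x 0)⁻¹ * dA u (hyp s x)) = dA u (hyp s x) := by field_simp
  have := abs_nonneg (ubd 0 u (hyp s x))
  have := abs_nonneg (ubd 1 u (hyp s x))
  have : 0 ≤ hyp s x 0 / s * (|ubd 0 u (hyp s x)| + |ubd 1 u (hyp s x)|) := by positivity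
  calc _ = hyp s x 0 / s * (s * (hyp s x 0)⁻¹ * dA u (hyp s x)) := e.symm
    _ ≤ _ := by rw [add_assoc, mul_add (hyp s x 0 / s)]; linarith

theorem nm_dA_dn {A k} {s : ℝ} (hs : 0 < s) (u : Pt → ℝ) (x) : nmF A dA k u (hyp s x) ≤ (hyp s x 0 / s) * nmF A (dn s) k u (hyp s x) :=
  nmF_congr_le _ (fun l => dA_le_dn hs _ x) k

theorem nm_dn_dm {A k} {s : ℝ} (u : Pt → ℝ) (p) : nmF A (dn s) k u p ≤ nmF A (dm s) k u p := by
  simpa using nmF_congr_le (A := A) (N := dn s) (N' := dm s) (u := u) (p := p) 1 (fun l => by unfold dm; simp) k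

theorem nm_aN_dm {A k} {s : ℝ} (u : Pt → ℝ) (p) : nmF A aN k u p ≤ nmF A (dm s) k u p := by
  simpa using nmF_congr_le (A := A) (N := aN) (N' := dm s) (u := u) (p := p) 1 (fun l => by
    unfold dm aN; simp [(Sn_dn s).nn]) k

theorem Wd_length {A k l} (h : l ∈ Wd A k) : l.length ≤ k := h.1

theorem LH.cmul {s K f} (h : LH s K f) {c : ℝ} (hc : 0 ≤ c) : LH s (c * K) (fun p => c * f p) := Lb.cmul h hc
theorem LH.add {s K K' f g} (h : LH s K f) (h' : LH s K' g) : LH s (K + K') (fun p => f p + g p) := Lb.add h h'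
theorem LH.le {s K K' f} (h : LH s K f) (h' : K ≤ K') : LH s K' f := Lb.le h h'
theorem LH.mono {s K f g} (h : LH s K f) (hg : CC (s^2+3) fun x => g (hyp s x)) (hl : ∀ x, |g (hyp s x)| ≤ |f (hyp s x)|) : LH s K g := Lb.mono h hg hl

theorem pt_dA (k : ℕ) : ∃ C, 0 ≤ C ∧ ∀ {s K : ℝ} {u : Pt → ℝ}, 2 ≤ s → Sm u → Sup u → LH s K (nmF Z5 (dn s) (k+2) u) →
    ∀ x, nmF Z5 dA k u (hyp s x) ≤ C * (K / s) := by
  refine ⟨6^k * (9 * 16^2), by positivity, fun {s K u} hs hu su h x => ?_⟩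
  have hs0 : 0 < s := by linarith
  have hK := h.2.1
  rw [mul_assoc]
  refine nmF_le (by positivity) fun l hl => ?_
  have key : ∀ α, |pd α (Dw l u) (hyp s x)| ≤ 3 * (16^2 * s⁻¹ * K) := by
    intro α
    refine sob_Lb (by fun_prop) ((su.Dw l).pd α) hs0 (f := fun p => 16^2 * s⁻¹ * nmF Z5 (dn s) (k+2) u p) (LH.cmul h (by positivity)) (fun y => ?_) x
    have hy := hyp_pos hs0 y
    have h1 := nm_pd_le (A := Z5) (smDw hu l) α 2 (hyp s y)
    have h2 := nmF_Dw' (A := Z5) (k := 2) (p := hyp s y) (u := u) (Sn_dn s) hl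
    have h3 := nm_dA_dn (A := Z5) (k := 2) hs0 (Dw l u) y
    rw [add_comm k 2, abs_of_nonneg (mul_nonneg (by positivity) (nmF_nn (Sn_dn s) _ _ _))]
    calc (hyp s y 0)⁻¹ * nmF Z5 aN 2 (pd α (Dw l u)) (hyp s y) ≤ (hyp s y 0)⁻¹ * (16^2 * (hyp s y 0 / s * nmF Z5 (dn s) (2+k) u (hyp s y))) := by
          refine mul_le_mul_of_nonneg_left (h1.trans (mul_le_mul_of_nonneg_left (h3.trans (mul_le_mul_of_nonneg_left h2 (by positivity))) (by positivity))) (by positivity)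
      _ = _ := by field_simp
  unfold dA
  have := key 0; have := key 1; have := key 2
  have e : 9 * 16^2 * (K / s) = 3 * (3 * (16^2 * s⁻¹ * K)) := by field_simp; ring
  rw [e]; linarith

theorem pt_V (k : ℕ) : ∃ C, 0 ≤ C ∧ ∀ {s K : ℝ} {u : Pt → ℝ}, 2 ≤ s → Sm u → Sup u → LH s K (nmF Z5 (dm s) (k+2) u) →
    ∀ x, nmF Z5 aN k u (hyp s x) ≤ C * (K / hyp s x 0) := by
  refine ⟨6^k * (3 * (12^2*6^2)), by positivity, fun {s K u} hs hu su h x => ?_⟩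
  have hs0 : 0 < s := by linarith
  have hK := h.2.1
  have hx := hyp_pos hs0 x
  rw [mul_assoc]
  refine nmF_le (by positivity) fun l hl => ?_
  have key : |hyp s x 0 * Dw l u (hyp s x)| ≤ 3 * (12^2 * 6^2 * K) := by
    refine sob_Lb (u := fun p => p 0 * Dw l u p) (by fun_prop) ?_ hs0 (f := fun p => 12^2 * 6^2 * nmF Z5 (dm s) (k+2) u p) (LH.cmul h (by positivity)) (fun y => ?_) x
    · intro p hp; simp [su.Dw l p hp]
    have hy := hyp_pos hs0 y
    obtain ⟨a, b, c⟩ := hyp_tx hs y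
    have h1 := nm_t_mul (A := Z5) (k := 2) (smDw hu l) a b c 0
    have h2 := nmF_Dw' (A := Z5) (k := 2) (p := hyp s y) (u := u) (Sn_dm s) hl
    have h3 := nm_aN_dm (A := Z5) (k := 2) (s := s) (Dw l u) (hyp s y)
    rw [add_comm k 2, abs_of_nonneg (mul_nonneg (by positivity) (nmF_nn (Sn_dm s) _ _ _))]
    calc _ ≤ (hyp s y 0)⁻¹ * (12^2 * (6^2 * hyp s y 0 * nmF Z5 (dm s) (2+k) u (hyp s y))) := by
          refine mul_le_mul_of_nonneg_left (h1.trans (mul_le_mul_of_nonneg_left (mul_le_mul_of_nonneg_left (h3.trans h2) (by positivity)) (by positivity))) (by positivity)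
      _ = _ := by field_simp
  rw [abs_mul, abs_of_pos hx] at key
  rw [← mul_div_assoc, le_div_iff₀ hx]
  unfold aN; linarith

structure BW (η : ℝ) (w : Pt → ℝ) : Prop where
  sm : Sm w
  sup : Sup w
  w1 : ∀ s, 2 ≤ s → LH s (η * yy s) (nmF Z5 (dn s) 6 w)
  w1' : ∀ s, 2 ≤ s → ∀ α, LH s (η * yy s) (nmF Z5 (dn s) 6 (pd α w))
  w2 : ∀ s, 2 ≤ s → ∀ x, nmF Z5 dA 1 w (hyp s x) ≤ η / s
  w3 : ∀ s, 2 ≤ s → ∀ x, |w (hyp s x)| ≤ η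

structure BV (η : ℝ) (V : Pt → ℝ) : Prop where
  sm : Sm V
  sup : Sup V
  v1 : ∀ s, 2 ≤ s → LH s (η * yy s) (nmF Z5 (dm s) 6 V)
  v2 : ∀ s, 2 ≤ s → LH s η (nmF Z5 (dm s) 5 V)

def dW (s : ℝ) (w : Pt → ℝ) (p : Pt) : ℝ :=
  nmF Z5 (dn s) 6 w p + (nmF Z5 (dn s) 6 (pd 0 w) p + nmF Z5 (dn s) 6 (pd 1 w) p + nmF Z5 (dn s) 6 (pd 2 w) p)

theorem dW_nn (s w p) : 0 ≤ dW s w p := by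
  have h := fun u => nmF_nn (A := Z5) (Sn_dn s) 6 u p
  unfold dW; linarith [h w, h (pd 0 w), h (pd 1 w), h (pd 2 w)]

theorem dW_ge (s w p) : nmF Z5 (dn s) 6 w p ≤ dW s w p := by
  have h := fun u => nmF_nn (A := Z5) (Sn_dn s) 6 u p
  unfold dW; linarith [h w, h (pd 0 w), h (pd 1 w), h (pd 2 w)]

theorem dW_ge' (s w p) (α : Fin 3) : nmF Z5 (dn s) 6 (pd α w) p ≤ dW s w p := by
  have h := fun u => nmF_nn (A := Z5) (Sn_dn s) 6 u p
  unfold dW; fin_cases α <;> simp <;> linarith [h w, h (pd 0 w), h (pd 1 w), h (pd 2 w)]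

theorem BW.dW {η w} (h : BW η w) {s : ℝ} (hs : 2 ≤ s) : LH s (4 * (η * yy s)) (dW s w) :=
  (Lb.add (h.w1 s hs) (Lb.add (Lb.add (h.w1' s hs 0) (h.w1' s hs 1)) (h.w1' s hs 2))).le (by linarith)

theorem BW.nn {η w} (h : BW η w) : 0 ≤ η := by
  have := (h.w1 2 le_rfl).2.1
  by_contra hc; push Not at hc; nlinarith [yy_one (by norm_num : (1:ℝ) ≤ 2)]

/-- second order derivatives -/
def d2A (u : Pt → ℝ) (p : Pt) : ℝ := dA (pd 0 u) p + dA (pd 1 u) p + dA (pd 2 u) p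

theorem BW.a4 : ∃ C, 1 ≤ C ∧ ∀ {η w}, BW η w → ∀ {s}, 2 ≤ s → ∀ x,
    nmF Z5 dA 4 w (hyp s x) ≤ C * (η * yy s / s) ∧ ∀ α, nmF Z5 dA 4 (pd α w) (hyp s x) ≤ C * (η * yy s / s) := by
  obtain ⟨C, hC, H⟩ := pt_dA 4
  refine ⟨C + 1, by linarith, fun {η w} h {s} hs x => ?_⟩
  have : 0 ≤ η * yy s / s := div_nonneg (h.w1 s hs).2.1 (by linarith)
  exact ⟨(H hs h.sm h.sup (h.w1 s hs) x).trans (by nlinarith), fun α => (H hs (smPd h.sm α) (h.sup.pd α) (h.w1' s hs α) x).trans (by nlinarith)⟩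

/-- the quadratic form -/
def Qf (P : Fin 3 → Fin 3 → ℝ) (w : Pt → ℝ) (p : Pt) : ℝ := ∑ α : Fin 3, ∑ β : Fin 3, P α β * pd α w p * pd β w p

def sP (P : Fin 3 → Fin 3 → ℝ) : ℝ := ∑ α : Fin 3, ∑ β : Fin 3, |P α β|
theorem sP_nn (P) : 0 ≤ sP P := Finset.sum_nonneg fun _ _ => Finset.sum_nonneg fun _ _ => abs_nonneg _

theorem sm_sum {ι : Type*} (A : Finset ι) {f : ι → Pt → ℝ} (h : ∀ i ∈ A, Sm (f i)) : Sm (fun p => ∑ i ∈ A, f i p) :=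
  ContDiff.sum h

theorem nmF_sum {A N} (hN : Sn N) {ι : Type*} (B : Finset ι) {f : ι → Pt → ℝ} (h : ∀ i, Sm (f i)) (k p) :
    nmF A N k (fun q => ∑ i ∈ B, f i q) p ≤ ∑ i ∈ B, nmF A N k (f i) p := by
  classical
  induction B using Finset.induction_on with
  | empty =>
    have := nmF_cmul (A := A) hN (u := fun _ => 0) contDiff_const 0 k p
    simp at this; simp [this]
  | insert a B ha ih =>
    simp only [Finset.sum_insert ha]
    exact (nmF_add hN (h a) (sm_sum B fun i _ => h i) k p).trans (by linarith)

theorem smQf {P w} (hw : Sm w) : Sm (Qf P w) := by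
  unfold Qf; exact sm_sum _ fun α _ => sm_sum _ fun β _ => by fun_prop

theorem supQf {P w} (hw : Sup w) : Sup (Qf P w) := by
  intro p hp; unfold Qf; exact Finset.sum_eq_zero fun α _ => Finset.sum_eq_zero fun β _ => by rw [hw.pd α p hp]; ring

theorem Qsum {A N} (hN : Sn N) {P : Fin 3 → Fin 3 → ℝ} {f : Fin 3 → Fin 3 → Pt → ℝ} (hf : ∀ α β, Sm (f α β)) {k p K}
    (h : ∀ α β, nmF A N k (f α β) p ≤ K) : nmF A N k (fun q => ∑ α : Fin 3, ∑ β : Fin 3, P α β * f α β q) p ≤ sP P * K := by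
  refine (nmF_sum hN _ (fun α => sm_sum _ fun β _ => by have := hf α β; fun_prop) k p).trans ?_
  unfold sP; rw [Finset.sum_mul]
  refine Finset.sum_le_sum fun α _ => ?_
  refine (nmF_sum hN _ (fun β => by have := hf α β; fun_prop) k p).trans ?_
  rw [Finset.sum_mul]
  refine Finset.sum_le_sum fun β _ => ?_
  rw [nmF_cmul hN (hf α β)]
  exact mul_le_mul_of_nonneg_left (h α β) (abs_nonneg _)

theorem Qf_eq (P w) : Qf P w = fun q => ∑ α : Fin 3, ∑ β : Fin 3, P α β * (pd α w q * pd β w q) := by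
  ext q; unfold Qf; simp only [mul_assoc]

theorem Q_nm {P : Fin 3 → Fin 3 → ℝ} {w : Pt → ℝ} (hw : Sm w) (A : Finset (Fin 5)) (k j : ℕ) (hj : k ≤ 2 * j + 1) (p) :
    nmF A aN k (Qf P w) p ≤ sP P * (12^k * (16^k * 16^k)) * (nmF A dA j w p * nmF A dA k w p) := by
  have n := fun i => nmF_nn (A := A) Sn_dA i w p
  rw [Qf_eq, mul_assoc]
  refine Qsum Sn_aN (fun α β => by fun_prop) fun α β => ?_
  rw [mul_assoc]
  refine nm_mul (by fun_prop) (by fun_prop) fun i i' hi => ?_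
  have h1 : nmF A aN i (pd α w) p ≤ 16^k * nmF A dA i w p := (nm_pd_le hw α i p).trans (mul_le_mul_of_nonneg_right (pow_le_pow_right₀ (by norm_num) (by omega)) (n i))
  have h2 : nmF A aN i' (pd β w) p ≤ 16^k * nmF A dA i' w p := (nm_pd_le hw β i' p).trans (mul_le_mul_of_nonneg_right (pow_le_pow_right₀ (by norm_num) (by omega)) (n i'))
  refine (mul_le_mul h1 h2 (nmF_nn Sn_aN _ _ _) (mul_nonneg (by positivity) (n i))).trans ?_
  rw [mul_mul_mul_comm]
  refine mul_le_mul_of_nonneg_left ?_ (by positivity)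
  rcases le_total i i' with h | h
  · exact mul_le_mul (nmF_mono Sn_dA (by omega) _ _) (nmF_mono Sn_dA (by omega) _ _) (n _) (n _)
  · rw [mul_comm]; exact mul_le_mul (nmF_mono Sn_dA (by omega) _ _) (nmF_mono Sn_dA (by omega) _ _) (n _) (n _)

theorem pd_Qf {P w} (hw : Sm w) (γ : Fin 3) : pd γ (Qf P w) = fun q => ∑ α : Fin 3, ∑ β : Fin 3, P α β * (pd α (pd γ w) q * pd β w q + pd α w q * pd β (pd γ w) q) := by
  rw [Qf_eq]
  simp only [Fin.sum_univ_three]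
  simp (disch := fun_prop) only [pd_add, pd_cmul, pd_mul]
  rw [pd_comm hw γ 0, pd_comm hw γ 1, pd_comm hw γ 2]

theorem dQ_nm {P : Fin 3 → Fin 3 → ℝ} {w : Pt → ℝ} (hw : Sm w) (A : Finset (Fin 5)) (k j : ℕ) (hj : k ≤ 2 * j + 1) (p) (γ : Fin 3) :
    nmF A aN k (pd γ (Qf P w)) p ≤ sP P * (2 * (12^k * (16^k * 16^k))) * (nmF A dA j w p * nmF A dA k (pd γ w) p + nmF A dA k w p * nmF A dA j (pd γ w) p) := by
  have n := fun i u => nmF_nn (A := A) Sn_dA i u p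
  rw [pd_Qf hw, mul_assoc]
  refine Qsum Sn_aN (fun α β => by fun_prop) fun α β => ?_
  have key : ∀ α β, nmF A aN k (fun q => pd α (pd γ w) q * pd β w q) p ≤ 12^k * (16^k * 16^k * (nmF A dA j w p * nmF A dA k (pd γ w) p + nmF A dA k w p * nmF A dA j (pd γ w) p)) := by
    intro α β
    refine nm_mul (by fun_prop) (by fun_prop) fun i i' hi => ?_
    have h1 : nmF A aN i (pd α (pd γ w)) p ≤ 16^k * nmF A dA i (pd γ w) p := (nm_pd_le (smPd hw γ) α i p).trans (mul_le_mul_of_nonneg_right (pow_le_pow_right₀ (by norm_num) (by omega)) (n _ _))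
    have h2 : nmF A aN i' (pd β w) p ≤ 16^k * nmF A dA i' w p := (nm_pd_le hw β i' p).trans (mul_le_mul_of_nonneg_right (pow_le_pow_right₀ (by norm_num) (by omega)) (n _ _))
    refine (mul_le_mul h1 h2 (nmF_nn Sn_aN _ _ _) (mul_nonneg (by positivity) (n _ _))).trans ?_
    rw [mul_mul_mul_comm]
    refine mul_le_mul_of_nonneg_left ?_ (by positivity)
    have p1 := mul_nonneg (n j w) (n k (pd γ w))
    have p2 := mul_nonneg (n k w) (n j (pd γ w))
    rcases le_total i i' with h | h
    · rw [mul_comm]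
      have := mul_le_mul (nmF_mono (A := A) Sn_dA (by omega : i' ≤ k) w p) (nmF_mono (A := A) Sn_dA (by omega : i ≤ j) (pd γ w) p) (n _ _) (n _ _)
      linarith
    · rw [mul_comm]
      have := mul_le_mul (nmF_mono (A := A) Sn_dA (by omega : i' ≤ j) w p) (nmF_mono (A := A) Sn_dA (by omega : i ≤ k) (pd γ w) p) (n _ _) (n _ _)
      linarith
  have c : (fun q => pd α w q * pd β (pd γ w) q) = fun q => pd β (pd γ w) q * pd α w q := by ext q; ring
  have a1 := key α β
  have a2 := key β α
  rw [← c] at a2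
  refine (nmF_add Sn_aN (by fun_prop) (by fun_prop) k p).trans ?_
  linarith

theorem nmF0 {A k s} (hs : 2 ≤ s) {u : Pt → ℝ} (su : Sup u) {x : X2} (hx : ¬ rad (hyp s x) ≤ hyp s x 0 - 1) : nmF A aN k u (hyp s x) = 0 := by
  refine le_antisymm ?_ (nmF_nn Sn_aN _ _ _)
  have := nmF_le (A := A) (N := aN) (k := k) (u := u) (p := hyp s x) (K := 0) le_rfl fun l _ => by simp [aN, (su.Dw l).hyp0 hs hx]
  simpa using this

theorem nmA_cc {A k s} {u : Pt → ℝ} (hu : Sm u) (su : Sup u) : CC (s^2+3) fun x => nmF A aN k u (hyp s x) :=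
  nmF_ccont (fun _ hv sv => aN_cc s hv sv) hu su

theorem Q_nm6 (P : Fin 3 → Fin 3 → ℝ) : ∃ c, 1 ≤ c ∧ ∀ {w : Pt → ℝ}, Sm w → ∀ k j, k ≤ 6 → k ≤ 2*j+1 → ∀ p,
    nmF Z5 aN k (Qf P w) p ≤ c * (nmF Z5 dA j w p * nmF Z5 dA k w p) ∧
    ∀ γ, nmF Z5 aN k (pd γ (Qf P w)) p ≤ c * (nmF Z5 dA j w p * nmF Z5 dA k (pd γ w) p + nmF Z5 dA k w p * nmF Z5 dA j (pd γ w) p) := by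
  refine ⟨sP P * (2 * (12^6 * (16^6 * 16^6))) + 1, by have := sP_nn P; nlinarith, fun {w} hw k j hk hj p => ?_⟩
  have n := fun i u => nmF_nn (A := Z5) Sn_dA i u p
  have hP := sP_nn P
  have e : ((12:ℝ)^k * (16^k * 16^k)) ≤ 12^6 * (16^6 * 16^6) := by gcongr <;> norm_num
  have e0 : (0:ℝ) ≤ 12^k * (16^k * 16^k) := by positivity
  constructor
  · refine (Q_nm hw Z5 k j hj p).trans (mul_le_mul_of_nonneg_right ?_ (mul_nonneg (n _ _) (n _ _)))
    nlinarith
  · intro γ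
    refine (dQ_nm hw Z5 k j hj p γ).trans (mul_le_mul_of_nonneg_right ?_ (add_nonneg (mul_nonneg (n _ _) (n _ _)) (mul_nonneg (n _ _) (n _ _))))
    nlinarith

structure Bv (C η : ℝ) (v : Pt → ℝ) : Prop where
  sm : Sm v
  sup : Sup v
  p1 : ∀ s, 2 ≤ s → ∀ x, nmF Z5 aN 1 v (hyp s x) ≤ C * (η / hyp s x 0)
  p3 : ∀ s, 2 ≤ s → ∀ x, nmF Z5 aN 3 v (hyp s x) ≤ C * (η * yy s / hyp s x 0)
  p3' : ∀ s, 2 ≤ s → ∀ x, nmF Z5 aN 3 v (hyp s x) ≤ C * (η / hyp s x 0 + η * yy s / s^2)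
  v1 : ∀ s, 2 ≤ s → ∃ D : Pt → ℝ, LH s (C * (η * yy s)) D ∧ ∀ x, 0 ≤ D (hyp s x) ∧ nmF Z5 aN 6 v (hyp s x) ≤ hyp s x 0 / s * D (hyp s x) ∧
    ∀ α, nmF Z5 aN 6 (pd α v) (hyp s x) ≤ hyp s x 0 / s * D (hyp s x)
  v2 : ∀ s, 2 ≤ s → ∃ D : Pt → ℝ, LH s (C * η) D ∧ ∀ x, 0 ≤ D (hyp s x) ∧ nmF Z5 aN 5 v (hyp s x) ≤ hyp s x 0 / s * D (hyp s x) ∧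
    ∀ α, nmF Z5 aN 5 (pd α v) (hyp s x) ≤ hyp s x 0 / s * D (hyp s x)
  v3 : ∀ s, 2 ≤ s → ∃ D D' : Pt → ℝ, LH s (C * η) D ∧ LH s (C * (η * yy s / s)) D' ∧ ∀ x, 0 ≤ D (hyp s x) ∧ 0 ≤ D' (hyp s x) ∧
    nmF Z5 aN 3 v (hyp s x) ≤ D (hyp s x) + hyp s x 0 / s * D' (hyp s x)

theorem t_s {s : ℝ} (hs : 2 ≤ s) (x) : 1 ≤ hyp s x 0 / s := by
  rw [le_div_iff₀ (by linarith)]; linarith [hyp_le (by linarith : 0 < s) x]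

/-- order-k bound for `V` and its first derivatives -/
theorem V_top {s : ℝ} (hs : 2 ≤ s) {V : Pt → ℝ} (hV : Sm V) (k : ℕ) (hk : k ≤ 6) (x) :
    nmF Z5 aN k V (hyp s x) ≤ hyp s x 0 / s * (16^6 * nmF Z5 (dm s) k V (hyp s x)) ∧
    ∀ α, nmF Z5 aN k (pd α V) (hyp s x) ≤ hyp s x 0 / s * (16^6 * nmF Z5 (dm s) k V (hyp s x)) := by
  have hs0 : 0 < s := by linarith
  have h1 := t_s hs x
  have n := nmF_nn (A := Z5) (Sn_dm s) k V (hyp s x)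
  constructor
  · have := nm_aN_dm (A := Z5) (k := k) (s := s) V (hyp s x)
    nlinarith
  · intro α
    have a := nm_pd_le (A := Z5) hV α k (hyp s x)
    have b := nm_dA_dn (A := Z5) (k := k) hs0 V x
    have c := nm_dn_dm (A := Z5) (k := k) (s := s) V (hyp s x)
    have e : (16:ℝ)^k ≤ 16^6 := by gcongr; norm_num
    have n2 := nmF_nn (A := Z5) Sn_dA k V (hyp s x)
    calc _ ≤ (16:ℝ)^k * nmF Z5 dA k V (hyp s x) := a
      _ ≤ 16^6 * (hyp s x 0 / s * nmF Z5 (dm s) k V (hyp s x)) :=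
        mul_le_mul e (b.trans (mul_le_mul_of_nonneg_left c (by linarith))) n2 (by positivity)
      _ = _ := by ring

theorem Q_top (P : Fin 3 → Fin 3 → ℝ) : ∃ c, 1 ≤ c ∧ ∀ {η w}, BW η w → ∀ {s}, 2 ≤ s → ∀ k ≤ 6, ∀ x,
    nmF Z5 aN k (Qf P w) (hyp s x) ≤ hyp s x 0 / s * (c * (η * yy s / s) * dW s w (hyp s x)) ∧
    ∀ α, nmF Z5 aN k (pd α (Qf P w)) (hyp s x) ≤ hyp s x 0 / s * (c * (η * yy s / s) * dW s w (hyp s x)) := by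
  obtain ⟨c, hc, H⟩ := Q_nm6 P
  obtain ⟨C, hC, H4⟩ := BW.a4
  refine ⟨c * (2 * C), by nlinarith, fun {η w} h {s} hs k hk x => ?_⟩
  have hs0 : 0 < s := by linarith
  obtain ⟨q1, q2⟩ := H h.sm 6 3 le_rfl (by omega) (hyp s x)
  obtain ⟨a1, a2⟩ := H4 h hs x
  have m := fun u => nmF_mono (A := Z5) Sn_dA (by omega : 3 ≤ 4) u (hyp s x)
  have n := fun i u => nmF_nn (A := Z5) Sn_dA i u (hyp s x)
  have d := fun u => nm_dA_dn (A := Z5) (k := 6) hs0 u x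
  have ts := t_s hs x
  have g : ∀ u, nmF Z5 (dn s) 6 u (hyp s x) ≤ dW s w (hyp s x) → nmF Z5 dA 6 u (hyp s x) ≤ hyp s x 0 / s * dW s w (hyp s x) := fun u hu =>
    (d u).trans (mul_le_mul_of_nonneg_left hu (by linarith))
  have e0 : 0 ≤ C * (η * yy s / s) := (n 4 w).trans a1
  have g0 := g w (dW_ge s w _)
  have gα := fun α => g (pd α w) (dW_ge' s w _ α)
  have c0 : 0 ≤ c := by linarith
  constructor
  · refine (nmF_mono Sn_aN hk _ _).trans (q1.trans ?_)
    have := mul_le_mul ((m w).trans a1) g0 (n _ _) e0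
    have z : 0 ≤ C * (η * yy s / s) * (hyp s x 0 / s * dW s w (hyp s x)) := (mul_nonneg (n _ _) (n _ _)).trans this
    calc _ ≤ c * (2 * (C * (η * yy s / s) * (hyp s x 0 / s * dW s w (hyp s x)))) := mul_le_mul_of_nonneg_left (by linarith) c0
      _ = _ := by ring
  · intro α
    refine (nmF_mono Sn_aN hk _ _).trans ((q2 α).trans ?_)
    have t1 := mul_le_mul ((m w).trans a1) (gα α) (n _ _) e0
    have t2 := mul_le_mul ((m (pd α w)).trans (a2 α)) g0 (n _ _) e0
    calc _ ≤ c * (2 * (C * (η * yy s / s) * (hyp s x 0 / s * dW s w (hyp s x)))) := mul_le_mul_of_nonneg_left (by linarith) c0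
      _ = _ := by ring

theorem Bv_of (P : Fin 3 → Fin 3 → ℝ) : ∃ C, 1 ≤ C ∧ ∀ {η w V}, η ≤ 1 → BW η w → BV η V → Bv C η (fun p => V p + Qf P w p) := by
  obtain ⟨c, hc, H⟩ := Q_nm6 P
  obtain ⟨C4, hC4, H4⟩ := BW.a4
  obtain ⟨cV, hcV, HV⟩ := pt_V 3
  obtain ⟨cT, hcT, HT⟩ := Q_top P
  refine ⟨4 * c + (c * C4 + cV + 16^6 + cT * 4), by nlinarith, fun {η w V} hη hw hV => ?_⟩
  set C := 4 * c + (c * C4 + cV + 16^6 + cT * 4) with hC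
  have hη0 := hw.nn
  have sQ := smQf (P := P) hw.sm
  have uQ := supQf (P := P) hw.sup
  have sV := hV.sm
  have sv : Sm (fun p => V p + Qf P w p) := sV.add sQ
  have uv : Sup (fun p => V p + Qf P w p) := hV.sup.add uQ
  have q1 : ∀ s, 2 ≤ s → ∀ x, nmF Z5 aN 1 (Qf P w) (hyp s x) ≤ c * (η / s^2) := by
    intro s hs x
    have h2 := hw.w2 s hs x
    have n := fun i u => nmF_nn (A := Z5) Sn_dA i u (hyp s x)
    refine ((H hw.sm 1 0 (by omega) (by omega) _).1).trans (mul_le_mul_of_nonneg_left ?_ (by linarith))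
    have := mul_le_mul ((nmF_mono (A := Z5) Sn_dA (by omega : 0 ≤ 1) w (hyp s x)).trans h2) h2 (n _ _) ((n _ _).trans h2)
    refine this.trans ?_
    rw [div_mul_div_comm, ← pow_two s]
    exact div_le_div_of_nonneg_right (by nlinarith) (by positivity)
  have q3 : ∀ s, 2 ≤ s → ∀ x, nmF Z5 aN 3 (Qf P w) (hyp s x) ≤ c * C4 * (η * yy s / s^2) := by
    intro s hs x
    have y1 := yy_one (by linarith : 1 ≤ s)
    have h2 := hw.w2 s hs x
    have n := fun i u => nmF_nn (A := Z5) Sn_dA i u (hyp s x)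
    rw [mul_assoc]
    refine ((H hw.sm 3 1 (by omega) (by omega) _).1).trans (mul_le_mul_of_nonneg_left ?_ (by linarith))
    have := mul_le_mul h2 ((nmF_mono (A := Z5) Sn_dA (by omega : 3 ≤ 4) w (hyp s x)).trans (H4 hw hs x).1) (n _ _) ((n _ _).trans h2)
    refine this.trans ?_
    have : η / s * (C4 * (η * yy s / s)) = C4 * (η * (η * yy s) / s^2) := by field_simp
    rw [this]
    refine mul_le_mul_of_nonneg_left (div_le_div_of_nonneg_right ?_ (by positivity)) (by linarith)
    have : 0 ≤ η * yy s := by positivity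
    nlinarith
  have v3 : ∀ s, 2 ≤ s → ∀ x, nmF Z5 aN 3 V (hyp s x) ≤ cV * (η / hyp s x 0) := fun s hs x => HV hs hV.sm hV.sup (hV.v2 s hs) x
  have cc0 : 0 ≤ c * C4 := by nlinarith
  have ccC : c ≤ c * C4 := by nlinarith
  have LdW : ∀ s, 2 ≤ s → ∀ k, k = 5 ∨ k = 6 → ∀ B, LH s B (nmF Z5 (dm s) k V) → η ≤ B →
      ∃ D : Pt → ℝ, LH s (C * B) D ∧ ∀ x, 0 ≤ D (hyp s x) ∧ nmF Z5 aN k (fun p => V p + Qf P w p) (hyp s x) ≤ hyp s x 0 / s * D (hyp s x) ∧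
      ∀ α, nmF Z5 aN k (pd α (fun p => V p + Qf P w p)) (hyp s x) ≤ hyp s x 0 / s * D (hyp s x) := by
    intro s hs k hk B hB hηB
    have y1 := yy_one (by linarith : 1 ≤ s)
    have y2 := yy_le (by linarith : 1 ≤ s) 2 (by omega)
    have e : 0 ≤ cT * (η * yy s / s) := by have : 0 < s := by linarith
                                           positivity
    refine ⟨fun p => 16^6 * nmF Z5 (dm s) k V p + cT * (η * yy s / s) * dW s w p, ((hB.cmul (by positivity)).add ((hw.dW hs).cmul e)).le ?_, fun x => ?_⟩
    · have : cT * (η * yy s / s) * (4 * (η * yy s)) ≤ cT * 4 * B := by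
        have : cT * (η * yy s / s) * (4 * (η * yy s)) = cT * 4 * (η * η * (yy s^2 / s)) := by ring
        rw [this]
        refine mul_le_mul_of_nonneg_left ?_ (by linarith)
        have : yy s^2 / s ≤ 1 := by rw [div_le_one (by linarith)]; exact y2
        have h0 : 0 ≤ yy s^2/s := by have : 0 < s := by linarith
                                     positivity
        nlinarith [mul_nonneg hη0 hη0]
      have hB0 : 0 ≤ B := hη0.trans hηB
      rw [hC]; nlinarith [mul_nonneg cc0 hB0, mul_nonneg hcV hB0]
    · obtain ⟨a1, a2⟩ := V_top hs hV.sm k (by omega) x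
      obtain ⟨b1, b2⟩ := HT hw hs k (by omega) x
      refine ⟨add_nonneg (mul_nonneg (by positivity) (nmF_nn (Sn_dm s) _ _ _)) (mul_nonneg e (dW_nn _ _ _)), ?_, fun α => ?_⟩
      · refine (nmF_add Sn_aN sV sQ _ _).trans ?_
        rw [mul_add]; linarith
      · rw [pd_add sV sQ]
        refine (nmF_add Sn_aN (smPd sV α) (smPd sQ α) _ _).trans ?_
        rw [mul_add]; linarith [a2 α, b2 α]
  refine ⟨sv, uv, ?_, ?_, ?_, ?_, ?_, ?_⟩
  · intro s hs x
    have ht := hyp_pos (by linarith : 0 < s) x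
    have hn : 0 ≤ η / hyp s x 0 := by positivity
    by_cases hx : rad (hyp s x) ≤ hyp s x 0 - 1
    · have ts := (supp_t (by linarith : 0 < s) hx).1
      refine (nmF_add Sn_aN sV sQ 1 _).trans ?_
      have h1 := (nmF_mono (A := Z5) Sn_aN (by omega : 1 ≤ 3) V (hyp s x)).trans (v3 s hs x)
      have h2 := q1 s hs x
      have : η / s^2 ≤ η / hyp s x 0 := div_le_div_of_nonneg_left hη0 ht ts
      rw [hC]; nlinarith
    · rw [nmF0 hs uv hx]; have : 0 ≤ C := by rw [hC]; nlinarith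
      positivity
  · intro s hs x
    have ht := hyp_pos (by linarith : 0 < s) x
    have y1 := yy_one (by linarith : 1 ≤ s)
    have hn : 0 ≤ η * yy s / hyp s x 0 := by positivity
    by_cases hx : rad (hyp s x) ≤ hyp s x 0 - 1
    · have ts := (supp_t (by linarith : 0 < s) hx).1
      refine (nmF_add Sn_aN sV sQ 3 _).trans ?_
      have h1 := v3 s hs x
      have h2 := q3 s hs x
      have : η * yy s / s^2 ≤ η * yy s / hyp s x 0 := div_le_div_of_nonneg_left (by positivity) ht ts
      have : η / hyp s x 0 ≤ η * yy s / hyp s x 0 := div_le_div_of_nonneg_right (by nlinarith) ht.le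
      rw [hC]; nlinarith
    · rw [nmF0 hs uv hx]; have : 0 ≤ C := by rw [hC]; nlinarith
      positivity
  · intro s hs x
    have ht := hyp_pos (by linarith : 0 < s) x
    have y1 := yy_one (by linarith : 1 ≤ s)
    have h1 := v3 s hs x
    have h2 := q3 s hs x
    have hn : 0 ≤ η * yy s / s^2 := by positivity
    have hn' : 0 ≤ η / hyp s x 0 := by positivity
    refine (nmF_add Sn_aN sV sQ 3 _).trans ?_
    rw [hC]; nlinarith
  · intro s hs
    exact LdW s hs 6 (by omega) _ (hV.v1 s hs) (by nlinarith [yy_one (by linarith : 1 ≤ s)])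
  · intro s hs
    exact LdW s hs 5 (by omega) _ (hV.v2 s hs) le_rfl
  · intro s hs
    have hs0 : 0 < s := by linarith
    have y1 := yy_one (by linarith : 1 ≤ s)
    have y2 := yy_le (by linarith : 1 ≤ s) 2 (by omega)
    refine ⟨nmF Z5 (dm s) 5 V, fun p => c * (η/s) * dW s w p, (hV.v2 s hs).le ?_, ((hw.dW hs).cmul (by positivity)).le ?_, fun x => ⟨nmF_nn (Sn_dm s) _ _ _, mul_nonneg (by positivity) (dW_nn _ _ _), ?_⟩⟩
    · rw [hC]; nlinarith
    · have e : c * (η/s) * (4 * (η * yy s)) = 4 * c * η * (η * yy s / s) := by ring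
      rw [e]
      have z : 0 ≤ η * yy s / s := by positivity
      refine mul_le_mul_of_nonneg_right ?_ z
      rw [hC]; nlinarith
    · refine (nmF_add Sn_aN sV sQ 3 _).trans (add_le_add ((nm_aN_dm _ _).trans (nmF_mono (Sn_dm s) (by omega) _ _)) ?_)
      have n := fun i u => nmF_nn (A := Z5) Sn_dA i u (hyp s x)
      have := mul_le_mul (hw.w2 s hs x) (((nmF_mono (A := Z5) Sn_dA (by omega : 3 ≤ 6) w (hyp s x)).trans (nm_dA_dn hs0 w x)).trans (mul_le_mul_of_nonneg_left (dW_ge s w _) (by linarith [t_s hs x]))) (n _ _) ((n _ _).trans (hw.w2 s hs x))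
      refine ((H hw.sm 3 1 (by omega) (by omega) _).1).trans ((mul_le_mul_of_nonneg_left this (by linarith)).trans (le_of_eq (by ring)))

structure BF (K η : ℝ) (F : Pt → ℝ) : Prop where
  sm : Sm F
  sup : Sup F
  f6 : ∀ s, 2 ≤ s → LH s (K * (η^2 * yy s / s)) (nmF Z5 aN 6 F)
  f6' : ∀ s, 2 ≤ s → ∀ α, LH s (K * (η^2 * yy s / s)) (nmF Z5 aN 6 (pd α F))
  f5 : ∀ s, 2 ≤ s → LH s (K * (η^2 / s)) (nmF Z5 aN 5 F)
  p1 : ∀ s, 2 ≤ s → ∀ x, nmF Z5 aN 1 F (hyp s x) ≤ K * (η^2 / hyp s x 0^2)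
  p3 : ∀ s, 2 ≤ s → ∀ x, nmF Z5 aN 3 F (hyp s x) ≤ K * (η^2 * yy s / hyp s x 0^2)

theorem BF_of {C : ℝ} (hC : 1 ≤ C) : ∃ K, 1 ≤ K ∧ ∀ {η v}, 0 ≤ η → Bv C η v → BF K η (fun p => v p ^ 2) := by
  refine ⟨2 * 12^6 * (4 * C^2), by nlinarith, fun {η v} hη h => ?_⟩
  have e2 : (fun p => v p ^ 2) = fun p => v p * v p := by ext p; ring
  have hv := h.sm
  have sF : Sm (fun p => v p * v p) := by fun_prop
  have uF : Sup (fun p => v p * v p) := h.sup.mul_left v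
  have nA := fun i u p => nmF_nn (A := Z5) Sn_aN i u p
  have mA := fun {i j : ℕ} (hij : i ≤ j) u p => nmF_mono (A := Z5) Sn_aN hij u p
  have hC0 : 0 ≤ C := by linarith
  -- generic order 6 estimate
  have key : ∀ f : Pt → ℝ, Sm f → Sup f → (∀ i p, nmF Z5 aN i f p ≤ nmF Z5 aN (i+1) v p) → (∀ s, 2 ≤ s → ∀ D6 D5 : Pt → ℝ, ∀ x,
      nmF Z5 aN 6 v (hyp s x) ≤ hyp s x 0 / s * D6 (hyp s x) → nmF Z5 aN 6 f (hyp s x) ≤ hyp s x 0 / s * D6 (hyp s x) →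
      nmF Z5 aN 5 v (hyp s x) ≤ hyp s x 0 / s * D5 (hyp s x) → nmF Z5 aN 5 f (hyp s x) ≤ hyp s x 0 / s * D5 (hyp s x) → 
      0 ≤ D6 (hyp s x) → 0 ≤ D5 (hyp s x) →
      nmF Z5 aN 6 (fun p => f p * v p) (hyp s x) ≤ 12^6 * (C * (η / s) * D6 (hyp s x) + C * (η * yy s / s) * D5 (hyp s x))) := by
    intro f hf sf hfv s hs D6 D5 x v6 f6 v5 f5 d6 d5
    have hs0 : 0 < s := by linarith
    have ht := hyp_pos hs0 x
    have y1 := yy_one (by linarith : 1 ≤ s)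
    have p1 := h.p1 s hs x
    have p3 := h.p3 s hs x
    set t := hyp s x 0
    set p := hyp s x
    have E6 : C * (η / t) * (t / s * D6 p) = C * (η / s) * D6 p := by field_simp
    have E5 : C * (η * yy s / t) * (t / s * D5 p) = C * (η * yy s / s) * D5 p := by field_simp
    have z6 : 0 ≤ C * (η / s) * D6 p := by positivity
    have z5 : 0 ≤ C * (η * yy s / s) * D5 p := by positivity
    refine nm_mul hf hv fun i j hij => ?_
    have c1 : ∀ a b : ℝ, 0 ≤ b → a ≤ C * (η / t) → b ≤ t / s * D6 p → a * b ≤ C * (η / s) * D6 p + C * (η * yy s / s) * D5 p := by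
      intro a b hb h1 h2
      have := mul_le_mul h1 h2 hb (by positivity)
      linarith
    have c2 : ∀ a b : ℝ, 0 ≤ b → a ≤ C * (η * yy s / t) → b ≤ t / s * D5 p → a * b ≤ C * (η / s) * D6 p + C * (η * yy s / s) * D5 p := by
      intro a b hb h1 h2
      have := mul_le_mul h1 h2 hb (by positivity)
      linarith
    by_cases h1 : j ≤ 1
    · rw [mul_comm]; exact c1 _ _ (nA _ _ _) ((mA h1 _ _).trans p1) ((mA (by omega) _ _).trans f6)
    by_cases h2 : j ≤ 3
    · rw [mul_comm]; exact c2 _ _ (nA _ _ _) ((mA h2 _ _).trans p3) ((mA (by omega) _ _).trans f5)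
    by_cases h3 : j ≤ 5
    · exact c2 _ _ (nA _ _ _) ((hfv _ _).trans ((mA (by omega) _ _).trans p3)) ((mA h3 _ _).trans v5)
    · exact c1 _ _ (nA _ _ _) ((hfv _ _).trans ((mA (by omega) _ _).trans p1)) ((mA (by omega) _ _).trans v6)
  have L6 : ∀ s, 2 ≤ s → ∀ D6 D5 : Pt → ℝ, LH s (C * (η * yy s)) D6 → LH s (C * η) D5 →
      LH s (12^6 * (2 * C^2) * (η^2 * yy s / s)) (fun p => 12^6 * (C * (η / s) * D6 p + C * (η * yy s / s) * D5 p)) := by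
    intro s hs D6 D5 h6 h5
    have hs0 : 0 < s := by linarith
    have y1 := yy_one (by linarith : 1 ≤ s)
    refine (((h6.cmul (by positivity)).add (h5.cmul (by positivity))).cmul (by positivity)).le (le_of_eq ?_)
    field_simp; ring
  rw [e2]
  refine ⟨sF, uF, fun s hs => ?_, fun s hs α => ?_, fun s hs => ?_, fun s hs x => ?_, fun s hs x => ?_⟩
  · obtain ⟨D6, a6, b6⟩ := h.v1 s hs
    obtain ⟨D5, a5, b5⟩ := h.v2 s hs
    have z : 0 ≤ η^2 * yy s / s := by have := yy_one (by linarith : 1 ≤ s); positivity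
    refine LH.le ((L6 s hs D6 D5 a6 a5).mono (nmA_cc sF uF) fun x => ?_) (mul_le_mul_of_nonneg_right (by nlinarith) z)
    rw [abs_of_nonneg (nA _ _ _)]
    exact (key v hv h.sup (fun i p => mA (by omega) _ _) s hs D6 D5 x (b6 x).2.1 (b6 x).2.1 (b5 x).2.1 (b5 x).2.1 (b6 x).1 (b5 x).1).trans (le_abs_self _)
  · obtain ⟨D6, a6, b6⟩ := h.v1 s hs
    obtain ⟨D5, a5, b5⟩ := h.v2 s hs
    have z : 0 ≤ η^2 * yy s / s := by have := yy_one (by linarith : 1 ≤ s); positivity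
    have eF : pd α (fun p => v p * v p) = fun p => 2 * (pd α v p * v p) := by rw [pd_mul hv hv]; ext p; ring
    refine LH.le (((L6 s hs D6 D5 a6 a5).cmul (by norm_num : (0:ℝ) ≤ 2)).mono (nmA_cc (smPd sF α) (uF.pd α)) fun x => ?_) (le_of_eq (by ring) |>.trans (mul_le_mul_of_nonneg_right (by nlinarith : 2 * (12^6 * (2 * C^2)) ≤ _) z))
    rw [abs_of_nonneg (nA _ _ _), eF, nmF_cmul Sn_aN (by fun_prop), abs_of_nonneg (by norm_num : (0:ℝ) ≤ 2)]
    refine (mul_le_mul_of_nonneg_left (key (pd α v) (by fun_prop) (h.sup.pd α) (fun i p => ?_) s hs D6 D5 x (b6 x).2.1 ((b6 x).2.2 α) (b5 x).2.1 ((b5 x).2.2 α) (b6 x).1 (b5 x).1) (by norm_num)).trans (le_abs_self _)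
    rw [← dd_emb]; exact nmF_dd Sn_aN _ _ _ (Finset.mem_univ _)
  · have hs0 : 0 < s := by linarith
    have y1 := yy_one (by linarith : 1 ≤ s)
    have y2 := yy_le (by linarith : 1 ≤ s) 2 (by omega)
    have y1' := yy_le (by linarith : 1 ≤ s) 1 (by omega)
    rw [pow_one] at y1'
    obtain ⟨D5, a5, b5⟩ := h.v2 s hs
    obtain ⟨D, D', a, a', bb⟩ := h.v3 s hs
    have big : LH s (12^5 * (C^2 * 4) * (η^2 / s)) (fun p => 12^5 * (C * (η/s) * D5 p + (C * (2 * (η/s)) * D p + C * (η * yy s / s) * D' p))) := by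
      refine (((a5.cmul (by positivity)).add ((a.cmul (by positivity)).add (a'.cmul (by positivity)))).cmul (by positivity)).le ?_
      rw [mul_assoc (12^5) (C^2 * 4)]
      refine mul_le_mul_of_nonneg_left ?_ (by positivity)
      have e : C * (η / s) * (C * η) + (C * (2 * (η / s)) * (C * η) + C * (η * yy s / s) * (C * (η * yy s / s))) = C^2 * (η^2/s) * (3 + yy s^2/s) := by ring
      have : yy s^2/s ≤ 1 := by rw [div_le_one hs0]; exact y2
      rw [e]
      have : 0 ≤ C^2 * (η^2/s) := by positivity
      nlinarith
    have z : 0 ≤ η^2 / s := by positivity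
    refine (big.mono (nmA_cc sF uF) fun x => ?_).le (mul_le_mul_of_nonneg_right (by nlinarith) z)
    rw [abs_of_nonneg (nA _ _ _)]
    refine le_trans ?_ (le_abs_self _)
    have ht := hyp_pos hs0 x
    have p1 := h.p1 s hs x
    have p3 := h.p3 s hs x
    have p3' := h.p3' s hs x
    have v5 := (b5 x).2.1
    have d5 := (b5 x).1
    obtain ⟨d, d', v3⟩ := bb x
    have st := hyp_le hs0 x
    set t := hyp s x 0
    set p := hyp s x
    have E5 : C * (η / t) * (t / s * D5 p) = C * (η / s) * D5 p := by field_simp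
    have E' : C * (η * yy s / t) * (t / s * D' p) = C * (η * yy s / s) * D' p := by field_simp
    have z1 : 0 ≤ C * (η / s) * D5 p := by positivity
    have z2 : 0 ≤ C * (2 * (η / s)) * D p := by positivity
    have z3 : 0 ≤ C * (η * yy s / s) * D' p := by positivity
    have P : η / t + η * yy s / s^2 ≤ 2 * (η / s) := by
      have a1 : η / t ≤ η / s := div_le_div_of_nonneg_left hη hs0 st
      have a2 : η * yy s / s^2 ≤ η / s := by
        rw [div_le_div_iff₀ (by positivity) hs0]; nlinarith [mul_nonneg hη hs0.le]
      linarith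
    have P' : nmF Z5 aN 3 v p ≤ C * (2 * (η / s)) := p3'.trans (mul_le_mul_of_nonneg_left P hC0)
    have c1 : ∀ i j, i ≤ 1 → j ≤ 5 → nmF Z5 aN i v p * nmF Z5 aN j v p ≤ C * (η/s) * D5 p + (C * (2 * (η/s)) * D p + C * (η * yy s / s) * D' p) := by
      intro i j hi hj
      have := mul_le_mul ((mA hi _ _).trans p1) ((mA hj _ _).trans v5) (nA _ _ _) (by positivity)
      linarith
    have c2 : ∀ i j, i ≤ 3 → j ≤ 3 → nmF Z5 aN i v p * nmF Z5 aN j v p ≤ C * (η/s) * D5 p + (C * (2 * (η/s)) * D p + C * (η * yy s / s) * D' p) := by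
      intro i j hi hj
      have h1 := mul_le_mul (mA hi v p) ((mA hj _ _).trans v3) (nA _ _ _) (nA _ _ _)
      have h2 := mul_le_mul_of_nonneg_right P' d
      have h3 := mul_le_mul_of_nonneg_right p3 (by positivity : 0 ≤ t / s * D' p)
      rw [mul_add] at h1
      linarith
    refine nm_mul hv hv fun i j hij => ?_
    by_cases h1 : i ≤ 1
    · exact c1 _ _ h1 (by omega)
    by_cases h2 : j ≤ 1
    · rw [mul_comm]; exact c1 _ _ h2 (by omega)
    exact c2 _ _ (by omega) (by omega)
  · have ht := hyp_pos (by linarith : 0 < s) x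
    have p1 := h.p1 s hs x
    have z : 0 ≤ η^2 / hyp s x 0^2 := by positivity
    refine (nm_mul (K := C^2 * (η^2 / hyp s x 0^2)) hv hv fun i j hij => ?_).trans ?_
    · have := mul_le_mul ((mA (by omega : i ≤ 1) _ _).trans p1) ((mA (by omega : j ≤ 1) _ _).trans p1) (nA _ _ _) (by positivity)
      exact this.trans (le_of_eq (by ring))
    · rw [← mul_assoc]; exact mul_le_mul_of_nonneg_right (by nlinarith) z
  · have ht := hyp_pos (by linarith : 0 < s) x
    have y1 := yy_one (by linarith : 1 ≤ s)
    have p1 := h.p1 s hs x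
    have p3 := h.p3 s hs x
    have z : 0 ≤ η^2 * yy s/ hyp s x 0^2 := by positivity
    refine (nm_mul (K := C^2 * (η^2 * yy s/ hyp s x 0^2)) hv hv fun i j hij => ?_).trans ?_
    · have key : ∀ i j, i ≤ 1 → j ≤ 3 → nmF Z5 aN i v (hyp s x) * nmF Z5 aN j v (hyp s x) ≤ C^2 * (η^2 * yy s/ hyp s x 0^2) := by
        intro i j hi hj
        have := mul_le_mul ((mA hi _ _).trans p1) ((mA hj _ _).trans p3) (nA _ _ _) (by positivity)
        exact this.trans (le_of_eq (by ring))
      by_cases h1 : i ≤ 1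
      · exact key _ _ h1 (by omega)
      · rw [mul_comm]; exact key _ _ (by omega) (by omega)
    · rw [← mul_assoc]; exact mul_le_mul_of_nonneg_right (by nlinarith) z

def LocB (k : ℕ) (κ : ℝ) (u : Pt → ℝ) : Prop := ∀ p : Pt, 2 ≤ p 0 → p 0 ≤ 3 → nmF Z5 aN k u p ≤ κ

theorem LocB.nn {k κ u} (h : LocB k κ u) : 0 ≤ κ :=
  (nmF_nn Sn_aN _ _ _).trans (h (fun _ => 2) le_rfl (by norm_num))

theorem Wd5 {k} {l : List (Fin 5)} (h : l.length ≤ k) : l ∈ Wd Z5 k := ⟨h, fun _ _ => Finset.mem_univ _⟩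

theorem LocB.w {k κ u} (h : LocB k κ u) {l : List (Fin 5)} (hl : l.length ≤ k) {p : Pt} (h2 : 2 ≤ p 0) (h3 : p 0 ≤ 3) : |Dw l u p| ≤ κ :=
  (nmF_Dw (N := aN) Sn_aN (Wd5 hl)).trans (h p h2 h3)

theorem LocB.d {k κ u} (h : LocB k κ u) {l : List (Fin 5)} (hl : l.length < k) {p : Pt} (h2 : 2 ≤ p 0) (h3 : p 0 ≤ 3) (i : Fin 5) : |dd i (Dw l u) p| ≤ κ := by
  have := h.w (l := l ++ [i]) (by simp; omega) h2 h3
  simpa [Dw_append, Dw] using this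

theorem LocB.pd {k κ u} (h : LocB k κ u) {l : List (Fin 5)} (hl : l.length < k) {p : Pt} (h2 : 2 ≤ p 0) (h3 : p 0 ≤ 3) (α : Fin 3) : |pd α (Dw l u) p| ≤ κ := by
  rw [← dd_emb]; exact h.d hl h2 h3 _

theorem LocB.der {k κ u} (h : LocB (k+1) κ u) (α : Fin 3) : LocB k κ (_root_.pd α u) := fun p h2 h3 => by
  rw [← dd_emb]; exact (nmF_dd Sn_aN _ _ _ (Finset.mem_univ _)).trans (h p h2 h3)

theorem LocB.mono {k j κ u} (h : LocB k κ u) (hj : j ≤ k) : LocB j κ u := fun p h2 h3 => (nmF_mono Sn_aN hj _ _).trans (h p h2 h3)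

theorem H2_t {u : Pt → ℝ} (su : Sup u) (x : X2) : u (hyp 2 x) = 0 ∨ (2 ≤ hyp 2 x 0 ∧ hyp 2 x 0 ≤ 3) := by
  by_cases hx : rad (hyp 2 x) ≤ hyp 2 x 0 - 1
  · right; have := (supp_t (by norm_num : (0:ℝ) < 2) hx).2
    exact ⟨hyp_le (by norm_num) x, by linarith⟩
  · left; exact su.hyp0 le_rfl hx

theorem H2_t' (x : X2) : (∀ u, Sup u → u (hyp 2 x) = 0) ∨ (2 ≤ hyp 2 x 0 ∧ hyp 2 x 0 ≤ 3) := by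
  by_cases h : (2 ≤ hyp 2 x 0 ∧ hyp 2 x 0 ≤ 3)
  · right; exact h
  · left; exact fun u su => (H2_t su x).resolve_right h

theorem Em_start {u : Pt → ℝ} (hu : Sm u) (su : Sup u) {κ m : ℝ} (hm : 0 ≤ m) (hm1 : m ≤ 1) (hκ : 0 ≤ κ)
    (h : ∀ p : Pt, 2 ≤ p 0 → p 0 ≤ 3 → |u p| ≤ κ ∧ ∀ α, |pd α u p| ≤ κ) : Real.sqrt (Em m 2 u) ≤ 4 * κ * (area 7 + 1) := by
  have ha := area_nn 7
  rw [Real.sqrt_le_left (by positivity)]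
  have c := eD_cc m (by norm_num : (0:ℝ) < 2) hu su
  norm_num at c
  have := int_bd (M := 10 * κ^2) c fun x => ?_
  · unfold Em
    refine this.trans ?_
    have : 10 * κ^2 * area 7 ≤ 16 * κ^2 * (area 7 + 1)^2 := by nlinarith [mul_nonneg (sq_nonneg κ) ha, mul_nonneg (sq_nonneg κ) (sq_nonneg (area 7)), sq_nonneg κ]
    nlinarith
  · rcases H2_t' x with h0 | ⟨h2, h3⟩
    · simp [eD, ubd, h0 u su, h0 _ (su.pd 0), h0 _ (su.pd 1), h0 _ (su.pd 2)]; positivity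
    · obtain ⟨a, b⟩ := h _ h2 h3
      obtain ⟨e1, e2⟩ := x_le_t (by norm_num : (0:ℝ) < 2) x
      set p := hyp 2 x
      have hp : 0 < p 0 := by linarith
      have q : ∀ i, |p i| ≤ p 0 → |p i / p 0| ≤ 1 := fun i hi => by rw [abs_div, abs_of_pos hp, div_le_one hp]; exact hi
      have u0 : |2 / p 0 * pd 0 u p| ≤ 1 * κ := abs_mul_le (by rw [abs_of_pos (by positivity), div_le_one hp]; exact h2) (b 0)
      have u1 : |ubd 0 u p| ≤ 1 * κ + κ := (abs_add_le _ _).trans (add_le_add (abs_mul_le (q 1 e1) (b 0)) (b 1))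
      have u2 : |ubd 1 u p| ≤ 1 * κ + κ := (abs_add_le _ _).trans (add_le_add (abs_mul_le (q 2 e2) (b 0)) (b 2))
      have s0 := sq_le_sq' (by linarith [neg_abs_le (2 / p 0 * pd 0 u p)]) ((le_abs_self _).trans u0)
      have s1 := sq_le_sq' (by linarith [neg_abs_le (ubd 0 u p)]) ((le_abs_self _).trans u1)
      have s2 := sq_le_sq' (by linarith [neg_abs_le (ubd 1 u p)]) ((le_abs_self _).trans u2)
      have s3 := sq_le_sq' (by linarith [neg_abs_le (u p)]) ((le_abs_self _).trans a)
      have : m * u p^2 ≤ 1 * κ^2 := mul_le_mul hm1 s3 (sq_nonneg _) (by norm_num)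
      unfold eD; nlinarith

/-- energy estimate producing the size of the energy -/
theorem en_step {m : ℝ} (hm : 0 ≤ m) (hm1 : m ≤ 1) {u : Pt → ℝ} (hu : Sm u) (su : Sup u) {κ : ℝ} (hκ : 0 ≤ κ) {g G : ℝ → ℝ}
    (hi : ∀ p : Pt, 2 ≤ p 0 → p 0 ≤ 3 → |u p| ≤ κ ∧ ∀ α, |pd α u p| ≤ κ)
    (hG : ∀ s, 2 ≤ s → HasDerivAt G (g s) s)
    (h : ∀ s, 2 ≤ s → LH s (g s) (fun p => negBox u p + m * u p)) {b : ℝ} (hb : 2 ≤ b) :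
    Real.sqrt (Em m b u) ≤ 4 * κ * (area 7 + 1) + (G b - G 2) :=
  (energy_ineq hm hu su (fun s hs => (h s hs).2.1) hG (fun s hs => (h s hs).2.2) hb).trans
    (add_le_add (Em_start hu su hm hm1 hκ hi) le_rfl)

theorem LH_Dw {s K k} {F : Pt → ℝ} (hF : Sm F) (sF : Sup F) (h : LH s K (nmF Z5 aN k F)) {l : List (Fin 5)} (hl : l ∈ Wd Z5 k) : LH s K (Dw l F) :=
  h.mono (CCh (smDw hF l) (sF.Dw l) s) fun _ => (nmF_Dw (N := aN) Sn_aN hl).trans (le_abs_self _)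

/-- W1 -/
theorem stepW1 {K : ℝ} (hK : 1 ≤ K) : ∃ C, 1 ≤ C ∧ ∀ {η κ : ℝ} {w F : Pt → ℝ}, Sm w → Sup w → negBox w = F → Sm F → Sup F →
    (∀ s, 2 ≤ s → LH s (K * (η^2 * yy s / s)) (nmF Z5 aN 6 F)) → LocB 7 κ w →
    ∀ s, 2 ≤ s → LH s (C * (κ + η^2) * yy s) (nmF Z5 (dn s) 6 w) := by
  have ha := area_nn 7
  refine ⟨6^6 * (10 * (4 * (area 7 + 1) + 10 * K)), by nlinarith, fun {η κ w F} hw sw he hF sF h6 hL s hs => ?_⟩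
  have hκ := hL.nn
  have y1 := yy_one (by linarith : 1 ≤ s)
  refine (nmF_LH (K := 10 * ((4 * (area 7 + 1) + 10 * K) * (κ + η^2) * yy s)) fun l hl => LH_dn (by linarith) (smDw hw l) (sw.Dw l) ?_).le (le_of_eq (by ring))
  have := en_step (m := 0) le_rfl zero_le_one (smDw hw l) (sw.Dw l) hκ (g := fun s => K * (η^2 * yy s / s)) (G := fun s => 10 * K * η^2 * yy s)
    (fun p h2 h3 => ⟨hL.w (by have := hl.1; omega) h2 h3, hL.pd (by have := hl.1; omega) h2 h3⟩) (fun s hs => ?_) (fun s hs => ?_) hs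
  · refine this.trans ?_
    have y2 := yy_one (by norm_num : (1:ℝ) ≤ 2)
    have e1 : 0 ≤ 10 * K * η^2 * yy 2 := by positivity
    have e2 : κ * (4 * (area 7 + 1)) ≤ κ * (4 * (area 7 + 1)) * yy s := le_mul_of_one_le_right (by positivity) y1
    have e3 : 0 ≤ 10 * K * κ * yy s + 4 * (area 7 + 1) * η^2 * yy s := by positivity
    linarith
  · have := (yy_deriv (by linarith : 0 < s)).const_mul (10 * K * η^2)
    exact this.congr_deriv (by ring)
  · simp only [zero_mul, add_zero]
    have e : negBox (Dw l w) = Dw l F := by rw [Dw_negBox hw, he]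
    rw [show (fun p => negBox (Dw l w) p) = Dw l F from e]
    exact LH_Dw hF sF (h6 s hs) hl

def kap (i : Fin 5) : ℝ := ![1,1,1,0,0] i

theorem dd_Sf {u : Pt → ℝ} (hu : Sm u) (i : Fin 5) : dd i (Sf u) = fun p => Sf (dd i u) p + kap i * dd i u p := by
  fin_cases i <;> ext p <;> simp only [dd, kap, Sf_eq, boost0, boost1, Matrix.cons_val, Fin.zero_eta, Fin.mk_one, Fin.reduceFinMk] <;>
    simp (disch := fun_prop) only [pd_add, pd_mul, pd_coord, pd_comm hu 1 0, pd_comm hu 2 0, pd_comm hu 2 1] <;> simp <;> ring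

def sN (u : Pt → ℝ) (p : Pt) : ℝ := |Sf u p| + |u p|

theorem Sf_add {u v : Pt → ℝ} (hu : Sm u) (hv : Sm v) : Sf (fun p => u p + v p) = fun p => Sf u p + Sf v p := by
  ext p; simp only [Sf_eq, pd_add hu hv]; ring
theorem Sf_cmul {u : Pt → ℝ} (hu : Sm u) (c : ℝ) : Sf (fun p => c * u p) = fun p => c * Sf u p := by
  ext p; simp only [Sf_eq, pd_cmul hu c]; ring

def sS (b : ℝ) (u : Pt → ℝ) (p : Pt) : ℝ := Real.sqrt ((p 0)⁻¹ * b⁻¹) * sN u p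

theorem Sn_sN : Sn sN where
  nn := fun u p => by unfold sN; positivity
  add := fun u v p hu hv => by
    unfold sN; rw [Sf_add hu hv]
    linarith [abs_add_le (Sf u p) (Sf v p), abs_add_le (u p) (v p)]
  smul := fun c u p hu => by unfold sN; rw [Sf_cmul hu]; simp only [abs_mul]; ring

theorem Sn_sS (b) : Sn (sS b) where
  nn := fun u p => mul_nonneg (Real.sqrt_nonneg _) (Sn_sN.nn u p)
  add := fun u v p hu hv => by
    unfold sS; rw [← mul_add]; exact mul_le_mul_of_nonneg_left (Sn_sN.add u v p hu hv) (Real.sqrt_nonneg _)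
  smul := fun c u p hu => by unfold sS; rw [Sn_sN.smul c u p hu]; ring

theorem nm_Sf {A k} {u : Pt → ℝ} (hu : Sm u) (p) : nmF A aN k (Sf u) p ≤ (k+1) * nmF A sN k u p := by
  have hs : ∀ k u, nmF A aN k u p ≤ nmF A sN k u p := fun k u => by
    simpa using nmF_congr_le (A := A) (N := aN) (N' := sN) (u := u) (p := p) 1 (fun l => by unfold aN sN; simp) k
  induction k generalizing u with
  | zero => simp [nmF, aN, sN]
  | succ k ih =>
    simp only [nmF]
    have h1 := ih hu
    have h2 : ∑ i ∈ A, nmF A aN k (dd i (Sf u)) p ≤ ∑ i ∈ A, (k + 2) * nmF A sN k (dd i u) p := by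
      refine Finset.sum_le_sum fun i _ => ?_
      rw [dd_Sf hu]
      have := nmF_add (A := A) Sn_aN (smSf (smDd hu i)) (contDiff_const.mul (smDd hu i) : Sm (fun p => kap i * dd i u p)) k p
      rw [nmF_cmul Sn_aN (smDd hu i)] at this
      have hk : |kap i| ≤ 1 := by fin_cases i <;> simp [kap]
      have h3 := hs k (dd i u)
      have h4 := nmF_nn (A := A) Sn_aN k (dd i u) p
      have h5 := ih (smDd hu i)
      nlinarith
    rw [← Finset.mul_sum] at h2
    have := nmF_nn (A := A) Sn_sN k u p
    push_cast
    rw [mul_add]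
    linarith

theorem Sf_loc {u : Pt → ℝ} {κ : ℝ} {p : Pt} (h2 : 2 ≤ p 0) (h3 : p 0 ≤ 3) (e1 : |p 1| ≤ p 0) (e2 : |p 2| ≤ p 0) (h : ∀ α, |pd α u p| ≤ κ) : |Sf u p| ≤ 9 * κ := by
  have a0 := abs_mul_le (by rw [abs_of_pos (by linarith)]; exact h3 : |p 0| ≤ 3) (h 0)
  have a1 := abs_mul_le (e1.trans h3) (h 1)
  have a2 := abs_mul_le (e2.trans h3) (h 2)
  unfold Sf
  rw [abs_le] at a0 a1 a2 ⊢
  constructor <;> linarith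

theorem sS_LH {K : ℝ} (hK : 1 ≤ K) : ∃ C, 1 ≤ C ∧ ∀ {η κ : ℝ} {w F : Pt → ℝ}, Sm w → Sup w → negBox w = F → BF K η F → LocB 6 κ w →
    ∀ s, 2 ≤ s → LH s (C * (κ + η^2)) (nmF Z5 (sS s) 5 w) := by
  have ha := area_nn 7
  refine ⟨6^5 * (11 * (8 * (area 7 + 1) + K)), by nlinarith, fun {η κ w F} hw sw he hB hL s hs => ?_⟩
  have hκ := hL.nn
  have hs0 : 0 < s := by linarith
  have key : ∀ l ∈ Wd Z5 5, LH s (11 * (8 * κ * (area 7 + 1) + K * η^2)) (sS s (Dw l w)) := by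
    intro l hl
    have hu := smDw hw l
    have su := sw.Dw l
    have := S_energy hu su (K := K * η^2) (D := 8 * κ * (area 7 + 1)) (by positivity) (by positivity) (fun s hs => ?_) ?_ hs
    · refine ⟨⟨?_, fun x hx => ?_⟩, by positivity, ?_⟩
      · have i := inv_t_cont (s := s) hs0
        have := (CCh (smSf hu) su.Sf s).1
        have := (CCh hu su s).1
        unfold sS sN
        fun_prop
      · simp [sS, sN, hyp_sup su hx, hyp_sup su.Sf hx]
      · have e : ∀ x, (sS s (Dw l w) (hyp s x))^2 = s⁻¹ * ((|Sf (Dw l w) (hyp s x)| + |Dw l w (hyp s x)|)^2 * (hyp s x 0)⁻¹) := by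
          intro x
          have := hyp_pos hs0 x
          unfold sS sN
          rw [mul_pow, Real.sq_sqrt (by positivity)]; ring
        simp only [e]
        rw [integral_const_mul]
        calc _ ≤ s⁻¹ * (104 * (8 * κ * (area 7 + 1) + K * η^2)^2 * s) := mul_le_mul_of_nonneg_left this (by positivity)
          _ = 104 * (8 * κ * (area 7 + 1) + K * η^2)^2 := by field_simp
          _ ≤ _ := by nlinarith [sq_nonneg (8 * κ * (area 7 + 1) + K * η^2)]
    · have e : negBox (Dw l w) = Dw l F := by rw [Dw_negBox hw, he]
      rw [e, show K * η^2 / s = K * (η^2/s) by ring]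
      exact (LH_Dw hB.sm hB.sup (hB.f5 s hs) hl).2.2
    · have i := inv_t_cont (s := 2) (by norm_num)
      have c : CC 7 (fun x => (zf (Dw l w) (hyp 2 x) ^ 2 + boost 0 (Dw l w) (hyp 2 x) ^ 2 + boost 1 (Dw l w) (hyp 2 x) ^ 2 + Dw l w (hyp 2 x)^2) * (hyp 2 x 0)⁻¹) := by
        have q1 := CCh (smSf hu) su.Sf 2
        have q2 := CCh hu su 2
        have q3 := CCh (smBoost hu 0) (su.dd 3) 2
        have q4 := CCh (smBoost hu 1) (su.dd 4) 2
        norm_num at q1 q2 q3 q4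
        have r1 := q1.1; have r2 := q2.1; have r3 := q3.1; have r4 := q4.1
        unfold zf
        refine ⟨by fun_prop, fun x hx => by simp [q1.2 x hx, q2.2 x hx, q3.2 x hx, q4.2 x hx]⟩
      have := int_bd (M := 52 * κ^2) c fun x => ?_
      · refine this.trans ?_
        have : 52 * κ^2 * area 7 ≤ 64 * κ^2 * (area 7 + 1)^2 := by nlinarith [mul_nonneg (sq_nonneg κ) ha, mul_nonneg (sq_nonneg κ) (sq_nonneg (area 7)), sq_nonneg κ]
        nlinarith
      · rcases H2_t' x with h0 | ⟨h2, h3⟩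
        · have := h0 _ su; have := h0 _ su.Sf; have := h0 _ (su.dd 3); have := h0 _ (su.dd 4)
          rw [dd3] at *; rw [dd4] at *
          simp [zf, *]
        · obtain ⟨e1, e2⟩ := x_le_t (by norm_num : (0:ℝ) < 2) x
          have ll := hl.1
          have a := hL.w (l := l) (by omega) h2 h3
          have b := hL.d (l := l) (by omega) h2 h3
          have hS := Sf_loc h2 h3 e1 e2 (hL.pd (l := l) (by omega) h2 h3)
          have b3 := b 3
          have b4 := b 4
          rw [dd3] at b3; rw [dd4] at b4
          set p := hyp 2 x
          have z : |zf (Dw l w) p| ≤ 10 * κ := by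
            unfold zf; rw [abs_le] at a hS ⊢; constructor <;> linarith
          have s0 := sq_le_sq' (by linarith [neg_abs_le (zf (Dw l w) p)]) ((le_abs_self _).trans z)
          have s1 := sq_le_sq' (by linarith [neg_abs_le (boost 0 (Dw l w) p)]) ((le_abs_self _).trans b3)
          have s2 := sq_le_sq' (by linarith [neg_abs_le (boost 1 (Dw l w) p)]) ((le_abs_self _).trans b4)
          have s3 := sq_le_sq' (by linarith [neg_abs_le (Dw l w p)]) ((le_abs_self _).trans a)
          rw [← div_eq_mul_inv, div_le_iff₀ (by linarith)]
          nlinarith [sq_nonneg κ]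
  refine (nmF_LH key).le ?_
  have : 0 ≤ K * κ := by positivity
  have : 0 ≤ η^2 * (8 * (area 7 + 1)) := by positivity
  nlinarith

theorem sqrt_t {s : ℝ} (hs : 0 < s) (x) : (hyp s x 0)⁻¹ ≤ Real.sqrt ((hyp s x 0)⁻¹ * s⁻¹) := by
  have ht := hyp_pos hs x
  refine Real.le_sqrt_of_sq_le ?_
  rw [pow_two]
  exact mul_le_mul_of_nonneg_left (inv_anti₀ hs (hyp_le hs x)) (by positivity)

/-- sharp pointwise bounds on `Γ^{≤3} w` and `SΓ^{≤3} w` -/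
theorem sharp_pt {s M : ℝ} (hs : 2 ≤ s) {w : Pt → ℝ} (hw : Sm w) (sw : Sup w) (h : LH s M (nmF Z5 (sS s) 5 w)) {l : List (Fin 5)} (hl : l.length ≤ 3) (x) :
    |Dw l w (hyp s x)| ≤ 9 * M ∧ |Sf (Dw l w) (hyp s x)| ≤ 9 * M := by
  have hs0 : 0 < s := by linarith
  have hM := h.2.1
  have hD : ∀ y, nmF Z5 (sS s) 2 (Dw l w) (hyp s y) ≤ nmF Z5 (sS s) 5 w (hyp s y) := fun y =>
    (nmF_Dw' (A := Z5) (k := 2) (j := 3) (Sn_sS s) (Wd5 hl))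
  have hS : ∀ y, nmF Z5 sN 2 (Dw l w) (hyp s y) * (hyp s y 0)⁻¹ ≤ nmF Z5 (sS s) 5 w (hyp s y) := fun y => by
    refine le_trans ?_ (hD y)
    have h1 : ∀ (k : ℕ) (u : Pt → ℝ), nmF Z5 sN k u (hyp s y) ≤ (Real.sqrt ((hyp s y 0)⁻¹ * s⁻¹))⁻¹ * nmF Z5 (sS s) k u (hyp s y) := fun k u =>
      nmF_congr_le _ (fun l => by
        have : 0 < Real.sqrt ((hyp s y 0)⁻¹ * s⁻¹) := by have := hyp_pos hs0 y; positivity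
        unfold sS; rw [inv_mul_cancel_left₀ this.ne']) k
    have h2 := h1 2 (Dw l w)
    have := hyp_pos hs0 y
    have q : 0 < Real.sqrt ((hyp s y 0)⁻¹ * s⁻¹) := by positivity
    have h3 := mul_le_mul h2 (sqrt_t hs0 y) (by positivity) (mul_nonneg (by positivity) (nmF_nn (Sn_sS s) _ _ _))
    refine h3.trans (le_of_eq ?_)
    field_simp
  constructor
  · have := sob_Lb (smDw hw l) (sw.Dw l) hs0 h (fun y => ?_) x
    · linarith
    · refine le_trans ?_ (le_abs_self _)
      refine le_trans ?_ (hS y)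
      rw [mul_comm]
      refine mul_le_mul_of_nonneg_right ?_ (inv_nonneg.2 (hyp_pos hs0 y).le)
      simpa using nmF_congr_le (A := Z5) (N := aN) (N' := sN) (u := Dw l w) (p := hyp s y) 1 (fun l => by unfold aN sN; simp) 2
  · have := sob_Lb (smSf (smDw hw l)) (sw.Dw l).Sf hs0 (h.cmul (by norm_num : (0:ℝ) ≤ 3)) (fun y => ?_) x
    · linarith
    · refine le_trans ?_ (le_abs_self _)
      have h1 := nm_Sf (A := Z5) (k := 2) (smDw hw l) (hyp s y)
      have h2 := hS y
      have h3 := mul_le_mul_of_nonneg_left h1 (inv_nonneg.2 (hyp_pos hs0 y).le)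
      norm_num at h3
      nlinarith

theorem dd34 (a : Fin 2) (u : Pt → ℝ) : ∃ i : Fin 5, boost a u = dd i u := by
  fin_cases a
  · exact ⟨3, rfl⟩
  · exact ⟨4, rfl⟩

theorem hyp_surj {p : Pt} {s : ℝ} (h0 : 0 ≤ p 0) (h : s^2 = p 0^2 - rad p^2) : hyp s (fun i => p i.succ) = p := by
  ext i; fin_cases i
  · simp only [hyp, Fin.succ_zero_eq_one, Fin.succ_one_eq_two, Fin.zero_eta, Matrix.cons_val_zero]
    rw [h, rad_sq, show p 0^2 - (p 1^2+p 2^2) + p 1^2 + p 2^2 = p 0^2 by ring, Real.sqrt_sq h0]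
  · rfl
  · rfl

/-- every point of the cone lies on a hyperboloid with `s ≥ 2`, or has `t ≤ 3` -/
theorem cone_cases {p : Pt} (h2 : 2 ≤ p 0) (hr : rad p ≤ p 0 - 1) : (∃ s x, 2 ≤ s ∧ p = hyp s x) ∨ p 0 ≤ 3 := by
  have r0 := rad_nn p
  by_cases h : 4 ≤ p 0^2 - rad p^2
  · left
    refine ⟨Real.sqrt (p 0^2 - rad p^2), fun i => p i.succ, ?_, (hyp_surj (by linarith) ?_).symm⟩
    · exact Real.le_sqrt_of_sq_le (by linarith)
    · rw [Real.sq_sqrt (by linarith)]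
  · right; push Not at h; nlinarith

theorem tx_le {p : Pt} (h2 : 2 ≤ p 0) (hr : rad p ≤ p 0 - 1) : |p 1| ≤ p 0 ∧ |p 2| ≤ p 0 :=
  ⟨(abs1_le_rad p).trans (by linarith), (abs2_le_rad p).trans (by linarith)⟩

theorem stepW {K : ℝ} (hK : 1 ≤ K) : ∃ C, 1 ≤ C ∧ ∀ {η κ : ℝ} {w F : Pt → ℝ}, Sm w → Sup w → negBox w = F → BF K η F → LocB 8 κ w →
    BW (C * (κ + η^2)) w := by
  obtain ⟨C1, hC1, H1⟩ := stepW1 hK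
  obtain ⟨C2, hC2, H2⟩ := sS_LH hK
  refine ⟨C1 + 6 * (3 * (60 * (27 + 9 * C2 + K))), by nlinarith, fun {η κ w F} hw sw he hB hL => ?_⟩
  have hκ := hL.nn
  have hη := sq_nonneg η
  set A := κ + η^2 with hA
  have hA0 : 0 ≤ A := by positivity
  have h1 := H1 hw sw he hB.sm hB.sup hB.f6 (hL.mono (by omega))
  have h2 := H2 hw sw he hB (hL.mono (by omega))
  have h1' : ∀ s, 2 ≤ s → ∀ α, LH s (C1 * (κ + η^2) * yy s) (nmF Z5 (dn s) 6 (pd α w)) := by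
    intro s hs α
    refine H1 (F := pd α F) (smPd hw α) (sw.pd α) ?_ (smPd hB.sm α) (hB.sup.pd α) (fun s hs => hB.f6' s hs α) (hL.der α) s hs
    rw [← dd_emb, dd_negBox hw, he]
  set M := (27 + 9 * C2 + K) * A with hM
  have M0 : 0 ≤ M := by positivity
  have eM : M = 27 * A + 9 * C2 * A + K * A := by rw [hM]; ring
  have t1 : 0 ≤ 9 * C2 * A := by positivity
  have t2 : 0 ≤ K * A := by positivity
  have κA : κ ≤ A := by rw [hA]; linarith
  have ηA : η^2 ≤ A := by rw [hA]; linarith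
  have pt : ∀ p : Pt, 2 ≤ p 0 → rad p ≤ p 0 - 1 → ∀ l : List (Fin 5), l.length ≤ 3 → |Dw l w p| ≤ M ∧ |Sf (Dw l w) p| ≤ M := by
    intro p hp hr l hl
    rcases cone_cases hp hr with ⟨s, x, hs, rfl⟩ | h3
    · obtain ⟨a, b⟩ := sharp_pt hs hw sw (h2 s hs) hl x
      constructor <;> linarith
    · obtain ⟨e1, e2⟩ := tx_le hp hr
      have a := hL.w (l := l) (by omega) hp h3
      have b := Sf_loc hp h3 e1 e2 (hL.pd (l := l) (by omega) hp h3)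
      constructor <;> linarith
  have pb : ∀ p : Pt, 2 ≤ p 0 → rad p ≤ p 0 - 1 → ∀ l : List (Fin 5), l.length ≤ 1 → |negBox (Dw l w) p| ≤ M / p 0^2 := by
    intro p hp hr l hl
    rcases cone_cases hp hr with ⟨s, x, hs, rfl⟩ | h3
    · rw [Dw_negBox hw, he]
      refine (nmF_Dw (N := aN) (k := 1) Sn_aN (Wd5 hl)).trans ((hB.p1 s hs x).trans ?_)
      rw [← mul_div_assoc]
      refine div_le_div_of_nonneg_right ?_ (sq_nonneg _)
      have := mul_le_mul_of_nonneg_left ηA (by linarith : 0 ≤ K)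
      linarith
    · have d2 : ∀ α, |pd α (pd α (Dw l w)) p| ≤ κ := by
        intro α
        have := hL.pd (l := l ++ [emb α]) (by simp; omega) hp h3 α
        simpa [Dw_append, Dw, dd_emb] using this
      have a0 := d2 0; have a1 := d2 1; have a2 := d2 2
      have : |negBox (Dw l w) p| ≤ 3 * κ := by
        unfold negBox; rw [abs_le] at a0 a1 a2 ⊢; constructor <;> linarith
      rw [le_div_iff₀ (by positivity)]
      have : p 0^2 ≤ 9 := by nlinarith
      nlinarith [abs_nonneg (negBox (Dw l w) p)]
  have nb : ∀ l : List (Fin 5), l.length ≤ 1 → ∀ s, 2 ≤ s → ∀ x, ∀ α, |pd α (Dw l w) (hyp s x)| ≤ 60 * M / s := by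
    intro l hl s hs x α
    have hs0 : 0 < s := by linarith
    by_cases hx : rad (hyp s x) ≤ hyp s x 0 - 1
    · have := null_bd (smDw hw l) (K := M) (fun p hp hr => ⟨(pt p hp hr l (by omega)).1, (pt p hp hr l (by omega)).2, fun a => ?_, fun a b => ?_, pb p hp hr l hl⟩) (hs.trans (hyp_le hs0 x)) hx α
      · set p := hyp s x
        have ht : 0 < p 0 := hyp_pos hs0 x
        have r0 := rad_nn p
        have es : p 0^2 - rad p^2 = s^2 := by rw [rad_sq, hyp_sq s x]; simp [p, hyp]
        have e : s^2 ≤ 2 * (p 0 * (p 0 - rad p)) := by nlinarith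
        have q : s^2 * pd α (Dw l w) p^2 ≤ 2 * (40*M)^2 := by nlinarith [sq_nonneg (pd α (Dw l w) p)]
        rw [le_div_iff₀ hs0]
        refine abs_le_of_sq_le_sq' (a := |pd α (Dw l w) p| * s) ?_ (by positivity) |>.2
        rw [mul_pow, sq_abs]; nlinarith [sq_nonneg M]
      · obtain ⟨i, hi⟩ := dd34 a (Dw l w)
        have := (pt p hp hr (l ++ [i]) (by simp; omega)).1
        rw [hi]; simpa [Dw_append, Dw] using this
      · obtain ⟨i, hi⟩ := dd34 b (Dw l w)
        obtain ⟨j, hj⟩ := dd34 a (dd i (Dw l w))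
        have := (pt p hp hr (l ++ [i, j]) (by simp; omega)).1
        rw [hi, hj]; simpa [Dw_append, Dw] using this
    · rw [((sw.Dw l).pd α).hyp0 hs hx]; simp; positivity
  refine ⟨hw, sw, fun s hs => (h1 s hs).le ?_, fun s hs α => (h1' s hs α).le ?_, fun s hs x => ?_, fun s hs x => ?_⟩
  · have := yy_one (by linarith : 1 ≤ s)
    refine mul_le_mul_of_nonneg_right (mul_le_mul_of_nonneg_right ?_ hA0) (by linarith)
    nlinarith
  · have := yy_one (by linarith : 1 ≤ s)
    refine mul_le_mul_of_nonneg_right (mul_le_mul_of_nonneg_right ?_ hA0) (by linarith)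
    nlinarith
  · have hs0 : 0 < s := by linarith
    refine (nmF_le (K := 3 * (60 * M / s)) (by positivity) fun l hl => ?_).trans ?_
    · have := nb l hl.1 s hs x
      unfold dA; linarith [this 0, this 1, this 2]
    · rw [show (6:ℝ)^1 * (3 * (60 * M / s)) = (6 * (3 * (60 * M))) / s by ring]
      refine div_le_div_of_nonneg_right ?_ hs0.le
      rw [hM]; nlinarith [mul_nonneg (by linarith : 0 ≤ C1) hA0]
  · have hs0 : 0 < s := by linarith
    have := (sharp_pt hs hw sw (h2 s hs) (l := []) (by simp) x).1
    simp only [Dw] at this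
    refine this.trans ?_
    have : C2 * A * 9 ≤ C2 * A * (6*(3*(60*9))) := mul_le_mul_of_nonneg_left (by norm_num) (by positivity)
    have := mul_nonneg (by linarith : 0 ≤ C1) hA0
    nlinarith

theorem nm_pd_leN {A N} (hN : Sn N) {u} (hu : Sm u) (α : Fin 3) (k p) :
    nmF A N k (pd α u) p ≤ 16^k * nmF A (fun u p => N (pd 0 u) p + N (pd 1 u) p + N (pd 2 u) p) k u p := by
  set M : (Pt → ℝ) → Pt → ℝ := fun u p => N (pd 0 u) p + N (pd 1 u) p + N (pd 2 u) p with hM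
  have hS : Sn M :=
    { nn := fun u p => by have h := hN.nn; simp only [hM]; linarith [h (pd 0 u) p, h (pd 1 u) p, h (pd 2 u) p]
      add := fun u v p hu hv => by
        simp only [hM, pd_add hu hv]
        linarith [hN.add _ _ p (smPd hu 0) (smPd hv 0), hN.add _ _ p (smPd hu 1) (smPd hv 1), hN.add _ _ p (smPd hu 2) (smPd hv 2)]
      smul := fun u p c hu => by
        simp only [hM, pd_cmul hu, hN.smul _ _ _ (smPd hu _)]; ring }
  induction k generalizing u α with
  | zero =>
    simp only [nmF, hM, pow_zero, one_mul]
    have h := fun α => hN.nn (pd α u) p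
    fin_cases α <;> simp <;> linarith [h 0, h 1, h 2]
  | succ k ih =>
    have hn := nmF_nn (A := A) hS k u p
    have h2 : ∑ i ∈ A, nmF A N k (dd i (pd α u)) p ≤ ∑ i ∈ A, (16^k * nmF A M k (dd i u) p + 3 * (16^k * nmF A M k u p)) := by
      refine Finset.sum_le_sum fun i _ => ?_
      linarith [nm_dd_pd (A := A) hN hu i α k p, ih (smDd hu i) α, ih hu 0, ih hu 1, ih hu 2]
    have h3 : ∑ i ∈ A, 3 * (16^k * nmF A M k u p) ≤ 5 * (3 * (16^k * nmF A M k u p)) :=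
      sum_le_five (by positivity) fun i _ => le_rfl
    have h1 := ih hu α
    rw [Finset.sum_add_distrib, ← Finset.mul_sum] at h2
    simp only [nmF]
    have h4 : 0 ≤ ∑ i ∈ A, nmF A M k (dd i u) p := Finset.sum_nonneg fun i _ => nmF_nn hS _ _ _
    rw [pow_succ]
    have : (0:ℝ) < 16^k := by positivity
    nlinarith [mul_nonneg this.le h4]

theorem d2_id {u : Pt → ℝ} (hu : Sm u) (p : Pt) :
    (p 0^2 - p 1^2 - p 2^2) * pd 0 (pd 0 u) p = p 0^2 * negBox u p + p 0 * (pd 1 (boost 0 u) p + pd 2 (boost 1 u) p) - 2 * p 0 * pd 0 u p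
      - p 1 * (pd 0 (boost 0 u) p - pd 1 u p) - p 2 * (pd 0 (boost 1 u) p - pd 2 u p) ∧
    p 0 * pd 1 (pd 0 u) p = pd 0 (boost 0 u) p - pd 1 u p - p 1 * pd 0 (pd 0 u) p ∧
    p 0 * pd 2 (pd 0 u) p = pd 0 (boost 1 u) p - pd 2 u p - p 2 * pd 0 (pd 0 u) p ∧
    p 0 * pd 1 (pd 1 u) p = pd 1 (boost 0 u) p - pd 0 u p - p 1 * pd 1 (pd 0 u) p ∧
    p 0 * pd 2 (pd 2 u) p = pd 2 (boost 1 u) p - pd 0 u p - p 2 * pd 2 (pd 0 u) p ∧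
    p 0 * pd 2 (pd 1 u) p = pd 2 (boost 0 u) p - p 1 * pd 2 (pd 0 u) p := by
  simp only [boost0, boost1, negBox]
  simp (disch := fun_prop) only [pd_add, pd_mul, pd_coord, pd_comm hu 0 1, pd_comm hu 0 2, pd_comm hu 1 2]
  refine ⟨?_, ?_, ?_, ?_, ?_, ?_⟩ <;> simp <;> ring

theorem d2_bd {u : Pt → ℝ} (hu : Sm u) {s : ℝ} (hs : 0 < s) (x) :
    d2A u (hyp s x) ≤ 50 * (hyp s x 0 ^ 2 * |negBox u (hyp s x)| + 4 * hyp s x 0 * nmF Z5 dA 1 u (hyp s x)) / s^2 := by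
  obtain ⟨e0, e1, e2, e3, e4, e5⟩ := d2_id hu (hyp s x)
  have ht := hyp_pos hs x
  have hst := hyp_le hs x
  obtain ⟨x1, x2⟩ := x_le_t hs x
  have hq := hyp_sq s x
  rw [← hyp1 s x, ← hyp2 s x] at hq
  set p := hyp s x
  have n1 : dA u p + dA (boost 0 u) p + dA (boost 1 u) p ≤ nmF Z5 dA 1 u p := by
    have h := fun i => Sn_dA.nn (dd i u) p
    simp only [nmF, Z5, Fin.sum_univ_five]
    have e3 : dd 3 u = boost 0 u := rfl
    have e4 : dd 4 u = boost 1 u := rfl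
    rw [← e3, ← e4]; linarith [h 0, h 1, h 2]
  set B := nmF Z5 dA 1 u p
  have d0 := Sn_dA.nn u p
  have d1 := Sn_dA.nn (boost 0 u) p
  have d2 := Sn_dA.nn (boost 1 u) p
  have bd : ∀ v, dA v p ≤ B → ∀ α, |pd α v p| ≤ B := fun v hv α => by
    refine le_trans ?_ hv
    unfold dA; fin_cases α <;> simp <;> linarith [abs_nonneg (pd 0 v p), abs_nonneg (pd 1 v p), abs_nonneg (pd 2 v p)]
  have bu := bd u (by linarith)
  have b0 := bd _ (by linarith : dA (boost 0 u) p ≤ B)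
  have b1 := bd _ (by linarith : dA (boost 1 u) p ≤ B)
  have hB : 0 ≤ B := (abs_nonneg _).trans (bu 0)
  set M := p 0^2 * |negBox u p| + 8 * p 0 * B with hM
  have hM0 : 0 ≤ M := by positivity
  have st : s^2 ≤ p 0^2 := by nlinarith
  have hsp : 0 < s^2 := by positivity
  have key : ∀ (q z a b : ℝ) (c : ℝ), p 0 * q = a - z * b → |z| ≤ p 0 → |a| ≤ 2 * B → s^2 * |b| ≤ c → s^2 * |q| ≤ c + M := by
    intro q z a b c e hz ha hb
    have : p 0 * |q| ≤ 2 * B + p 0 * |b| := by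
      rw [← abs_of_pos ht, ← abs_mul, e, abs_of_pos ht]
      exact (abs_sub _ _).trans (add_le_add ha (by rw [abs_mul]; exact mul_le_mul_of_nonneg_right hz (abs_nonneg _)))
    have h2 : p 0 * (s^2 * |q|) ≤ p 0 * (c + M) := by
      have z : 0 ≤ p 0 ^ 2 * |negBox u p| * p 0 := by positivity
      have := mul_le_mul_of_nonneg_right st (by linarith : 0 ≤ 2 * B)
      have f1 := mul_nonneg hB (sq_nonneg (p 0))
      have f2 := mul_le_mul_of_nonneg_left hb ht.le
      have f3 := mul_le_mul_of_nonneg_left ‹p 0 * |q| ≤ _› hsp.le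
      rw [hM]; linarith
    exact le_of_mul_le_mul_left h2 ht
  have k0 : s^2 * |pd 0 (pd 0 u) p| ≤ M := by
    have e : p 0^2 - p 1^2 - p 2^2 = s^2 := by rw [hq]; ring
    rw [e] at e0
    rw [← abs_of_pos hsp, ← abs_mul, e0]
    have a1 : |p 0^2 * negBox u p| ≤ p 0^2 * |negBox u p| := by rw [abs_mul, abs_of_nonneg (by positivity)]
    have a2 : |p 0 * (pd 1 (boost 0 u) p + pd 2 (boost 1 u) p)| ≤ p 0 * (B + B) := abs_mul_le (by rw [abs_of_pos ht]) ((abs_add_le _ _).trans (add_le_add (b0 1) (b1 2)))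
    have a3 : |2 * p 0 * pd 0 u p| ≤ 2 * p 0 * B := abs_mul_le (by rw [abs_of_pos (by positivity)]) (bu 0)
    have a4 : |p 1 * (pd 0 (boost 0 u) p - pd 1 u p)| ≤ p 0 * (B + B) := abs_mul_le x1 ((abs_sub _ _).trans (add_le_add (b0 0) (bu 1)))
    have a5 : |p 2 * (pd 0 (boost 1 u) p - pd 2 u p)| ≤ p 0 * (B + B) := abs_mul_le x2 ((abs_sub _ _).trans (add_le_add (b1 0) (bu 2)))
    rw [abs_le] at a1 a2 a3 a4 a5 ⊢
    constructor <;> linarith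
  have s2 : ∀ a b : ℝ, |a| ≤ B → |b| ≤ B → |a - b| ≤ 2 * B := fun a b ha hb => (abs_sub _ _).trans (by linarith)
  have k1 := key _ _ _ _ _ e1 x1 (s2 _ _ (b0 0) (bu 1)) k0
  have k2 := key _ _ _ _ _ e2 x2 (s2 _ _ (b1 0) (bu 2)) k0
  have k3 := key _ _ _ _ _ e3 x1 (s2 _ _ (b0 1) (bu 0)) k1
  have k4 := key _ _ _ _ _ e4 x2 (s2 _ _ (b1 2) (bu 0)) k2
  have k5 := key _ _ _ _ _ e5 x1 ((b0 2).trans (by linarith)) k2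
  rw [le_div_iff₀ hsp]
  unfold d2A dA
  rw [pd_comm hu 0 1, pd_comm hu 0 2, pd_comm hu 1 2]
  have hneg : 0 ≤ p 0^2 * |negBox u p| := by positivity
  have hneg' : 0 ≤ p 0 * B := by positivity
  have : (50:ℝ) * (p 0 ^ 2 * |negBox u p| + 4 * p 0 * B) = 25 * M + 25 * (p 0 ^ 2 * |negBox u p|) := by rw [hM]; ring
  rw [this]; linarith

def Q0 (f g : Pt → ℝ) (p : Pt) : ℝ := pd 0 f p * pd 0 g p - pd 1 f p * pd 1 g p - pd 2 f p * pd 2 g p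

theorem smQ0 {f g : Pt → ℝ} (hf : Sm f) (hg : Sm g) : Sm (Q0 f g) := by unfold Q0; fun_prop

theorem dd_Q0 {f g : Pt → ℝ} (hf : Sm f) (hg : Sm g) (i : Fin 5) : dd i (Q0 f g) = fun p => Q0 (dd i f) g p + Q0 f (dd i g) p := by
  have e : Q0 f g = fun p => pd 0 f p * pd 0 g p - pd 1 f p * pd 1 g p - pd 2 f p * pd 2 g p := rfl
  rw [e]
  ext p
  fin_cases i <;> simp only [dd, Q0, boost0, boost1, Fin.zero_eta, Fin.mk_one, Fin.reduceFinMk, Matrix.cons_val] <;>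
    simp (disch := fun_prop) only [pd_add, pd_sub, pd_mul, pd_coord, pd_comm hf 1 0, pd_comm hf 2 0, pd_comm hf 2 1, pd_comm hg 1 0, pd_comm hg 2 0, pd_comm hg 2 1] <;> (try simp) <;> ring

theorem Q0_comm (f g : Pt → ℝ) (p) : Q0 f g p = Q0 g f p := by unfold Q0; ring

theorem negBox_mul {f g : Pt → ℝ} (hf : Sm f) (hg : Sm g) : negBox (fun p => f p * g p) = fun p => negBox f p * g p + f p * negBox g p + 2 * Q0 f g p := by
  ext p; unfold negBox Q0
  simp (disch := fun_prop) only [pd_add, pd_mul]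
  ring

theorem negBox_pd {w : Pt → ℝ} (hw : Sm w) (α : Fin 3) : negBox (pd α w) = pd α (negBox w) := by
  rw [← dd_emb, dd_negBox hw]

theorem negBox_add {f g : Pt → ℝ} (hf : Sm f) (hg : Sm g) : negBox (fun p => f p + g p) = fun p => negBox f p + negBox g p := by
  ext p; unfold negBox
  simp (disch := fun_prop) only [pd_add]
  ring
theorem negBox_cmul {f : Pt → ℝ} (hf : Sm f) (c : ℝ) : negBox (fun p => c * f p) = fun p => c * negBox f p := by
  ext p; unfold negBox
  simp (disch := fun_prop) only [pd_cmul]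
  ring

theorem negBox_Qf {P : Fin 3 → Fin 3 → ℝ} {w F : Pt → ℝ} (hw : Sm w) (he : negBox w = F) :
    negBox (Qf P w) = fun q => ∑ α : Fin 3, ∑ β : Fin 3, P α β * (pd α F q * pd β w q + pd α w q * pd β F q + 2 * Q0 (pd α w) (pd β w) q) := by
  have key : ∀ α β, negBox (fun q => pd α w q * pd β w q) = fun q => pd α F q * pd β w q + pd α w q * pd β F q + 2 * Q0 (pd α w) (pd β w) q := fun α β => by
    rw [negBox_mul (smPd hw α) (smPd hw β), negBox_pd hw, negBox_pd hw, he]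
  rw [Qf_eq]
  simp only [Fin.sum_univ_three]
  simp (disch := fun_prop) only [negBox_add, negBox_cmul, key]

theorem Q0_bd {f g : Pt → ℝ} {s : ℝ} (hs : 0 < s) (x) : |Q0 f g (hyp s x)| ≤
    (s / hyp s x 0 * |pd 0 f (hyp s x)| + 2 * (hyp s x 0 / s) * (|ubd 0 f (hyp s x)| + |ubd 1 f (hyp s x)|)) * dn s g (hyp s x)
    + |pd 0 f (hyp s x)| * (|ubd 0 g (hyp s x)| + |ubd 1 g (hyp s x)|) := by
  have ht := hyp_pos hs x
  have hst := hyp_le hs x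
  obtain ⟨x1, x2⟩ := x_le_t hs x
  have hq := hyp_sq s x
  rw [← hyp1 s x, ← hyp2 s x] at hq
  have hg := dA_le_dn hs g x
  set p := hyp s x
  have ts : 1 ≤ p 0 / s := by rw [le_div_iff₀ hs]; linarith
  have g0 : |pd 0 g p| ≤ p 0 / s * dn s g p := le_trans (by unfold dA; linarith [abs_nonneg (pd 1 g p), abs_nonneg (pd 2 g p)]) hg
  have u0 : |ubd 0 g p| ≤ dn s g p ∧ |ubd 1 g p| ≤ dn s g p := by
    have := Sn_dA.nn g p
    have : 0 ≤ |s * (p 0)⁻¹| * dA g p := by positivity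
    unfold dn; constructor <;> linarith [abs_nonneg (ubd 0 g p), abs_nonneg (ubd 1 g p)]
  have dn0 := (Sn_dn s).nn g p
  have r1 : |p 1 / p 0| ≤ 1 := by rw [abs_div, abs_of_pos ht, div_le_one ht]; exact x1
  have r2 : |p 2 / p 0| ≤ 1 := by rw [abs_div, abs_of_pos ht, div_le_one ht]; exact x2
  have e : Q0 f g p = (s^2 / p 0^2) * pd 0 f p * pd 0 g p - ubd 0 f p * ubd 0 g p - ubd 1 f p * ubd 1 g p
      + ((p 1 / p 0) * (pd 0 f p * ubd 0 g p) + (p 2 / p 0) * (pd 0 f p * ubd 1 g p)) + ((p 1 / p 0) * (pd 0 g p * ubd 0 f p) + (p 2 / p 0) * (pd 0 g p * ubd 1 f p)) := by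
    have : s^2 = p 0^2 - p 1^2 - p 2^2 := by rw [hq]; ring
    rw [this]
    simp only [ubd, Q0, Fin.succ_zero_eq_one, Fin.succ_one_eq_two]
    field_simp; ring
  have a1 : |(s^2 / p 0^2) * pd 0 f p * pd 0 g p| ≤ s / p 0 * |pd 0 f p| * dn s g p := by
    rw [abs_mul, abs_mul, abs_of_nonneg (by positivity : 0 ≤ s^2/p 0^2)]
    calc _ ≤ s^2 / p 0^2 * |pd 0 f p| * (p 0 / s * dn s g p) := mul_le_mul_of_nonneg_left g0 (by positivity)
      _ = _ := by field_simp
  have a2 : ∀ a b c : ℝ, |a| ≤ 1 → |a * (b * c)| ≤ |b| * |c| := fun a b c h => by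
    rw [abs_mul, abs_mul]; exact mul_le_of_le_one_left (by positivity) h
  have a3 : ∀ a b : ℝ, |b| ≤ dn s g p → |a * b| ≤ p 0 / s * |a| * dn s g p := fun a b h => by
    rw [abs_mul]
    calc _ ≤ |a| * dn s g p := mul_le_mul_of_nonneg_left h (abs_nonneg _)
      _ ≤ p 0 / s * (|a| * dn s g p) := le_mul_of_one_le_left (by positivity) ts
      _ = _ := by ring
  have a4 : ∀ a z : ℝ, |z| ≤ 1 → |z * (pd 0 g p * a)| ≤ p 0 / s * |a| * dn s g p := fun a z h => by
    refine (a2 _ _ _ h).trans ?_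
    calc _ ≤ (p 0 / s * dn s g p) * |a| := mul_le_mul_of_nonneg_right g0 (abs_nonneg _)
      _ = _ := by ring
  have b1 := a3 (ubd 0 f p) _ u0.1
  have b2 := a3 (ubd 1 f p) _ u0.2
  have b3 := a2 _ (pd 0 f p) (ubd 0 g p) r1
  have b4 := a2 _ (pd 0 f p) (ubd 1 g p) r2
  have b5 := a4 (ubd 0 f p) _ r1
  have b6 := a4 (ubd 1 f p) _ r2
  rw [e]
  have tri : ∀ a b c d e f g : ℝ, |a - b - c + (d + e) + (f + g)| ≤ |a| + |b| + |c| + |d| + |e| + |f| + |g| := fun a b c d e f g => by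
    rw [abs_le]; constructor <;> linarith [neg_abs_le a, neg_abs_le b, neg_abs_le c, neg_abs_le d, neg_abs_le e, neg_abs_le f, neg_abs_le g, le_abs_self a, le_abs_self b, le_abs_self c, le_abs_self d, le_abs_self e, le_abs_self f, le_abs_self g]
  refine (tri _ _ _ _ _ _ _).trans ?_
  linarith

theorem ubd_boost' (a : Fin 2) (u : Pt → ℝ) {s : ℝ} (hs : 0 < s) (x) : |ubd a u (hyp s x)| = |boost a u (hyp s x)| / hyp s x 0 := by
  have ht := hyp_pos hs x
  have : ubd a u (hyp s x) = boost a u (hyp s x) / hyp s x 0 := by unfold ubd boost; field_simp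
  rw [this, abs_div, abs_of_pos ht]

theorem d2_w {K : ℝ} (hK : 1 ≤ K) : ∃ c, 1 ≤ c ∧ ∀ {η w F}, η ≤ 1 → BW η w → negBox w = F → BF K η F → ∀ {s}, 2 ≤ s → ∀ x α,
    nmF Z5 dA 3 (pd α w) (hyp s x) ≤ c * (η * yy s * hyp s x 0 / s^3) := by
  obtain ⟨C4, hC4, H4⟩ := BW.a4
  refine ⟨16^3 * (6^3 * (50 * (K + 4 * C4))), by nlinarith, fun {η w F} hη hw he hF {s} hs x α => ?_⟩
  have hs0 : 0 < s := by linarith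
  have ht := hyp_pos hs0 x
  have hη0 := hw.nn
  have y1 := yy_one (by linarith : 1 ≤ s)
  have a := nm_pd_leN (A := Z5) Sn_dA hw.sm α 3 (hyp s x)
  rw [mul_assoc ((16:ℝ)^3)]
  refine a.trans (mul_le_mul_of_nonneg_left ?_ (by positivity))
  rw [mul_assoc ((6:ℝ)^3)]
  refine nmF_le (by positivity) fun l hl => ?_
  refine (d2_bd (smDw hw.sm l) hs0 x).trans ?_
  have e : negBox (Dw l w) = Dw l F := by rw [Dw_negBox hw.sm, he]
  have n1 : |negBox (Dw l w) (hyp s x)| ≤ K * (η^2 * yy s / hyp s x 0^2) := by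
    rw [e]; exact (nmF_Dw (N := aN) Sn_aN hl).trans (hF.p3 s hs x)
  have n2 : nmF Z5 dA 1 (Dw l w) (hyp s x) ≤ C4 * (η * yy s / s) :=
    (nmF_Dw' Sn_dA hl).trans ((H4 hw hs x).1)
  have ts := t_s hs x
  have m1 : hyp s x 0^2 * |negBox (Dw l w) (hyp s x)| ≤ K * (η * yy s) * (hyp s x 0 / s) := by
    calc _ ≤ hyp s x 0^2 * (K * (η^2 * yy s / hyp s x 0^2)) := mul_le_mul_of_nonneg_left n1 (by positivity)
      _ = K * (η * yy s) * η := by field_simp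
      _ ≤ _ := mul_le_mul_of_nonneg_left (by linarith) (by positivity)
  have m2 := mul_le_mul_of_nonneg_left n2 (by positivity : 0 ≤ 4 * hyp s x 0)
  calc _ ≤ 50 * (K * (η * yy s) * (hyp s x 0 / s) + 4 * hyp s x 0 * (C4 * (η * yy s / s))) / s^2 := by
        apply div_le_div_of_nonneg_right _ (by positivity); linarith
    _ = _ := by field_simp

theorem Q0_w {K : ℝ} (hK : 1 ≤ K) : ∃ c, 1 ≤ c ∧ ∀ {η w F}, η ≤ 1 → BW η w → negBox w = F → BF K η F → ∀ {s}, 2 ≤ s → ∀ x α β i j l1 l2,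
    i + j ≤ 6 → i ≤ 3 → l1 ∈ Wd Z5 i → l2 ∈ Wd Z5 j →
    |Q0 (Dw l1 (pd α w)) (Dw l2 (pd β w)) (hyp s x)| ≤ c * ((η * yy s / s^2 + (if i + j = 6 then η / s else 0)) * dW s w (hyp s x)) := by
  obtain ⟨C4, hC4, H4⟩ := BW.a4
  obtain ⟨c2, hc2, H2⟩ := d2_w hK
  refine ⟨c2 + 4 * (16^4 * C4) + 2 * C4 * 16^6, by nlinarith, fun {η w F} hη hw he hF {s} hs x α β i j l1 l2 hij hi h1 h2 => ?_⟩
  have hs0 : 0 < s := by linarith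
  have ht := hyp_pos hs0 x
  have hη0 := hw.nn
  have y1 := yy_one (by linarith : 1 ≤ s)
  have sf := smDw (smPd hw.sm α) l1
  have d0 := dW_nn s w (hyp s x)
  have f0 : |pd 0 (Dw l1 (pd α w)) (hyp s x)| ≤ dA (Dw l1 (pd α w)) (hyp s x) := by
    unfold dA; linarith [abs_nonneg (pd 1 (Dw l1 (pd α w)) (hyp s x)), abs_nonneg (pd 2 (Dw l1 (pd α w)) (hyp s x))]
  have f1 : |pd 0 (Dw l1 (pd α w)) (hyp s x)| ≤ c2 * (η * yy s * hyp s x 0 / s^3) :=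
    f0.trans ((nmF_Dw Sn_dA (Wd_mono hi h1)).trans (H2 hη hw he hF hs x α))
  have f2 : |pd 0 (Dw l1 (pd α w)) (hyp s x)| ≤ C4 * (η * yy s / s) :=
    f0.trans ((nmF_Dw Sn_dA (Wd_mono (by omega : i ≤ 4) h1)).trans ((H4 hw hs x).2 α))
  have fu : ∀ a, |ubd a (Dw l1 (pd α w)) (hyp s x)| ≤ 16^4 * C4 * (η * yy s / s) / hyp s x 0 := by
    intro a
    rw [ubd_boost' a _ hs0]
    refine div_le_div_of_nonneg_right ?_ ht.le
    have : |boost a (Dw l1 (pd α w)) (hyp s x)| ≤ nmF Z5 aN 4 (pd α w) (hyp s x) := by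
      have hl : ∀ q : Fin 5, |dd q (Dw l1 (pd α w)) (hyp s x)| ≤ nmF Z5 aN 4 (pd α w) (hyp s x) := fun q => by
        have := nmF_Dw (A := Z5) (N := aN) (k := 4) (u := pd α w) (p := hyp s x) Sn_aN (l := l1 ++ [q]) (Wd5 (by have := h1.1; simp; omega))
        simpa [Dw_append, Dw, aN] using this
      fin_cases a
      · exact hl 3
      · exact hl 4
    rw [mul_assoc]
    exact this.trans ((nm_pd_le hw.sm α 4 _).trans (mul_le_mul_of_nonneg_left (H4 hw hs x).1 (by positivity)))
  have gd : dn s (Dw l2 (pd β w)) (hyp s x) ≤ dW s w (hyp s x) :=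
    (nmF_Dw (Sn_dn s) (Wd_mono (by omega : j ≤ 6) h2)).trans (dW_ge' s w _ β)
  have ts := t_s hs x
  have part1 : (s / hyp s x 0 * |pd 0 (Dw l1 (pd α w)) (hyp s x)| + 2 * (hyp s x 0 / s) * (|ubd 0 (Dw l1 (pd α w)) (hyp s x)| + |ubd 1 (Dw l1 (pd α w)) (hyp s x)|)) * dn s (Dw l2 (pd β w)) (hyp s x)
      ≤ (c2 + 4 * (16^4 * C4)) * ((η * yy s / s^2) * dW s w (hyp s x)) := by
    calc _ ≤ (s / hyp s x 0 * (c2 * (η * yy s * hyp s x 0 / s^3)) + 2 * (hyp s x 0 / s) * (16^4 * C4 * (η * yy s / s) / hyp s x 0 + 16^4 * C4 * (η * yy s / s) / hyp s x 0)) * dW s w (hyp s x) := by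
          refine mul_le_mul (add_le_add (mul_le_mul_of_nonneg_left f1 (by positivity)) (mul_le_mul_of_nonneg_left (add_le_add (fu 0) (fu 1)) (by positivity))) gd ((Sn_dn s).nn _ _) (by positivity)
      _ = _ := by field_simp; ring
  have gub : ∀ a, |ubd a (Dw l2 (pd β w)) (hyp s x)| ≤ dW s w (hyp s x) := by
    intro a
    refine le_trans ?_ gd
    have := Sn_dA.nn (Dw l2 (pd β w)) (hyp s x)
    have : 0 ≤ |s * (hyp s x 0)⁻¹| * dA (Dw l2 (pd β w)) (hyp s x) := by positivity
    unfold dn; fin_cases a <;> simp only [Fin.zero_eta, Fin.mk_one] <;> linarith [abs_nonneg (ubd 0 (Dw l2 (pd β w)) (hyp s x)), abs_nonneg (ubd 1 (Dw l2 (pd β w)) (hyp s x))]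
  have part2 : |pd 0 (Dw l1 (pd α w)) (hyp s x)| * (|ubd 0 (Dw l2 (pd β w)) (hyp s x)| + |ubd 1 (Dw l2 (pd β w)) (hyp s x)|)
      ≤ 2 * C4 * 16^6 * ((η * yy s / s^2 + (if i + j = 6 then η / s else 0)) * dW s w (hyp s x)) := by
    have dn0 : 0 ≤ η / s * dW s w (hyp s x) := by positivity
    have dn1 : 0 ≤ η * yy s / s^2 * dW s w (hyp s x) := by positivity
    have hif : 0 ≤ (if i + j = 6 then η / s else 0) * dW s w (hyp s x) := by split_ifs <;> [exact dn0; simp]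
    by_cases hj : j = 6
    · have hi0 : i = 0 := by omega
      subst hj hi0
      have hl1 : l1 = [] := by have := h1.1; exact List.length_eq_zero_iff.1 (by omega)
      have f3 : |pd 0 (Dw l1 (pd α w)) (hyp s x)| ≤ η / s := by
        refine f0.trans (le_trans ?_ (hw.w2 s hs x))
        rw [hl1]; simp only [Dw]; rw [← dd_emb]
        exact nmF_dd (A := Z5) Sn_dA 0 _ _ (Finset.mem_univ _)
      have := mul_le_mul f3 (add_le_add (gub 0) (gub 1)) (by positivity) (by positivity)
      refine this.trans ?_
      simp only [zero_add, ↓reduceIte]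
      have : 2 * (η / s * dW s w (hyp s x)) ≤ 2 * C4 * 16^6 * (η / s * dW s w (hyp s x)) := mul_le_mul_of_nonneg_right (by nlinarith) dn0
      have : 0 ≤ 2 * C4 * 16^6 * (η * yy s / s^2 * dW s w (hyp s x)) := by positivity
      rw [add_mul, mul_add (2 * C4 * 16^6)]
      linarith
    · have gu : ∀ a, |ubd a (Dw l2 (pd β w)) (hyp s x)| ≤ 16^6 * (dW s w (hyp s x) / s) := by
        intro a
        rw [ubd_boost' a _ hs0, div_le_iff₀ ht]
        have hl : ∀ q : Fin 5, |dd q (Dw l2 (pd β w)) (hyp s x)| ≤ nmF Z5 aN 6 (pd β w) (hyp s x) := fun q => by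
          have := nmF_Dw (A := Z5) (N := aN) (k := 6) (u := pd β w) (p := hyp s x) Sn_aN (l := l2 ++ [q]) (Wd5 (by have := h2.1; simp; omega))
          simpa [Dw_append, Dw, aN] using this
        have : |boost a (Dw l2 (pd β w)) (hyp s x)| ≤ nmF Z5 aN 6 (pd β w) (hyp s x) := by
          fin_cases a
          · exact hl 3
          · exact hl 4
        refine this.trans ((nm_pd_le hw.sm β 6 _).trans ?_)
        rw [mul_assoc]
        refine mul_le_mul_of_nonneg_left ?_ (by positivity)
        refine (nm_dA_dn hs0 w x).trans ((mul_le_mul_of_nonneg_left (dW_ge s w _) (by positivity)).trans (le_of_eq (by ring)))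
      have := mul_le_mul f2 (add_le_add (gu 0) (gu 1)) (by positivity) (by positivity)
      refine this.trans ?_
      rw [add_mul, mul_add (2 * C4 * 16^6)]
      have e : C4 * (η * yy s / s) * (16^6 * (dW s w (hyp s x) / s) + 16^6 * (dW s w (hyp s x) / s)) = 2 * C4 * 16^6 * (η * yy s / s^2 * dW s w (hyp s x)) := by field_simp; ring
      rw [e]
      have : 0 ≤ 2 * C4 * 16^6 * ((if i + j = 6 then η / s else 0) * dW s w (hyp s x)) := by positivity
      linarith
  refine (Q0_bd hs0 x).trans ((add_le_add part1 part2).trans ?_)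
  have hif : 0 ≤ (if i + j = 6 then η / s else 0) := by split_ifs <;> positivity
  have : (c2 + 4 * (16^4 * C4)) * ((η * yy s / s^2) * dW s w (hyp s x)) ≤ (c2 + 4 * (16^4 * C4)) * ((η * yy s / s^2 + (if i + j = 6 then η / s else 0)) * dW s w (hyp s x)) := by
    refine mul_le_mul_of_nonneg_left (mul_le_mul_of_nonneg_right (by linarith) d0) (by positivity)
  rw [add_mul (c2 + 4 * (16^4 * C4))]
  linarith

/-- the source of the `V` equation -/
theorem R_nm (P : Fin 3 → Fin 3 → ℝ) {K : ℝ} (hK : 1 ≤ K) : ∃ c, 1 ≤ c ∧ ∀ {η w F}, η ≤ 1 → BW η w → negBox w = F → BF K η F → ∀ {s}, 2 ≤ s → ∀ x k, k ≤ 6 →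
    nmF Z5 aN k (negBox (Qf P w)) (hyp s x) ≤ c * ((η * yy s / s) * (nmF Z5 aN 6 (pd 0 F) (hyp s x) + nmF Z5 aN 6 (pd 1 F) (hyp s x) + nmF Z5 aN 6 (pd 2 F) (hyp s x))
      + (η * yy s / s^2 + (if k = 6 then η / s else 0)) * dW s w (hyp s x)) := by
  obtain ⟨C4, hC4, H4⟩ := BW.a4
  obtain ⟨c0, hc0, H0⟩ := Q0_w hK
  set ct : ℝ := 16^6 * C4 + K * 16^6 with hct
  have hsP := sP_nn P
  refine ⟨(sP P + 1) * (2 * (12^6 * ct) + 2 * (12^6 * c0)), ?_, fun {η w F} hη hw he hF {s} hs x k hk => ?_⟩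
  · have : 1 ≤ ct := by rw [hct]; nlinarith
    nlinarith [mul_nonneg hsP (by linarith : 0 ≤ ct), mul_nonneg hsP (by linarith : 0 ≤ c0)]
  have hs0 : 0 < s := by linarith
  have ht := hyp_pos hs0 x
  have hst := hyp_le hs0 x
  have hη0 := hw.nn
  have y1 := yy_one (by linarith : 1 ≤ s)
  have d0 := dW_nn s w (hyp s x)
  have nF := fun α => nmF_nn (A := Z5) Sn_aN 6 (pd α F) (hyp s x)
  set Φ := nmF Z5 aN 6 (pd 0 F) (hyp s x) + nmF Z5 aN 6 (pd 1 F) (hyp s x) + nmF Z5 aN 6 (pd 2 F) (hyp s x) with hΦ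
  have hΦα : ∀ α, nmF Z5 aN 6 (pd α F) (hyp s x) ≤ Φ := fun α => by
    rw [hΦ]; fin_cases α <;> simp <;> linarith [nF 0, nF 1, nF 2]
  have hΦ0 : 0 ≤ Φ := (nF 0).trans (hΦα 0)
  have hif : 0 ≤ (if k = 6 then η / s else 0) := by split_ifs <;> positivity
  set δ := (if k = 6 then η / s else 0) with hδ
  set X := (η * yy s / s) * Φ + (η * yy s / s^2 + δ) * dW s w (hyp s x) with hX
  have z1 : 0 ≤ (η * yy s / s) * Φ := by positivity
  have z2 : 0 ≤ (η * yy s / s^2) * dW s w (hyp s x) := by positivity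
  have z3 : 0 ≤ δ * dW s w (hyp s x) := by positivity
  have X0 : 0 ≤ X := by rw [hX, add_mul]; linarith
  have hw' := hw.sm
  have hF' := hF.sm
  -- cubic terms
  have cub : ∀ α β, nmF Z5 aN k (fun q => pd α F q * pd β w q) (hyp s x) ≤ 12^6 * (ct * X) := by
    intro α β
    have : nmF Z5 aN k (fun q => pd α F q * pd β w q) (hyp s x) ≤ 12^k * (ct * X) := by
      refine nm_mul (by fun_prop) (by fun_prop) fun i j hij => ?_
      by_cases hj : j ≤ 4
      · have a := (nmF_mono (A := Z5) Sn_aN (by omega : i ≤ 6) (pd α F) (hyp s x)).trans (hΦα α)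
        have b := (nmF_mono (A := Z5) Sn_aN hj (pd β w) (hyp s x)).trans ((nm_pd_le hw.sm β 4 _).trans (mul_le_mul_of_nonneg_left (H4 hw hs x).1 (by positivity)))
        refine (mul_le_mul a b (nmF_nn Sn_aN _ _ _) hΦ0).trans ?_
        calc Φ * (16^4 * (C4 * (η * yy s / s))) = 16^4 * C4 * ((η * yy s / s) * Φ) := by ring
          _ ≤ ct * X := mul_le_mul (by rw [hct]; nlinarith) (by rw [hX, add_mul]; linarith) z1 (by rw [hct]; positivity)
      · have a : nmF Z5 aN i (pd α F) (hyp s x) ≤ K * (η^2 * yy s / hyp s x 0^2) := by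
          refine le_trans ?_ (hF.p3 s hs x)
          refine le_trans ?_ (nmF_mono Sn_aN (by omega : i + 1 ≤ 3) _ _)
          rw [← dd_emb]; exact nmF_dd Sn_aN _ _ _ (Finset.mem_univ _)
        have b : nmF Z5 aN j (pd β w) (hyp s x) ≤ 16^6 * (hyp s x 0 / s * dW s w (hyp s x)) :=
          (nmF_mono (A := Z5) Sn_aN (by omega : j ≤ 6) (pd β w) (hyp s x)).trans ((nm_pd_le hw.sm β 6 _).trans (mul_le_mul_of_nonneg_left ((nm_dA_dn hs0 w x).trans (mul_le_mul_of_nonneg_left (dW_ge s w _) (by positivity))) (by positivity)))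
        refine (mul_le_mul a b (nmF_nn Sn_aN _ _ _) (by positivity)).trans ?_
        have e : K * (η^2 * yy s / hyp s x 0^2) * (16^6 * (hyp s x 0 / s * dW s w (hyp s x))) = K * 16^6 * (η * (η * yy s) / (s * hyp s x 0) * dW s w (hyp s x)) := by field_simp
        rw [e]
        refine mul_le_mul (by rw [hct]; nlinarith) ?_ (by positivity) (by rw [hct]; positivity)
        have : η * (η * yy s) / (s * hyp s x 0) ≤ η * yy s / s^2 := by
          refine div_le_div₀ (by positivity) ?_ (by positivity) (by nlinarith)
          exact mul_le_of_le_one_left (by positivity) hη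
        have := mul_le_mul_of_nonneg_right this d0
        rw [hX, add_mul]; linarith
    exact this.trans (mul_le_mul_of_nonneg_right (pow_le_pow_right₀ (by norm_num) hk) (by rw [hct]; positivity))
  have qq : ∀ α β, nmF Z5 aN k (Q0 (pd α w) (pd β w)) (hyp s x) ≤ 12^6 * (c0 * X) := by
    intro α β
    have hc : c0 * ((η * yy s / s^2 + δ) * dW s w (hyp s x)) ≤ c0 * X := mul_le_mul_of_nonneg_left (by rw [hX]; linarith) (by linarith)
    have : nmF Z5 aN k (Q0 (pd α w) (pd β w)) (hyp s x) ≤ 6^k * (2^k * (c0 * X)) := by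
      refine nmF_le (by positivity) fun l hl => ?_
      refine leibW (fun f g hf hg => smQ0 hf hg) (fun f g i hf hg => dd_Q0 hf hg i) (smPd hw.sm α) (smPd hw.sm β) hl fun i j l1 l2 hij h1 h2 => ?_
      rcases le_total i j with h | h
      · have := H0 hη hw he hF hs x α β i j l1 l2 (by omega) (by omega) h1 h2
        rw [hij] at this
        exact this.trans hc
      · rw [Q0_comm]
        have := H0 hη hw he hF hs x β α j i l2 l1 (by omega) (by omega) h2 h1
        rw [add_comm j i, hij] at this
        exact this.trans hc
    refine this.trans ?_
    rw [← mul_assoc, ← mul_pow]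
    norm_num only
    exact mul_le_mul_of_nonneg_right ((pow_le_pow_right₀ (by norm_num) hk).trans (by norm_num)) (by positivity)
  rw [negBox_Qf hw.sm he]
  have := Qsum (A := Z5) (P := P) Sn_aN (k := k) (p := hyp s x) (K := 2 * (12^6 * (ct * X)) + 2 * (12^6 * (c0 * X)))
    (f := fun α β q => pd α F q * pd β w q + pd α w q * pd β F q + 2 * Q0 (pd α w) (pd β w) q)
    (fun α β => by have := smQ0 (smPd hw.sm α) (smPd hw.sm β); fun_prop) fun α β => ?_
  · refine this.trans ?_
    have : 0 ≤ 2 * (12^6 * (ct * X)) + 2 * (12^6 * (c0 * X)) := by rw [hct]; positivity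
    calc _ ≤ (sP P + 1) * (2 * (12^6 * (ct * X)) + 2 * (12^6 * (c0 * X))) := mul_le_mul_of_nonneg_right (by linarith) this
      _ = _ := by ring
  · have sq := smQ0 (smPd hw.sm α) (smPd hw.sm β)
    have a1 := nmF_add (A := Z5) Sn_aN (u := fun q => pd α F q * pd β w q + pd α w q * pd β F q) (v := fun q => 2 * Q0 (pd α w) (pd β w) q) (by fun_prop) (by fun_prop) k (hyp s x)
    have a2 := nmF_add (A := Z5) Sn_aN (u := fun q => pd α F q * pd β w q) (v := fun q => pd α w q * pd β F q) (by fun_prop) (by fun_prop) k (hyp s x)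
    have c : (fun q => pd α w q * pd β F q) = fun q => pd β F q * pd α w q := by ext q; ring
    rw [nmF_cmul Sn_aN sq] at a1
    rw [c] at a2
    have a3 := cub α β
    have a4 := cub β α
    have a5 := qq α β
    rw [abs_of_pos (by norm_num : (0:ℝ) < 2)] at a1
    rw [c] at *
    linarith

theorem R_LH (P : Fin 3 → Fin 3 → ℝ) {K : ℝ} (hK : 1 ≤ K) : ∃ c, 1 ≤ c ∧ ∀ {η w F}, η ≤ 1 → BW η w → negBox w = F → BF K η F → ∀ {s}, 2 ≤ s →
    LH s (c * (η^2 * yy s / s)) (nmF Z5 aN 6 (negBox (Qf P w))) ∧ LH s (c * (η^2 / (s * yy s))) (nmF Z5 aN 5 (negBox (Qf P w))) := by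
  obtain ⟨c, hc, H⟩ := R_nm P hK
  refine ⟨c * (3 * K + 8), by nlinarith, fun {η w F} hη hw he hF {s} hs => ?_⟩
  have hs0 : 0 < s := by linarith
  have hη0 := hw.nn
  have y1 := yy_one (by linarith : 1 ≤ s)
  have y0 : 0 < yy s := by linarith
  have sR : Sm (negBox (Qf P w)) := smNegBox (smQf hw.sm)
  have uR : Sup (negBox (Qf P w)) := (supQf hw.sup).negBox
  have ts : 0 ≤ η * yy s / s := by positivity
  have y3 := yy_le (by linarith : 1 ≤ s) 3 (by omega)
  have y2 := yy_le (by linarith : 1 ≤ s) 1 (by omega)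
  have e3 : yy s^2 / s^2 ≤ 1 / (s * yy s) := by
    rw [div_le_div_iff₀ (by positivity) (by positivity)]; nlinarith
  have e2 : yy s^2 / s^2 ≤ yy s / s := by
    rw [div_le_div_iff₀ (by positivity) (by positivity)]; nlinarith [mul_pos y0 hs0]
  have L : ∀ δ, 0 ≤ δ → LH s (c * ((η * yy s / s) * (K * (η^2 * yy s / s) + K * (η^2 * yy s / s) + K * (η^2 * yy s / s)) + (η * yy s / s^2 + δ) * (4 * (η * yy s))))
      (fun p => c * ((η * yy s / s) * (nmF Z5 aN 6 (pd 0 F) p + nmF Z5 aN 6 (pd 1 F) p + nmF Z5 aN 6 (pd 2 F) p) + (η * yy s / s^2 + δ) * dW s w p)) := fun δ hδ =>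
    ((((hF.f6' s hs 0).add (hF.f6' s hs 1)).add (hF.f6' s hs 2)).cmul ts |>.add ((hw.dW hs).cmul (by positivity : 0 ≤ η * yy s / s^2 + δ))).cmul (by linarith)
  have main : (η * yy s / s) * (K * (η^2 * yy s / s) + K * (η^2 * yy s / s) + K * (η^2 * yy s / s)) + (η * yy s / s^2) * (4 * (η * yy s)) ≤ (3 * K + 4) * (η^2 * (yy s^2/s^2)) := by
    have e : (η * yy s / s) * (K * (η^2 * yy s / s) + K * (η^2 * yy s / s) + K * (η^2 * yy s / s)) + (η * yy s / s^2) * (4 * (η * yy s)) = 3 * K * η * (η^2 * (yy s^2/s^2)) + 4 * (η^2 * (yy s^2/s^2)) := by field_simp; ring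
    rw [e, add_mul]
    have : 3 * K * η * (η^2 * (yy s^2/s^2)) ≤ 3 * K * (η^2 * (yy s^2/s^2)) := mul_le_mul_of_nonneg_right (by nlinarith) (by positivity)
    linarith
  constructor
  · refine LH.mono ((L (η/s) (by positivity)).le ?_) (nmA_cc sR uR) fun x => ?_
    · rw [mul_assoc c]
      refine mul_le_mul_of_nonneg_left ?_ (by linarith)
      have e : (η / s) * (4 * (η * yy s)) = 4 * (η^2 * (yy s / s)) := by ring
      have := mul_le_mul_of_nonneg_left e2 (by positivity : 0 ≤ (3 * K + 4) * η^2)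
      rw [add_mul, e, ← add_assoc]
      have e' : (3 * K + 8) * (η^2 * yy s / s) = (3*K+4) * η^2 * (yy s / s) + 4 * (η^2 * (yy s / s)) := by ring
      linarith
    · rw [abs_of_nonneg (nmF_nn Sn_aN _ _ _)]
      have := H hη hw he hF hs x 6 le_rfl
      simp only [↓reduceIte] at this
      exact this.trans (le_abs_self _)
  · refine LH.mono ((L 0 le_rfl).le ?_) (nmA_cc sR uR) fun x => ?_
    · rw [mul_assoc c]
      refine mul_le_mul_of_nonneg_left ?_ (by linarith)
      have := mul_le_mul_of_nonneg_left e3 (by positivity : 0 ≤ (3 * K + 4) * η^2)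
      rw [add_zero]
      have e' : (3 * K + 8) * (η^2 / (s * yy s)) = (3*K+4) * η^2 * (1 / (s * yy s)) + 4 * (η^2 / (s * yy s)) := by ring
      have : 0 ≤ η^2 / (s * yy s) := by positivity
      linarith
    · rw [abs_of_nonneg (nmF_nn Sn_aN _ _ _)]
      have := H hη hw he hF hs x 5 (by omega)
      simp only [show ¬ (5 = 6) by omega, ↓reduceIte] at this
      exact this.trans (le_abs_self _)

theorem stepV (P : Fin 3 → Fin 3 → ℝ) {K : ℝ} (hK : 1 ≤ K) : ∃ C, 1 ≤ C ∧ ∀ {η κ : ℝ} {w F V : Pt → ℝ}, η ≤ 1 → BW η w → negBox w = F → BF K η F →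
    Sm V → Sup V → (∀ p, negBox V p + V p = - negBox (Qf P w) p) → LocB 7 κ V → BV (C * (κ + η^2)) V := by
  have ha := area_nn 7
  obtain ⟨c, hc, H⟩ := R_LH P hK
  refine ⟨6^6 * (11 * (4 * (area 7 + 1) + 10 * c)), by nlinarith, fun {η κ w F V} hη hw he hF hV sV hE hL => ?_⟩
  have hκ := hL.nn
  have sR : Sm (negBox (Qf P w)) := smNegBox (smQf hw.sm)
  have uR : Sup (negBox (Qf P w)) := (supQf hw.sup).negBox
  have eq : ∀ l, (fun p => negBox (Dw l V) p + 1 * Dw l V p) = fun p => (-1) * Dw l (negBox (Qf P w)) p := fun l => by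
    have : (fun p => negBox V p + V p) = fun p => (-1) * negBox (Qf P w) p := by ext p; rw [hE]; ring
    have h2 := congrArg (Dw l) this
    rw [Dw_add (smNegBox hV) hV, Dw_cmul sR] at h2
    rw [← h2, Dw_negBox hV]; ext p; ring
  have LR : ∀ {s B k} {l : List (Fin 5)}, l ∈ Wd Z5 k → LH s B (nmF Z5 aN k (negBox (Qf P w))) → LH s B (fun p => negBox (Dw l V) p + 1 * Dw l V p) := fun {s B k l} hl h => by
    rw [eq]
    refine LH.mono (LH_Dw sR uR h hl) ?_ fun x => by simp
    exact CCh (u := fun p => (-1) * Dw l (negBox (Qf P w)) p) (by have := smDw sR l; fun_prop) (by intro p hp; simp [uR.Dw l p hp]) s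
  have y2 := yy_one (by norm_num : (1:ℝ) ≤ 2)
  have hini : ∀ l ∈ Wd Z5 6, ∀ p : Pt, 2 ≤ p 0 → p 0 ≤ 3 → |Dw l V p| ≤ κ ∧ ∀ α, |pd α (Dw l V) p| ≤ κ := fun l hl p h2 h3 =>
    ⟨hL.w (by have := hl.1; omega) h2 h3, hL.pd (by have := hl.1; omega) h2 h3⟩
  refine ⟨hV, sV, fun s hs => ?_, fun s hs => ?_⟩
  · have y1 := yy_one (by linarith : 1 ≤ s)
    refine (nmF_LH (K := 11 * ((4 * (area 7 + 1) + 10 * c) * (κ + η^2) * yy s)) fun l hl => LH_dm (by linarith) (smDw hV l) (sV.Dw l) ?_).le (le_of_eq (by ring))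
    have := en_step (m := 1) zero_le_one le_rfl (smDw hV l) (sV.Dw l) hκ (g := fun s => c * (η^2 * yy s / s)) (G := fun s => 10 * c * η^2 * yy s)
      (hini l hl) (fun s hs => ?_) (fun s hs => LR hl (H hη hw he hF hs).1) hs
    · refine this.trans ?_
      have e1 : 0 ≤ 10 * c * η^2 * yy 2 := by positivity
      have e2 : κ * (4 * (area 7 + 1)) ≤ κ * (4 * (area 7 + 1)) * yy s := le_mul_of_one_le_right (by positivity) y1
      have e3 : 0 ≤ 10 * c * κ * yy s + 4 * (area 7 + 1) * η^2 * yy s := by positivity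
      linarith
    · have := (yy_deriv (by linarith : 0 < s)).const_mul (10 * c * η^2)
      exact this.congr_deriv (by ring)
  · have y1 := yy_one (by linarith : 1 ≤ s)
    refine (nmF_LH (K := 11 * ((4 * (area 7 + 1) + 10 * c) * (κ + η^2))) fun l hl => LH_dm (by linarith) (smDw hV l) (sV.Dw l) ?_).le ?_
    · have := en_step (m := 1) zero_le_one le_rfl (smDw hV l) (sV.Dw l) hκ (g := fun s => c * (η^2 / (s * yy s))) (G := fun s => - (10 * c * η^2) * (yy s)⁻¹)
        (hini l (Wd_mono (by omega) hl)) (fun s hs => ?_) (fun s hs => LR hl (H hη hw he hF hs).2) hs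
      · refine this.trans ?_
        have e1 : 0 ≤ 10 * c * η^2 * (yy s)⁻¹ := by positivity
        have e2 : 10 * c * η^2 * (yy 2)⁻¹ ≤ 10 * c * η^2 := mul_le_of_le_one_right (by positivity) (inv_le_one_of_one_le₀ y2)
        have e3 : 0 ≤ 10 * c * κ + 4 * (area 7 + 1) * η^2 := by positivity
        linarith
      · have hs0 : 0 < s := by linarith
        have y1 := yy_one (by linarith : 1 ≤ s)
        have := ((yy_deriv hs0).fun_inv (by linarith)).const_mul (- (10 * c * η^2))
        exact this.congr_deriv (by field_simp)
    · have : 0 ≤ 11 * ((4 * (area 7 + 1) + 10 * c) * (κ + η^2)) := by positivity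
      calc _ ≤ (6:ℝ)^6 * (11 * ((4 * (area 7 + 1) + 10 * c) * (κ + η^2))) := mul_le_mul_of_nonneg_right (by norm_num) this
        _ = _ := by ring

theorem PI_fd {E F : Type} [NormedAddCommGroup E] [NormedSpace ℝ E] [FiniteDimensional ℝ E]
    [NormedAddCommGroup F] [NormedSpace ℝ F] [FiniteDimensional ℝ F] {H : E × ℝ → F} (hH : ContDiff ℝ 1 H) (a b : ℝ) (p : E) :
    HasFDerivAt (fun p => ∫ l in a..b, H (p, l))
      (∫ l in a..b, (fderiv ℝ H (p, l)).comp (ContinuousLinearMap.inl ℝ E ℝ)) p := by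
  have hc : Continuous H := hH.continuous
  have hd : Continuous (fun z : E × ℝ => (fderiv ℝ H z).comp (ContinuousLinearMap.inl ℝ E ℝ)) :=
    (hH.continuous_fderiv (by simp)).clm_comp continuous_const
  have : ProperSpace E := FiniteDimensional.proper ℝ E
  obtain ⟨M, hM⟩ := ((isCompact_closedBall p 1).prod (isCompact_uIcc (a := a) (b := b))).exists_bound_of_continuousOn hd.continuousOn
  refine (intervalIntegral.hasFDerivAt_integral_of_dominated_of_fderiv_le (bound := fun _ => M)
    (F' := fun x l => (fderiv ℝ H (x, l)).comp (ContinuousLinearMap.inl ℝ E ℝ)) (s := Metric.closedBall p 1)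
    (Metric.closedBall_mem_nhds p one_pos) ?_ ?_ ?_ ?_ ?_ ?_)
  · exact .of_forall fun x => (by fun_prop : Continuous fun l => H (x, l)).aestronglyMeasurable
  · exact (by fun_prop : Continuous fun l => H (p, l)).intervalIntegrable _ _
  · exact (hd.comp (by fun_prop : Continuous fun l : ℝ => (p, l))).aestronglyMeasurable
  · exact .of_forall fun l hl x hx => hM (x, l) ⟨hx, Set.uIoc_subset_uIcc hl⟩
  · exact intervalIntegrable_const
  · refine .of_forall fun l hl x hx => ?_
    have h1 := ((hH.differentiable (by simp)) (x, l)).hasFDerivAt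
    exact h1.comp x (hasFDerivAt_prodMk_left x l)

theorem PI_n (n : ℕ) : ∀ {E F : Type} [NormedAddCommGroup E] [NormedSpace ℝ E] [FiniteDimensional ℝ E]
    [NormedAddCommGroup F] [NormedSpace ℝ F] [FiniteDimensional ℝ F] {H : E × ℝ → F}
    (_ : Sm H) (a b : ℝ), ContDiff ℝ n (fun p => ∫ l in a..b, H (p, l)) := by
  induction n with
  | zero =>
    intro E F _ _ _ _ _ _ H hH a b
    have : ContDiff ℝ 1 H := hH.of_le (by norm_cast)
    exact contDiff_zero.2 (continuous_iff_continuousAt.2 fun p => (PI_fd this a b p).continuousAt)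
  | succ n ih =>
    intro E F _ _ _ _ _ _ H hH a b
    have : ContDiff ℝ 1 H := hH.of_le (by norm_cast)
    push_cast
    rw [contDiff_succ_iff_hasFDerivAt]
    refine ⟨_, ?_, fun p => PI_fd this a b p⟩
    refine ih (H := fun z => (fderiv ℝ H z).comp (ContinuousLinearMap.inl ℝ E ℝ)) ?_ a b
    exact (hH.fderiv_right (by simp)).clm_comp contDiff_const

@[fun_prop]
theorem PI_sm {E : Type} [NormedAddCommGroup E] [NormedSpace ℝ E] [FiniteDimensional ℝ E]
    {H : E × ℝ → ℝ} (hH : ContDiff ℝ (⊤ : ℕ∞) H) (a b : ℝ) : ContDiff ℝ (⊤ : ℕ∞) (fun p => ∫ l in a..b, H (p, l)) :=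
  contDiff_infty.2 fun n => PI_n n hH a b

theorem PI1 {G G' : ℝ → ℝ → ℝ} (hG : ∀ s, Continuous (G s)) (hc : Continuous (fun z : ℝ × ℝ => G' z.1 z.2))
    (hd : ∀ s l, HasDerivAt (fun s => G s l) (G' s l) s) (a b s : ℝ) :
    HasDerivAt (fun s => ∫ l in a..b, G s l) (∫ l in a..b, G' s l) s := by
  obtain ⟨M, hM⟩ := ((isCompact_closedBall s 1).prod (isCompact_uIcc (a := a) (b := b))).exists_bound_of_continuousOn hc.continuousOn
  refine (intervalIntegral.hasDerivAt_integral_of_dominated_loc_of_deriv_le (bound := fun _ => M)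
    (F' := G') (s := Metric.closedBall s 1)
    (Metric.closedBall_mem_nhds s one_pos) ?_ ?_ ?_ ?_ ?_ ?_).2
  · exact .of_forall fun x => (hG x).aestronglyMeasurable
  · exact (hG s).intervalIntegrable _ _
  · exact (hc.comp (by fun_prop : Continuous fun l : ℝ => (s, l))).aestronglyMeasurable
  · exact .of_forall fun l hl x hx => hM (x, l) ⟨hx, Set.uIoc_subset_uIcc hl⟩
  · exact intervalIntegrable_const
  · exact .of_forall fun l hl x hx => hd x l

theorem pt_eta (p : Pt) : ![p 0, p 1, p 2] = p := by funext i; fin_cases i <;> rfl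

theorem pd_of0 {u : Pt → ℝ} (hu : Sm u) {p : Pt} {d : ℝ} (h : HasDerivAt (fun y => u ![y, p 1, p 2]) d (p 0)) : pd 0 u p = d := by
  have := chain hu (c := fun y => ![y, p 1, p 2]) (y := p 0) (hasDerivAt_id _) (hasDerivAt_const _ _) (hasDerivAt_const _ _)
  have := this.unique h
  simpa [pt_eta] using this
theorem pd_of1 {u : Pt → ℝ} (hu : Sm u) {p : Pt} {d : ℝ} (h : HasDerivAt (fun y => u ![p 0, y, p 2]) d (p 1)) : pd 1 u p = d := by
  have := chain hu (c := fun y => ![p 0, y, p 2]) (y := p 1) (hasDerivAt_const _ _) (hasDerivAt_id _) (hasDerivAt_const _ _)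
  have := this.unique h
  simpa [pt_eta] using this
theorem pd_of2 {u : Pt → ℝ} (hu : Sm u) {p : Pt} {d : ℝ} (h : HasDerivAt (fun y => u ![p 0, p 1, y]) d (p 2)) : pd 2 u p = d := by
  have := chain hu (c := fun y => ![p 0, p 1, y]) (y := p 2) (hasDerivAt_const _ _) (hasDerivAt_const _ _) (hasDerivAt_id _)
  have := this.unique h
  simpa [pt_eta] using this

/-- smooth vector assembly -/
@[fun_prop]
theorem sm_vec {E : Type} [NormedAddCommGroup E] [NormedSpace ℝ E] {a b c : E → ℝ}
    (ha : ContDiff ℝ (⊤ : ℕ∞) a) (hb : ContDiff ℝ (⊤ : ℕ∞) b) (hc : ContDiff ℝ (⊤ : ℕ∞) c) :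
    ContDiff ℝ (⊤ : ℕ∞) (fun z => (![a z, b z, c z] : Pt)) := by
  rw [contDiff_pi]; intro i; fin_cases i
  exacts [ha, hb, hc]

/-- σ derivative -/
def dsg (H : ℝ × Pt → ℝ) (z : ℝ × Pt) : ℝ := fderiv ℝ H z (1, 0)

@[fun_prop]
theorem sm_dsg {H : ℝ × Pt → ℝ} (hH : ContDiff ℝ (⊤ : ℕ∞) H) : ContDiff ℝ (⊤ : ℕ∞) (dsg H) :=
  (hH.fderiv_right (by simp)).clm_apply contDiff_const

def DU (H : ℝ × Pt → ℝ) (p : Pt) : ℝ :=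
  ∫ l in (0:ℝ)..1, (p 0 - 2) * H ((1 - l) * (p 0 - 2), ![2 + l * (p 0 - 2), p 1, p 2])

@[fun_prop]
theorem sm_DU {H : ℝ × Pt → ℝ} (hH : ContDiff ℝ (⊤ : ℕ∞) H) : ContDiff ℝ (⊤ : ℕ∞) (DU H) := by
  have : ContDiff ℝ (⊤ : ℕ∞) (fun z : Pt × ℝ => (z.1 0 - 2) * H ((1 - z.2) * (z.1 0 - 2), ![2 + z.2 * (z.1 0 - 2), z.1 1, z.1 2])) := by
    fun_prop
  exact PI_sm this 0 1

theorem dsg_da {H : ℝ × Pt → ℝ} (hH : Sm H) {c : ℝ → ℝ} {q : ℝ → Pt} {c' q0 q1 q2 y : ℝ} (hc : HasDerivAt c c' y)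
    (h0 : HasDerivAt (fun y => q y 0) q0 y) (h1 : HasDerivAt (fun y => q y 1) q1 y)
    (h2 : HasDerivAt (fun y => q y 2) q2 y) :
    HasDerivAt (fun y => H (c y, q y)) (c' * dsg H (c y, q y) + q0 * pd 0 (fun p => H (c y, p)) (q y)
      + q1 * pd 1 (fun p => H (c y, p)) (q y) + q2 * pd 2 (fun p => H (c y, p)) (q y)) y := by
  have hq : HasDerivAt q ![q0, q1, q2] y := by
    rw [hasDerivAt_pi]; intro i; fin_cases i
    exacts [h0, h1, h2]
  have hD : HasFDerivAt H (fderiv ℝ H (c y, q y)) (c y, q y) := (hH.differentiable (by simp) _).hasFDerivAt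
  have h3 := hD.comp_hasDerivAt y (hc.prodMk hq)
  refine h3.congr_deriv ?_
  have e1 : fderiv ℝ H (c y, q y) (c', ![q0, q1, q2]) = fderiv ℝ H (c y, q y) (c', 0) + fderiv ℝ H (c y, q y) (0, ![q0, q1, q2]) := by
    rw [← map_add]; simp
  have e2 : fderiv ℝ H (c y, q y) (c', 0) = c' * dsg H (c y, q y) := by
    have : ((c', 0) : ℝ × Pt) = c' • ((1, 0) : ℝ × Pt) := by simp
    rw [this, map_smul]; rfl
  have e3 : fderiv ℝ (fun p => H (c y, p)) (q y) ![q0, q1, q2] = fderiv ℝ H (c y, q y) (0, ![q0, q1, q2]) := by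
    have := hD.comp (q y) (hasFDerivAt_prodMk_right (c y) (q y))
    rw [HasFDerivAt.fderiv (f := fun p => H (c y, p)) this]; simp
  rw [e1, e2, ← e3, fderiv_sum3]
  simp; ring

def pdH (i : Fin 3) (H : ℝ × Pt → ℝ) (z : ℝ × Pt) : ℝ := pd i (fun p => H (z.1, p)) z.2

@[fun_prop]
theorem sm_pdH {H : ℝ × Pt → ℝ} (hH : ContDiff ℝ (⊤ : ℕ∞) H) (i : Fin 3) : ContDiff ℝ (⊤ : ℕ∞) (pdH i H) := by
  have : pdH i H = fun z => fderiv ℝ H z (0, Pi.single i 1) := by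
    funext z
    have hD : HasFDerivAt H (fderiv ℝ H z) (z.1, z.2) := (hH.differentiable (by simp) _).hasFDerivAt
    have := hD.comp z.2 (hasFDerivAt_prodMk_right (𝕜 := ℝ) z.1 z.2)
    unfold pdH pd
    rw [HasFDerivAt.fderiv (f := fun p => H (z.1, p)) this]; simp
  rw [this]
  exact (hH.fderiv_right (by simp)).clm_apply contDiff_const

theorem pd1_DU {H : ℝ × Pt → ℝ} (hH : Sm H) :
    pd 1 (DU H) = DU (pdH 1 H) := by
  funext p
  refine pd_of1 (sm_DU hH) ?_
  have hs := sm_pdH hH 1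
  have := PI1 (G := fun y l => (p 0 - 2) * H ((1 - l) * (p 0 - 2), ![2 + l * (p 0 - 2), y, p 2]))
    (G' := fun y l => (p 0 - 2) * pd 1 (fun q => H ((1 - l) * (p 0 - 2), q)) ![2 + l * (p 0 - 2), y, p 2]) ?_ ?_ ?_ 0 1 (p 1)
  · simpa [DU, pdH, pt_eta] using this
  · intro s
    have : Sm (fun l => (p 0 - 2) * H ((1 - l) * (p 0 - 2), ![2 + l * (p 0 - 2), s, p 2])) := by fun_prop
    exact this.continuous
  · have : Sm (fun z : ℝ × ℝ => (p 0 - 2) * pdH 1 H ((1 - z.2) * (p 0 - 2), ![2 + z.2 * (p 0 - 2), z.1, p 2])) := by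
      fun_prop
    exact this.continuous
  · intro s l
    have := dsg_da hH (c := fun _ => (1 - l) * (p 0 - 2)) (q := fun y => ![2 + l * (p 0 - 2), y, p 2]) (y := s)
      (hasDerivAt_const _ _) (hasDerivAt_const _ _) (hasDerivAt_id _) (hasDerivAt_const _ _)
    exact (this.const_mul (p 0 - 2)).congr_deriv (by ring)

theorem pd2_DU {H : ℝ × Pt → ℝ} (hH : Sm H) :
    pd 2 (DU H) = DU (pdH 2 H) := by
  funext p
  refine pd_of2 (sm_DU hH) ?_
  have hs := sm_pdH hH 2
  have := PI1 (G := fun y l => (p 0 - 2) * H ((1 - l) * (p 0 - 2), ![2 + l * (p 0 - 2), p 1, y]))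
    (G' := fun y l => (p 0 - 2) * pd 2 (fun q => H ((1 - l) * (p 0 - 2), q)) ![2 + l * (p 0 - 2), p 1, y]) ?_ ?_ ?_ 0 1 (p 2)
  · simpa [DU, pdH, pt_eta] using this
  · intro s
    have : Sm (fun l => (p 0 - 2) * H ((1 - l) * (p 0 - 2), ![2 + l * (p 0 - 2), p 1, s])) := by fun_prop
    exact this.continuous
  · have : Sm (fun z : ℝ × ℝ => (p 0 - 2) * pdH 2 H ((1 - z.2) * (p 0 - 2), ![2 + z.2 * (p 0 - 2), p 1, z.1])) := by
      fun_prop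
    exact this.continuous
  · intro s l
    have := dsg_da hH (c := fun _ => (1 - l) * (p 0 - 2)) (q := fun y => ![2 + l * (p 0 - 2), p 1, y]) (y := s)
      (hasDerivAt_const _ _) (hasDerivAt_const _ _) (hasDerivAt_const _ _) (hasDerivAt_id _)
    exact (this.const_mul (p 0 - 2)).congr_deriv (by ring)

theorem pd0_DU {H : ℝ × Pt → ℝ} (hH : Sm H) :
    pd 0 (DU H) = fun p => H (0, p) + DU (dsg H) p := by
  funext p
  refine pd_of0 (sm_DU hH) ?_
  have hs := sm_pdH hH 0
  have hs' := sm_dsg hH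
  have := PI1 (G := fun y l => (y - 2) * H ((1 - l) * (y - 2), ![2 + l * (y - 2), p 1, p 2]))
    (G' := fun y l => H ((1 - l) * (y - 2), ![2 + l * (y - 2), p 1, p 2])
      + (y - 2) * ((1 - l) * dsg H ((1 - l) * (y - 2), ![2 + l * (y - 2), p 1, p 2])
      + l * pd 0 (fun q => H ((1 - l) * (y - 2), q)) ![2 + l * (y - 2), p 1, p 2])) ?_ ?_ ?_ 0 1 (p 0)
  · refine this.congr_deriv ?_
    have hc1 : Continuous (fun l => (p 0 - 2) * dsg H ((1 - l) * (p 0 - 2), ![2 + l * (p 0 - 2), p 1, p 2])) := by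
      have : Sm (fun l => (p 0 - 2) * dsg H ((1 - l) * (p 0 - 2), ![2 + l * (p 0 - 2), p 1, p 2])) := by fun_prop
      exact this.continuous
    have hd : ∀ l, HasDerivAt (fun l => l * H ((1 - l) * (p 0 - 2), ![2 + l * (p 0 - 2), p 1, p 2]))
        (H ((1 - l) * (p 0 - 2), ![2 + l * (p 0 - 2), p 1, p 2])
      + (p 0 - 2) * ((1 - l) * dsg H ((1 - l) * (p 0 - 2), ![2 + l * (p 0 - 2), p 1, p 2])
      + l * pd 0 (fun q => H ((1 - l) * (p 0 - 2), q)) ![2 + l * (p 0 - 2), p 1, p 2]) -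
        (p 0 - 2) * dsg H ((1 - l) * (p 0 - 2), ![2 + l * (p 0 - 2), p 1, p 2])) l := by
      intro l
      have := dsg_da hH (c := fun l => (1 - l) * (p 0 - 2)) (q := fun l => ![2 + l * (p 0 - 2), p 1, p 2]) (y := l)
        (((hasDerivAt_id l).const_sub 1).mul_const (p 0 - 2)) (((hasDerivAt_id l).mul_const (p 0 - 2)).const_add 2) (hasDerivAt_const _ _) (hasDerivAt_const _ _)
      exact ((hasDerivAt_id l).fun_mul this).congr_deriv (by simp only [id]; ring)
    have hc2 : Continuous (fun l => (H ((1 - l) * (p 0 - 2), ![2 + l * (p 0 - 2), p 1, p 2])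
      + (p 0 - 2) * ((1 - l) * dsg H ((1 - l) * (p 0 - 2), ![2 + l * (p 0 - 2), p 1, p 2])
      + l * pd 0 (fun q => H ((1 - l) * (p 0 - 2), q)) ![2 + l * (p 0 - 2), p 1, p 2]))) := by
      have : Sm (fun l => (H ((1 - l) * (p 0 - 2), ![2 + l * (p 0 - 2), p 1, p 2])
        + (p 0 - 2) * ((1 - l) * dsg H ((1 - l) * (p 0 - 2), ![2 + l * (p 0 - 2), p 1, p 2])
        + l * pdH 0 H ((1 - l) * (p 0 - 2), ![2 + l * (p 0 - 2), p 1, p 2])))) := by fun_prop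
      exact this.continuous
    have := intervalIntegral.integral_eq_sub_of_hasDerivAt (a := 0) (b := 1) (fun l _ => hd l) ((hc2.sub hc1).intervalIntegrable _ _)
    rw [intervalIntegral.integral_sub (hc2.intervalIntegrable _ _) (hc1.intervalIntegrable _ _)] at this
    rw [sub_eq_iff_eq_add] at this
    rw [this]
    simp [DU, pt_eta]
  · intro s
    have : Sm (fun l => (s - 2) * H ((1 - l) * (s - 2), ![2 + l * (s - 2), p 1, p 2])) := by fun_prop
    exact this.continuous
  · have : Sm (fun z : ℝ × ℝ => H ((1 - z.2) * (z.1 - 2), ![2 + z.2 * (z.1 - 2), p 1, p 2])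
        + (z.1 - 2) * ((1 - z.2) * dsg H ((1 - z.2) * (z.1 - 2), ![2 + z.2 * (z.1 - 2), p 1, p 2])
        + z.2 * pdH 0 H ((1 - z.2) * (z.1 - 2), ![2 + z.2 * (z.1 - 2), p 1, p 2]))) := by
      fun_prop
    exact this.continuous
  · intro s l
    have h1 := (hasDerivAt_id s).sub_const 2
    have := dsg_da hH (c := fun s => (1 - l) * (s - 2)) (q := fun s => ![2 + l * (s - 2), p 1, p 2]) (y := s)
        (h1.const_mul (1 - l)) ((h1.const_mul l).const_add 2) (hasDerivAt_const _ _) (hasDerivAt_const _ _)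
    exact (h1.fun_mul this).congr_deriv (by simp only [id]; ring)

abbrev Q4 : Type := ((ℝ × Pt) × ℝ) × ℝ

def AV (A : Q4 → ℝ) (z : ℝ × Pt) : ℝ := ∫ θ in (0:ℝ)..Real.pi, ∫ φ in (0:ℝ)..2 * Real.pi, A ((z, θ), φ)

@[fun_prop]
theorem sm_AV {A : Q4 → ℝ} (hA : ContDiff ℝ (⊤ : ℕ∞) A) : ContDiff ℝ (⊤ : ℕ∞) (AV A) :=
  PI_sm (PI_sm hA _ _) _ _

theorem AV_d {A B : Q4 → ℝ} (hA : Sm A) (hB : Sm B) {c : ℝ → ℝ × Pt} (hc : Sm c)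
    (hd : ∀ y θ φ, HasDerivAt (fun y => A ((c y, θ), φ)) (B ((c y, θ), φ)) y) (y : ℝ) :
    HasDerivAt (fun y => AV A (c y)) (AV B (c y)) y := by
  have hA' := (PI_sm hA 0 (2 * Real.pi)).continuous
  have hB' := (PI_sm hB 0 (2 * Real.pi)).continuous
  have hcc := hc.continuous
  have hAc := hA.continuous
  have hBc := hB.continuous
  refine PI1 (G := fun y θ => ∫ φ in (0:ℝ)..2 * Real.pi, A ((c y, θ), φ)) (G' := fun y θ => ∫ φ in (0:ℝ)..2 * Real.pi, B ((c y, θ), φ)) ?_ ?_ ?_ _ _ _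
  · intro s; exact hA'.comp (by fun_prop : Continuous fun θ : ℝ => (c s, θ))
  · exact hB'.comp (by fun_prop : Continuous fun z : ℝ × ℝ => (c z.1, z.2))
  · intro s θ
    refine PI1 (G := fun y φ => A ((c y, θ), φ)) (G' := fun y φ => B ((c y, θ), φ)) ?_ ?_ ?_ _ _ _
    · intro s; fun_prop
    · fun_prop
    · intro s φ; exact hd s θ φ

theorem AV_ii {A : Q4 → ℝ} (hA : Sm A) (z : ℝ × Pt) (θ a b : ℝ) : IntervalIntegrable (fun φ => A ((z, θ), φ)) volume a b :=
  (hA.continuous.comp (by fun_prop : Continuous fun φ : ℝ => ((z, θ), φ))).intervalIntegrable _ _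

theorem AV_ii' {A : Q4 → ℝ} (hA : Sm A) (z : ℝ × Pt) (a b : ℝ) :
    IntervalIntegrable (fun θ => ∫ φ in (0:ℝ)..2 * Real.pi, A ((z, θ), φ)) volume a b :=
  ((PI_sm hA 0 (2 * Real.pi)).continuous.comp (by fun_prop : Continuous fun φ : ℝ => (z, φ))).intervalIntegrable _ _

theorem AV_add {A B : Q4 → ℝ} (hA : Sm A) (hB : Sm B) (z) : AV (fun q => A q + B q) z = AV A z + AV B z := by
  unfold AV
  rw [← intervalIntegral.integral_add (AV_ii' hA z _ _) (AV_ii' hB z _ _)]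
  congr 1; funext θ
  rw [intervalIntegral.integral_add (AV_ii hA z _ _ _) (AV_ii hB z _ _ _)]

theorem AV_cmul (A : Q4 → ℝ) (c : ℝ) (z) : AV (fun q => c * A q) z = c * AV A z := by
  unfold AV
  simp only [intervalIntegral.integral_const_mul]

theorem AV_th {b T : Q4 → ℝ} (hb : Sm b) (hT : Sm T) (hd : ∀ z θ φ, HasDerivAt (fun θ => b ((z, θ), φ)) (T ((z, θ), φ)) θ)
    (h0 : ∀ z φ, b ((z, 0), φ) = 0) (h1 : ∀ z φ, b ((z, Real.pi), φ) = 0) (z) : AV T z = 0 := by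
  have hbc := hb.continuous
  have hTc := hT.continuous
  have : ∀ θ, HasDerivAt (fun θ => ∫ φ in (0:ℝ)..2 * Real.pi, b ((z, θ), φ)) (∫ φ in (0:ℝ)..2 * Real.pi, T ((z, θ), φ)) θ := by
    intro θ
    refine PI1 (G := fun θ φ => b ((z, θ), φ)) (G' := fun θ φ => T ((z, θ), φ)) ?_ ?_ ?_ _ _ _
    · intro s; fun_prop
    · fun_prop
    · intro s φ; exact hd z s φ
  unfold AV
  rw [intervalIntegral.integral_eq_sub_of_hasDerivAt (fun θ _ => this θ) (AV_ii' hT z _ _)]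
  simp [h0, h1]

theorem AV_ph {b T : Q4 → ℝ} (hT : Sm T) (hd : ∀ z θ φ, HasDerivAt (fun φ => b ((z, θ), φ)) (T ((z, θ), φ)) φ)
    (h0 : ∀ z θ, b ((z, θ), 0) = b ((z, θ), 2 * Real.pi)) (z) : AV T z = 0 := by
  unfold AV
  have : ∀ θ, ∫ φ in (0:ℝ)..2 * Real.pi, T ((z, θ), φ) = 0 := fun θ => by
    rw [intervalIntegral.integral_eq_sub_of_hasDerivAt (fun φ _ => hd z θ φ) (AV_ii hT z θ _ _), h0]; simp
  simp [this]

/-- evaluation point -/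
def sp (q : Q4) : Pt := ![q.1.1.2 0, q.1.1.2 1 + q.1.1.1 * (Real.sin q.1.2 * Real.cos q.2), q.1.1.2 2 + q.1.1.1 * (Real.sin q.1.2 * Real.sin q.2)]

@[fun_prop]
theorem sm_sp : ContDiff ℝ (⊤ : ℕ∞) sp := by unfold sp; fun_prop

def Ck (m : ℝ) (q : Q4) : ℝ := Real.cos (m * q.1.1.1 * Real.cos q.1.2)
def Sk (m : ℝ) (q : Q4) : ℝ := Real.sin (m * q.1.1.1 * Real.cos q.1.2)
@[fun_prop]
theorem sm_Ck (m) : ContDiff ℝ (⊤ : ℕ∞) (Ck m) := by unfold Ck; fun_prop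
@[fun_prop]
theorem sm_Sk (m) : ContDiff ℝ (⊤ : ℕ∞) (Sk m) := by unfold Sk; fun_prop

def A0 (m : ℝ) (F : Pt → ℝ) (q : Q4) : ℝ := q.1.1.1 * Real.sin q.1.2 * Ck m q * F (sp q)
def A1 (m : ℝ) (F : Pt → ℝ) (q : Q4) : ℝ :=
  Real.sin q.1.2 * ((Ck m q - q.1.1.1 * (m * Real.cos q.1.2) * Sk m q) * F (sp q)
    + q.1.1.1 * Ck m q * Real.sin q.1.2 * (Real.cos q.2 * pd 1 F (sp q) + Real.sin q.2 * pd 2 F (sp q)))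
def A2 (m : ℝ) (F : Pt → ℝ) (q : Q4) : ℝ :=
  Real.sin q.1.2 * ((- 2 * (m * Real.cos q.1.2) * Sk m q - q.1.1.1 * (m * Real.cos q.1.2) ^ 2 * Ck m q) * F (sp q)
    + 2 * (Ck m q - q.1.1.1 * (m * Real.cos q.1.2) * Sk m q) * Real.sin q.1.2 * (Real.cos q.2 * pd 1 F (sp q) + Real.sin q.2 * pd 2 F (sp q))
    + q.1.1.1 * Ck m q * Real.sin q.1.2 ^ 2 * (Real.cos q.2 ^ 2 * pd 1 (pd 1 F) (sp q) + Real.cos q.2 * Real.sin q.2 * (pd 2 (pd 1 F) (sp q) + pd 1 (pd 2 F) (sp q)) + Real.sin q.2 ^ 2 * pd 2 (pd 2 F) (sp q)))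
@[fun_prop]
theorem sm_A0 (m) {F : Pt → ℝ} (h : ContDiff ℝ (⊤ : ℕ∞) F) : ContDiff ℝ (⊤ : ℕ∞) (A0 m F) := by unfold A0; fun_prop
@[fun_prop]
theorem sm_A1 (m) {F : Pt → ℝ} (h : ContDiff ℝ (⊤ : ℕ∞) F) : ContDiff ℝ (⊤ : ℕ∞) (A1 m F) := by unfold A1; fun_prop
@[fun_prop]
theorem sm_A2 (m) {F : Pt → ℝ} (h : ContDiff ℝ (⊤ : ℕ∞) F) : ContDiff ℝ (⊤ : ℕ∞) (A2 m F) := by unfold A2; fun_prop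

section
variable (p : Pt) (θ φ y : ℝ)

theorem d_sp {F : Pt → ℝ} (hF : Sm F) : HasDerivAt (fun y => F (sp (((y, p), θ), φ)))
    (Real.sin θ * (Real.cos φ * pd 1 F (sp (((y, p), θ), φ)) + Real.sin φ * pd 2 F (sp (((y, p), θ), φ)))) y := by
  have := chain hF (c := fun y => sp (((y, p), θ), φ)) (y := y) (hasDerivAt_const y (p 0))
    (((hasDerivAt_id y).mul_const (Real.sin θ * Real.cos φ)).const_add (p 1)) (((hasDerivAt_id y).mul_const (Real.sin θ * Real.sin φ)).const_add (p 2))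
  exact this.congr_deriv (by ring)

theorem d_sp_th {F : Pt → ℝ} (hF : Sm F) : HasDerivAt (fun θ => F (sp (((y, p), θ), φ)))
    (y * (Real.cos θ * (Real.cos φ * pd 1 F (sp (((y, p), θ), φ)) + Real.sin φ * pd 2 F (sp (((y, p), θ), φ))))) θ := by
  have := chain hF (c := fun θ => sp (((y, p), θ), φ)) (y := θ) (hasDerivAt_const θ (p 0))
    ((((Real.hasDerivAt_sin θ).mul_const (Real.cos φ)).const_mul y).const_add (p 1)) ((((Real.hasDerivAt_sin θ).mul_const (Real.sin φ)).const_mul y).const_add (p 2))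
  exact this.congr_deriv (by ring)

theorem d_sp_ph {F : Pt → ℝ} (hF : Sm F) : HasDerivAt (fun φ => F (sp (((y, p), θ), φ)))
    (y * (Real.sin θ * (- Real.sin φ * pd 1 F (sp (((y, p), θ), φ)) + Real.cos φ * pd 2 F (sp (((y, p), θ), φ))))) φ := by
  have := chain hF (c := fun φ => sp (((y, p), θ), φ)) (y := φ) (hasDerivAt_const φ (p 0))
    ((((Real.hasDerivAt_cos φ).const_mul (Real.sin θ)).const_mul y).const_add (p 1)) ((((Real.hasDerivAt_sin φ).const_mul (Real.sin θ)).const_mul y).const_add (p 2))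
  exact this.congr_deriv (by ring)

theorem d_Ck (m) : HasDerivAt (fun y => Ck m (((y, p), θ), φ)) (- (m * Real.cos θ) * Sk m (((y, p), θ), φ)) y := by
  have := (((hasDerivAt_id y).const_mul m).mul_const (Real.cos θ)).cos
  exact this.congr_deriv (by simp [Sk]; ring)
theorem d_Sk (m) : HasDerivAt (fun y => Sk m (((y, p), θ), φ)) ((m * Real.cos θ) * Ck m (((y, p), θ), φ)) y := by
  have := (((hasDerivAt_id y).const_mul m).mul_const (Real.cos θ)).sin
  exact this.congr_deriv (by simp [Ck]; ring)
theorem d_Ck_th (m) : HasDerivAt (fun θ => Ck m (((y, p), θ), φ)) (m * y * Real.sin θ * Sk m (((y, p), θ), φ)) θ := by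
  have := ((Real.hasDerivAt_cos θ).const_mul (m * y)).cos
  exact this.congr_deriv (by simp [Sk]; ring)
theorem d_Sk_th (m) : HasDerivAt (fun θ => Sk m (((y, p), θ), φ)) (- (m * y * Real.sin θ) * Ck m (((y, p), θ), φ)) θ := by
  have := ((Real.hasDerivAt_cos θ).const_mul (m * y)).sin
  exact this.congr_deriv (by simp [Ck]; ring)

theorem d_A0 (m) {F : Pt → ℝ} (hF : Sm F) : HasDerivAt (fun y => A0 m F (((y, p), θ), φ)) (A1 m F (((y, p), θ), φ)) y := by
  have := (((hasDerivAt_id y).mul_const (Real.sin θ)).fun_mul (d_Ck p θ φ y m)).fun_mul (d_sp p θ φ y hF)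
  exact this.congr_deriv (by simp only [A1, id]; ring)

theorem d_A1 (m) {F : Pt → ℝ} (hF : Sm F) : HasDerivAt (fun y => A1 m F (((y, p), θ), φ)) (A2 m F (((y, p), θ), φ)) y := by
  have hC := d_Ck p θ φ y m
  have hS := d_Sk p θ φ y m
  have h1 := d_sp p θ φ y (smPd hF 1)
  have h2 := d_sp p θ φ y (smPd hF 2)
  have hi := hasDerivAt_id y
  have := (((hC.fun_sub ((hi.mul_const (m * Real.cos θ)).fun_mul hS)).fun_mul (d_sp p θ φ y hF)).fun_add
    (((hi.fun_mul hC).mul_const (Real.sin θ)).fun_mul ((h1.const_mul (Real.cos φ)).fun_add (h2.const_mul (Real.sin φ))))).const_mul (Real.sin θ)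
  exact this.congr_deriv (by simp only [A2, id]; ring)
end

/-- θ-potential -/
def bT (m : ℝ) (F : Pt → ℝ) (q : Q4) : ℝ :=
  Real.sin q.1.2 * (Real.cos q.1.2 * Ck m q * (Real.cos q.2 * pd 1 F (sp q) + Real.sin q.2 * pd 2 F (sp q))
    + m * Real.sin q.1.2 * Sk m q * F (sp q))
def bT' (m : ℝ) (F : Pt → ℝ) (q : Q4) : ℝ :=
  Real.cos q.1.2 * (Real.cos q.1.2 * Ck m q * (Real.cos q.2 * pd 1 F (sp q) + Real.sin q.2 * pd 2 F (sp q))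
    + m * Real.sin q.1.2 * Sk m q * F (sp q)) +
  Real.sin q.1.2 * ((- Real.sin q.1.2 * Ck m q + Real.cos q.1.2 * (m * q.1.1.1 * Real.sin q.1.2 * Sk m q)) * (Real.cos q.2 * pd 1 F (sp q) + Real.sin q.2 * pd 2 F (sp q))
    + Real.cos q.1.2 * Ck m q * (q.1.1.1 * Real.cos q.1.2 * (Real.cos q.2 ^ 2 * pd 1 (pd 1 F) (sp q) + Real.cos q.2 * Real.sin q.2 * (pd 2 (pd 1 F) (sp q) + pd 1 (pd 2 F) (sp q)) + Real.sin q.2 ^ 2 * pd 2 (pd 2 F) (sp q)))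
    + (m * Real.cos q.1.2 * Sk m q - m * Real.sin q.1.2 * (m * q.1.1.1 * Real.sin q.1.2 * Ck m q)) * F (sp q)
    + m * Real.sin q.1.2 * Sk m q * (q.1.1.1 * Real.cos q.1.2 * (Real.cos q.2 * pd 1 F (sp q) + Real.sin q.2 * pd 2 F (sp q))))
/-- φ-potential -/
def bP (m : ℝ) (F : Pt → ℝ) (q : Q4) : ℝ := Ck m q * (- Real.sin q.2 * pd 1 F (sp q) + Real.cos q.2 * pd 2 F (sp q))
def bP' (m : ℝ) (F : Pt → ℝ) (q : Q4) : ℝ := Ck m q * (- Real.cos q.2 * pd 1 F (sp q) - Real.sin q.2 * pd 2 F (sp q)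
  + q.1.1.1 * Real.sin q.1.2 * (Real.sin q.2 ^ 2 * pd 1 (pd 1 F) (sp q) - Real.cos q.2 * Real.sin q.2 * (pd 2 (pd 1 F) (sp q) + pd 1 (pd 2 F) (sp q)) + Real.cos q.2 ^ 2 * pd 2 (pd 2 F) (sp q)))
@[fun_prop]
theorem sm_bT (m) {F : Pt → ℝ} (h : ContDiff ℝ (⊤ : ℕ∞) F) : ContDiff ℝ (⊤ : ℕ∞) (bT m F) := by unfold bT; fun_prop
@[fun_prop]
theorem sm_bT' (m) {F : Pt → ℝ} (h : ContDiff ℝ (⊤ : ℕ∞) F) : ContDiff ℝ (⊤ : ℕ∞) (bT' m F) := by unfold bT'; fun_prop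
@[fun_prop]
theorem sm_bP' (m) {F : Pt → ℝ} (h : ContDiff ℝ (⊤ : ℕ∞) F) : ContDiff ℝ (⊤ : ℕ∞) (bP' m F) := by unfold bP'; fun_prop

theorem AV_bT (m) {F : Pt → ℝ} (hF : Sm F) (z) : AV (bT' m F) z = 0 := by
  refine AV_th (sm_bT m hF) (sm_bT' m hF) ?_ ?_ ?_ z
  · rintro ⟨y, p⟩ θ φ
    have hC := d_Ck_th p θ φ y m
    have hS := d_Sk_th p θ φ y m
    have h1 := d_sp_th p θ φ y (smPd hF 1)
    have h2 := d_sp_th p θ φ y (smPd hF 2)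
    have hs := Real.hasDerivAt_sin θ
    have hc := Real.hasDerivAt_cos θ
    have := hs.fun_mul (((hc.fun_mul hC).fun_mul ((h1.const_mul (Real.cos φ)).fun_add (h2.const_mul (Real.sin φ)))).fun_add
      (((hs.const_mul m).fun_mul hS).fun_mul (d_sp_th p θ φ y hF)))
    exact this.congr_deriv (by simp only [bT']; ring)
  · intro z φ; simp [bT]
  · intro z φ; simp [bT]

theorem AV_bP (m) {F : Pt → ℝ} (hF : Sm F) (z) : AV (bP' m F) z = 0 := by
  refine AV_ph (b := bP m F) (sm_bP' m hF) ?_ ?_ z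
  · rintro ⟨y, p⟩ θ φ
    have h1 := d_sp_ph p θ φ y (smPd hF 1)
    have h2 := d_sp_ph p θ φ y (smPd hF 2)
    have hs := Real.hasDerivAt_sin φ
    have hc := Real.hasDerivAt_cos φ
    have := ((hs.fun_neg.fun_mul h1).fun_add (hc.fun_mul h2)).const_mul (Ck m (((y, p), θ), φ))
    exact this.congr_deriv (by simp only [bP']; ring)
  · intro z θ; simp [bP, sp, Ck]

theorem A2_id (m) (F : Pt → ℝ) (q) : A2 m F q = (A0 m (pd 1 (pd 1 F)) q + A0 m (pd 2 (pd 2 F)) q) + (- m^2) * A0 m F q +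
    (- 1) * (bT' m F q + bP' m F q) := by
  have h1 := Real.sin_sq_add_cos_sq q.1.2
  have h2 := Real.sin_sq_add_cos_sq q.2
  simp only [A2, A0, bT', bP']
  generalize pd 1 (pd 1 F) (sp q) = f11
  generalize pd 1 (pd 2 F) (sp q) = f12
  generalize pd 2 (pd 1 F) (sp q) = f21
  generalize pd 2 (pd 2 F) (sp q) = f22
  generalize pd 1 F (sp q) = f1
  generalize pd 2 F (sp q) = f2
  generalize Real.sin q.1.2 = s at *
  generalize Real.cos q.1.2 = c at *
  generalize Real.sin q.2 = a at *
  generalize Real.cos q.2 = b at *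
  have e1 : s^2 = 1 - c^2 := by linarith
  have e2 : a^2 = 1 - b^2 := by linarith
  have e3 : s^3 = s * (1 - c^2) := by rw [← e1]; ring
  ring_nf
  simp only [e1, e2, e3]
  ring

def VV (m : ℝ) (F : Pt → ℝ) (z : ℝ × Pt) : ℝ := (4 * Real.pi)⁻¹ * AV (A0 m F) z

@[fun_prop]
theorem sm_VV (m) {F : Pt → ℝ} (h : ContDiff ℝ (⊤ : ℕ∞) F) : ContDiff ℝ (⊤ : ℕ∞) (VV m F) := by unfold VV; fun_prop

theorem dsg_of {H : ℝ × Pt → ℝ} (hH : Sm H) {y : ℝ} {p : Pt} {d} (h : HasDerivAt (fun y => H (y, p)) d y) : dsg H (y, p) = d := by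
  have := dsg_da hH (c := fun y => y) (q := fun _ => p) (y := y) (hasDerivAt_id y) (hasDerivAt_const _ _) (hasDerivAt_const _ _) (hasDerivAt_const _ _)
  have := this.unique h
  simpa using this

theorem VV_s (m) {F : Pt → ℝ} (h : Sm F) (z) : dsg (VV m F) z = (4 * Real.pi)⁻¹ * AV (A1 m F) z := by
  obtain ⟨y, p⟩ := z
  refine dsg_of (sm_VV m h) ?_
  exact (AV_d (sm_A0 m h) (sm_A1 m h) (c := fun y => (y, p)) (by fun_prop) (fun y θ φ => d_A0 p θ φ y m h) y).const_mul _

theorem VV_ss (m) {F : Pt → ℝ} (h : Sm F) (z) : dsg (dsg (VV m F)) z = (4 * Real.pi)⁻¹ * AV (A2 m F) z := by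
  obtain ⟨y, p⟩ := z
  refine dsg_of (sm_dsg (sm_VV m h)) ?_
  simp only [VV_s m h]
  exact (AV_d (sm_A1 m h) (sm_A2 m h) (c := fun y => (y, p)) (by fun_prop) (fun y θ φ => d_A1 p θ φ y m h) y).const_mul _

theorem VV_0 (m) (F : Pt → ℝ) (p) : VV m F (0, p) = 0 := by
  simp [VV, AV, A0]

theorem VV_s0 (m) {F : Pt → ℝ} (h : Sm F) (p) : dsg (VV m F) (0, p) = F p := by
  rw [VV_s m h]
  simp [AV, A1, Ck, sp, pt_eta, intervalIntegral.integral_mul_const]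
  have := Real.pi_pos
  field_simp; norm_num

theorem VV_1 (m) {F : Pt → ℝ} (h : Sm F) : pdH 1 (VV m F) = VV m (pd 1 F) := by
  funext ⟨y, p⟩
  have hs : Sm (fun p => VV m F (y, p)) := by fun_prop
  refine pd_of1 hs ?_
  have := (AV_d (sm_A0 m h) (sm_A0 m (smPd h 1)) (c := fun a => (y, ![p 0, a, p 2])) (by fun_prop) (fun a θ φ => ?_) (p 1)).const_mul (4 * Real.pi)⁻¹
  · simpa [VV, pt_eta] using this
  · have := chain h (c := fun a => sp (((y, ![p 0, a, p 2]), θ), φ)) (y := a) (hasDerivAt_const a (p 0)) ((hasDerivAt_id a).add_const (y * (Real.sin θ * Real.cos φ))) (hasDerivAt_const a (p 2 + y * (Real.sin θ * Real.sin φ)))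
    exact (this.const_mul (y * Real.sin θ * Ck m (((y, ![p 0, a, p 2]), θ), φ))).congr_deriv (by simp only [A0]; ring)

theorem VV_2 (m) {F : Pt → ℝ} (h : Sm F) : pdH 2 (VV m F) = VV m (pd 2 F) := by
  funext ⟨y, p⟩
  have hs : Sm (fun p => VV m F (y, p)) := by fun_prop
  refine pd_of2 hs ?_
  have := (AV_d (sm_A0 m h) (sm_A0 m (smPd h 2)) (c := fun a => (y, ![p 0, p 1, a])) (by fun_prop) (fun a θ φ => ?_) (p 2)).const_mul (4 * Real.pi)⁻¹
  · simpa [VV, pt_eta] using this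
  · have := chain h (c := fun a => sp (((y, ![p 0, p 1, a]), θ), φ)) (y := a) (hasDerivAt_const a (p 0)) (hasDerivAt_const a (p 1 + y * (Real.sin θ * Real.cos φ))) ((hasDerivAt_id a).add_const (y * (Real.sin θ * Real.sin φ)))
    exact (this.const_mul (y * Real.sin θ * Ck m (((y, ![p 0, p 1, a]), θ), φ))).congr_deriv (by simp only [A0]; ring)

theorem VV_eq (m) {F : Pt → ℝ} (h : Sm F) (z) : dsg (dsg (VV m F)) z = (VV m (pd 1 (pd 1 F)) z + VV m (pd 2 (pd 2 F)) z) + (- m^2) * VV m F z := by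
  rw [VV_ss m h]
  have e : A2 m F = fun q => ((A0 m (pd 1 (pd 1 F)) q + A0 m (pd 2 (pd 2 F)) q) + (- m^2) * A0 m F q) +
    (- 1) * (bT' m F q + bP' m F q) := by funext q; exact A2_id m F q
  rw [e, AV_add (by fun_prop) (by fun_prop), AV_add (by fun_prop) (by fun_prop), AV_add (by fun_prop) (by fun_prop), AV_cmul, AV_cmul,
    AV_add (by fun_prop) (by fun_prop), AV_bT m h, AV_bP m h]
  simp only [VV]; ring

theorem DU_add {H G : ℝ × Pt → ℝ} (hH : Sm H) (hG : Sm G) (p) : DU (fun z => H z + G z) p = DU H p + DU G p := by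
  unfold DU
  have c : ∀ H : ℝ × Pt → ℝ, Sm H → Continuous (fun l : ℝ => (p 0 - 2) * H ((1 - l) * (p 0 - 2), ![2 + l * (p 0 - 2), p 1, p 2])) := by
    intro H hH
    have : Sm (fun l : ℝ => (p 0 - 2) * H ((1 - l) * (p 0 - 2), ![2 + l * (p 0 - 2), p 1, p 2])) := by fun_prop
    exact this.continuous
  rw [← intervalIntegral.integral_add ((c H hH).intervalIntegrable _ _) ((c G hG).intervalIntegrable _ _)]
  simp only [mul_add]

theorem DU_cmul (H : ℝ × Pt → ℝ) (c : ℝ) (p) : DU (fun z => c * H z) p = c * DU H p := by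
  unfold DU
  rw [← intervalIntegral.integral_const_mul]
  congr 1; funext l; ring

def Duh (m : ℝ) (F : Pt → ℝ) : Pt → ℝ := DU (VV m F)

theorem Duh_sm (m) {F : Pt → ℝ} (h : Sm F) : Sm (Duh m F) := by unfold Duh; fun_prop

theorem Duh_eq (m) {F : Pt → ℝ} (h : Sm F) (p) : negBox (Duh m F) p + m^2 * Duh m F p = F p := by
  rw [negBox_eq]
  have e0 : pd 0 (Duh m F) = DU (dsg (VV m F)) := by
    unfold Duh; rw [pd0_DU (by fun_prop)]; funext p; simp [VV_0]
  have e1 : pd 1 (pd 1 (Duh m F)) = DU (VV m (pd 1 (pd 1 F))) := by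
    unfold Duh; rw [pd1_DU (by fun_prop), VV_1 m h, pd1_DU (by fun_prop), VV_1 m (by fun_prop)]
  have e2 : pd 2 (pd 2 (Duh m F)) = DU (VV m (pd 2 (pd 2 F))) := by
    unfold Duh; rw [pd2_DU (by fun_prop), VV_2 m h, pd2_DU (by fun_prop), VV_2 m (by fun_prop)]
  have e3 : dsg (dsg (VV m F)) = fun z => (VV m (pd 1 (pd 1 F)) z + VV m (pd 2 (pd 2 F)) z) + (- m^2) * VV m F z := funext fun z => VV_eq m h z
  simp only [e0, e1, e2]
  rw [pd0_DU (by fun_prop), e3]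
  beta_reduce
  rw [DU_add (by fun_prop) (by fun_prop), DU_add (by fun_prop) (by fun_prop), DU_cmul]
  simp only [VV_s0 m h, Duh]; ring

theorem Duh_0 (m) (F : Pt → ℝ) (x) : Duh m F (sl x) = 0 := by simp [Duh, DU, sl]

theorem Duh_t0 (m) {F : Pt → ℝ} (h : Sm F) (x) : pd 0 (Duh m F) (sl x) = 0 := by
  unfold Duh; rw [pd0_DU (by fun_prop)]; simp [VV_0, DU, sl]

theorem rad_tri (t t' a b c d r : ℝ) (hr : c^2 + d^2 ≤ r^2) (h0 : 0 ≤ r) : rad ![t, a, b] ≤ rad ![t', a + c, b + d] + r := by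
  unfold rad
  simp only [Matrix.cons_val]
  have h1 := Real.sqrt_nonneg ((a+c)^2 + (b+d)^2)
  have h2 := Real.sq_sqrt (by positivity : 0 ≤ (a+c)^2 + (b+d)^2)
  set A := Real.sqrt ((a+c)^2 + (b+d)^2)
  rw [Real.sqrt_le_left (by positivity)]
  have h3 : |(a+c) * c + (b+d) * d| ≤ A * r := by
    refine abs_le_of_sq_le_sq (?_) (by positivity)
    have : ((a+c) * c + (b+d) * d)^2 + ((a+c) * d - (b+d) * c)^2 = ((a+c)^2 + (b+d)^2) * (c^2+d^2) := by ring
    rw [mul_pow, h2]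
    have := mul_le_mul_of_nonneg_left hr (by positivity : 0 ≤ (a+c)^2 + (b+d)^2)
    nlinarith [sq_nonneg ((a+c) * d - (b+d) * c)]
  have := (abs_le.1 h3).1
  nlinarith

theorem Duh_sup (m) {F : Pt → ℝ} (hS : Sup F) : Sup (Duh m F) := by
  intro p hp
  have : ∀ l ∈ Set.uIcc (0:ℝ) 1, (p 0 - 2) * VV m F ((1 - l) * (p 0 - 2), ![2 + l * (p 0 - 2), p 1, p 2]) = 0 := by
    intro l hl
    rw [Set.uIcc_of_le zero_le_one] at hl
    have : ∀ θ φ, A0 m F ((((1 - l) * (p 0 - 2), ![2 + l * (p 0 - 2), p 1, p 2]), θ), φ) = 0 := by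
      intro θ φ
      simp only [A0]
      rw [hS, mul_zero]
      have h1 := rad_tri (p 0) (2 + l * (p 0 - 2)) (p 1) (p 2) ((1 - l) * (p 0 - 2) * (Real.sin θ * Real.cos φ)) ((1 - l) * (p 0 - 2) * (Real.sin θ * Real.sin φ)) ((1 - l) * |p 0 - 2|) ?_ ?_
      · rw [pt_eta] at h1
        simp only [sp, Matrix.cons_val]
        have : |2 + l * (p 0 - 2) - 2| = l * |p 0 - 2| := by
          rw [add_sub_cancel_left, abs_mul, abs_of_nonneg hl.1]
        rw [this]; linarith
      · have e1 := Real.sin_sq_add_cos_sq φ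
        have e2 := Real.sin_sq_le_one θ
        rw [mul_pow (1 - l) |p 0 - 2|, sq_abs]
        have : ((1 - l) * (p 0 - 2) * (Real.sin θ * Real.cos φ))^2 + ((1 - l) * (p 0 - 2) * (Real.sin θ * Real.sin φ))^2 = ((1-l)^2 * (p 0 - 2)^2) * (Real.sin θ^2 * (Real.sin φ^2 + Real.cos φ^2)) := by ring
        rw [this, e1, mul_one]
        exact mul_le_of_le_one_right (by positivity) e2
      · exact mul_nonneg (by linarith [hl.2]) (abs_nonneg _)
    simp [VV, AV, this]
  unfold Duh DU
  rw [intervalIntegral.integral_congr this]; simp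

/-- extension of data -/
def ext (g : X2 → ℝ) (p : Pt) : ℝ := g ![p 1, p 2]
@[fun_prop]
theorem sm_ext {g : X2 → ℝ} (h : ContDiff ℝ (⊤ : ℕ∞) g) : ContDiff ℝ (⊤ : ℕ∞) (ext g) := by
  refine h.comp (f := fun p : Pt => (![p 1, p 2] : X2)) ?_
  refine contDiff_pi.2 fun i => ?_
  fin_cases i
  · exact contDiff_apply ℝ ℝ (1 : Fin 3)
  · exact contDiff_apply ℝ ℝ (2 : Fin 3)
theorem ext_sup {g : X2 → ℝ} (h : ∀ x, 1 < rad2 x → g x = 0) : Sup (ext g) := by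
  intro p hp
  refine h _ ?_
  have : rad2 ![p 1, p 2] = rad p := rfl
  rw [this]; linarith [abs_nonneg (p 0 - 2)]
theorem pd0_ext {g : X2 → ℝ} (h : Sm g) : pd 0 (ext g) = fun _ => 0 := by
  funext p
  refine pd_of0 (sm_ext h) ?_
  exact hasDerivAt_const (p 0) (g ![p 1, p 2])

theorem solve (m : ℝ) {F : Pt → ℝ} (hF : Sm F) (hS : Sup F) {g0 g1 : X2 → ℝ} (h0 : Sm g0) (h1 : Sm g1)
    (s0 : ∀ x, 1 < rad2 x → g0 x = 0) (s1 : ∀ x, 1 < rad2 x → g1 x = 0) :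
    ∃ u : Pt → ℝ, Sm u ∧ Sup u ∧ (∀ p, negBox u p + m^2 * u p = F p) ∧ (∀ x, u (sl x) = g0 x) ∧ (∀ x, pd 0 u (sl x) = g1 x) := by
  set e : Pt → ℝ := fun p => ext g0 p + (p 0 - 2) * ext g1 p with he
  have es : Sm e := by fun_prop
  have eS : Sup e := (ext_sup s0).add ((ext_sup s1).mul_left _)
  set G : Pt → ℝ := fun p => F p - (negBox e p + m^2 * e p) with hG
  have Gs : Sm G := by
    have := smNegBox es
    fun_prop
  have GS : Sup G := hS.sub (eS.negBox.add (eS.mul_left _))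
  have hD := Duh_sm m Gs
  refine ⟨fun p => e p + Duh m G p, by fun_prop, eS.add (Duh_sup m GS), ?_, ?_, ?_⟩
  · intro p
    rw [negBox_add es hD]
    have := Duh_eq m Gs p
    simp only [hG] at this ⊢
    linarith
  · intro x
    beta_reduce; rw [Duh_0]; simp [he, ext, sl, x2_eta]
  · intro x
    rw [pd_add es hD]
    simp only [Duh_t0 m Gs]
    rw [he]
    simp (disch := fun_prop) only [pd_add, pd_mul, pd_sub, pd0_ext h0, pd0_ext h1, pd_coord, pd_const]
    simp [ext, sl, x2_eta]

/-- flat slices -/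
def ft (t : ℝ) (x : X2) : Pt := ![t, x 0, x 1]
theorem ft_cont2 : Continuous (fun q : ℝ × X2 => ft q.1 q.2) := by
  unfold ft
  refine continuous_pi fun i => ?_
  fin_cases i <;> simp <;> fun_prop
theorem ft_cont (t) : Continuous (ft t) := ft_cont2.comp (by fun_prop : Continuous fun x : X2 => (t, x))
theorem ft_sl (x) : ft 2 x = sl x := rfl
theorem ft_rad (t x) : rad (ft t x) = rad2 x := rfl
theorem ft_surj (p : Pt) : ft (p 0) ![p 1, p 2] = p := pt_eta p

theorem ft_cc {f : Pt → ℝ} (hf : Continuous f) (sf : Sup f) (t) : CC (|t - 2| + 1) (fun x => f (ft t x)) :=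
  ⟨hf.comp (ft_cont t), fun x hx => sf _ hx⟩

def Z2 : Finset (Fin 5) := {1, 2}
def Z3 : Finset (Fin 5) := {0, 1, 2}

/-- energy density -/
def eN (u : Pt → ℝ) (p : Pt) : ℝ := pd 0 u p ^ 2 + pd 1 u p ^ 2 + pd 2 u p ^ 2 + u p ^ 2
def qN (u : Pt → ℝ) (p : Pt) : ℝ := u p ^ 2

theorem nm2 (N : (Pt → ℝ) → Pt → ℝ) (k u p) : nmF Z2 N (k+1) u p = nmF Z2 N k u p + (nmF Z2 N k (pd 1 u) p + nmF Z2 N k (pd 2 u) p) := by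
  show nmF Z2 N k u p + ∑ i ∈ Z2, nmF Z2 N k (dd i u) p = _
  congr 1
  rw [Z2, Finset.sum_insert (by decide), Finset.sum_singleton]; rfl

theorem eN_cs {u : Pt → ℝ} (hu : Sm u) (su : Sup u) : Continuous (eN u) ∧ Sup (eN u) := by
  constructor
  · have : Sm (eN u) := by unfold eN; fun_prop
    exact this.continuous
  · intro p hp
    simp [eN, su p hp, su.pd _ p hp]
theorem qN_cs {u : Pt → ℝ} (hu : Sm u) (su : Sup u) : Continuous (qN u) ∧ Sup (qN u) := by
  constructor
  · have : Sm (qN u) := by unfold qN; fun_prop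
    exact this.continuous
  · intro p hp
    simp [qN, su p hp]
theorem aN_cs {u : Pt → ℝ} (hu : Sm u) (su : Sup u) : Continuous (aN u) ∧ Sup (aN u) := by
  constructor
  · exact hu.continuous.abs
  · intro p hp
    simp [aN, su p hp]

theorem nm2_cs {N : (Pt → ℝ) → Pt → ℝ} (hN : ∀ {u}, Sm u → Sup u → Continuous (N u) ∧ Sup (N u)) (k) {u} (hu : Sm u) (su : Sup u) :
    Continuous (nmF Z2 N k u) ∧ Sup (nmF Z2 N k u) := by
  induction k generalizing u with
  | zero => exact hN hu su
  | succ k ih =>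
    have h0 := ih hu su
    have h1 := ih (smPd hu 1) (su.pd 1)
    have h2 := ih (smPd hu 2) (su.pd 2)
    have : nmF Z2 N (k+1) u = fun p => nmF Z2 N k u p + (nmF Z2 N k (pd 1 u) p + nmF Z2 N k (pd 2 u) p) := funext fun p => nm2 N k u p
    rw [this]
    exact ⟨h0.1.add (h1.1.add h2.1), h0.2.add (h1.2.add h2.2)⟩

def IN (N : (Pt → ℝ) → Pt → ℝ) (k : ℕ) (u : Pt → ℝ) (t : ℝ) : ℝ := ∫ x, nmF Z2 N k u (ft t x)
abbrev EN := IN eN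
abbrev SN := IN qN

theorem eN_cc (k) {u} (hu : Sm u) (su : Sup u) (t) : CC (|t - 2| + 1) (fun x => nmF Z2 eN k u (ft t x)) :=
  ft_cc (nm2_cs eN_cs k hu su).1 (nm2_cs eN_cs k hu su).2 t
theorem qN_cc (k) {u} (hu : Sm u) (su : Sup u) (t) : CC (|t - 2| + 1) (fun x => nmF Z2 qN k u (ft t x)) :=
  ft_cc (nm2_cs qN_cs k hu su).1 (nm2_cs qN_cs k hu su).2 t
theorem aN_ccf (k) {u} (hu : Sm u) (su : Sup u) (t) : CC (|t - 2| + 1) (fun x => nmF Z2 aN k u (ft t x)) :=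
  ft_cc (nm2_cs aN_cs k hu su).1 (nm2_cs aN_cs k hu su).2 t

theorem IN_succ {N : (Pt → ℝ) → Pt → ℝ} (hN : ∀ {u}, Sm u → Sup u → Continuous (N u) ∧ Sup (N u)) (k) {u} (hu : Sm u) (su : Sup u) (t) :
    IN N (k+1) u t = IN N k u t + (IN N k (pd 1 u) t + IN N k (pd 2 u) t) := by
  have h := fun {u} (hu : Sm u) (su : Sup u) => (ft_cc (nm2_cs hN k hu su).1 (nm2_cs hN k hu su).2 t).int
  unfold IN
  simp only [nm2]
  rw [integral_add (h hu su) ((h (smPd hu 1) (su.pd 1)).fun_add (h (smPd hu 2) (su.pd 2))), integral_add (h (smPd hu 1) (su.pd 1)) (h (smPd hu 2) (su.pd 2))]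

theorem EN0_deriv {u} (hu : Sm u) (su : Sup u) (t) :
    HasDerivAt (EN 0 u) (∫ x, 2 * pd 0 u (ft t x) * (negBox u (ft t x) + u (ft t x))) t := by
  set D : Pt → ℝ := fun p => 2 * pd 0 u p * pd 0 (pd 0 u) p + 2 * pd 1 u p * pd 0 (pd 1 u) p + 2 * pd 2 u p * pd 0 (pd 2 u) p + 2 * u p * pd 0 u p with hD
  have sD : Sm D := by fun_prop
  have SD : Sup D := fun p hp => by simp [hD, su p hp, su.pd _ p hp]
  have h1 : HasDerivAt (EN 0 u) (∫ x, D (ft t x)) t := by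
    refine dint (O := Set.univ) isOpen_univ (Set.mem_univ t) (F := fun t x => eN u (ft t x)) (F' := fun t x => D (ft t x)) (R := fun t => |t - 2| + 1)
      (by fun_prop) ?_ ?_ ?_ ?_
    · intro s _ x
      have c := fun {f : Pt → ℝ} (hf : Sm f) => chain hf (c := fun s => ft s x) (y := s) (hasDerivAt_id s) (hasDerivAt_const _ _) (hasDerivAt_const _ _)
      have := ((((c (smPd hu 0)).fun_pow 2).fun_add ((c (smPd hu 1)).fun_pow 2)).fun_add ((c (smPd hu 2)).fun_pow 2)).fun_add ((c hu).fun_pow 2)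
      exact this.congr_deriv (by simp only [hD]; push_cast; ring)
    · exact (sD.continuous.comp ft_cont2).continuousOn
    · intro s _; exact eN_cc 0 hu su s
    · intro s _ x hx; exact SD _ hx
  refine h1.congr_deriv ?_
  have z1 : ∫ x, (fun p => pd 1 (fun p => 2 * (pd 1 u p * pd 0 u p)) p) (ft t x) = 0 := by
    have sm1 : Sm (fun p => 2 * (pd 1 u p * pd 0 u p)) := by fun_prop
    have S1 : Sup (fun p => 2 * (pd 1 u p * pd 0 u p)) := ((su.pd 1).mul_right _).mul_left _
    exact int_d0 (h := fun x => (fun p => 2 * (pd 1 u p * pd 0 u p)) (ft t x)) (fun a b => by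
      have := chain sm1 (c := fun y => ft t ![y, b]) (y := a) (hasDerivAt_const _ _) (hasDerivAt_id a) (hasDerivAt_const _ _)
      simpa using this) (ft_cc sm1.continuous S1 t) (ft_cc (smPd sm1 1).continuous (S1.pd 1) t)
  have z2 : ∫ x, (fun p => pd 2 (fun p => 2 * (pd 2 u p * pd 0 u p)) p) (ft t x) = 0 := by
    have sm1 : Sm (fun p => 2 * (pd 2 u p * pd 0 u p)) := by fun_prop
    have S1 : Sup (fun p => 2 * (pd 2 u p * pd 0 u p)) := ((su.pd 2).mul_right _).mul_left _
    exact int_d1 (h := fun x => (fun p => 2 * (pd 2 u p * pd 0 u p)) (ft t x)) (fun a b => by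
      have := chain sm1 (c := fun y => ft t ![a, y]) (y := b) (hasDerivAt_const _ _) (hasDerivAt_const _ _) (hasDerivAt_id b)
      simpa using this) (ft_cc sm1.continuous S1 t) (ft_cc (smPd sm1 2).continuous (S1.pd 2) t)
  have i1 := (ft_cc (smPd (show Sm (fun p => 2 * (pd 1 u p * pd 0 u p)) by fun_prop) 1).continuous (Sup.pd (((su.pd 1).mul_right _).mul_left _) 1) t).int
  have i2 := (ft_cc (smPd (show Sm (fun p => 2 * (pd 2 u p * pd 0 u p)) by fun_prop) 2).continuous (Sup.pd (((su.pd 2).mul_right _).mul_left _) 2) t).int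
  have sG : Sm (fun p => 2 * pd 0 u p * (negBox u p + u p)) := by
    have := smNegBox hu; fun_prop
  have iG := (ft_cc sG.continuous (Sup.mul_right ((su.pd 0).mul_left _) _) t).int
  have e : ∀ x, D (ft t x) = 2 * pd 0 u (ft t x) * (negBox u (ft t x) + u (ft t x)) +
      ((fun p => pd 1 (fun p => 2 * (pd 1 u p * pd 0 u p)) p) (ft t x) + (fun p => pd 2 (fun p => 2 * (pd 2 u p * pd 0 u p)) p) (ft t x)) := by
    intro x
    simp (disch := fun_prop) only [hD, negBox_eq, pd_cmul, pd_mul, pd_comm hu 1 0, pd_comm hu 2 0]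
    ring
  simp only [e]
  rw [integral_add iG (i1.fun_add i2), integral_add i1 i2, z1, z2]; simp

theorem Dw1 (u : Pt → ℝ) : pd 1 u = dd 1 u := rfl

theorem dd12_negBox {u} (hu : Sm u) (m : ℝ) (α : Fin 3) : (fun p => negBox (pd α u) p + m * pd α u p) = pd α (fun p => negBox u p + m * u p) := by
  have := smNegBox hu
  simp (disch := fun_prop) only [pd_add, pd_cmul, negBox_pd hu]

theorem EN_deriv (k) {m : ℝ} (hm : m = 0 ∨ m = 1) {u} (hu : Sm u) (su : Sup u) (t) :
    ∃ D, HasDerivAt (EN k u) D t ∧ |D| ≤ 2 * EN k u t + SN k (fun p => negBox u p + m * u p) t := by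
  induction k generalizing u with
  | zero =>
    refine ⟨_, EN0_deriv hu su t, ?_⟩
    have sF : Sm (fun p => negBox u p + m * u p) := by have := smNegBox hu; fun_prop
    have SF : Sup (fun p => negBox u p + m * u p) := su.negBox.add (su.mul_left _)
    have i1 := (eN_cc 0 hu su t).int
    have i2 := (qN_cc 0 sF SF t).int
    unfold EN SN IN
    rw [← integral_const_mul, ← integral_add (i1.const_mul 2) i2]
    refine abs_integral_le_integral_abs.trans (int_mono (fun x => abs_nonneg _) ((i1.const_mul 2).fun_add i2) fun x => ?_)
    simp only [nmF, eN, qN]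
    generalize pd 0 u (ft t x) = a, pd 1 u (ft t x) = b, pd 2 u (ft t x) = c, negBox u (ft t x) = f, u (ft t x) = z
    have e1 := sq_nonneg b
    have e2 := sq_nonneg c
    have e3 := sq_nonneg z
    have e4 := sq_nonneg a
    rcases hm with rfl | rfl <;> rw [abs_le] <;> constructor
    · nlinarith [sq_nonneg (a + f), sq_nonneg (a + z)]
    · nlinarith [sq_nonneg (a - f), sq_nonneg (a - z)]
    · nlinarith [sq_nonneg (a + (f + 1 * z))]
    · nlinarith [sq_nonneg (a - (f + 1 * z))]
  | succ k ih =>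
    obtain ⟨D0, a0, b0⟩ := ih hu su
    obtain ⟨D1, a1, b1⟩ := ih (smPd hu 1) (su.pd 1)
    obtain ⟨D2, a2, b2⟩ := ih (smPd hu 2) (su.pd 2)
    have sF : Sm (fun p => negBox u p + m * u p) := by have := smNegBox hu; fun_prop
    have SF : Sup (fun p => negBox u p + m * u p) := su.negBox.add (su.mul_left _)
    have e : EN (k+1) u = fun t => EN k u t + (EN k (pd 1 u) t + EN k (pd 2 u) t) := funext fun t => IN_succ eN_cs k hu su t
    refine ⟨D0 + (D1 + D2), ?_, ?_⟩
    · rw [e]; exact a0.fun_add (a1.fun_add a2)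
    · rw [e, SN, IN_succ qN_cs k sF SF]
      rw [dd12_negBox hu] at b1 b2
      simp only [SN] at b0 b1 b2
      have := abs_add_le D0 (D1 + D2)
      have := abs_add_le D1 D2
      linarith

/-- Gronwall comparison -/
theorem GR {y : ℝ → ℝ} {T B c L : ℝ} (hd : ∀ t, 2 ≤ t → t ≤ T → ∃ D, HasDerivAt y D t ∧ D ≤ 2 * y t + c * Real.exp (L * (t - 2)))
    (h0 : y 2 ≤ B) (hL : 2 * B + c ≤ L * B) {t} (h2 : 2 ≤ t) (hT : t ≤ T) : y t ≤ B * Real.exp (L * (t - 2)) := by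
  choose! D hD hD' using hd
  have key : AntitoneOn (fun s => (y s - B * Real.exp (L * (s - 2))) * Real.exp (-2 * (s - 2))) (Set.Icc 2 T) := by
    have hder : ∀ s ∈ Set.Icc 2 T, HasDerivAt (fun s => (y s - B * Real.exp (L * (s - 2))) * Real.exp (-2 * (s - 2)))
        ((D s - B * (Real.exp (L * (s - 2)) * L)) * Real.exp (-2 * (s - 2)) + (y s - B * Real.exp (L * (s - 2))) * (Real.exp (-2 * (s - 2)) * (-2))) s := by
      intro s hs
      have e1 : ∀ a : ℝ, HasDerivAt (fun s => Real.exp (a * (s - 2))) (Real.exp (a * (s - 2)) * a) s := fun a => by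
        have := (((hasDerivAt_id s).sub_const 2).const_mul a).exp
        exact this.congr_deriv (by simp)
      exact (((hD s hs.1 hs.2).fun_sub ((e1 L).const_mul B)).fun_mul (e1 (-2)))
    refine antitoneOn_of_hasDerivWithinAt_nonpos (f' := fun s => ((D s - B * (Real.exp (L * (s - 2)) * L)) * Real.exp (-2 * (s - 2)) + (y s - B * Real.exp (L * (s - 2))) * (Real.exp (-2 * (s - 2)) * (-2)))) (convex_Icc 2 T)
      (fun s hs => (hder s hs).continuousAt.continuousWithinAt) (fun s hs => (hder s (interior_subset hs)).hasDerivWithinAt) ?_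
    intro s hs
    have hs := interior_subset hs
    have := hD' s hs.1 hs.2
    have e1 := Real.exp_pos (L * (s - 2))
    have e2 := Real.exp_pos (-2 * (s - 2))
    have h3 : D s - B * (Real.exp (L * (s - 2)) * L) - 2 * (y s - B * Real.exp (L * (s - 2))) ≤ 0 := by
      have := mul_le_mul_of_nonneg_right hL e1.le
      nlinarith
    have := mul_nonpos_of_nonpos_of_nonneg h3 e2.le
    linarith
  have := key ⟨le_rfl, h2.trans hT⟩ ⟨h2, hT⟩ h2
  simp only [sub_self, mul_zero, Real.exp_zero, mul_one] at this
  have e2 := Real.exp_pos (-2 * (t - 2))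
  by_contra hc
  push Not at hc
  have := mul_pos (sub_pos.2 hc) e2
  linarith


/-- two-sided Gronwall on `[1,T]` -/
theorem GR2 {y : ℝ → ℝ} {T B c L : ℝ} (hd : ∀ t, 1 ≤ t → t ≤ T → ∃ D, HasDerivAt y D t ∧ |D| ≤ 2 * y t + c * Real.exp (L * |t - 2|))
    (hT2 : 2 ≤ T) (h0 : y 2 ≤ B) (hL : 2 * B + c ≤ L * B) {t} (h1 : 1 ≤ t) (hT : t ≤ T) : y t ≤ B * Real.exp (L * |t - 2|) := by
  rcases le_total 2 t with h | h
  · rw [abs_of_nonneg (by linarith)]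
    refine GR (T := T) (c := c) (fun s h2 hs => ?_) h0 hL h hT
    obtain ⟨D, a, b⟩ := hd s (by linarith) hs
    rw [abs_of_nonneg (show 0 ≤ s - 2 by linarith)] at b
    exact ⟨D, a, (le_abs_self D).trans b⟩
  · have := GR (y := fun s => y (4 - s)) (T := 3) (B := B) (c := c) (L := L) (fun s h2 hs => ?_) (by norm_num; exact h0) hL (t := 4 - t) (by linarith) (by linarith)
    · rw [abs_of_nonpos (by linarith)]
      simp only [sub_sub_cancel] at this
      convert this using 3; ring
    · obtain ⟨D, a, b⟩ := hd (4 - s) (by linarith) (by linarith)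
      refine ⟨-D, ?_, ?_⟩
      · have := a.comp s ((hasDerivAt_id s).const_sub 4)
        exact this.congr_deriv (by ring)
      · rw [abs_of_nonpos (show 4 - s - 2 ≤ 0 by linarith)] at b
        refine (neg_le_abs D).trans (b.trans (le_of_eq ?_))
        congr 3; ring

theorem q_nn (k u p) : 0 ≤ nmF Z2 qN k u p := by
  induction k generalizing u with
  | zero => exact sq_nonneg _
  | succ k ih => rw [nm2]; linarith [ih u, ih (pd 1 u), ih (pd 2 u)]

theorem eN_split (k) {u} (hu : Sm u) (p) : nmF Z2 eN k u p =
    nmF Z2 qN k (pd 0 u) p + nmF Z2 qN k (pd 1 u) p + nmF Z2 qN k (pd 2 u) p + nmF Z2 qN k u p := by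
  induction k generalizing u with
  | zero => rfl
  | succ k ih =>
    simp only [nm2]
    rw [ih hu, ih (smPd hu 1), ih (smPd hu 2), pd_comm hu 0 1, pd_comm hu 0 2, pd_comm hu 2 1]
    ring

theorem e_nn (k) {u} (hu : Sm u) (p) : 0 ≤ nmF Z2 eN k u p := by
  rw [eN_split k hu]; linarith [q_nn k (pd 0 u) p, q_nn k (pd 1 u) p, q_nn k (pd 2 u) p, q_nn k u p]

theorem qpd_le (k) {u} (hu : Sm u) (α p) : nmF Z2 qN k (pd α u) p ≤ nmF Z2 eN k u p := by
  rw [eN_split k hu]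
  have := q_nn k (pd 0 u) p
  have := q_nn k (pd 1 u) p
  have := q_nn k (pd 2 u) p
  have := q_nn k u p
  fin_cases α <;> simp only [Fin.zero_eta, Fin.mk_one, Fin.reduceFinMk] <;> linarith

theorem qu_le (k) {u} (hu : Sm u) (p) : nmF Z2 qN k u p ≤ nmF Z2 eN k u p := by
  rw [eN_split k hu]; linarith [q_nn k (pd 0 u) p, q_nn k (pd 1 u) p, q_nn k (pd 2 u) p]

theorem SN_pd (k) {u} (hu : Sm u) (su : Sup u) (α t) : SN k (pd α u) t ≤ EN k u t :=
  int_mono (fun x => q_nn _ _ _) (eN_cc k hu su t).int fun x => qpd_le k hu α _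
theorem SN_u (k) {u} (hu : Sm u) (su : Sup u) (t) : SN k u t ≤ EN k u t :=
  int_mono (fun x => q_nn _ _ _) (eN_cc k hu su t).int fun x => qu_le k hu _
theorem SN_nn (k u t) : 0 ≤ SN k u t := integral_nonneg fun x => q_nn _ _ _
theorem EN_nn (k) {u} (hu : Sm u) (t) : 0 ≤ EN k u t := integral_nonneg fun x => e_nn k hu _

theorem q_le (k u p) : nmF Z2 qN k u p ≤ nmF Z2 aN k u p ^ 2 := by
  induction k generalizing u with
  | zero => simp [nmF, qN, aN]
  | succ k ih =>
    simp only [nm2]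
    have := nmF_nn (A := Z2) Sn_aN k u p
    have := nmF_nn (A := Z2) Sn_aN k (pd 1 u) p
    have := nmF_nn (A := Z2) Sn_aN k (pd 2 u) p
    have a := ih u
    have b := ih (pd 1 u)
    have c := ih (pd 2 u)
    refine (add_le_add a (add_le_add b c)).trans ?_
    have h1 : 0 ≤ nmF Z2 aN k u p * nmF Z2 aN k (pd 1 u) p := by positivity
    have h2 : 0 ≤ nmF Z2 aN k u p * nmF Z2 aN k (pd 2 u) p := by positivity
    have h3 : 0 ≤ nmF Z2 aN k (pd 1 u) p * nmF Z2 aN k (pd 2 u) p := by positivity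
    linarith [show (nmF Z2 aN k u p + (nmF Z2 aN k (pd 1 u) p + nmF Z2 aN k (pd 2 u) p))^2 = nmF Z2 aN k u p^2 + nmF Z2 aN k (pd 1 u) p^2 + nmF Z2 aN k (pd 2 u) p^2 + 2 * (nmF Z2 aN k u p * nmF Z2 aN k (pd 1 u) p) + 2 * (nmF Z2 aN k u p * nmF Z2 aN k (pd 2 u) p) + 2 * (nmF Z2 aN k (pd 1 u) p * nmF Z2 aN k (pd 2 u) p) by ring]

theorem sq3 (a b c : ℝ) : (a + (b + c))^2 ≤ 3 * (a^2 + (b^2 + c^2)) := by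
  linarith [sq_nonneg (a - b), sq_nonneg (a - c), sq_nonneg (b - c),
    show 3 * (a^2 + (b^2 + c^2)) - (a + (b + c))^2 = (a - b)^2 + (a-c)^2 + (b-c)^2 by ring]

theorem a_le (k u p) : nmF Z2 aN k u p ^ 2 ≤ 3^k * nmF Z2 qN k u p := by
  induction k generalizing u with
  | zero => simp [nmF, qN, aN]
  | succ k ih =>
    simp only [nm2]
    refine (sq3 _ _ _).trans ?_
    have a := ih u
    have b := ih (pd 1 u)
    have c := ih (pd 2 u)
    rw [pow_succ (3:ℝ) k]; linarith

theorem int_sq {R} {f : X2 → ℝ} (hf : CC R f) : (∫ x, |f x|)^2 ≤ area R * ∫ x, f x^2 := by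
  have hm : MeasurableSet {x : X2 | rad2 x ≤ R} := (isClosed_le rad2_cont continuous_const).measurableSet
  set g : X2 → ℝ := Set.indicator {x : X2 | rad2 x ≤ R} (fun _ => 1) with hg
  have g2 : (fun x => g x ^ 2) = g := by
    funext x; by_cases h : x ∈ {x : X2 | rad2 x ≤ R} <;> simp [hg, h]
  have ig : Integrable g := (integrable_indicator_iff hm).2 (integrableOn_const (compact_rad2 R).measure_lt_top.ne)
  have e : (fun x => |f x| * g x) = fun x => |f x| := by
    funext x; by_cases h : rad2 x ≤ R
    · simp [hg, h]
    · simp [hf.2 x (not_le.1 h)]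
  have := cauchy_sq (f := fun x => |f x|) (g := g) hf.abs.sq.int (by rw [g2]; exact ig) (by rw [e]; exact hf.abs.int)
  rw [e, g2] at this
  have e2 : ∫ x, g x = area R := by
    rw [hg, integral_indicator hm]; simp [area]
  rw [e2] at this
  simp only [sq_abs] at this
  linarith

theorem pt_q (k) {f} (hf : Sm f) (sf : Sup f) (p : Pt) :
    nmF Z2 qN k f p ≤ area (|p 0 - 2| + 1) * SN (k+2) f (p 0) := by
  induction k generalizing f with
  | zero =>
    set t := p 0 with ht
    have c := fun {f : Pt → ℝ} (hf : Sm f) (x : X2) (y) => chain hf (c := fun s => ft t ![s, y]) (y := x 0) (hasDerivAt_const _ _) (hasDerivAt_id _) (hasDerivAt_const _ _)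
    have hs := sob2 (h := fun x => f (ft t x)) (h1 := fun x => pd 1 f (ft t x)) (h12 := fun x => pd 2 (pd 1 f) (ft t x)) (R := |t - 2| + 1)
      (fun a b => by
        have := chain hf (c := fun y => ft t ![y, b]) (y := a) (hasDerivAt_const _ _) (hasDerivAt_id a) (hasDerivAt_const _ _)
        simpa using this)
      (fun a b => by
        have := chain (smPd hf 1) (c := fun y => ft t ![a, y]) (y := b) (hasDerivAt_const _ _) (hasDerivAt_const _ _) (hasDerivAt_id b)
        simpa using this)
      (ft_cc hf.continuous sf t) (ft_cc (smPd hf 1).continuous (sf.pd 1) t) (ft_cc (smPd (smPd hf 1) 2).continuous ((sf.pd 1).pd 2) t) ![p 1, p 2]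
    rw [ht, ft_surj] at hs
    have h2 := int_sq (ft_cc (smPd (smPd hf 1) 2).continuous ((sf.pd 1).pd 2) t)
    have h3 : (f p)^2 ≤ (∫ x, |pd 2 (pd 1 f) (ft t x)|)^2 := by
      rw [← sq_abs (f p)]; exact pow_le_pow_left₀ (abs_nonneg _) hs 2
    refine h3.trans (h2.trans (mul_le_mul_of_nonneg_left ?_ (area_nn _)))
    refine int_mono (fun x => sq_nonneg _) (qN_cc 2 hf sf t).int fun x => ?_
    simp only [nm2]
    simp only [nmF, qN]
    have h := fun g : Pt → ℝ => sq_nonneg (g (ft t x))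
    linarith [h f, h (pd 1 f), h (pd 2 f), h (pd 1 (pd 1 f)), h (pd 1 (pd 2 f)), h (pd 2 (pd 2 f))]
  | succ k ih =>
    rw [nm2, SN, IN_succ qN_cs _ hf sf]
    have a := ih hf sf
    have b := ih (smPd hf 1) (sf.pd 1)
    have c := ih (smPd hf 2) (sf.pd 2)
    rw [mul_add, mul_add]
    exact add_le_add a (add_le_add b c)

/-- slab constant -/
def aT (T : ℝ) : ℝ := area (T + 2) + 1
theorem aT_pos (T) : 0 < aT T := by have := area_nn (T+2); unfold aT; linarith

theorem area_le {R R' : ℝ} (h : R ≤ R') : area R ≤ area R' :=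
  measureReal_mono (fun x (hx : rad2 x ≤ R) => hx.trans h) (compact_rad2 R').measure_lt_top.ne

theorem pt_a (k) {f} (hf : Sm f) (sf : Sup f) {p : Pt} {T : ℝ} (h1 : 1 ≤ p 0) (hT : p 0 ≤ T) (hT2 : 2 ≤ T) :
    nmF Z2 aN k f p ^ 2 ≤ 3^k * aT T * SN (k+2) f (p 0) := by
  have a := a_le k f p
  have b := pt_q k hf sf p
  have c : area (|p 0 - 2| + 1) ≤ aT T := by
    have : |p 0 - 2| + 1 ≤ T + 2 := by
      have : |p 0 - 2| ≤ T + 1 := abs_le.2 ⟨by linarith, by linarith⟩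
      linarith
    have := area_le this
    unfold aT; linarith
  have d := SN_nn (k+2) f (p 0)
  have := mul_le_mul_of_nonneg_right c d
  rw [mul_assoc]
  exact a.trans (mul_le_mul_of_nonneg_left (b.trans this) (by positivity))

theorem sq2 (a b : ℝ) : (a + b)^2 ≤ 2 * (a^2 + b^2) := by
  linarith [sq_nonneg (a - b), show 2 * (a^2 + b^2) - (a + b)^2 = (a - b)^2 by ring]

theorem SNp {f g} (hf : Sm f) (sf : Sup f) (hg : Sm g) (sg : Sup g) {k t Mf Mg}
    (h : ∀ p : Pt, p 0 = t → ∀ i j, i + j = k → nmF Z2 aN i f p * nmF Z2 aN j g p ≤ Mf * nmF Z2 aN k g p + Mg * nmF Z2 aN k f p) :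
    SN k (fun p => f p * g p) t ≤ (12^k)^2 * (2 * 3^k) * (Mf^2 * SN k g t + Mg^2 * SN k f t) := by
  have i1 := (qN_cc k hf sf t).int
  have i2 := (qN_cc k hg sg t).int
  unfold SN IN
  rw [← integral_const_mul, ← integral_const_mul, ← integral_add (i2.const_mul _) (i1.const_mul _), ← integral_const_mul]
  refine int_mono (fun x => q_nn _ _ _) (((i2.const_mul _).fun_add (i1.const_mul _)).const_mul _) fun x => ?_
  have h1 := nm_mul hf hg (h (ft t x) rfl)
  have h2 := q_le k (fun p => f p * g p) (ft t x)
  have h3 := pow_le_pow_left₀ (nmF_nn (A := Z2) Sn_aN k _ _) h1 2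
  refine h2.trans (h3.trans ?_)
  rw [mul_pow, mul_assoc]
  refine mul_le_mul_of_nonneg_left ((sq2 _ _).trans ?_) (by positivity)
  rw [mul_pow, mul_pow]
  have := mul_le_mul_of_nonneg_left (a_le k g (ft t x)) (sq_nonneg Mf)
  have := mul_le_mul_of_nonneg_left (a_le k f (ft t x)) (sq_nonneg Mg)
  linarith

def Qb (P : Fin 3 → Fin 3 → ℝ) (a b : Pt → ℝ) (p : Pt) : ℝ := ∑ α : Fin 3, ∑ β : Fin 3, P α β * (pd α a p * pd β b p)
theorem Qf_Qb (P w) : Qf P w = Qb P w w := Qf_eq P w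

theorem pdsum_sq (k) {u} (hu : Sm u) (p) : (nmF Z2 aN k (pd 0 u) p + (nmF Z2 aN k (pd 1 u) p + nmF Z2 aN k (pd 2 u) p))^2 ≤ 3^(k+1) * nmF Z2 eN k u p := by
  refine (sq3 _ _ _).trans ?_
  rw [eN_split k hu, pow_succ (3:ℝ) k]
  have := a_le k (pd 0 u) p
  have := a_le k (pd 1 u) p
  have := a_le k (pd 2 u) p
  have := mul_nonneg (show (0:ℝ) ≤ 3^k by positivity) (q_nn k u p)
  linarith

theorem pdsum_le (k) {u : Pt → ℝ} (α p) : nmF Z2 aN k (pd α u) p ≤ nmF Z2 aN k (pd 0 u) p + (nmF Z2 aN k (pd 1 u) p + nmF Z2 aN k (pd 2 u) p) := by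
  have h := fun α => nmF_nn (A := Z2) Sn_aN k (pd α u) p
  have := h 0
  have := h 1
  have := h 2
  fin_cases α <;> simp only [Fin.zero_eta, Fin.mk_one, Fin.reduceFinMk] <;> linarith

theorem smQb (P) {a b} (ha : Sm a) (hb : Sm b) : Sm (Qb P a b) := by
  refine sm_sum _ fun α _ => sm_sum _ fun β _ => by fun_prop
theorem supQb (P) {a b} (ha : Sup a) : Sup (Qb P a b) := fun p hp => by simp [Qb, ha.pd _ p hp]

theorem SNQ (P) {a b} (ha : Sm a) (sa : Sup a) (hb : Sm b) (sb : Sup b) {k t Mf Mg} (hMf : 0 ≤ Mf) (hMg : 0 ≤ Mg)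
    (h : ∀ α β, ∀ p : Pt, p 0 = t → ∀ i j, i + j = k → nmF Z2 aN i (pd α a) p * nmF Z2 aN j (pd β b) p ≤ Mf * nmF Z2 aN k (pd β b) p + Mg * nmF Z2 aN k (pd α a) p) :
    SN k (Qb P a b) t ≤ (sP P * 12^k)^2 * (2 * 3^(k+1)) * (Mf^2 * EN k b t + Mg^2 * EN k a t) := by
  have i1 := (eN_cc k ha sa t).int
  have i2 := (eN_cc k hb sb t).int
  unfold SN EN IN
  rw [← integral_const_mul, ← integral_const_mul, ← integral_add (i2.const_mul _) (i1.const_mul _), ← integral_const_mul]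
  refine int_mono (fun x => q_nn _ _ _) (((i2.const_mul _).fun_add (i1.const_mul _)).const_mul _) fun x => ?_
  set p := ft t x
  set X := nmF Z2 aN k (pd 0 b) p + (nmF Z2 aN k (pd 1 b) p + nmF Z2 aN k (pd 2 b) p) with hX
  set Y := nmF Z2 aN k (pd 0 a) p + (nmF Z2 aN k (pd 1 a) p + nmF Z2 aN k (pd 2 a) p) with hY
  have h1 : nmF Z2 aN k (Qb P a b) p ≤ sP P * (12^k * (Mf * X + Mg * Y)) := by
    refine Qsum Sn_aN (fun α β => by fun_prop) fun α β => nm_mul (smPd ha α) (smPd hb β) fun i j e => (h α β p rfl i j e).trans ?_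
    have := mul_le_mul_of_nonneg_left (pdsum_le k (u := b) β p) hMf
    have := mul_le_mul_of_nonneg_left (pdsum_le k (u := a) α p) hMg
    linarith
  have h3 := pow_le_pow_left₀ (nmF_nn (A := Z2) Sn_aN k _ _) h1 2
  refine (q_le k _ _).trans (h3.trans ?_)
  rw [← mul_assoc, mul_pow, mul_assoc ((sP P * 12^k)^2)]
  refine mul_le_mul_of_nonneg_left ((sq2 _ _).trans ?_) (sq_nonneg _)
  rw [mul_pow, mul_pow]
  have := mul_le_mul_of_nonneg_left (pdsum_sq k hb p) (sq_nonneg Mf)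
  have := mul_le_mul_of_nonneg_left (pdsum_sq k ha p) (sq_nonneg Mg)
  linarith

theorem SN_add (k) {f g} (hf : Sm f) (sf : Sup f) (hg : Sm g) (sg : Sup g) (t) :
    SN k (fun p => f p + g p) t ≤ 2 * 3^k * (SN k f t + SN k g t) := by
  have i1 := (qN_cc k hf sf t).int
  have i2 := (qN_cc k hg sg t).int
  unfold SN IN
  rw [← integral_add i1 i2, ← integral_const_mul]
  refine int_mono (fun x => q_nn _ _ _) ((i1.fun_add i2).const_mul _) fun x => ?_
  refine (q_le k _ _).trans ((pow_le_pow_left₀ (nmF_nn (A := Z2) Sn_aN k _ _) (nmF_add Sn_aN hf hg k _) 2).trans ((sq2 _ _).trans ?_))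
  have := a_le k f (ft t x)
  have := a_le k g (ft t x)
  linarith

structure Dt (g : X2 → ℝ) : Prop where
  sm : Sm g
  s : ∀ x, 1 < rad2 x → g x = 0

theorem Dt.hcs {g} (h : Dt g) : HasCompactSupport g := CC.hcs (R := 1) ⟨h.sm.continuous, h.s⟩

theorem slice_pd {u : Pt → ℝ} {g : X2 → ℝ} (hu : Sm u) (hg : Sm g) (h : ∀ x, u (sl x) = g x) (i : Fin 2) (x) :
    pd i.succ u (sl x) = fderiv ℝ g x (Pi.single i 1) := by
  have dg := (hg.differentiable (by simp) x).hasFDerivAt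
  fin_cases i
  · have a := chain hu (c := fun y => sl ![y, x 1]) (y := x 0) (hasDerivAt_const _ _) (hasDerivAt_id _) (hasDerivAt_const _ _)
    have c : HasDerivAt (fun y : ℝ => (![y, x 1] : X2)) (Pi.single 0 1) (x 0) := by
      rw [hasDerivAt_pi]; intro j; fin_cases j
      · simpa using hasDerivAt_id' (x 0)
      · simpa using hasDerivAt_const (x 0) (x 1)
    have e : x = (![x 0, x 1] : X2) := by ext j; fin_cases j <;> rfl
    have b := HasFDerivAt.comp_hasDerivAt (x 0) (by rw [← e]; exact dg) c
    have := a.unique (b.congr_of_eventuallyEq (Filter.Eventually.of_forall fun y => h _))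
    rw [← e] at this
    simpa using this
  · have a := chain hu (c := fun y => sl ![x 0, y]) (y := x 1) (hasDerivAt_const _ _) (hasDerivAt_const _ _) (hasDerivAt_id _)
    have c : HasDerivAt (fun y : ℝ => (![x 0, y] : X2)) (Pi.single 1 1) (x 1) := by
      rw [hasDerivAt_pi]; intro j; fin_cases j
      · simpa using hasDerivAt_const (x 1) (x 0)
      · simpa using hasDerivAt_id' (x 1)
    have e : x = (![x 0, x 1] : X2) := by ext j; fin_cases j <;> rfl
    have b := HasFDerivAt.comp_hasDerivAt (x 1) (by rw [← e]; exact dg) c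
    have := a.unique (b.congr_of_eventuallyEq (Filter.Eventually.of_forall fun y => h _))
    rw [← e] at this
    simpa using this

def Sq (k : ℕ) (g : X2 → ℝ) (x : X2) : ℝ := ∑ j ∈ Finset.range (k + 1), ‖iteratedFDeriv ℝ j g x‖^2

theorem sm_fd {g : X2 → ℝ} (hg : Sm g) (e : X2) : Sm (fun x => fderiv ℝ g x e) :=
  (hg.fderiv_right (m := (⊤ : ℕ∞)) (by simp)).clm_apply contDiff_const

theorem Sq_fd {g : X2 → ℝ} (hg : Sm g) (i : Fin 2) (k x) : Sq k (fun x => fderiv ℝ g x (Pi.single i 1)) x ≤ Sq (k+1) g x := by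
  unfold Sq
  rw [Finset.sum_range_succ' _ (k+1)]
  refine le_add_of_le_of_nonneg (Finset.sum_le_sum fun j _ => ?_) (sq_nonneg _)
  refine pow_le_pow_left₀ (norm_nonneg _) ?_ 2
  have h1 := norm_iteratedFDeriv_clm_apply_const (𝕜 := ℝ) (f := fderiv ℝ g) (c := (Pi.single i 1 : X2)) (x := x) (N := j) (n := j)
    ((hg.fderiv_right (m := ((⊤ : ℕ∞) : WithTop ℕ∞)) (by rfl)).contDiffAt.of_le (by exact_mod_cast le_top)) le_rfl
  rw [norm_iteratedFDeriv_fderiv] at h1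
  have : ‖(Pi.single i 1 : X2)‖ = 1 := by rw [Pi.norm_single]; simp
  rw [this, one_mul] at h1
  exact h1

theorem Sq_succ (k g x) : Sq k g x ≤ Sq (k+1) g x := by
  unfold Sq; rw [Finset.sum_range_succ _ (k+1)]; exact le_add_of_nonneg_right (sq_nonneg _)

theorem q_Sq (k) {u : Pt → ℝ} {g : X2 → ℝ} (hu : Sm u) (hg : Sm g) (h : ∀ x, u (sl x) = g x) (x) :
    nmF Z2 qN k u (sl x) ≤ 3^k * Sq k g x := by
  induction k generalizing u g with
  | zero => simp [nmF, qN, Sq, h x]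
  | succ k ih =>
    rw [nm2]
    have a := (ih hu hg h).trans (mul_le_mul_of_nonneg_left (Sq_succ k g x) (by positivity))
    have b := (ih (smPd hu 1) (sm_fd hg _) (slice_pd hu hg h 0)).trans (mul_le_mul_of_nonneg_left (Sq_fd hg 0 k x) (by positivity))
    have c := (ih (smPd hu 2) (sm_fd hg _) (slice_pd hu hg h 1)).trans (mul_le_mul_of_nonneg_left (Sq_fd hg 1 k x) (by positivity))
    rw [pow_succ]; linarith

theorem itint {g} (h : Dt g) (j) : Integrable fun x => ‖iteratedFDeriv ℝ j g x‖^2 := by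
  refine Continuous.integrable_of_hasCompactSupport (((h.sm.continuous_iteratedFDeriv (by exact_mod_cast le_top)).norm).pow 2) ?_
  exact (h.hcs.iteratedFDeriv j).comp_left (g := fun m => ‖m‖^2) (by simp)

theorem Sq_int {g} (h : Dt g) (k) : Integrable (Sq k g) := integrable_finsetSum _ fun j _ => itint h j

theorem Sq_sob {g} (h : Dt g) (k) : ∫ x, Sq k g x = sobolevNorm k g ^ 2 := by
  unfold sobolevNorm Sq
  rw [Real.sq_sqrt (Finset.sum_nonneg fun j _ => integral_nonneg fun x => sq_nonneg _), integral_finsetSum _ fun j _ => itint h j]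

theorem EN_data (k) {u : Pt → ℝ} {g0 g1 : X2 → ℝ} (hu : Sm u) (su : Sup u) (d0 : Dt g0) (d1 : Dt g1)
    (h0 : ∀ x, u (sl x) = g0 x) (h1 : ∀ x, pd 0 u (sl x) = g1 x) :
    EN k u 2 ≤ 3^k * (3 * sobolevNorm (k+1) g0 ^ 2 + sobolevNorm k g1 ^ 2) := by
  rw [← Sq_sob d0, ← Sq_sob d1, ← integral_const_mul, ← integral_add ((Sq_int d0 _).const_mul _) (Sq_int d1 _), ← integral_const_mul]
  refine int_mono (fun x => e_nn _ hu _) ((((Sq_int d0 _).const_mul _).fun_add (Sq_int d1 _)).const_mul _) fun x => ?_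
  rw [eN_split k hu, ft_sl]
  have a := (q_Sq k hu d0.sm h0 x).trans (mul_le_mul_of_nonneg_left (Sq_succ k g0 x) (by positivity))
  have b := (q_Sq k (smPd hu 1) (sm_fd d0.sm _) (slice_pd hu d0.sm h0 0) x).trans (mul_le_mul_of_nonneg_left (Sq_fd d0.sm 0 k x) (by positivity))
  have c := (q_Sq k (smPd hu 2) (sm_fd d0.sm _) (slice_pd hu d0.sm h0 1) x).trans (mul_le_mul_of_nonneg_left (Sq_fd d0.sm 1 k x) (by positivity))
  have d := q_Sq k (smPd hu 0) d1.sm h1 x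
  linarith

theorem sob_mono {g : X2 → ℝ} {k j} (h : k ≤ j) : sobolevNorm k g ≤ sobolevNorm j g :=
  Real.sqrt_le_sqrt (Finset.sum_le_sum_of_subset_of_nonneg (Finset.range_mono (by omega)) fun _ _ _ => integral_nonneg fun x => sq_nonneg _)

/-- the Picard iteration -/
structure It (P : Fin 3 → Fin 3 → ℝ) (w0 w1 v0 v1 : X2 → ℝ) (w v : ℕ → Pt → ℝ) : Prop where
  d0 : Dt w0
  d1 : Dt w1
  e0 : Dt v0
  e1 : Dt v1
  sw : ∀ n, Sm (w n)
  Sw : ∀ n, Sup (w n)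
  sv : ∀ n, Sm (v n)
  Sv : ∀ n, Sup (v n)
  zw : w 0 = fun _ => 0
  zv : v 0 = fun _ => 0
  ew : ∀ n, (fun p => negBox (w (n+1)) p + 0 * w (n+1) p) = fun p => v n p * v n p
  ev : ∀ n, (fun p => negBox (v (n+1)) p + 1 * v (n+1) p) = Qb P (w n) (w n)
  iw0 : ∀ n x, w (n+1) (sl x) = w0 x
  iw1 : ∀ n x, pd 0 (w (n+1)) (sl x) = w1 x
  iv0 : ∀ n x, v (n+1) (sl x) = v0 x
  iv1 : ∀ n x, pd 0 (v (n+1)) (sl x) = v1 x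

theorem It_ex (P) {w0 w1 v0 v1 : X2 → ℝ} (d0 : Dt w0) (d1 : Dt w1) (e0 : Dt v0) (e1 : Dt v1) : ∃ w v, It P w0 w1 v0 v1 w v := by
  have W : ∀ v : {v : Pt → ℝ // Sm v ∧ Sup v}, ∃ w : {v : Pt → ℝ // Sm v ∧ Sup v}, (∀ p, negBox w.1 p + 0 * w.1 p = v.1 p * v.1 p) ∧ (∀ x, w.1 (sl x) = w0 x) ∧ ∀ x, pd 0 w.1 (sl x) = w1 x := fun ⟨v, hv, sv⟩ => by
    obtain ⟨u, a, b, c, d, e⟩ := solve 0 (hv.mul hv) (sv.mul_left v) d0.sm d1.sm d0.s d1.s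
    exact ⟨⟨u, a, b⟩, fun p => by have := c p; norm_num at this ⊢; exact this, d, e⟩
  have V : ∀ w : {v : Pt → ℝ // Sm v ∧ Sup v}, ∃ v : {v : Pt → ℝ // Sm v ∧ Sup v}, (∀ p, negBox v.1 p + 1 * v.1 p = Qb P w.1 w.1 p) ∧ (∀ x, v.1 (sl x) = v0 x) ∧ ∀ x, pd 0 v.1 (sl x) = v1 x := fun ⟨w, hw, sw⟩ => by
    obtain ⟨u, a, b, c, d, e⟩ := solve 1 (smQb P hw hw) (supQb P sw) e0.sm e1.sm e0.s e1.s
    exact ⟨⟨u, a, b⟩, fun p => by have := c p; norm_num at this ⊢; exact this, d, e⟩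
  choose fw hw0 hw1 hw2 using W
  choose fv hv0 hv1 hv2 using V
  let z : {v : Pt → ℝ // Sm v ∧ Sup v} := ⟨fun _ => 0, contDiff_const, fun _ _ => rfl⟩
  let q : ℕ → {v : Pt → ℝ // Sm v ∧ Sup v} × {v : Pt → ℝ // Sm v ∧ Sup v} := fun n => Nat.rec (z, z) (fun _ r => (fw r.2, fv r.1)) n
  exact ⟨fun n => (q n).1.1, fun n => (q n).2.1, d0, d1, e0, e1, fun n => (q n).1.2.1, fun n => (q n).1.2.2, fun n => (q n).2.2.1, fun n => (q n).2.2.2, rfl, rfl,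
    fun n => funext (hw0 (q n).2), fun n => funext (hv0 (q n).1), fun n => hw1 (q n).2, fun n => hw2 (q n).2, fun n => hv1 (q n).1, fun n => hv2 (q n).1⟩

def Y2 (k : ℕ) (a b : Pt → ℝ) (t : ℝ) : ℝ := EN k a t + EN k b t

theorem Y2_nn (k) {a b} (ha : Sm a) (hb : Sm b) (t) : 0 ≤ Y2 k a b t := add_nonneg (EN_nn k ha t) (EN_nn k hb t)

theorem Ystep (k) {a b} (ha : Sm a) (sa : Sup a) (hb : Sm b) (sb : Sup b) (t) :
    ∃ D, HasDerivAt (Y2 k a b) D t ∧ |D| ≤ 2 * Y2 k a b t + (SN k (fun p => negBox a p + 0 * a p) t + SN k (fun p => negBox b p + 1 * b p) t) := by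
  obtain ⟨D, d, e⟩ := EN_deriv k (Or.inl rfl) ha sa t
  obtain ⟨D', d', e'⟩ := EN_deriv k (Or.inr rfl) hb sb t
  refine ⟨D + D', d.fun_add d', (abs_add_le _ _).trans ?_⟩
  unfold Y2; linarith

theorem lowhigh {A f g p j k M} (hk : k ≤ 2 * j + 1) (hf : nmF A aN j f p ≤ M) (hg : nmF A aN j g p ≤ M) :
    ∀ i i', i + i' = k → nmF A aN i f p * nmF A aN i' g p ≤ M * nmF A aN k g p + M * nmF A aN k f p := by
  intro i i' e
  have n := fun i u => nmF_nn (A := A) Sn_aN i u p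
  have hM := (n _ _).trans hf
  rcases le_or_gt i j with h | h
  · have := mul_le_mul ((nmF_mono Sn_aN h f p).trans hf) (nmF_mono (A := A) Sn_aN (show i' ≤ k by omega) g p) (n _ _) hM
    have := mul_nonneg hM (n k f)
    linarith
  · have := mul_le_mul (nmF_mono (A := A) Sn_aN (show i ≤ k by omega) f p) ((nmF_mono Sn_aN (show i' ≤ j by omega) g p).trans hg) (n _ _) (n _ _)
    have := mul_nonneg hM (n k g)
    linarith

theorem Src (P : Fin 3 → Fin 3 → ℝ) (k : ℕ) : ∃ c, 0 < c ∧ ∀ {w v : Pt → ℝ} {t M : ℝ} {j : ℕ}, Sm w → Sup w → Sm v → Sup v → k ≤ 2 * j + 1 →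
    (∀ p : Pt, p 0 = t → nmF Z2 aN j v p ≤ M ∧ ∀ α, nmF Z2 aN j (pd α w) p ≤ M) →
    SN k (fun p => v p * v p) t + SN k (Qb P w w) t ≤ c * M^2 * Y2 k w v t := by
  have hs := sP_nn P
  refine ⟨(12^k)^2 * (2 * 3^k) * 2 + (sP P * 12^k)^2 * (2 * 3^(k+1)) * 2, by positivity, fun {w v t M j} hw sw hv sv hk h => ?_⟩
  have hM : 0 ≤ M := (nmF_nn Sn_aN _ _ _).trans (h (ft t 0) rfl).1
  have a := SNp hv sv hv sv (fun p hp => lowhigh hk (h p hp).1 (h p hp).1)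
  have b := SNQ P hw sw hw sw hM hM (fun α β p hp => lowhigh hk ((h p hp).2 α) ((h p hp).2 β))
  have c := SN_u k hv sv t
  have e1 := EN_nn k hw t
  have e2 := EN_nn k hv t
  refine (add_le_add a b).trans ?_
  unfold Y2
  have c1 : M^2 * SN k v t + M^2 * SN k v t ≤ 2 * (M^2 * (EN k w t + EN k v t)) := by nlinarith [mul_le_mul_of_nonneg_left c (sq_nonneg M), mul_nonneg (sq_nonneg M) e1]
  have c2 : M^2 * EN k w t + M^2 * EN k w t ≤ 2 * (M^2 * (EN k w t + EN k v t)) := by nlinarith [mul_nonneg (sq_nonneg M) e2]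
  have d1 := mul_le_mul_of_nonneg_left c1 (show (0:ℝ) ≤ (12^k)^2 * (2 * 3^k) by positivity)
  have d2 := mul_le_mul_of_nonneg_left c2 (show (0:ℝ) ≤ (sP P * 12^k)^2 * (2 * 3^(k+1)) by positivity)
  linarith

theorem pt_Y (k) {w v : Pt → ℝ} (hw : Sm w) (sw : Sup w) (hv : Sm v) (sv : Sup v) {p : Pt} {T} (h1 : 1 ≤ p 0) (hT : p 0 ≤ T) (hT2 : 2 ≤ T) :
    (nmF Z2 aN k v p ≤ √(3^k * aT T * Y2 (k+2) w v (p 0)) ∧ ∀ α, nmF Z2 aN k (pd α v) p ≤ √(3^k * aT T * Y2 (k+2) w v (p 0))) ∧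
    nmF Z2 aN k w p ≤ √(3^k * aT T * Y2 (k+2) w v (p 0)) ∧ ∀ α, nmF Z2 aN k (pd α w) p ≤ √(3^k * aT T * Y2 (k+2) w v (p 0)) := by
  have ha := aT_pos T
  have e1 := EN_nn (k+2) hw (p 0)
  have e2 := EN_nn (k+2) hv (p 0)
  have key : ∀ {f}, Sm f → Sup f → SN (k+2) f (p 0) ≤ Y2 (k+2) w v (p 0) → nmF Z2 aN k f p ≤ √(3^k * aT T * Y2 (k+2) w v (p 0)) := fun hf sf h =>
    Real.le_sqrt_of_sq_le ((pt_a k hf sf h1 hT hT2).trans (mul_le_mul_of_nonneg_left h (by positivity)))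
  unfold Y2 at *
  exact ⟨⟨key hv sv (by linarith [SN_u (k+2) hv sv (p 0)]), fun α => key (smPd hv α) (sv.pd α) (by linarith [SN_pd (k+2) hv sv α (p 0)])⟩,
    key hw sw (by linarith [SN_u (k+2) hw sw (p 0)]), fun α => key (smPd hw α) (sw.pd α) (by linarith [SN_pd (k+2) hw sw α (p 0)])⟩

theorem EN_zero (k t) : EN k (fun _ => 0) t = 0 := by
  have : ∀ k, ∀ p, nmF Z2 eN k (fun _ => 0) p = 0 := by
    have h0 : ∀ α, pd α (fun _ : Pt => (0:ℝ)) = fun _ => 0 := fun α => by funext p; simp [pd]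
    intro k
    induction k with
    | zero => intro p; simp [nmF, eN, h0]
    | succ k ih => intro p; simp [nm2, h0, ih]
  simp [IN, this]

theorem loc_Y (P : Fin 3 → Fin 3 → ℝ) : ∃ c, 0 < c ∧ ∀ {w0 w1 v0 v1 w v} {e : ℝ}, It P w0 w1 v0 v1 w v → 0 ≤ e → (∀ n, Y2 10 (w n) (v n) 2 ≤ e) → c * e ≤ 1 →
    ∀ n t, 1 ≤ t → t ≤ 3 → Y2 10 (w n) (v n) t ≤ 54 * e := by
  obtain ⟨c, hc, H⟩ := Src P 10
  have ha := aT_pos 3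
  refine ⟨2 * 27 * 54 * (c * (3^8 * aT 3)), by positivity, fun {w0 w1 v0 v1 w v e} h he h2 hs n => ?_⟩
  induction n with
  | zero =>
    intro t _ _
    rw [h.zw, h.zv, Y2, EN_zero]; linarith
  | succ n ih =>
    intro t t1 t3
    set c1 := c * (3^8 * aT 3) with hc1
    have c1p : 0 < c1 := by positivity
    have := GR2 (y := Y2 10 (w (n+1)) (v (n+1))) (T := 3) (B := e + c1 * (54*e)^2) (c := c1 * (54*e)^2) (L := 3) (fun s s1 s3 => ?_) (by norm_num)
      (by have := h2 (n+1); have : 0 ≤ c1 * (54 * e)^2 := by positivity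
          linarith) (by linarith) t1 t3
    · refine this.trans ?_
      have e3 : Real.exp (3 * |t - 2|) ≤ 27 := by
        have : |t - 2| ≤ 1 := abs_le.2 ⟨by linarith, by linarith⟩
        have h1 : Real.exp (3 * |t-2|) ≤ Real.exp 3 := Real.exp_le_exp.2 (by linarith)
        have h2 : Real.exp 3 = Real.exp 1 ^ 3 := by rw [← Real.exp_nat_mul]; norm_num
        have h3 : Real.exp 1 < 3 := by have := Real.exp_one_lt_d9; linarith
        have h4 : Real.exp 1 ^ 3 ≤ 3 ^ 3 := pow_le_pow_left₀ (Real.exp_pos 1).le h3.le 3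
        rw [h2] at h1; linarith
      refine (mul_le_mul_of_nonneg_left e3 (by positivity)).trans ?_
      have := mul_le_mul_of_nonneg_right hs he
      nlinarith
    · obtain ⟨D, d, b⟩ := Ystep 10 (h.sw (n+1)) (h.Sw _) (h.sv (n+1)) (h.Sv _) s
      refine ⟨D, d, b.trans ?_⟩
      rw [h.ew n, h.ev n]
      have y0 := Y2_nn 10 (h.sw n) (h.sv n) s
      have y1 := ih s s1 s3
      have := H (j := 8) (t := s) (M := √(3^8 * aT 3 * Y2 10 (w n) (v n) s)) (h.sw n) (h.Sw n) (h.sv n) (h.Sv n) (by norm_num) (fun p hp => by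
        have := pt_Y 8 (h.sw n) (h.Sw n) (h.sv n) (h.Sv n) (p := p) (T := 3) (by linarith) (by linarith) (by norm_num)
        rw [hp] at this
        exact ⟨this.1.1, this.2.2⟩)
      rw [Real.sq_sqrt (by positivity)] at this
      have e1 : Real.exp (3 * |s - 2|) ≥ 1 := Real.one_le_exp (by positivity)
      have q : c * (3^8 * aT 3 * Y2 10 (w n) (v n) s) * Y2 10 (w n) (v n) s ≤ c1 * (54 * e)^2 := by
        rw [hc1, ← mul_assoc c, mul_assoc, ← sq]
        exact mul_le_mul_of_nonneg_left (pow_le_pow_left₀ y0 y1 2) (by positivity)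
      have q2 : c1 * (54*e)^2 ≤ c1 * (54 * e)^2 * Real.exp (3 * |s - 2|) := le_mul_of_one_le_right (by positivity) e1
      linarith

theorem nm3 (N : (Pt → ℝ) → Pt → ℝ) (k u p) : nmF Z3 N (k+1) u p = nmF Z3 N k u p + (nmF Z3 N k (pd 0 u) p + (nmF Z3 N k (pd 1 u) p + nmF Z3 N k (pd 2 u) p)) := by
  show nmF Z3 N k u p + ∑ i ∈ Z3, nmF Z3 N k (dd i u) p = _
  congr 1
  rw [Z3, Finset.sum_insert (by decide), Finset.sum_insert (by decide), Finset.sum_singleton]; rfl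

theorem nmF_subset {A B : Finset (Fin 5)} (h : A ⊆ B) (k u p) : nmF A aN k u p ≤ nmF B aN k u p := by
  induction k generalizing u with
  | zero => exact le_rfl
  | succ k ih =>
    refine add_le_add (ih u) ((Finset.sum_le_sum fun i _ => ih _).trans ?_)
    exact Finset.sum_le_sum_of_subset_of_nonneg h fun _ _ _ => nmF_nn Sn_aN _ _ _

theorem pd_emb2 (k) (u p) {α : Fin 3} (h : emb α ∈ Z2) : nmF Z2 aN k (pd α u) p ≤ nmF Z2 aN (k+1) u p := by
  rw [← dd_emb]; exact nmF_dd Sn_aN k u p h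
theorem pd_emb3 (k) (u p) (α : Fin 3) : nmF Z3 aN k (pd α u) p ≤ nmF Z3 aN (k+1) u p := by
  rw [← dd_emb]; exact nmF_dd Sn_aN k u p (by fin_cases α <;> decide)

theorem red (k) {m : ℝ} (hm : m = 0 ∨ m = 1) {u} (hu : Sm u) (p) :
    nmF Z3 aN (k+2) u p ≤ 7^(k+1) * (nmF Z2 aN (k+2) u p + nmF Z2 aN (k+1) (pd 0 u) p + nmF Z3 aN k (fun p => negBox u p + m * u p) p) := by
  have m1 : |m| ≤ 1 := by rcases hm with rfl | rfl <;> simp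
  induction k generalizing u with
  | zero =>
    have h00 : |pd 0 (pd 0 u) p| ≤ |negBox u p + m * u p| + |u p| + |pd 1 (pd 1 u) p| + |pd 2 (pd 2 u) p| := by
      have e : pd 0 (pd 0 u) p = (negBox u p + m * u p) - m * u p + pd 1 (pd 1 u) p + pd 2 (pd 2 u) p := by
        unfold negBox; ring
      rw [e]
      have a := abs_add_le ((negBox u p + m * u p) - m * u p + pd 1 (pd 1 u) p) (pd 2 (pd 2 u) p)
      have b := abs_add_le ((negBox u p + m * u p) - m * u p) (pd 1 (pd 1 u) p)
      have c := abs_sub (negBox u p + m * u p) (m * u p)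
      have d : |m * u p| ≤ |u p| := by rw [abs_mul]; exact mul_le_of_le_one_left (abs_nonneg _) m1
      linarith
    show nmF Z3 aN (0+1+1) u p ≤ 7^(0+1) * (nmF Z2 aN (0+1+1) u p + nmF Z2 aN (0+1) (pd 0 u) p + nmF Z3 aN 0 (fun p => negBox u p + m * u p) p)
    simp only [nm3, nm2]
    simp only [nmF, aN]
    rw [pd_comm hu 0 1, pd_comm hu 0 2, pd_comm hu 2 1]
    have h := fun f : Pt → ℝ => abs_nonneg (f p)
    have := h u
    have := h (pd 0 u)
    have := h (pd 1 u)
    have := h (pd 2 u)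
    have := h (pd 1 (pd 0 u))
    have := h (pd 2 (pd 0 u))
    have := h (pd 1 (pd 1 u))
    have := h (pd 1 (pd 2 u))
    have := h (pd 2 (pd 2 u))
    have := abs_nonneg (negBox u p + m * u p)
    norm_num
    linarith
  | succ k ih =>
    have hF : Sm (fun p => negBox u p + m * u p) := by have := smNegBox hu; fun_prop
    have i0 := ih hu
    have i1 := fun α => ih (smPd hu α)
    simp only [dd12_negBox hu] at i1
    set F := fun p => negBox u p + m * u p with hFd
    have j0 := i1 0
    have j1 := i1 1
    have j2 := i1 2
    rw [nm3]
    have n := fun A k u => nmF_nn (A := A) Sn_aN k u p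
    -- pieces
    have a1 := nmF_le_succ (A := Z2) Sn_aN (k+2) u p
    have a2 := nmF_le_succ (A := Z2) Sn_aN (k+1) (pd 0 u) p
    have a3 := nmF_le_succ (A := Z3) Sn_aN k F p
    have b1 := pd_emb2 (k+2) u p (α := 1) (by decide)
    have b2 := pd_emb2 (k+2) u p (α := 2) (by decide)
    have b3 := pd_emb2 (k+1) (pd 0 u) p (α := 1) (by decide)
    have b4 := pd_emb2 (k+1) (pd 0 u) p (α := 2) (by decide)
    rw [pd_comm hu 1 0] at b3
    rw [pd_comm hu 2 0] at b4
    have c0 := pd_emb3 k F p 0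
    have c1 := pd_emb3 k F p 1
    have c2 := pd_emb3 k F p 2
    have d1 := (pd_emb2 (k+1) (pd 1 u) p (α := 1) (by decide)).trans b1
    have d2 := (pd_emb2 (k+1) (pd 2 u) p (α := 2) (by decide)).trans b2
    have d3 := nmF_subset (show Z2 ⊆ Z3 by decide) (k+1) F p
    have d4 := nmF_mono (A := Z2) Sn_aN (show k+1 ≤ k+3 by omega) u p
    have e : pd 0 (pd 0 u) = fun p => (F p - m * u p) + (pd 1 (pd 1 u) p + pd 2 (pd 2 u) p) := by
      funext p; simp only [hFd]; unfold negBox; ring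
    have e1 : nmF Z2 aN (k+1) (pd 0 (pd 0 u)) p ≤ nmF Z3 aN (k+1) F p + 3 * nmF Z2 aN (k+3) u p := by
      rw [e]
      have q1 := nmF_add (A := Z2) Sn_aN (show Sm fun p => F p - m * u p by fun_prop) (show Sm fun p => pd 1 (pd 1 u) p + pd 2 (pd 2 u) p by fun_prop) (k+1) p
      have q2 := nmF_sub (A := Z2) Sn_aN hF (show Sm fun p => m * u p by fun_prop) (k+1) p
      have q3 := nmF_add (A := Z2) Sn_aN (show Sm (pd 1 (pd 1 u)) by fun_prop) (show Sm (pd 2 (pd 2 u)) by fun_prop) (k+1) p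
      rw [nmF_cmul Sn_aN hu] at q2
      have q4 := mul_le_of_le_one_left (n Z2 (k+1) u) m1
      linarith
    refine (add_le_add i0 (add_le_add j0 (add_le_add j1 j2))).trans ?_
    rw [← mul_add, ← mul_add, ← mul_add, pow_succ (7:ℝ) (k+1), mul_assoc]
    refine mul_le_mul_of_nonneg_left ?_ (by positivity)
    have := n Z2 (k+3) u
    have := n Z2 (k+2) (pd 0 u)
    have := n Z3 (k+1) F
    linarith

theorem nm_const (k) (c : ℝ) (p) : nmF Z3 aN k (fun _ => c) p = |c| := by
  have z : ∀ k, nmF Z3 aN k (fun _ => (0:ℝ)) p = 0 := fun k => by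
    have := nmF_cmul (A := Z3) Sn_aN (u := fun _ => 0) contDiff_const 0 k p
    simpa using this
  cases k with
  | zero => rfl
  | succ k =>
    have : ∀ k, nmF Z3 aN k (fun _ => c) p = |c| := fun k => by
      induction k with
      | zero => rfl
      | succ k ih => rw [nm3, ih]; simp only [pd_const, z]; ring
    exact this _

theorem nm_coord (k) (j : Fin 3) (p : Pt) : nmF Z3 aN k (fun p => p j) p ≤ |p j| + 3 * k := by
  induction k with
  | zero => simp [nmF, aN]
  | succ k ih =>
    rw [nm3]; simp only [pd_coord, nm_const]
    have hi : ∀ i : Fin 3, |(if i = j then 1 else 0 : ℝ)| ≤ 1 := fun i => by split_ifs <;> simp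
    have := hi 0
    have := hi 1
    have := hi 2
    push_cast; linarith

theorem nm_coord_mul (k) (j : Fin 3) {u} (hu : Sm u) {p : Pt} (hp : |p j| ≤ 3) :
    nmF Z3 aN k (fun p => p j * u p) p ≤ 12^k * ((3 + 3 * k) * nmF Z3 aN k u p) := by
  refine nm_mul (by fun_prop) hu fun i i' e => ?_
  have h1 := nm_coord i j p
  have h2 : (i:ℝ) ≤ k := by exact_mod_cast (by omega : i ≤ k)
  exact mul_le_mul (by linarith) (nmF_mono Sn_aN (by omega) u p) (nmF_nn Sn_aN _ _ _) (by positivity)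

theorem Z53 (k : ℕ) : ∃ C, 1 ≤ C ∧ ∀ {u : Pt → ℝ} {p : Pt}, Sm u → (∀ j, |p j| ≤ 3) → nmF Z5 aN k u p ≤ C * nmF Z3 aN k u p := by
  induction k with
  | zero => exact ⟨1, le_rfl, fun {u p} _ _ => by simp [nmF]⟩
  | succ k ih =>
    obtain ⟨C, hC, H⟩ := ih
    set q : ℝ := 12^k * (3 + 3 * k) with hq
    have q0 : 0 ≤ q := by positivity
    refine ⟨C * (4 + 4 * q), by nlinarith, fun {u p} hu hp => ?_⟩
    have n := fun k u => nmF_nn (A := Z3) Sn_aN k u p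
    have s1 := nmF_le_succ (A := Z3) Sn_aN k u p
    have s2 := fun α => pd_emb3 k u p α
    have L : ∀ j α, nmF Z3 aN k (fun p => p j * pd α u p) p ≤ q * nmF Z3 aN (k+1) u p := fun j α => by
      refine (nm_coord_mul k j (smPd hu α) (hp j)).trans ?_
      rw [← mul_assoc]; exact mul_le_mul_of_nonneg_left (s2 α) q0
    have B : ∀ a : Fin 2, nmF Z3 aN k (boost a u) p ≤ 2 * q * nmF Z3 aN (k+1) u p := fun a => by
      have := nmF_add (A := Z3) Sn_aN (show Sm fun p => p a.succ * pd 0 u p by fun_prop) (show Sm fun p => p 0 * pd a.succ u p by fun_prop) k p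
      have l1 := L a.succ 0
      have l2 := L 0 a.succ
      have e : boost a u = fun p => p a.succ * pd 0 u p + p 0 * pd a.succ u p := rfl
      rw [e]; linarith
    have e : nmF Z5 aN (k+1) u p = nmF Z5 aN k u p + (nmF Z5 aN k (pd 0 u) p + nmF Z5 aN k (pd 1 u) p + nmF Z5 aN k (pd 2 u) p + nmF Z5 aN k (boost 0 u) p + nmF Z5 aN k (boost 1 u) p) := by
      show nmF Z5 aN k u p + ∑ i ∈ Z5, nmF Z5 aN k (dd i u) p = _
      congr 1
      exact Fin.sum_univ_five _
    rw [e]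
    have t0 := H hu hp
    have t1 := fun α => H (smPd hu α) hp
    have t2 := fun a => H (smBoost hu a) hp
    have r1 := t1 0
    have r2 := t1 1
    have r3 := t1 2
    have r4 := t2 0
    have r5 := t2 1
    have C0 : 0 ≤ C := by linarith
    have := mul_le_mul_of_nonneg_left s1 C0
    have := mul_le_mul_of_nonneg_left (s2 0) C0
    have := mul_le_mul_of_nonneg_left (s2 1) C0
    have := mul_le_mul_of_nonneg_left (s2 2) C0
    have := mul_le_mul_of_nonneg_left (B 0) C0
    have := mul_le_mul_of_nonneg_left (B 1) C0
    linarith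

theorem nm_out {A k u} {p : Pt} (su : Sup u) (h : |p 0 - 2| + 1 < rad p) : nmF A aN k u p = 0 := by
  refine le_antisymm ?_ (nmF_nn Sn_aN _ _ _)
  have := nmF_le (A := A) (N := aN) (k := k) (u := u) (p := p) le_rfl fun l _ => by simp [aN, su.Dw l p h]
  simpa using this

theorem LocB_of (k : ℕ) : ∃ C, 1 ≤ C ∧ ∀ {u : Pt → ℝ} {κ : ℝ}, Sm u → Sup u → (∀ p : Pt, 1 ≤ p 0 → p 0 ≤ 3 → nmF Z3 aN k u p ≤ κ) → LocB k (C * κ) u := by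
  obtain ⟨C, hC, H⟩ := Z53 k
  refine ⟨C, hC, fun {u κ} hu su h p h2 h3 => ?_⟩
  have hk := (nmF_nn Sn_aN _ _ _).trans (h p (by linarith) h3)
  by_cases hr : |p 0 - 2| + 1 < rad p
  · rw [nm_out su hr]; positivity
  · rw [abs_of_nonneg (by linarith)] at hr
    push Not at hr
    refine (H hu fun j => ?_).trans (mul_le_mul_of_nonneg_left (h p (by linarith) h3) (by linarith))
    fin_cases j
    · simp only [Fin.zero_eta]; rw [abs_of_nonneg (by linarith)]; linarith
    · exact (abs1_le_rad p).trans (by linarith)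
    · exact (abs2_le_rad p).trans (by linarith)

theorem nm_zero {A k p} : nmF A aN k (fun _ => (0:ℝ)) p = 0 := by
  have := nmF_cmul (A := A) Sn_aN (u := fun _ => 0) contDiff_const 0 k p
  simpa using this

theorem nmQb {A k P a b p M M'} (ha : Sm a) (hb : Sm b) (hM : ∀ α, nmF A aN k (pd α a) p ≤ M) (hM' : ∀ α, nmF A aN k (pd α b) p ≤ M') :
    nmF A aN k (Qb P a b) p ≤ sP P * (12^k * (M * M')) := by
  have n := fun k u => nmF_nn (A := A) Sn_aN k u p
  refine Qsum Sn_aN (fun α β => by fun_prop) fun α β => nm_mul (smPd ha α) (smPd hb β) fun i j e => ?_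
  exact mul_le_mul ((nmF_mono Sn_aN (by omega) _ p).trans (hM α)) ((nmF_mono Sn_aN (by omega) _ p).trans (hM' β)) (n _ _) ((n _ _).trans (hM 0))

theorem nmMul {A k a b p M M'} (ha : Sm a) (hb : Sm b) (hM : nmF A aN k a p ≤ M) (hM' : nmF A aN k b p ≤ M') :
    nmF A aN k (fun p => a p * b p) p ≤ 12^k * (M * M') := by
  have n := fun k u => nmF_nn (A := A) Sn_aN k u p
  refine nm_mul ha hb fun i j e => ?_
  exact mul_le_mul ((nmF_mono Sn_aN (by omega) _ p).trans hM) ((nmF_mono Sn_aN (by omega) _ p).trans hM') (n _ _) ((n _ _).trans hM)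

theorem loc_Z3 (P : Fin 3 → Fin 3 → ℝ) : ∃ C c, 1 ≤ C ∧ 0 < c ∧ ∀ {w0 w1 v0 v1 w v} {e : ℝ}, It P w0 w1 v0 v1 w v → 0 ≤ e →
    (∀ n, Y2 10 (w n) (v n) 2 ≤ e^2) → c * e ≤ 1 → ∀ n p, 1 ≤ p 0 → p 0 ≤ 3 → nmF Z3 aN 8 (w n) p ≤ C * e ∧ nmF Z3 aN 8 (v n) p ≤ C * e := by
  obtain ⟨c, hc, H⟩ := loc_Y P
  have ha := aT_pos 3
  have hs := sP_nn P
  set c0 := √(3^8 * aT 3 * 54) with hc0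
  have c00 : 0 ≤ c0 := Real.sqrt_nonneg _
  set C : ℝ := 7^7 * (2 * c0 + 1) with hC
  have C1 : 1 ≤ C := by rw [hC]; norm_num; linarith
  refine ⟨C, c + 1 + 12^6 * (1 + sP P) * C^2, C1, by positivity, fun {w0 w1 v0 v1 w v e} h he h2 hs' n => ?_⟩
  have ce : c * e ≤ 1 ∧ e ≤ 1 ∧ 12^6 * (1 + sP P) * C^2 * e ≤ 1 := by
    have : 0 ≤ c * e := by positivity
    have : 0 ≤ 12^6 * (1 + sP P) * C^2 * e := by positivity
    have q : (c + 1 + 12^6 * (1 + sP P) * C^2) * e = c * e + e + 12^6 * (1 + sP P) * C^2 * e := by ring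
    rw [q] at hs'
    refine ⟨?_, ?_, ?_⟩ <;> linarith
  have HY := H h (sq_nonneg e) h2 (by nlinarith [ce.1, ce.2.1])
  have B : ∀ n (p : Pt), 1 ≤ p 0 → p 0 ≤ 3 → √(3^8 * aT 3 * Y2 (8+2) (w n) (v n) (p 0)) ≤ c0 * e := fun n p h1 h3 => by
    have y := HY n (p 0) h1 h3
    rw [hc0, ← Real.sqrt_sq he, ← Real.sqrt_mul (by positivity)]
    refine Real.sqrt_le_sqrt ?_
    rw [mul_assoc _ 54]
    exact mul_le_mul_of_nonneg_left y (by positivity)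
  have Ce : 12^6 * (1 + sP P) * (C * e * (C * e)) ≤ e := by nlinarith [mul_le_mul_of_nonneg_right ce.2.2 he]
  have Ce0 : 0 ≤ C * e * (C * e) := by positivity
  induction n with
  | zero => intro p _ _; rw [h.zw, h.zv, nm_zero]; constructor <;> positivity
  | succ n ih =>
    intro p h1 h3
    obtain ⟨ihw, ihv⟩ := ih p h1 h3
    obtain ⟨⟨b1, b2⟩, b3, b4⟩ := pt_Y 8 (h.sw (n+1)) (h.Sw _) (h.sv (n+1)) (h.Sv _) h1 h3 (by norm_num)
    have bb := B (n+1) p h1 h3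
    have rw_ := red 6 (Or.inl rfl) (h.sw (n+1)) p
    have rv_ := red 6 (Or.inr rfl) (h.sv (n+1)) p
    rw [h.ew n] at rw_
    rw [h.ev n] at rv_
    have s1 := nmMul (A := Z3) (k := 6) (p := p) (h.sv n) (h.sv n) ((nmF_mono Sn_aN (by norm_num) _ p).trans ihv) ((nmF_mono Sn_aN (by norm_num) _ p).trans ihv)
    have pw : ∀ α, nmF Z3 aN 6 (pd α (w n)) p ≤ C * e := fun α => (pd_emb3 6 _ p α).trans ((nmF_mono Sn_aN (by norm_num) _ p).trans ihw)
    have s2 := nmQb (P := P) (h.sw n) (h.sw n) pw pw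
    have m1 := nmF_mono (A := Z2) Sn_aN (show 7 ≤ 8 by norm_num) (pd 0 (w (n+1))) p
    have m2 := nmF_mono (A := Z2) Sn_aN (show 7 ≤ 8 by norm_num) (pd 0 (v (n+1))) p
    have b40 := b4 0
    have b20 := b2 0
    have f1 : 12^6 * (C * e * (C * e)) ≤ e := by nlinarith [mul_nonneg hs Ce0]
    have f2 : sP P * (12^6 * (C * e * (C * e))) ≤ e := by nlinarith [mul_nonneg hs Ce0]
    constructor
    · refine rw_.trans ?_
      rw [hC, mul_assoc]; refine mul_le_mul_of_nonneg_left ?_ (by positivity)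
      norm_num at *; linarith
    · refine rv_.trans ?_
      rw [hC, mul_assoc]; refine mul_le_mul_of_nonneg_left ?_ (by positivity)
      norm_num at *; linarith

theorem nmF_zero' {A : Finset (Fin 5)} {N : (Pt → ℝ) → Pt → ℝ} (hN : Sn N) (k p) : nmF A N k (fun _ => 0) p = 0 := by
  have := nmF_cmul (A := A) hN (u := fun _ => (0:ℝ)) contDiff_const 0 k p
  have n := nmF_nn (A := A) hN k (fun _ => (0:ℝ)) p
  simp only [mul_zero, abs_zero, zero_mul] at this
  linarith

theorem LH_zero {s K : ℝ} (hK : 0 ≤ K) {f : Pt → ℝ} (h : ∀ p, f p = 0) : LH s K f := by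
  have e : (fun x => f (hyp s x)) = fun _ => 0 := by funext x; exact h _
  unfold LH; rw [e]
  obtain ⟨a, -, -⟩ := Lb.zero (R := s^2+3)
  exact ⟨a, hK, by simp; positivity⟩

theorem boot (P : Fin 3 → Fin 3 → ℝ) : ∃ A c C : ℝ, 1 ≤ A ∧ 0 < c ∧ 1 ≤ C ∧ ∀ {w0 w1 v0 v1 : X2 → ℝ} {w v : ℕ → Pt → ℝ} {e : ℝ},
    It P w0 w1 v0 v1 w v → 0 ≤ e → (∀ n, Y2 10 (w n) (v n) 2 ≤ e^2) → c * e ≤ 1 →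
    ∀ n, (BW (A * e) (w n) ∧ Bv C (A * e) (v n)) ∧ ∀ p : Pt, 1 ≤ p 0 → p 0 ≤ 3 → nmF Z3 aN 8 (w n) p ≤ A * e ∧ nmF Z3 aN 8 (v n) p ≤ A * e := by
  obtain ⟨C, C1, hC⟩ := Bv_of P
  obtain ⟨K, K1, hK⟩ := BF_of C1
  obtain ⟨CW, CW1, hW⟩ := stepW K1
  obtain ⟨CV, CV1, hV⟩ := stepV P K1
  obtain ⟨Cl, cl, Cl1, cl0, hl⟩ := loc_Z3 P
  obtain ⟨L8, L81, h8⟩ := LocB_of 8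
  obtain ⟨L7, L71, h7⟩ := LocB_of 7
  have hs := sP_nn P
  obtain ⟨B, hB⟩ : ∃ B, B = L8 * Cl + L7 * (2 * Cl) := ⟨_, rfl⟩
  obtain ⟨A, hA⟩ : ∃ A, A = 2 * (CW * CV) * B := ⟨_, rfl⟩
  have q1 : Cl ≤ L8 * Cl := by nlinarith
  have q2 : 0 ≤ L7 * (2 * Cl) := by positivity
  have CC1 : 1 ≤ CW * CV := by nlinarith
  have BA : 2 * B ≤ A := by rw [hA]; nlinarith
  have B1 : 1 ≤ B := by linarith
  refine ⟨A, cl + A^2 + sP P * 12^7 * Cl, C, by linarith, by positivity, C1, fun {w0 w1 v0 v1 w v e} h he h2 hc => ?_⟩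
  have t1 : 0 ≤ cl * e := by positivity
  have t2 : 0 ≤ A^2 * e := by positivity
  have t3 : 0 ≤ sP P * 12^7 * Cl * e := by positivity
  have hc' : cl * e + A^2 * e + sP P * 12^7 * Cl * e ≤ 1 := by linarith
  have H := hl h he h2 (by linarith)
  have hη0 : 0 ≤ A * e := mul_nonneg (by linarith) he
  have hη1 : A * e ≤ 1 := by nlinarith
  have hη2 : (A * e)^2 ≤ B * e := by
    have : (A * e)^2 = A^2 * e * e := by ring
    rw [this]; exact mul_le_mul_of_nonneg_right (by linarith) he
  have negz : (negBox fun _ => (0:ℝ)) = fun _ => 0 := by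
    have pz : ∀ α, pd α (fun _ : Pt => (0:ℝ)) = fun _ => 0 := fun α => by funext p; simp [pd]
    funext p; simp [negBox, pz]
  have main : ∀ n, BW (A * e) (w n) ∧ Bv C (A * e) (v n) ∧ BF K (A * e) (negBox (w n)) := by
    intro n
    induction n with
    | zero =>
      rw [h.zw, h.zv, negz]
      have yn : ∀ s, 2 ≤ s → 0 ≤ A * e * yy s := fun s h2 => mul_nonneg hη0 (zero_le_one.trans (yy_one (by linarith)))
      have pz : ∀ α, pd α (fun _ : Pt => (0:ℝ)) = fun _ => 0 := fun α => by funext p; simp [pd]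
      have w : BW (A * e) (fun _ => 0) := by
        refine ⟨contDiff_const, fun _ _ => rfl, fun s h2 => LH_zero (yn s h2) fun p => nmF_zero' (Sn_dn s) _ _, fun s h2 α => LH_zero (yn s h2) fun p => ?_, fun s h2 x => ?_, fun s h2 x => ?_⟩
        · rw [pz]; exact nmF_zero' (Sn_dn s) _ _
        · rw [nmF_zero' Sn_dA]; positivity
        · simpa using hη0
      have V : BV (A * e) (fun _ => 0) := ⟨contDiff_const, fun _ _ => rfl, fun s h2 => LH_zero (yn s h2) fun p => nmF_zero' (Sn_dm s) _ _, fun s h2 => LH_zero hη0 fun p => nmF_zero' (Sn_dm s) _ _⟩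
      have v := hC hη1 w V
      have e1 : (fun p => (fun _ : Pt => (0:ℝ)) p + Qf P (fun _ => 0) p) = fun _ => 0 := by
        funext p; simp [Qf_Qb, Qb, pz]
      rw [e1] at v
      have f := hK hη0 v
      simp only [ne_eq, OfNat.ofNat_ne_zero, not_false_eq_true, zero_pow] at f
      exact ⟨w, v, f⟩
    | succ n ih =>
      obtain ⟨iw, iv, iF⟩ := ih
      have eF : negBox (w (n+1)) = fun p => v n p ^ 2 := by
        funext p; have := congrFun (h.ew n) p; simp only [zero_mul, add_zero] at this; rw [this]; ring
      have F := hK hη0 iv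
      have W := hW (κ := A * e / CW - (A * e)^2) (h.sw (n+1)) (h.Sw _) eF F fun p p2 p3 => by
        refine (h8 (h.sw (n+1)) (h.Sw _) (κ := Cl * e) (fun p a b => (H (n+1) p a b).1) p p2 p3).trans ?_
        have : A * e / CW = 2 * CV * B * e := by rw [hA]; field_simp
        have : 2 * B * e ≤ 2 * CV * B * e := by nlinarith [mul_nonneg (by linarith : 0 ≤ B) he]
        nlinarith
      have V := hV (κ := A * e / CV - (A * e)^2) (V := fun p => v (n+1) p - Qb P (w n) (w n) p) hη1 iw rfl iF ((h.sv _).sub (smQb P (h.sw n) (h.sw n))) ((h.Sv _).sub (supQb P (h.Sw n))) (fun p => by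
        have := congrFun (h.ev n) p
        have s1 := h.sv (n+1)
        have s2 := smQb P (h.sw n) (h.sw n)
        have e2 : (fun p => v (n+1) p - Qb P (w n) (w n) p) = fun p => v (n+1) p + (-1) * Qb P (w n) (w n) p := by funext p; ring
        rw [e2, negBox_add s1 (by fun_prop), negBox_cmul s2, Qf_Qb]
        simp only; simp only [one_mul] at this; linarith) fun p p2 p3 => by
        refine (h7 ((h.sv _).sub (smQb P (h.sw n) (h.sw n))) ((h.Sv _).sub (supQb P (h.Sw n))) (κ := 2 * Cl * e) (fun p a b => ?_) p p2 p3).trans ?_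
        · refine (nmF_sub Sn_aN (h.sv _) (smQb P (h.sw n) (h.sw n)) 7 p).trans ?_
          have x1 := (nmF_le_succ (A := Z3) Sn_aN 7 (v (n+1)) p).trans (H (n+1) p a b).2
          have x2 := nmQb (A := Z3) (k := 7) (P := P) (p := p) (h.sw n) (h.sw n) (fun α => (pd_emb3 7 (w n) p α).trans (H n p a b).1) (fun α => (pd_emb3 7 (w n) p α).trans (H n p a b).1)
          have x3 : sP P * (12 ^ 7 * (Cl * e * (Cl * e))) = (sP P * 12^7 * Cl * e) * (Cl * e) := by ring
          have x4 : (sP P * 12^7 * Cl * e) * (Cl * e) ≤ 1 * (Cl * e) := mul_le_mul_of_nonneg_right (by linarith) (by positivity)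
          linarith
        · have : A * e / CV = 2 * CW * B * e := by rw [hA]; field_simp
          have : 2 * B * e ≤ 2 * CW * B * e := by nlinarith [mul_nonneg (by linarith : 0 ≤ B) he]
          nlinarith
      have r : ∀ c : ℝ, 1 ≤ c → c * (A * e / c - (A * e)^2 + (A * e)^2) = A * e := fun c hc => by field_simp; ring
      rw [r _ CW1] at W
      rw [r _ CV1] at V
      have v' := hC hη1 iw V
      have e3 : (fun p => (fun p => v (n+1) p - Qb P (w n) (w n) p) p + Qf P (w n) p) = v (n+1) := by funext p; rw [Qf_Qb]; ring
      rw [e3] at v'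
      exact ⟨W, v', by rw [eF]; exact F⟩
  have ClA : Cl * e ≤ A * e := mul_le_mul_of_nonneg_right (by linarith) he
  exact fun n => ⟨⟨(main n).1, (main n).2.1⟩, fun p a b => ⟨(H n p a b).1.trans ClA, (H n p a b).2.trans ClA⟩⟩

theorem Ydata (P) {w0 w1 v0 v1 w v} (h : It P w0 w1 v0 v1 w v) (k) : ∀ n, Y2 k (w n) (v n) 2 ≤ 3^k * (3 * sobolevNorm (k+1) w0^2 + sobolevNorm k w1^2) + 3^k * (3 * sobolevNorm (k+1) v0^2 + sobolevNorm k v1^2) := by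
  intro n
  cases n with
  | zero => rw [h.zw, h.zv, Y2, EN_zero, add_zero]; positivity
  | succ n => exact add_le_add (EN_data k (h.sw _) (h.Sw _) h.d0 h.d1 (h.iw0 n) (h.iw1 n)) (EN_data k (h.sv _) (h.Sv _) h.e0 h.e1 (h.iv0 n) (h.iv1 n))

theorem exp_T {L t T B : ℝ} (hL : 0 ≤ L) (hB : 0 ≤ B) (hT : 2 ≤ T) (h1 : 1 ≤ t) (h2 : t ≤ T) : B * Real.exp (L * |t - 2|) ≤ B * Real.exp (L * T) := by
  refine mul_le_mul_of_nonneg_left (Real.exp_le_exp.2 (mul_le_mul_of_nonneg_left (abs_le.2 ⟨by linarith, by linarith⟩) hL)) hB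

def Bd (T : ℝ) (k : ℕ) (M : ℝ) (w v : ℕ → Pt → ℝ) : Prop := ∀ n (p : Pt), 1 ≤ p 0 → p 0 ≤ T → nmF Z2 aN k (v n) p ≤ M ∧ ∀ α, nmF Z2 aN k (pd α (w n)) p ≤ M

theorem Ybd (P) {w0 w1 v0 v1 w v} (h : It P w0 w1 v0 v1 w v) {T M j k} (hT : 2 ≤ T) (hB : Bd T j M w v) (hk : k ≤ 2 * j + 1) :
    ∃ B, ∀ n t, 1 ≤ t → t ≤ T → Y2 k (w n) (v n) t ≤ B := by
  obtain ⟨c, c0, H⟩ := Src P k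
  obtain ⟨B, hBd⟩ : ∃ B, B = 3^k * (3 * sobolevNorm (k+1) w0^2 + sobolevNorm k w1^2) + 3^k * (3 * sobolevNorm (k+1) v0^2 + sobolevNorm k v1^2) := ⟨_, rfl⟩
  have B0 : 0 ≤ B := by rw [hBd]; positivity
  have cm : 0 ≤ c * M^2 := by positivity
  refine ⟨B * Real.exp ((2 + c * M^2) * T), fun n t t1 tT => le_trans ?_ (exp_T (by positivity) B0 hT t1 tT)⟩
  induction n generalizing t with
  | zero => rw [h.zw, h.zv, Y2, EN_zero]; have := Real.exp_pos ((2 + c * M^2) * |t-2|); simp; positivity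
  | succ n ih =>
    refine GR2 (T := T) (c := c * M^2 * B) (fun s s1 s2 => ?_) hT (by rw [hBd]; exact Ydata P h k (n+1)) (by linarith) t1 tT
    obtain ⟨D, d, b⟩ := Ystep k (h.sw (n+1)) (h.Sw _) (h.sv (n+1)) (h.Sv _) s
    refine ⟨D, d, b.trans ?_⟩
    rw [h.ew n, h.ev n]
    have := H (t := s) (M := M) (h.sw n) (h.Sw n) (h.sv n) (h.Sv n) hk (fun p hp => hB n p (by linarith) (by linarith))
    have y := mul_le_mul_of_nonneg_left (ih s s1 s2) cm
    linarith

theorem Yall (P) {w0 w1 v0 v1 w v} (h : It P w0 w1 v0 v1 w v) {T M} (hT : 2 ≤ T) (hB : Bd T 2 M w v) :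
    ∀ k, (∃ B, ∀ n t, 1 ≤ t → t ≤ T → Y2 k (w n) (v n) t ≤ B) ∧ ∃ M, Bd T k M w v := by
  have P2 : ∀ k, (∃ B, ∀ n t, 1 ≤ t → t ≤ T → Y2 (k+2) (w n) (v n) t ≤ B) → ∃ M, Bd T k M w v := fun k ⟨B, b⟩ =>
    ⟨√(3^k * aT T * B), fun n p p1 pT => by
      have := pt_Y k (h.sw n) (h.Sw n) (h.sv n) (h.Sv n) p1 pT hT
      have q : √(3^k * aT T * Y2 (k+2) (w n) (v n) (p 0)) ≤ √(3^k * aT T * B) :=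
        Real.sqrt_le_sqrt (mul_le_mul_of_nonneg_left (b n _ p1 pT) (by have := aT_pos T; positivity))
      exact ⟨this.1.1.trans q, fun α => (this.2.2 α).trans q⟩⟩
  have H : ∀ j, ∃ M, Bd T (j+2) M w v := by
    intro j
    induction j with
    | zero => exact ⟨M, hB⟩
    | succ j ih => obtain ⟨M, hM⟩ := ih; exact P2 _ (Ybd P h hT hM (by omega))
  have Y : ∀ k, ∃ B, ∀ n t, 1 ≤ t → t ≤ T → Y2 k (w n) (v n) t ≤ B := fun k => by
    obtain ⟨M, hM⟩ := H k; exact Ybd P h hT hM (by omega)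
  exact fun k => ⟨Y k, P2 k (Y _)⟩

theorem Dsrc (P : Fin 3 → Fin 3 → ℝ) (k : ℕ) : ∃ c, 0 < c ∧ ∀ {a a' b b' : Pt → ℝ} {t M : ℝ}, Sm a → Sup a → Sm b → Sup b → Sm a' → Sup a' → Sm b' → Sup b' →
    (∀ p : Pt, p 0 = t → nmF Z2 aN k b p ≤ M ∧ ∀ α, nmF Z2 aN k (pd α a) p ≤ M) → (∀ p : Pt, p 0 = t → nmF Z2 aN k b' p ≤ M ∧ ∀ α, nmF Z2 aN k (pd α a') p ≤ M) →
    SN k (fun p => b' p * b' p - b p * b p) t + SN k (fun p => Qb P a' a' p - Qb P a a p) t ≤ c * M^2 * Y2 k (fun p => a' p - a p) (fun p => b' p - b p) t := by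
  have hs := sP_nn P
  refine ⟨(12^k)^2 * (2 * 3^k) * 4 + 2 * 3^k * ((sP P * 12^k)^2 * (2 * 3^(k+1)) * 2), by positivity, fun {a a' b b' t M} ha sa hb sb ha' sa' hb' sb' h h' => ?_⟩
  have n := fun i u p => nmF_nn (A := Z2) Sn_aN i u p
  have hM : 0 ≤ M := (n _ _ _).trans (h (ft t 0) rfl).1
  have hδa : Sm fun p => a' p - a p := by fun_prop
  have hδb : Sm fun p => b' p - b p := by fun_prop
  have sδa : Sup fun p => a' p - a p := sa'.sub sa
  have sδb : Sup fun p => b' p - b p := sb'.sub sb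
  have e1 : (fun p => b' p * b' p - b p * b p) = fun p => (b' p - b p) * (b' p + b p) := by funext p; ring
  have e2 : (fun p => Qb P a' a' p - Qb P a a p) = fun p => Qb P (fun p => a' p - a p) a' p + Qb P a (fun p => a' p - a p) p := by
    funext p
    simp only [Qb, ← Finset.sum_sub_distrib, ← Finset.sum_add_distrib]
    refine Finset.sum_congr rfl fun α _ => Finset.sum_congr rfl fun β _ => ?_
    simp (disch := fun_prop) only [pd_sub]; ring
  rw [e1, e2]
  have A := SNp (k := k) (t := t) (Mf := 0) (Mg := 2 * M) hδb sδb (hb'.add hb) (sb'.add sb) (fun p hp i j e => by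
    have x := nmF_add (A := Z2) Sn_aN hb' hb k p
    have x1 := nmF_mono (A := Z2) Sn_aN (show i ≤ k by omega) (fun p => b' p - b p) p
    have x2 := nmF_mono (A := Z2) Sn_aN (show j ≤ k by omega) (fun p => b' p + b p) p
    have := mul_le_mul x1 (x2.trans (x.trans (add_le_add (h' p hp).1 (h p hp).1))) (n _ _ _) (n _ _ _)
    linarith)
  have B := SNQ P (k := k) (t := t) (Mf := 0) (Mg := M) hδa sδa ha' sa' le_rfl hM (fun α β p hp i j e => by
    have x1 := nmF_mono (A := Z2) Sn_aN (show i ≤ k by omega) (pd α fun p => a' p - a p) p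
    have x2 := nmF_mono (A := Z2) Sn_aN (show j ≤ k by omega) (pd β a') p
    have := mul_le_mul x1 (x2.trans ((h' p hp).2 β)) (n _ _ _) (n _ _ _)
    linarith)
  have C := SNQ P (k := k) (t := t) (Mf := M) (Mg := 0) ha sa hδa sδa hM le_rfl (fun α β p hp i j e => by
    have x1 := nmF_mono (A := Z2) Sn_aN (show j ≤ k by omega) (pd β fun p => a' p - a p) p
    have x2 := nmF_mono (A := Z2) Sn_aN (show i ≤ k by omega) (pd α a) p
    have := mul_le_mul (x2.trans ((h p hp).2 α)) x1 (n _ _ _) hM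
    linarith)
  have D := SN_add k (smQb P hδa ha') (supQb P sδa) (smQb P ha hδa) (supQb P sa) t
  have s := SN_u k hδb sδb t
  have n1 := EN_nn k hδa t
  have n2 := EN_nn k hδb t
  unfold Y2
  set X := EN k (fun p => a' p - a p) t
  set Y := EN k (fun p => b' p - b p) t
  have A1 : SN k (fun p => (b' p - b p) * (b' p + b p)) t ≤ (12^k)^2 * (2 * 3^k) * 4 * (M^2 * (X + Y)) := by
    refine A.trans ?_
    have : 0^2 * SN k (fun p => b' p + b p) t + (2*M)^2 * SN k (fun p => b' p - b p) t ≤ 4 * (M^2 * (X + Y)) := by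
      nlinarith [mul_le_mul_of_nonneg_left s (sq_nonneg M), mul_nonneg (sq_nonneg M) n1]
    have := mul_le_mul_of_nonneg_left this (show (0:ℝ) ≤ (12^k)^2 * (2 * 3^k) by positivity)
    linarith
  have B1 : (sP P * 12^k)^2 * (2 * 3^(k+1)) * (M^2 * X) ≤ (sP P * 12^k)^2 * (2 * 3^(k+1)) * (M^2 * (X + Y)) :=
    mul_le_mul_of_nonneg_left (mul_le_mul_of_nonneg_left (by linarith) (sq_nonneg M)) (by positivity)
  have z : ∀ r : ℝ, (0:ℝ)^2 * r = 0 := fun r => by ring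
  rw [z, zero_add] at B
  rw [z, add_zero] at C
  have D1 := D.trans (mul_le_mul_of_nonneg_left (add_le_add (B.trans B1) (C.trans B1)) (by positivity))
  linarith

theorem Ddec (P) {w0 w1 v0 v1 w v} (h : It P w0 w1 v0 v1 w v) {T} (hT : 2 ≤ T) (H : ∀ k, (∃ B, ∀ n t, 1 ≤ t → t ≤ T → Y2 k (w n) (v n) t ≤ B) ∧ ∃ M, Bd T k M w v) (k) :
    ∃ A, ∀ n t, 1 ≤ t → t ≤ T → Y2 k (fun p => w (n+1) p - w n p) (fun p => v (n+1) p - v n p) t ≤ A * (1/4)^n := by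
  obtain ⟨⟨B, hB⟩, M, hM⟩ := H k
  obtain ⟨c, c0, hc⟩ := Dsrc P k
  have cm : 0 ≤ c * M^2 := by positivity
  have B0 : 0 ≤ B := (Y2_nn k (h.sw 0) (h.sv 0) 2).trans (hB 0 2 (by norm_num) hT)
  obtain ⟨L, hL⟩ : ∃ L, L = 2 + 4 * (c * M^2) := ⟨_, rfl⟩
  have L0 : 0 ≤ L := by rw [hL]; positivity
  refine ⟨B * Real.exp (L * T), fun n t t1 tT => ?_⟩
  have := exp_T L0 (show 0 ≤ B * (1/4)^n by positivity) hT t1 tT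
  refine le_trans ?_ (this.trans (by linarith))
  clear this
  induction n generalizing t with
  | zero =>
    have e1 : (fun p => w (0+1) p - w 0 p) = w 1 := by rw [h.zw]; funext p; simp
    have e2 : (fun p => v (0+1) p - v 0 p) = v 1 := by rw [h.zv]; funext p; simp
    rw [e1, e2]
    have : 1 ≤ Real.exp (L * |t-2|) := Real.one_le_exp (by positivity)
    have := hB 1 t t1 tT
    nlinarith
  | succ n ih =>
    have d : ∀ u : ℕ → Pt → ℝ, (∀ n, Sm (u n)) → Sm fun p => u (n+1+1) p - u (n+1) p := fun u hu => (hu _).sub (hu _)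
    have s : ∀ u : ℕ → Pt → ℝ, (∀ n, Sup (u n)) → Sup fun p => u (n+1+1) p - u (n+1) p := fun u hu => (hu _).sub (hu _)
    have dz : Dt fun _ => 0 := ⟨contDiff_const, fun _ _ => rfl⟩
    have sz : ∀ k, sobolevNorm k (fun _ => 0) = 0 := fun k => by
      have : ∀ j, iteratedFDeriv ℝ j (fun _ : X2 => (0:ℝ)) = 0 := fun j => iteratedFDeriv_zero_fun
      simp [sobolevNorm, this]
    have dat : ∀ u : ℕ → Pt → ℝ, (∀ n, Sm (u n)) → (∀ n, Sup (u n)) → ∀ g0 g1 : X2 → ℝ, (∀ n x, u (n+1) (sl x) = g0 x) → (∀ n x, pd 0 (u (n+1)) (sl x) = g1 x) →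
        EN k (fun p => u (n+1+1) p - u (n+1) p) 2 ≤ 0 := fun u hu su g0 g1 h0 h1 => by
      have := EN_data k (d u hu) (s u su) dz dz (fun x => by rw [h0, h0, sub_self]) (fun x => by
        have a := hu (n+1+1)
        have b := hu (n+1)
        simp (disch := fun_prop) only [pd_sub]
        rw [h1, h1, sub_self])
      simpa [sz] using this
    refine GR2 (T := T) (c := c * M^2 * (B * (1/4)^n)) (fun t t1 tT => ?_) hT ?_ ?_ t1 tT
    · obtain ⟨D, d, b⟩ := Ystep k (d w h.sw) (s w h.Sw) (d v h.sv) (s v h.Sv) t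
      refine ⟨D, d, b.trans ?_⟩
      have r : ∀ (m : ℝ) {f g : Pt → ℝ}, Sm f → Sm g → (fun p => negBox (fun p => f p - g p) p + m * (f p - g p)) = fun p => (fun p => negBox f p + m * f p) p - (fun p => negBox g p + m * g p) p := fun m f g hf hg => by
        have e2 : (fun p => f p - g p) = fun p => f p + (-1) * g p := by funext p; ring
        rw [e2, negBox_add hf (by fun_prop), negBox_cmul hg]
        funext p; simp only; ring
      rw [r 0 (h.sw _) (h.sw _), r 1 (h.sv _) (h.sv _), h.ew, h.ew, h.ev, h.ev]
      have := hc (t := t) (M := M) (h.sw n) (h.Sw n) (h.sv n) (h.Sv n) (h.sw (n+1)) (h.Sw _) (h.sv (n+1)) (h.Sv _) (fun p hp => hM n p (by linarith) (by linarith)) (fun p hp => hM (n+1) p (by linarith) (by linarith))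
      have y := mul_le_mul_of_nonneg_left (ih t t1 tT) cm
      linarith
    · have a := dat w h.sw h.Sw w0 w1 h.iw0 h.iw1
      have b := dat v h.sv h.Sv v0 v1 h.iv0 h.iv1
      refine (add_le_add a b).trans ?_
      rw [add_zero]; positivity
    · rw [hL, pow_succ]; linarith

theorem nb_sub (m : ℝ) {f g : Pt → ℝ} (hf : Sm f) (hg : Sm g) : (fun p => negBox (fun p => f p - g p) p + m * (f p - g p)) = fun p => (fun p => negBox f p + m * f p) p - (fun p => negBox g p + m * g p) p := by
  have e2 : (fun p => f p - g p) = fun p => f p + (-1) * g p := by funext p; ring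
  rw [e2, negBox_add hf (by fun_prop), negBox_cmul hg]
  funext p; simp only; ring

theorem Ub {u : ℕ → Pt → ℝ} {A : ℝ} {k p} (hu : ∀ n, Sm (u n)) (h0 : u 0 = fun _ => 0) (h : ∀ n, nmF Z3 aN k (fun p => u (n+1) p - u n p) p ≤ A * (1/2)^n) (n) :
    nmF Z3 aN k (u n) p ≤ 2 * A := by
  have A0 : 0 ≤ A := by have := (nmF_nn Sn_aN _ _ _).trans (h 0); simpa using this
  have : nmF Z3 aN k (u n) p ≤ 2 * A * (1 - (1/2)^n) := by
    induction n with
    | zero => rw [h0, nm_zero]; simp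
    | succ n ih =>
      have e : u (n+1) = fun p => u n p + (u (n+1) p - u n p) := by funext p; ring
      have := nmF_add (A := Z3) Sn_aN (hu n) ((hu (n+1)).sub (hu n)) k p
      rw [← e] at this
      have := h n
      rw [pow_succ]; linarith
  have : 0 ≤ A * (1/2)^n := by positivity
  linarith

theorem DZ3 (P) {w0 w1 v0 v1 w v} (h : It P w0 w1 v0 v1 w v) {T} (hT : 2 ≤ T) (H : ∀ k, (∃ B, ∀ n t, 1 ≤ t → t ≤ T → Y2 k (w n) (v n) t ≤ B) ∧ ∃ M, Bd T k M w v) :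
    ∀ k, ∃ A, ∀ n (p : Pt), 1 ≤ p 0 → p 0 ≤ T → nmF Z3 aN k (fun p => w (n+1) p - w n p) p ≤ A * (1/2)^n ∧ nmF Z3 aN k (fun p => v (n+1) p - v n p) p ≤ A * (1/2)^n := by
  have dw : ∀ n, Sm fun p => w (n+1) p - w n p := fun n => (h.sw _).sub (h.sw _)
  have dv : ∀ n, Sm fun p => v (n+1) p - v n p := fun n => (h.sv _).sub (h.sv _)
  have sw : ∀ n, Sup fun p => w (n+1) p - w n p := fun n => (h.Sw _).sub (h.Sw _)
  have sv : ∀ n, Sup fun p => v (n+1) p - v n p := fun n => (h.Sv _).sub (h.Sv _)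
  have Z : ∀ k, ∃ A, ∀ n (p : Pt), 1 ≤ p 0 → p 0 ≤ T →
      (nmF Z2 aN k (fun p => v (n+1) p - v n p) p ≤ A * (1/2)^n ∧ ∀ α, nmF Z2 aN k (pd α fun p => v (n+1) p - v n p) p ≤ A * (1/2)^n) ∧
      nmF Z2 aN k (fun p => w (n+1) p - w n p) p ≤ A * (1/2)^n ∧ ∀ α, nmF Z2 aN k (pd α fun p => w (n+1) p - w n p) p ≤ A * (1/2)^n := fun k => by
    obtain ⟨A, hA⟩ := Ddec P h hT H (k+2)
    have ha := aT_pos T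
    refine ⟨√(3^k * aT T * A), fun n p p1 pT => ?_⟩
    have := pt_Y k (dw n) (sw n) (dv n) (sv n) p1 pT hT
    have q : √(3^k * aT T * Y2 (k+2) (fun p => w (n+1) p - w n p) (fun p => v (n+1) p - v n p) (p 0)) ≤ √(3^k * aT T * A) * (1/2)^n := by
      have e : (1/2:ℝ)^n = √((1/4)^n) := by
        rw [show (1/4:ℝ) = (1/2)^2 by norm_num, ← pow_mul, mul_comm, pow_mul, Real.sqrt_sq (by positivity)]
      rw [e, ← Real.sqrt_mul' _ (by positivity)]
      refine Real.sqrt_le_sqrt ?_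
      rw [mul_assoc (3^k * aT T) A]; exact mul_le_mul_of_nonneg_left (hA n _ p1 pT) (by positivity)
    exact ⟨⟨this.1.1.trans q, fun α => (this.1.2 α).trans q⟩, this.2.1.trans q, fun α => (this.2.2 α).trans q⟩
  have main : ∀ k, (∃ A, ∀ n (p : Pt), 1 ≤ p 0 → p 0 ≤ T → nmF Z3 aN k (fun p => w (n+1) p - w n p) p ≤ A * (1/2)^n ∧ nmF Z3 aN k (fun p => v (n+1) p - v n p) p ≤ A * (1/2)^n) ∧
      (∃ A, ∀ n (p : Pt), 1 ≤ p 0 → p 0 ≤ T → nmF Z3 aN (k+1) (fun p => w (n+1) p - w n p) p ≤ A * (1/2)^n ∧ nmF Z3 aN (k+1) (fun p => v (n+1) p - v n p) p ≤ A * (1/2)^n) := by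
    intro k
    induction k with
    | zero =>
      obtain ⟨A, hA⟩ := Z 0
      refine ⟨⟨A, fun n p a b => ⟨(hA n p a b).2.1, (hA n p a b).1.1⟩⟩, 4 * A, fun n p a b => ?_⟩
      obtain ⟨⟨a1, a2⟩, a3, a4⟩ := hA n p a b
      have := fun α => a2 α
      rw [nm3, nm3]
      simp only [nmF] at *
      constructor
      · linarith [a4 0, a4 1, a4 2]
      · linarith [a2 0, a2 1, a2 2]
    | succ k ih =>
      obtain ⟨-, A, hA⟩ := ih
      refine ⟨⟨A, hA⟩, ?_⟩
      obtain ⟨A1, hA1⟩ := Z (k+2)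
      have le1 : ∀ u p, nmF Z3 aN k u p ≤ nmF Z3 aN (k+1) u p := fun u p => nmF_le_succ Sn_aN k u p
      have A0 : 0 ≤ A := by
        have := (nmF_nn Sn_aN _ _ _).trans (hA 0 (fun _ => 2) (by norm_num) (by simpa using hT)).1
        simpa using this
      have s0 := sP_nn P
      have uw := fun n p a b => Ub h.sw h.zw (fun n => (hA n p a b).1) n
      have uv := fun n p a b => (le1 _ _).trans (Ub h.sv h.zv (fun n => (hA n p a b).2) n)
      have S1 : ∀ n (p : Pt), 1 ≤ p 0 → p 0 ≤ T → nmF Z3 aN k (fun p => negBox (fun p => w (n+1) p - w n p) p + 0 * (w (n+1) p - w n p)) p ≤ 12^k * (8 * A^2) * (1/2)^n := by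
        intro n p a b
        rw [nb_sub 0 (h.sw _) (h.sw _)]
        cases n with
        | zero =>
          rw [h.ew, h.zw, h.zv]
          have : (fun p => (fun _ : Pt => (0:ℝ) * 0) p - (negBox (fun _ => (0:ℝ)) p + 0 * 0)) = fun _ => 0 := by
            have pz : ∀ α, pd α (fun _ : Pt => (0:ℝ)) = fun _ => 0 := fun α => by funext p; simp [pd]
            funext p; simp [negBox, pz]
          simp only at this ⊢
          rw [this, nm_zero]; positivity
        | succ n =>
          rw [h.ew, h.ew]
          have e1 : (fun p => (fun p => v (n+1) p * v (n+1) p) p - (fun p => v n p * v n p) p) = fun p => (v (n+1) p - v n p) * (v (n+1) p + v n p) := by funext p; ring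
          rw [e1]
          refine (nmMul (dv n) ((h.sv _).add (h.sv _)) ((le1 _ _).trans (hA n p a b).2) ((nmF_add Sn_aN (h.sv _) (h.sv _) k p).trans (add_le_add (uv (n+1) p a b) (uv n p a b)))).trans ?_
          rw [pow_succ (1/2:ℝ) n]; linarith
      have S2 : ∀ n (p : Pt), 1 ≤ p 0 → p 0 ≤ T → nmF Z3 aN k (fun p => negBox (fun p => v (n+1) p - v n p) p + 1 * (v (n+1) p - v n p)) p ≤ sP P * 12^k * (8 * A^2) * (1/2)^n := by
        intro n p a b
        rw [nb_sub 1 (h.sv _) (h.sv _)]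
        cases n with
        | zero =>
          rw [h.ev, h.zw, h.zv]
          have : (fun p => Qb P (fun _ => 0) (fun _ => 0) p - (negBox (fun _ => (0:ℝ)) p + 1 * 0)) = fun _ => 0 := by
            have pz : ∀ α, pd α (fun _ : Pt => (0:ℝ)) = fun _ => 0 := fun α => by funext p; simp [pd]
            funext p; simp [negBox, pz, Qb]
          simp only at this ⊢
          rw [this, nm_zero]; positivity
        | succ n =>
          rw [h.ev, h.ev]
          have e2 : (fun p => Qb P (w (n+1)) (w (n+1)) p - Qb P (w n) (w n) p) = fun p => Qb P (fun p => w (n+1) p - w n p) (w (n+1)) p + Qb P (w n) (fun p => w (n+1) p - w n p) p := by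
            have a1 := h.sw (n+1)
            have a2 := h.sw n
            funext p
            simp only [Qb, ← Finset.sum_sub_distrib, ← Finset.sum_add_distrib]
            refine Finset.sum_congr rfl fun α _ => Finset.sum_congr rfl fun β _ => ?_
            simp (disch := fun_prop) only [pd_sub]; ring
          rw [e2]
          have x1 := nmQb (P := P) (dw n) (h.sw (n+1)) (fun α => (pd_emb3 k _ p α).trans (hA n p a b).1) (fun α => (pd_emb3 k _ p α).trans (uw (n+1) p a b))
          have x2 := nmQb (P := P) (h.sw n) (dw n) (fun α => (pd_emb3 k _ p α).trans (uw n p a b)) (fun α => (pd_emb3 k _ p α).trans (hA n p a b).1)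
          refine (nmF_add Sn_aN (smQb P (dw n) (h.sw (n+1))) (smQb P (h.sw n) (dw n)) k p).trans ?_
          rw [pow_succ (1/2:ℝ) n]; linarith
      refine ⟨7^(k+1) * (A1 + A1 + (1 + sP P) * 12^k * (8 * A^2)), fun n p a b => ?_⟩
      have r1 := red k (Or.inl rfl) (dw n) p
      have r2 := red k (Or.inr rfl) (dv n) p
      obtain ⟨⟨a1, a2⟩, a3, a4⟩ := hA1 n p a b
      have s1 := S1 n p a b
      have s2 := S2 n p a b
      have l1 := nmF_le_succ (A := Z2) Sn_aN (k+1) (pd 0 fun p => w (n+1) p - w n p) p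
      have l2 := nmF_le_succ (A := Z2) Sn_aN (k+1) (pd 0 fun p => v (n+1) p - v n p) p
      have y1 : 0 ≤ 12^k * (8 * A^2) * (1/2)^n := by positivity
      have y2 : 0 ≤ sP P * 12^k * (8 * A^2) * (1/2)^n := by positivity
      have y : (A1 + A1 + (1 + sP P) * 12^k * (8 * A^2)) * (1/2)^n = A1 * (1/2)^n + A1 * (1/2)^n + 12^k * (8 * A^2) * (1/2)^n + sP P * 12^k * (8 * A^2) * (1/2)^n := by ring
      rw [mul_assoc, y]
      exact ⟨r1.trans (mul_le_mul_of_nonneg_left (by linarith [a4 0]) (by positivity)), r2.trans (mul_le_mul_of_nonneg_left (by linarith [a2 0]) (by positivity))⟩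
  exact fun k => (main k).1

section
open Filter Topology

def Cv (u : ℕ → Pt → ℝ) : Prop := (∀ n, Sm (u n)) ∧ ∀ T k, ∃ A, ∀ n (p : Pt), 1 ≤ p 0 → p 0 ≤ T → nmF Z3 aN k (fun p => u (n+1) p - u n p) p ≤ A * (1/2)^n

theorem Cv.pd {u} (h : Cv u) (α : Fin 3) : Cv (fun n => pd α (u n)) := by
  refine ⟨fun n => smPd (h.1 n) α, fun T k => ?_⟩
  obtain ⟨A, hA⟩ := h.2 T (k+1)
  refine ⟨A, fun n p a b => ?_⟩
  have h1 := h.1 n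
  have h2 := h.1 (n+1)
  have e : (fun p => _root_.pd α (u (n+1)) p - _root_.pd α (u n) p) = _root_.pd α (fun p => u (n+1) p - u n p) := by
    simp (disch := fun_prop) only [pd_sub]
  rw [e]
  exact (pd_emb3 k _ p α).trans (hA n p a b)

def Lm (u : ℕ → Pt → ℝ) (p : Pt) : ℝ := limUnder atTop fun n => u n p

theorem Cv.step {u} (h : Cv u) (T) : ∃ A, ∀ n (p : Pt), 1 ≤ p 0 → p 0 ≤ T → dist (u n p) (u (n+1) p) ≤ A * (1/2)^n := by
  obtain ⟨A, hA⟩ := h.2 T 0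
  exact ⟨A, fun n p a b => by rw [dist_comm, Real.dist_eq]; exact hA n p a b⟩

theorem Cv.lim {u} (h : Cv u) {p : Pt} (hp : 1 ≤ p 0) : Tendsto (fun n => u n p) atTop (𝓝 (Lm u p)) := by
  obtain ⟨A, hA⟩ := h.step (p 0)
  exact (cauchySeq_of_le_geometric (1/2) A (by norm_num) fun n => hA n p hp le_rfl).tendsto_limUnder

theorem Cv.unif {u} (h : Cv u) (T) : TendstoUniformlyOn u (Lm u) atTop {p : Pt | 1 < p 0 ∧ p 0 < T} := by
  obtain ⟨A, hA⟩ := h.step T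
  have t : Tendsto (fun n : ℕ => A * (1/2:ℝ)^n / (1 - 1/2)) atTop (𝓝 0) := by
    have := ((tendsto_pow_atTop_nhds_zero_of_lt_one (r := (1/2:ℝ)) (by norm_num) (by norm_num)).const_mul A).div_const (1 - 1/2)
    simpa using this
  rw [Metric.tendstoUniformlyOn_iff]
  intro ε hε
  filter_upwards [t.eventually (gt_mem_nhds hε)] with n hn p hp
  rw [dist_comm]
  exact (dist_le_of_le_geometric_of_tendsto (1/2) A (by norm_num) (fun n => hA n p hp.1.le hp.2.le) (h.lim hp.1.le) n).trans_lt hn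

abbrev Pr (α : Fin 3) : Pt →L[ℝ] ℝ := ContinuousLinearMap.proj α

theorem fd_sum (f : Pt → ℝ) (p : Pt) : fderiv ℝ f p = pd 0 f p • Pr 0 + pd 1 f p • Pr 1 + pd 2 f p • Pr 2 := by
  ext x
  have e : x = x 0 • Pi.single 0 1 + x 1 • Pi.single 1 1 + x 2 • Pi.single 2 1 := by
    funext i; fin_cases i <;> simp [Pi.single_apply]
  conv_lhs => rw [e]
  simp [pd]; ring

theorem Cv.fd {u} (h : Cv u) {p : Pt} (hp : 1 < p 0) : HasFDerivAt (Lm u) (Lm (fun n => _root_.pd 0 (u n)) p • Pr 0 + Lm (fun n => _root_.pd 1 (u n)) p • Pr 1 + Lm (fun n => _root_.pd 2 (u n)) p • Pr 2) p := by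
  have op : IsOpen {q : Pt | 1 < q 0 ∧ q 0 < p 0 + 1} :=
    (isOpen_lt continuous_const (continuous_apply 0)).inter (isOpen_lt (continuous_apply 0) continuous_const)
  have c : ∀ α, TendstoUniformlyOn (fun n q => _root_.pd α (u n) q • Pr α) (fun q => Lm (fun n => _root_.pd α (u n)) q • Pr α) atTop {q : Pt | 1 < q 0 ∧ q 0 < p 0 + 1} := fun α =>
    (ContinuousLinearMap.toSpanSingleton ℝ (Pr α)).uniformContinuous.comp_tendstoUniformlyOn ((h.pd α).unif _)
  refine hasFDerivAt_of_tendstoUniformlyOn (f := u) (f' := fun n q => _root_.pd 0 (u n) q • Pr 0 + _root_.pd 1 (u n) q • Pr 1 + _root_.pd 2 (u n) q • Pr 2)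
    (g' := fun p => Lm (fun n => _root_.pd 0 (u n)) p • Pr 0 + Lm (fun n => _root_.pd 1 (u n)) p • Pr 1 + Lm (fun n => _root_.pd 2 (u n)) p • Pr 2) op
    (((c 0).add (c 1)).add (c 2)) (fun n q _ => ?_) (fun q hq => h.lim hq.1.le) ⟨hp, by linarith⟩
  rw [← fd_sum]
  exact ((h.1 n).differentiable (by simp)).differentiableAt.hasFDerivAt

theorem Cv.pdL {u} (h : Cv u) {p : Pt} (hp : 1 < p 0) (α) : _root_.pd α (Lm u) p = Lm (fun n => _root_.pd α (u n)) p := by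
  rw [_root_.pd, (h.fd hp).fderiv]
  fin_cases α <;> simp [Pi.single_apply]

theorem opU : IsOpen {q : Pt | 1 < q 0} := isOpen_lt continuous_const (continuous_apply 0)

theorem Cv.pdL2 {u} (h : Cv u) {p : Pt} (hp : 1 < p 0) (α β) : _root_.pd β (_root_.pd α (Lm u)) p = Lm (fun n => _root_.pd β (_root_.pd α (u n))) p := by
  rw [← (h.pd α).pdL hp]
  have : _root_.pd α (Lm u) =ᶠ[𝓝 p] Lm (fun n => _root_.pd α (u n)) := by
    filter_upwards [opU.mem_nhds hp] with q hq using h.pdL hq α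
  rw [_root_.pd, this.fderiv_eq, _root_.pd]

theorem Cv.smooth {u} (h : Cv u) : ContDiffOn ℝ (⊤ : ℕ∞) (Lm u) {q : Pt | 1 < q 0} := by
  rw [contDiffOn_infty]
  intro k
  induction k generalizing u with
  | zero =>
    rw [Nat.cast_zero, contDiffOn_zero]
    exact fun p hp => (h.fd hp).continuousAt.continuousWithinAt
  | succ k ih =>
    rw [Nat.cast_add, Nat.cast_one, contDiffOn_succ_iff_fderiv_of_isOpen opU]
    refine ⟨fun p hp => (h.fd hp).differentiableAt.differentiableWithinAt, fun hw => by simp at hw, ?_⟩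
    refine ContDiffOn.congr ?_ fun p hp => (h.fd hp).fderiv
    exact (((ih (h.pd 0)).smul contDiffOn_const).add ((ih (h.pd 1)).smul contDiffOn_const)).add ((ih (h.pd 2)).smul contDiffOn_const)

theorem Cv.negB {u} (h : Cv u) {p : Pt} (hp : 1 < p 0) : Tendsto (fun n => negBox (u n) p) atTop (𝓝 (negBox (Lm u) p)) := by
  unfold negBox
  rw [h.pdL2 hp, h.pdL2 hp, h.pdL2 hp]
  exact ((((h.pd 0).pd 0).lim hp.le).sub (((h.pd 1).pd 1).lim hp.le)).sub (((h.pd 2).pd 2).lim hp.le)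

theorem Cv.pdt {u} (h : Cv u) {p : Pt} (hp : 1 < p 0) (α) : Tendsto (fun n => _root_.pd α (u n) p) atTop (𝓝 (_root_.pd α (Lm u) p)) := by
  rw [h.pdL hp]; exact (h.pd α).lim hp.le

end

theorem Dt0 {u : Pt → ℝ} (hu : Sm u) (τ a b : ℝ) : HasDerivAt (fun τ => u ![τ, a, b]) (pd 0 u ![τ, a, b]) τ := by
  have := chain hu (c := fun y => ![y, a, b]) (y := τ) (hasDerivAt_id _) (hasDerivAt_const _ _) (hasDerivAt_const _ _)
  simpa using this

theorem start {w v : ℕ → Pt → ℝ} {η C T : ℝ} (hη : 0 ≤ η) (hC : 1 ≤ C) (h : ∀ n, (BW η (w n) ∧ Bv C η (v n)) ∧ ∀ p : Pt, 1 ≤ p 0 → p 0 ≤ 3 → nmF Z3 aN 8 (w n) p ≤ η ∧ nmF Z3 aN 8 (v n) p ≤ η) :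
    ∃ M, Bd T 2 M w v := by
  obtain ⟨Ca, Ca1, ha⟩ := BW.a4
  refine ⟨η + C * η + 16^4 * (Ca * η), fun n p p1 _ => ?_⟩
  obtain ⟨⟨hw, hv⟩, hl⟩ := h n
  have x1 : 0 ≤ C * η := by positivity
  have x2 : 0 ≤ 16^4 * (Ca * η) := by positivity
  have s23 : Z2 ⊆ Z3 := by decide
  have s25 : Z2 ⊆ Z5 := by decide
  rcases le_or_gt (p 0) 3 with h3 | h3
  · obtain ⟨a, b⟩ := hl p p1 h3
    refine ⟨?_, fun α => ?_⟩
    · have := (nmF_subset s23 2 (v n) p).trans (nmF_mono Sn_aN (show 2 ≤ 8 by norm_num) (v n) p); linarith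
    · have := (nmF_subset s23 2 (pd α (w n)) p).trans ((nmF_mono Sn_aN (show 2 ≤ 7 by norm_num) _ p).trans (pd_emb3 7 (w n) p α)); linarith
  · rcases lt_or_ge (p 0 - 1) (rad p) with hr | hr
    · have o : |p 0 - 2| + 1 < rad p := by rw [abs_of_pos (by linarith)]; linarith
      refine ⟨?_, fun α => ?_⟩
      · rw [nm_out hv.sup o]; linarith
      · rw [nm_out (hw.sup.pd α) o]; linarith
    · rcases cone_cases (by linarith) hr with ⟨s, x, s2, rfl⟩ | h3'
      · have y : η * yy s / s ≤ η := by
          rw [div_le_iff₀ (by linarith)]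
          exact mul_le_mul_of_nonneg_left (by simpa using yy_le (s := s) (by linarith) 1 (by norm_num)) hη
        have y0 : 0 ≤ η * yy s := mul_nonneg hη (zero_le_one.trans (yy_one (by linarith)))
        have y' : η * yy s / hyp s x 0 ≤ η := (div_le_div_of_nonneg_left y0 (by linarith) (hyp_ge x)).trans y
        refine ⟨?_, fun α => ?_⟩
        · have := (nmF_subset s25 2 (v n) (hyp s x)).trans ((nmF_mono Sn_aN (show 2 ≤ 3 by norm_num) _ _).trans (hv.p3 s s2 x))
          have := mul_le_mul_of_nonneg_left y' (show 0 ≤ C by linarith)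
          linarith
        · have := (nmF_subset s25 2 (pd α (w n)) (hyp s x)).trans ((nmF_mono Sn_aN (show 2 ≤ 4 by norm_num) _ _).trans (nm_pd_le hw.sm α 4 _))
          have a := (ha hw s2 x).1
          have := mul_le_mul_of_nonneg_left y (show 0 ≤ Ca by linarith)
          linarith
      · linarith

theorem dec_D {w : Pt → ℝ} {η : ℝ} (hη : 0 ≤ η) (hw : BW η w) (hl : ∀ p : Pt, 1 ≤ p 0 → p 0 ≤ 3 → nmF Z3 aN 8 w p ≤ η) {p : Pt} (p2 : 2 ≤ p 0) (hr : rad p ≤ p 0 - 1) :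
    dA w p ≤ 3 * η / (√(p 0) * √(p 0 - rad p)) := by
  have r0 := rad_nn p
  rw [← Real.sqrt_mul (by linarith)]
  have q0 : 0 < p 0 * (p 0 - rad p) := mul_pos (by linarith) (by linarith)
  have t0 := Real.sqrt_pos.2 q0
  rw [le_div_iff₀ t0]
  rcases cone_cases p2 hr with ⟨s, x, s2, rfl⟩ | h3
  · have a : dA w (hyp s x) ≤ η / s := (nmF_mono (A := Z5) Sn_dA (show 0 ≤ 1 by norm_num) w (hyp s x)).trans (hw.w2 s s2 x)
    have b : √(hyp s x 0 * (hyp s x 0 - rad (hyp s x))) ≤ s := by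
      rw [Real.sqrt_le_left (by linarith)]
      have := hyp_sq s x
      have := rad_sq (hyp s x)
      rw [hyp1, hyp2] at this
      nlinarith
    have := mul_le_mul a b t0.le (by positivity)
    rw [div_mul_cancel₀ _ (by linarith)] at this
    linarith
  · have a : dA w p ≤ η := by
      refine le_trans ?_ ((nmF_mono Sn_aN (show 1 ≤ 8 by norm_num) w p).trans (hl p (by linarith) h3))
      rw [nm3]; simp only [nmF, aN, dA]; linarith [abs_nonneg (w p)]
    have b : √(p 0 * (p 0 - rad p)) ≤ 3 := by
      rw [Real.sqrt_le_left (by norm_num)]; nlinarith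
    have := mul_le_mul a b t0.le hη
    linarith

theorem dec_W {w : Pt → ℝ} {η : ℝ} (hη : 0 ≤ η) (hw : BW η w) (hl : ∀ p : Pt, 1 ≤ p 0 → p 0 ≤ 3 → nmF Z3 aN 8 w p ≤ η) {p : Pt} (p2 : 2 ≤ p 0) (hr : rad p ≤ p 0 - 1) :
    |w p| ≤ 12 * η / √(p 0) * √(p 0 - rad p) := by
  have r0 := rad_nn p
  have t0 := Real.sqrt_pos.2 (show 0 < p 0 by linarith)
  have easy : |w p| ≤ η → p 0 ≤ 4 * (p 0 - rad p) → |w p| ≤ 12 * η / √(p 0) * √(p 0 - rad p) := fun a b => by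
    have : √(p 0) ≤ 2 * √(p 0 - rad p) := by
      rw [Real.sqrt_le_left (by positivity), mul_pow, Real.sq_sqrt (by linarith)]; linarith
    rw [div_mul_eq_mul_div, le_div_iff₀ t0]
    have := mul_le_mul a this t0.le hη
    have := mul_nonneg hη (Real.sqrt_nonneg (p 0 - rad p))
    linarith
  rcases le_or_gt (p 0) 3 with h3 | h3
  · exact easy ((nmF_mono (A := Z3) Sn_aN (show 0 ≤ 8 by norm_num) w p).trans (hl p (by linarith) h3)) (by linarith)
  rcases le_or_gt (rad p) (p 0 / 2) with hh | hh
  · refine easy ?_ (by linarith)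
    rcases cone_cases p2 hr with ⟨s, x, s2, rfl⟩ | h3'
    · exact hw.w3 s s2 x
    · linarith
  set r := rad p with hrd
  have rq : ∀ τ, rad ![τ, p 1, p 2] = r := fun τ => rfl
  have key := abs_le_of_deriv (a := r + 1/2) (b := p 0) (f := fun τ => w ![τ, p 1, p 2]) (f' := fun τ => pd 0 w ![τ, p 1, p 2])
    (G := fun τ => 12 * η / √(p 0) * √(τ - r)) (G' := fun τ => 12 * η / √(p 0) * (1 / (2 * √(τ - r)))) (by linarith) ?_ ?_ ?_
  · have z : w ![r + 1/2, p 1, p 2] = 0 := hw.sup _ (by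
      rw [rq]; show |r + 1/2 - 2| + 1 < r
      rw [abs_of_nonneg (by linarith)]; linarith)
    have e : ![p 0, p 1, p 2] = p := by funext i; fin_cases i <;> rfl
    simp only [e, z, sub_zero] at key
    have : 0 ≤ 12 * η / √(p 0) * √(r + 1/2 - r) := by positivity
    linarith
  · exact fun τ _ => Dt0 hw.sm τ _ _
  · intro τ hτ
    have := ((Real.hasDerivAt_sqrt (show τ - r ≠ 0 by linarith [hτ.1])).comp τ ((hasDerivAt_id τ).sub_const r)).const_mul (12 * η / √(p 0))
    simpa using this
  · intro τ hτ
    have g0 : 0 < √(τ - r) := Real.sqrt_pos.2 (by linarith [hτ.1])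
    rcases lt_or_ge τ (r + 1) with h1 | h1
    · have z : pd 0 w ![τ, p 1, p 2] = 0 := hw.sup.pd 0 _ (by
        rw [rq]; show |τ - 2| + 1 < r
        rcases abs_cases (τ - 2) with ⟨e, _⟩ | ⟨e, _⟩ <;> rw [e] <;> linarith [hτ.1])
      rw [z, abs_zero]; positivity
    · have d := dec_D hη hw hl (p := ![τ, p 1, p 2]) (show 2 ≤ τ by linarith) (by rw [rq]; show r ≤ τ - 1; linarith)
      rw [rq] at d
      change _ ≤ 3 * η / (√τ * √(τ - r)) at d
      have d0 : |pd 0 w ![τ, p 1, p 2]| ≤ dA w ![τ, p 1, p 2] := by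
        unfold dA; linarith [abs_nonneg (pd 1 w ![τ, p 1, p 2]), abs_nonneg (pd 2 w ![τ, p 1, p 2])]
      refine d0.trans (d.trans ?_)
      have q : √(p 0) ≤ 2 * √τ := by
        rw [Real.sqrt_le_left (by positivity), mul_pow, Real.sq_sqrt (by linarith)]; linarith
      have e : 12 * η / √(p 0) * (1 / (2 * √(τ - r))) = 6 * η / (√(p 0) * √(τ - r)) := by field_simp; ring
      have t1 : 0 < √τ := Real.sqrt_pos.2 (by linarith)
      rw [e, div_le_div_iff₀ (by positivity) (by positivity)]
      have := mul_le_mul_of_nonneg_left (mul_le_mul_of_nonneg_right q g0.le) (show 0 ≤ 3 * η by linarith)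
      linarith

theorem dec_v {v : Pt → ℝ} {η C : ℝ} (hη : 0 ≤ η) (hC : 1 ≤ C) (hv : Bv C η v) (hl : ∀ p : Pt, 1 ≤ p 0 → p 0 ≤ 3 → nmF Z3 aN 8 v p ≤ η) {p : Pt} (p2 : 2 ≤ p 0) (hr : rad p ≤ p 0 - 1) :
    |v p| ≤ 3 * C * η / p 0 ∧ dA v p ≤ 3 * C * η / p 0 := by
  have a : nmF Z3 aN 1 v p ≤ 3 * C * η / p 0 := by
    rw [le_div_iff₀ (by linarith)]
    have ce : 0 ≤ C * η := by positivity
    rcases cone_cases p2 hr with ⟨s, x, s2, rfl⟩ | h3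
    · have := (nmF_subset (show Z3 ⊆ Z5 by decide) 1 v (hyp s x)).trans (hv.p1 s s2 x)
      have := mul_le_mul_of_nonneg_right this (show 0 ≤ hyp s x 0 by linarith)
      have e : C * (η / hyp s x 0) * hyp s x 0 = C * η := by have := hyp_ne (show 0 < s by linarith) x; field_simp
      linarith
    · have := mul_le_mul ((nmF_mono Sn_aN (show 1 ≤ 8 by norm_num) v p).trans (hl p (by linarith) h3)) h3 (by linarith) hη
      nlinarith
  rw [nm3] at a
  simp only [nmF, aN] at a
  have := abs_nonneg (v p)
  have := abs_nonneg (pd 0 v p)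
  have := abs_nonneg (pd 1 v p)
  have := abs_nonneg (pd 2 v p)
  unfold dA
  constructor <;> linarith

/-- **Global existence and decay for Model I** (Theorem 1.1). For arbitrary constants
`P^{αβ}` and `N ≥ 10`, there is `ε₀ > 0` such that for all `0 < ε < ε₀` and smooth data
supported in the unit ball with `‖w₀‖_{H^{N+1}} + ‖w₁‖_{H^N} + ‖v₀‖_{H^{N+1}} + ‖v₁‖_{H^N} ≤ ε`,
the system `−□w = v²`, `−□v + v = P^{αβ}∂_αw∂_βw`, with data at `t = 2`, has a smooth
solution for all `t ≥ 2`, supported in `{|x| ≤ t − 1}`, with the decay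
`|w| ≤ Cε t^{−1/2}(t−|x|)^{1/2}`, `|∂w| ≤ Cε t^{−1/2}(t−|x|)^{−1/2}`,
`|v| ≤ Cε t^{−1}`, `|∂v| ≤ Cε t^{−1}`. -/
theorem model_I_global_existence_and_decay
    (P : Fin 3 → Fin 3 → ℝ) (N : ℕ) (hN : 10 ≤ N) :
    ∃ ε₀ : ℝ, 0 < ε₀ ∧
      ∀ ε : ℝ, 0 < ε → ε < ε₀ →
      ∀ w₀ w₁ v₀ v₁ : (Fin 2 → ℝ) → ℝ,
        ContDiff ℝ (⊤ : ℕ∞) w₀ → ContDiff ℝ (⊤ : ℕ∞) w₁ →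
        ContDiff ℝ (⊤ : ℕ∞) v₀ → ContDiff ℝ (⊤ : ℕ∞) v₁ →
        (∀ x, 1 < rad2 x → w₀ x = 0 ∧ w₁ x = 0 ∧ v₀ x = 0 ∧ v₁ x = 0) →
        sobolevNorm (N + 1) w₀ + sobolevNorm N w₁
          + sobolevNorm (N + 1) v₀ + sobolevNorm N v₁ ≤ ε →
        ∃ (w v : Pt → ℝ) (U : Set Pt),
          IsOpen U ∧ {p : Pt | 2 ≤ p 0} ⊆ U ∧
          ContDiffOn ℝ (⊤ : ℕ∞) w U ∧ ContDiffOn ℝ (⊤ : ℕ∞) v U ∧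
          (∀ p : Pt, 2 ≤ p 0 →
            negBox w p = (v p)^2 ∧
            negBox v p + v p = ∑ α : Fin 3, ∑ β : Fin 3, P α β * pd α w p * pd β w p) ∧
          (∀ x : Fin 2 → ℝ,
            w (sl x) = w₀ x ∧ pd 0 w (sl x) = w₁ x ∧
            v (sl x) = v₀ x ∧ pd 0 v (sl x) = v₁ x) ∧
          (∀ p : Pt, 2 ≤ p 0 → p 0 - 1 < rad p → w p = 0 ∧ v p = 0) ∧
          ∃ C : ℝ, 0 < C ∧
            ∀ p : Pt, 2 ≤ p 0 → rad p ≤ p 0 - 1 →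
              |w p| ≤ C * ε * (p 0) ^ (-(1:ℝ)/2) * (p 0 - rad p) ^ ((1:ℝ)/2) ∧
              (∑ α : Fin 3, |pd α w p|)
                ≤ C * ε * (p 0) ^ (-(1:ℝ)/2) * (p 0 - rad p) ^ (-(1:ℝ)/2) ∧
              |v p| ≤ C * ε * (p 0)⁻¹ ∧
              (∑ α : Fin 3, |pd α v p|) ≤ C * ε * (p 0)⁻¹ := by
  obtain ⟨A, c, C, A1, c0, C1, hboot⟩ := boot P
  refine ⟨1 / (c * 729), by positivity, fun ε ε0 εl w₀ w₁ v₀ v₁ hw0 hw1 hv0 hv1 hs hn => ?_⟩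
  obtain ⟨w, v, h⟩ := It_ex P ⟨hw0, fun x hx => (hs x hx).1⟩ ⟨hw1, fun x hx => (hs x hx).2.1⟩ ⟨hv0, fun x hx => (hs x hx).2.2.1⟩ ⟨hv1, fun x hx => (hs x hx).2.2.2⟩
  have Y : ∀ n, Y2 10 (w n) (v n) 2 ≤ (729 * ε)^2 := fun n => by
    refine (Ydata P h 10 n).trans ?_
    have a1 := sob_mono (g := w₀) (show 10 + 1 ≤ N + 1 by omega)
    have a2 := sob_mono (g := w₁) hN
    have a3 := sob_mono (g := v₀) (show 10 + 1 ≤ N + 1 by omega)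
    have a4 := sob_mono (g := v₁) hN
    have n1 : 0 ≤ sobolevNorm (10 + 1) w₀ := Real.sqrt_nonneg _
    have n2 : 0 ≤ sobolevNorm 10 w₁ := Real.sqrt_nonneg _
    have n3 : 0 ≤ sobolevNorm (10 + 1) v₀ := Real.sqrt_nonneg _
    have n4 : 0 ≤ sobolevNorm 10 v₁ := Real.sqrt_nonneg _
    generalize sobolevNorm (10 + 1) w₀ = x1 at *
    generalize sobolevNorm 10 w₁ = x2 at *
    generalize sobolevNorm (10 + 1) v₀ = x3 at *
    generalize sobolevNorm 10 v₁ = x4 at *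
    have q : x1 + x2 + x3 + x4 ≤ ε := by linarith
    have q2 := pow_le_pow_left₀ (by positivity) q 2
    have m1 := mul_nonneg n1 n2
    have m2 := mul_nonneg n1 n3
    have m3 := mul_nonneg n1 n4
    have m4 := mul_nonneg n2 n3
    have m5 := mul_nonneg n2 n4
    have m6 := mul_nonneg n3 n4
    have e1 : (x1 + x2 + x3 + x4)^2 = x1^2 + x2^2 + x3^2 + x4^2 + 2 * (x1 * x2) + 2 * (x1 * x3) + 2 * (x1 * x4) + 2 * (x2 * x3) + 2 * (x2 * x4) + 2 * (x3 * x4) := by ring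
    have e2 : (729 * ε)^2 = 531441 * ε^2 := by ring
    rw [e2]
    norm_num
    linarith [sq_nonneg x1, sq_nonneg x2, sq_nonneg x3, sq_nonneg x4]
  have ce : c * (729 * ε) ≤ 1 := by
    rw [lt_div_iff₀ (by positivity)] at εl; linarith
  have H := hboot h (by positivity) Y ce
  obtain ⟨η, hη⟩ : ∃ η, η = A * (729 * ε) := ⟨_, rfl⟩
  rw [← hη] at H
  have η0 : 0 ≤ η := by rw [hη]; positivity
  have D : ∀ T k, ∃ A, ∀ n (p : Pt), 1 ≤ p 0 → p 0 ≤ T → nmF Z3 aN k (fun p => w (n+1) p - w n p) p ≤ A * (1/2)^n ∧ nmF Z3 aN k (fun p => v (n+1) p - v n p) p ≤ A * (1/2)^n := fun T k => by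
    have hT : 2 ≤ max T 2 := le_max_right _ _
    obtain ⟨M, hM⟩ := start (T := max T 2) η0 C1 H
    obtain ⟨B, hB⟩ := DZ3 P h hT (Yall P h hT hM) k
    exact ⟨B, fun n p a b => hB n p a (b.trans (le_max_left _ _))⟩
  have cw : Cv w := ⟨h.sw, fun T k => by obtain ⟨B, hB⟩ := D T k; exact ⟨B, fun n p a b => (hB n p a b).1⟩⟩
  have cv : Cv v := ⟨h.sv, fun T k => by obtain ⟨B, hB⟩ := D T k; exact ⟨B, fun n p a b => (hB n p a b).2⟩⟩
  have sh : ∀ {f : ℕ → ℝ} {l : ℝ}, Filter.Tendsto f Filter.atTop (nhds l) → Filter.Tendsto (fun n => f (n + 1)) Filter.atTop (nhds l) :=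
    fun hf => hf.comp (Filter.tendsto_add_atTop_nat 1)
  have cst : ∀ {f : ℕ → ℝ} {l m : ℝ}, Filter.Tendsto f Filter.atTop (nhds l) → (∀ n, f (n + 1) = m) → l = m := fun hf e =>
    tendsto_nhds_unique (sh hf) (by simp only [e]; exact tendsto_const_nhds)
  refine ⟨Lm w, Lm v, {q | 1 < q 0}, opU, fun p (hp : 2 ≤ p 0) => show 1 < p 0 by linarith, cw.smooth, cv.smooth, fun p p2 => ?_, fun x => ?_, fun p p2 hr => ?_, ?_⟩
  · have p1 : 1 < p 0 := by linarith
    constructor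
    · refine tendsto_nhds_unique (sh (cw.negB p1)) ?_
      have e : ∀ n, negBox (w (n+1)) p = v n p ^ 2 := fun n => by
        have := congrFun (h.ew n) p
        linarith
      simp only [e]
      exact (cv.lim p1.le).pow 2
    · refine tendsto_nhds_unique ((sh (cv.negB p1)).add (sh (cv.lim p1.le))) ?_
      have e : ∀ n, negBox (v (n+1)) p + v (n+1) p = ∑ α : Fin 3, ∑ β : Fin 3, P α β * pd α (w n) p * pd β (w n) p := fun n => by
        have := congrFun (h.ev n) p
        simp only [one_mul, Qb, ← mul_assoc] at this; exact this
      simp only [e]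
      exact tendsto_finsetSum _ fun α _ => tendsto_finsetSum _ fun β _ => ((cw.pdt p1 α).const_mul _).mul (cw.pdt p1 β)
  · have p1 : 1 < sl x 0 := show (1:ℝ) < 2 by norm_num
    exact ⟨cst (cw.lim p1.le) fun n => h.iw0 n x, cst (cw.pdt p1 0) fun n => h.iw1 n x, cst (cv.lim p1.le) fun n => h.iv0 n x, cst (cv.pdt p1 0) fun n => h.iv1 n x⟩
  · have o : |p 0 - 2| + 1 < rad p := by rw [abs_of_nonneg (by linarith)]; linarith
    have p1 : 1 ≤ p 0 := by linarith
    exact ⟨cst (cw.lim p1) fun n => h.Sw _ p o, cst (cv.lim p1) fun n => h.Sv _ p o⟩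
  · refine ⟨12 * C * (A * 729), by positivity, fun p p2 hr => ?_⟩
    have p1 : 1 < p 0 := by linarith
    have p0 : 0 < p 0 := by linarith
    have t0 : 0 < p 0 - rad p := by linarith
    have Ce : 12 * C * (A * 729) * ε = 12 * C * η := by rw [hη]; ring
    have k1 : η ≤ C * η := by nlinarith
    have r1 : ∀ {x : ℝ}, 0 < x → x ^ (-(1:ℝ)/2) = (√x)⁻¹ := fun hx => by
      rw [neg_div, Real.rpow_neg hx.le, Real.sqrt_eq_rpow]
    rw [Ce, r1 p0, r1 t0, ← Real.sqrt_eq_rpow, Fin.sum_univ_three, Fin.sum_univ_three]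
    have s0 := Real.sqrt_pos.2 p0
    have s1 := Real.sqrt_pos.2 t0
    refine ⟨?_, ?_, ?_, ?_⟩
    · refine le_of_tendsto' (cw.lim p1.le).abs fun n => (dec_W η0 (H n).1.1 (fun q a b => ((H n).2 q a b).1) p2 hr).trans ?_
      rw [div_eq_mul_inv]
      gcongr ?_ * _ * _
      linarith
    · refine le_of_tendsto' (((cw.pdt p1 0).abs.add (cw.pdt p1 1).abs).add (cw.pdt p1 2).abs) fun n => (dec_D η0 (H n).1.1 (fun q a b => ((H n).2 q a b).1) p2 hr).trans ?_
      rw [div_eq_mul_inv, mul_inv, ← mul_assoc]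
      gcongr ?_ * _ * _
      linarith
    · refine le_of_tendsto' (cv.lim p1.le).abs fun n => (dec_v η0 C1 (H n).1.2 (fun q a b => ((H n).2 q a b).2) p2 hr).1.trans ?_
      rw [div_eq_mul_inv]
      gcongr ?_ * _
      linarith
    · refine le_of_tendsto' (((cv.pdt p1 0).abs.add (cv.pdt p1 1).abs).add (cv.pdt p1 2).abs) fun n => (dec_v η0 C1 (H n).1.2 (fun q a b => ((H n).2 q a b).2) p2 hr).2.trans ?_
      rw [div_eq_mul_inv]
      gcongr ?_ * _
      linarith
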